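/- Let p ∈ (1,2], p' = p/(p−1), h ≥ 0 and d ∈ ℕ. There exists a constant C = C(p,h,d) > 0 such that for every incompressible sequence Λ = (μ_n)_{n∈ℤ} of density d lying in the strip Π_h and every g ∈ L^p[0,1], one has ∑_{n∈ℤ} (𝓕[g](μ_n))^{p'} ≤ C · ‖g‖_{L^p[0,1]}^{p'}. -/

import Mathlib

open MeasureTheory

/-- A sequence `Λ : ℤ → ℂ` is *incompressible of density `d`* if every vertical
strip `[t-1, t+1] × ℝ` contains at most `d` entries of the sequence. -/
def Incompressible (d : ℕ) (Λ : ℤ → ℂ) : Prop :=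
  ∀ t : ℝ, {n : ℤ | |(Λ n).re - t| ≤ 1}.encard ≤ (d : ℕ∞)

/-- The "maximal" Fourier transform `𝓕[g](λ) = sup_{x ∈ [0,1]} |∫₀ˣ g(t) e^{iλt} dt|`. -/
noncomputable def maxFourier (g : ℝ → ℂ) (lam : ℂ) : ℝ :=
  ⨆ x : Set.Icc (0:ℝ) 1, ‖∫ t in (0:ℝ)..(x : ℝ), g t * Complex.exp (Complex.I * lam * t)‖

/-- The `L^p`-norm of `g` on `[0,1]`. -/
noncomputable def lpNorm01 (p : ℝ) (g : ℝ → ℂ) : ℝ :=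
  (∫ t in (0:ℝ)..1, ‖g t‖ ^ p) ^ (1 / p)

/-- The reciprocal weight `(1 + |t|)⁻¹`. -/
noncomputable def wt (t : ℝ) : ℝ := (1 + |t|)⁻¹

lemma wt_pos (t : ℝ) : 0 < wt t := by unfold wt; positivity
lemma wt_nonneg (t : ℝ) : 0 ≤ wt t := (wt_pos t).le
lemma wt_le_one (t : ℝ) : wt t ≤ 1 := by
  unfold wt; exact inv_le_one_of_one_le₀ (by linarith [abs_nonneg t])

lemma wt_pow_le {m n : ℕ} (h : m ≤ n) (t : ℝ) : wt t ^ n ≤ wt t ^ m :=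
  pow_le_pow_of_le_one (wt_nonneg t) (wt_le_one t) h

lemma wt_pow_le_one (n : ℕ) (t : ℝ) : wt t ^ n ≤ 1 := pow_le_one₀ (wt_nonneg t) (wt_le_one t)

lemma wt_anti {s t : ℝ} (h : |s| ≤ |t|) : wt t ≤ wt s := by
  unfold wt; gcongr

lemma wt_neg (t : ℝ) : wt (-t) = wt t := by simp [wt]

/-- Submultiplicativity: `wt a * wt b ≤ wt c` whenever `|c| ≤ |a| + |b|`. -/
lemma wt_mul_le {a b c : ℝ} (h : |c| ≤ |a| + |b|) : wt a * wt b ≤ wt c := by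
  unfold wt
  rw [← mul_inv]
  gcongr
  nlinarith [abs_nonneg a, abs_nonneg b, mul_nonneg (abs_nonneg a) (abs_nonneg b)]

lemma wt_sq_le_telescope (L : ℝ) (hL : 1 ≤ L) (t : ℝ) :
    wt (t / L) ^ 2 ≤ 4 * (L * (t + 1) / (L + |t + 1|) - L * t / (L + |t|)) := by
  have hL0 : 0 < L := by linarith
  have h1 : 0 < L + |t| := by positivity
  have h2 : 0 < L + |t + 1| := by positivity
  have e1 : wt (t / L) = L / (L + |t|) := by
    unfold wt; rw [abs_div, abs_of_pos hL0]; field_simp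
  have e2 : L * (t + 1) / (L + |t + 1|) - L * t / (L + |t|)
      = (L * (L + ((t + 1) * |t| - t * |t + 1|))) / ((L + |t + 1|) * (L + |t|)) := by
    field_simp; ring
  have e3 : 0 ≤ (t + 1) * |t| - t * |t + 1| := by
    rcases abs_cases t with ⟨h, h'⟩ | ⟨h, h'⟩ <;> rcases abs_cases (t + 1) with ⟨g, g'⟩ | ⟨g, g'⟩ <;>
      rw [h, g] <;> nlinarith
  have e4 : |t + 1| ≤ |t| + 1 := by simpa using abs_add_le t 1
  rw [e1, e2, div_pow, ← mul_div_assoc, div_le_div_iff₀ (by positivity) (by positivity)]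
  have : (L + |t + 1|) ≤ 2 * (L + |t|) := by linarith [abs_nonneg t]
  have h5 : L ^ 2 * ((L + |t + 1|) * (L + |t|)) ≤ L ^ 2 * (2 * (L + |t|) * (L + |t|)) := by gcongr
  have h6 : 0 ≤ L * ((t + 1) * |t| - t * |t + 1|) * (L + |t|) ^ 2 := by positivity
  nlinarith [sq_nonneg (L * (L + |t|))]

lemma sum_wt_sq_le (L : ℝ) (hL : 1 ≤ L) (c : ℝ) (A : Finset ℤ) :
    ∑ y ∈ A, wt ((y - c) / L) ^ 2 ≤ 8 * L := by
  have hL0 : 0 < L := by linarith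
  set F : ℤ → ℝ := fun y => L * (y - c) / (L + |y - c|) with hF
  have hb : ∀ y, |F y| ≤ L := by
    intro y
    have : 0 < L + |(y:ℝ) - c| := by positivity
    rw [hF]; simp only; rw [abs_div, abs_mul, abs_of_pos hL0, abs_of_pos this, div_le_iff₀ this]
    nlinarith [abs_nonneg ((y:ℝ) - c)]
  obtain ⟨n, hn⟩ : ∃ n : ℕ, A ⊆ Finset.Ico (-(n:ℤ)) n := by
    obtain ⟨n, hn⟩ := (A.image Int.natAbs).bddAbove
    refine ⟨n + 1, fun y hy => ?_⟩
    have := hn (Finset.mem_coe.2 (Finset.mem_image_of_mem _ hy))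
    simp; omega
  have tele : ∀ m : ℕ, ∑ y ∈ Finset.Ico (-(n:ℤ)) (-n + m), (F (y + 1) - F y) = F (-n + m) - F (-n) := by
    intro m
    induction m with
    | zero => simp
    | succ m ih =>
      have : Finset.Ico (-(n:ℤ)) (-n + (m + 1 : ℕ)) = insert (-(n:ℤ) + m) (Finset.Ico (-(n:ℤ)) (-n + m)) := by
        ext y; simp
      rw [this, Finset.sum_insert (by simp), ih]
      push_cast
      rw [show -(n:ℤ) + (m + 1) = -n + m + 1 by ring]; ring
  calc ∑ y ∈ A, wt ((y - c) / L) ^ 2 ≤ ∑ y ∈ Finset.Ico (-(n:ℤ)) n, wt ((y - c) / L) ^ 2 :=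
        Finset.sum_le_sum_of_subset_of_nonneg hn fun _ _ _ => by positivity
    _ ≤ ∑ y ∈ Finset.Ico (-(n:ℤ)) n, 4 * (F (y + 1) - F y) := by
        gcongr with y _
        have := wt_sq_le_telescope L hL (y - c)
        simp only [hF]; push_cast
        rw [show ((y:ℝ) + 1 - c) = y - c + 1 by ring]; exact this
    _ = 4 * (F n - F (-n)) := by
        rw [← Finset.mul_sum]
        have := tele (2 * n)
        rw [show -(n:ℤ) + (2 * n : ℕ) = n by push_cast; ring] at this
        rw [this]
    _ ≤ 8 * L := by
        have := abs_le.1 (hb n); have := abs_le.1 (hb (-n)); linarith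

lemma sum_wt_pow_le {n : ℕ} (hn : 2 ≤ n) (L : ℝ) (hL : 1 ≤ L) (c : ℝ) (A : Finset ℤ) :
    ∑ y ∈ A, wt ((y - c) / L) ^ n ≤ 8 * L :=
  (Finset.sum_le_sum fun _ _ => wt_pow_le hn _).trans (sum_wt_sq_le L hL c A)

section Bessel
variable {E ι : Type*} [NormedAddCommGroup E] [InnerProductSpace ℂ E]

lemma norm_sq_sum_smul_le (s : Finset ι) (v : ι → E) (c : ι → ℂ) :
    ‖∑ i ∈ s, c i • v i‖ ^ 2 ≤ ∑ i ∈ s, ∑ j ∈ s, ‖c i‖ * ‖c j‖ * ‖inner ℂ (v i) (v j)‖ := by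
  have h : ((‖∑ i ∈ s, c i • v i‖ ^ 2 : ℝ) : ℂ) = inner ℂ (∑ i ∈ s, c i • v i) (∑ i ∈ s, c i • v i) := by
    rw [inner_self_eq_norm_sq_to_K]; norm_cast
  have h2 : ‖∑ i ∈ s, c i • v i‖ ^ 2 = ‖((‖∑ i ∈ s, c i • v i‖ ^ 2 : ℝ) : ℂ)‖ := by
    rw [Complex.norm_real, Real.norm_of_nonneg (by positivity)]
  rw [h2, h, sum_inner]
  refine (norm_sum_le _ _).trans (Finset.sum_le_sum fun i _ => ?_)
  rw [inner_sum]
  refine (norm_sum_le _ _).trans (Finset.sum_le_sum fun j _ => ?_)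
  rw [inner_smul_left, inner_smul_right, norm_mul, norm_mul, RCLike.norm_conj, mul_assoc]

lemma bessel_of_gram (s : Finset ι) (v : ι → E) (f : E) (K : ℝ) (hK : 0 ≤ K)
    (h : ∑ i ∈ s, ∑ j ∈ s, ‖inner ℂ (v i) f‖ * ‖inner ℂ (v j) f‖ * ‖inner ℂ (v i) (v j)‖
      ≤ K * ∑ i ∈ s, ‖inner ℂ (v i) f‖ ^ 2) :
    ∑ i ∈ s, ‖inner ℂ (v i) f‖ ^ 2 ≤ K * ‖f‖ ^ 2 := by
  set S := ∑ i ∈ s, ‖inner ℂ (v i) f‖ ^ 2 with hS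
  have hS0 : 0 ≤ S := by positivity
  set c : ι → ℂ := fun i => inner ℂ (v i) f
  set u := ∑ i ∈ s, c i • v i
  have h1 : ‖u‖ ^ 2 ≤ K * S := (norm_sq_sum_smul_le s v c).trans h
  have h2 : (S : ℂ) = inner ℂ u f := by
    rw [sum_inner, hS]
    push_cast
    refine Finset.sum_congr rfl fun i _ => ?_
    rw [inner_smul_left]
    exact (RCLike.conj_mul _).symm
  have h3 : S ≤ ‖u‖ * ‖f‖ := by
    have : ‖(S : ℂ)‖ = S := by rw [Complex.norm_real, Real.norm_of_nonneg hS0]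
    rw [← this, h2]; exact norm_inner_le_norm u f
  have h4 : S * S ≤ K * ‖f‖ ^ 2 * S := by
    calc S * S ≤ (‖u‖ * ‖f‖) * (‖u‖ * ‖f‖) := by gcongr
      _ = ‖u‖ ^ 2 * ‖f‖ ^ 2 := by ring
      _ ≤ K * S * ‖f‖ ^ 2 := by gcongr
      _ = _ := by ring
  rcases hS0.eq_or_lt with h0 | h0
  · rw [← h0] at h1 ⊢
    positivity
  · exact le_of_mul_le_mul_right h4 h0

lemma schur_sum_le (s : Finset ι) (a : ι → ℝ) (G : ι → ι → ℝ) (K : ℝ) 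
    (hG : ∀ i j, 0 ≤ G i j) (hsymm : ∀ i j, G i j = G j i) (hrow : ∀ i ∈ s, ∑ j ∈ s, G i j ≤ K) :
    ∑ i ∈ s, ∑ j ∈ s, a i * a j * G i j ≤ K * ∑ i ∈ s, a i ^ 2 := by
  have h1 : ∑ i ∈ s, ∑ j ∈ s, a i * a j * G i j
      ≤ ∑ i ∈ s, ∑ j ∈ s, (a i ^ 2 * G i j / 2 + a j ^ 2 * G i j / 2) := by
    gcongr with i _ j _
    nlinarith [mul_nonneg (sq_nonneg (a i - a j)) (hG i j)]
  have h2 : ∑ i ∈ s, ∑ j ∈ s, a j ^ 2 * G i j / 2 = ∑ i ∈ s, ∑ j ∈ s, a i ^ 2 * G i j / 2 := by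
    rw [Finset.sum_comm]
    exact Finset.sum_congr rfl fun i _ => Finset.sum_congr rfl fun j _ => by rw [hsymm]
  simp only [Finset.sum_add_distrib] at h1
  rw [h2] at h1
  refine h1.trans ?_
  rw [← Finset.sum_add_distrib, Finset.mul_sum]
  gcongr with i hi
  rw [← Finset.sum_add_distrib]
  calc ∑ j ∈ s, (a i ^ 2 * G i j / 2 + a i ^ 2 * G i j / 2) = a i ^ 2 * ∑ j ∈ s, G i j := by
        rw [Finset.mul_sum]; exact Finset.sum_congr rfl fun _ _ => by ring
    _ ≤ a i ^ 2 * K := by gcongr; exact hrow i hi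
    _ = _ := by ring
end Bessel

/-- The dyadic (4-adic) interval of integers of length `4 ^ i` at position `k`. -/
def iv (i : ℕ) (k : ℤ) : Set ℤ := {y | y / 4 ^ i = k}

/-- The 4-adic interval of reals of length `4⁻ⁱ` at position `m`. -/
def om (i : ℕ) (m : ℤ) : Set ℝ := {x | ⌊x * 4 ^ i⌋ = m}

/-- A space-frequency tile. -/
structure Tile where
  i : ℕ
  k : ℤ
  m : ℤ

noncomputable instance : DecidableEq Tile := Classical.decEq _

namespace Tile
def iv (P : Tile) : Set ℤ := _root_.iv P.i P.k
def om (P : Tile) : Set ℝ := _root_.om P.i P.m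
/-- The part of the frequency interval in which the linearizing function is tested. -/
def om2 (P : Tile) : Set ℝ := _root_.om (P.i + 2) (16 * P.m + 8)
/-- The part of the frequency interval that contains the spectrum of the wave packet. -/
def spt (P : Tile) : Set ℝ := {x | 1 / 16 ≤ x * 4 ^ P.i - P.m ∧ x * 4 ^ P.i - P.m ≤ 1 / 2 - 1 / 128}
/-- The weight attached to the tile. -/
noncomputable def w (P : Tile) (y : ℤ) : ℝ := wt ((y - P.k * 4 ^ P.i) / 4 ^ P.i)

/-- The tree order. -/
def Le (P T : Tile) : Prop := P.i ≤ T.i ∧ P.iv ⊆ T.iv ∧ T.om ⊆ P.om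
/-- The order of 2-trees. -/
def Le2 (P T : Tile) : Prop := P = T ∨ (P.i ≤ T.i ∧ P.iv ⊆ T.iv ∧ T.om ⊆ P.om2)
end Tile

lemma mem_iv {i : ℕ} {k y : ℤ} : y ∈ iv i k ↔ y / 4 ^ i = k := Iff.rfl

lemma mem_iv_iff {i : ℕ} {k y : ℤ} : y ∈ iv i k ↔ k * 4 ^ i ≤ y ∧ y < (k + 1) * 4 ^ i := by
  rw [mem_iv, Int.ediv_eq_iff_of_pos (by positivity)]
  constructor <;> rintro ⟨h1, h2⟩ <;> constructor <;> linarith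

lemma mem_om_iff {i : ℕ} {m : ℤ} {x : ℝ} : x ∈ om i m ↔ (m : ℝ) ≤ x * 4 ^ i ∧ x * 4 ^ i < m + 1 :=
  Int.floor_eq_iff

lemma ediv_pow_of_le {i i' : ℕ} (h : i ≤ i') (y : ℤ) : y / 4 ^ i' = y / 4 ^ i / 4 ^ (i' - i) := by
  rw [Int.ediv_ediv_of_nonneg (by positivity), ← pow_add, Nat.add_sub_cancel' h]

lemma floor_pow_of_le {i i' : ℕ} (h : i ≤ i') (x : ℝ) :
    ⌊x * 4 ^ i⌋ = ⌊x * 4 ^ i'⌋ / 4 ^ (i' - i) := by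
  have : x * 4 ^ i = x * 4 ^ i' / ((4 ^ (i' - i) : ℕ) : ℝ) := by
    rw [eq_div_iff (by positivity)]; push_cast
    rw [mul_assoc, ← pow_add, Nat.add_sub_cancel' h]
  rw [this, Int.floor_div_natCast]; push_cast; rfl

lemma iv_nest {i i' : ℕ} (h : i ≤ i') {k k' y : ℤ} (h1 : y ∈ iv i k) (h2 : y ∈ iv i' k') :
    iv i k ⊆ iv i' k' := by
  intro z hz
  rw [mem_iv] at *
  rw [ediv_pow_of_le h, h1] at h2
  rw [ediv_pow_of_le h, hz, h2]

lemma om_nest {i i' : ℕ} (h : i ≤ i') {m m' : ℤ} {x : ℝ} (h1 : x ∈ om i m) (h2 : x ∈ om i' m') :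
    om i' m' ⊆ om i m := by
  intro z hz
  simp only [om, Set.mem_ofPred_eq] at *
  rw [floor_pow_of_le h, h2] at h1
  rw [floor_pow_of_le h, hz, h1]

lemma iv_nonempty (i : ℕ) (k : ℤ) : (iv i k).Nonempty :=
  ⟨k * 4 ^ i, by rw [mem_iv_iff]; constructor <;> [rfl; nlinarith [show (0:ℤ) < 4 ^ i by positivity]]⟩

lemma om_nonempty (i : ℕ) (m : ℤ) : (om i m).Nonempty :=
  ⟨m / 4 ^ i, by rw [mem_om_iff, div_mul_cancel₀ _ (by positivity)]; constructor <;> linarith⟩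

lemma iv_eq_of_mem {i : ℕ} {k k' y : ℤ} (h1 : y ∈ iv i k) (h2 : y ∈ iv i k') : k = k' :=
  (mem_iv.1 h1).symm.trans h2

lemma om_eq_of_mem {i : ℕ} {k k' : ℤ} {y : ℝ} (h1 : y ∈ om i k) (h2 : y ∈ om i k') : k = k' :=
  Eq.trans (Eq.symm h1) h2

namespace Tile

lemma om2_subset_om (P : Tile) : P.om2 ⊆ P.om := by
  intro x hx
  simp only [om2, om, _root_.mem_om_iff] at *
  rw [pow_add] at hx
  push_cast at hx
  constructor <;> linarith [hx.1, hx.2]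

lemma spt_subset_om (P : Tile) : P.spt ⊆ P.om := by
  intro x hx
  simp only [spt, om, _root_.mem_om_iff, Set.mem_ofPred_eq] at *
  constructor <;> linarith [hx.1, hx.2]

lemma spt_nonempty (P : Tile) : P.spt.Nonempty :=
  ⟨(P.m + 1 / 4) / 4 ^ P.i, by
    simp only [spt, Set.mem_ofPred_eq]; rw [div_mul_cancel₀ _ (by positivity)]
    constructor <;> linarith⟩

lemma disjoint_spt_om2 (P : Tile) : Disjoint P.spt P.om2 := by
  rw [Set.disjoint_left]
  intro x hx hx'
  simp only [spt, om2, _root_.mem_om_iff, Set.mem_ofPred_eq] at *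
  rw [pow_add] at hx'
  push_cast at hx'
  linarith [hx.2, hx'.1]

lemma Le.refl (P : Tile) : P.Le P := ⟨le_rfl, subset_rfl, subset_rfl⟩
lemma Le.trans {P Q T : Tile} (h : P.Le Q) (h' : Q.Le T) : P.Le T :=
  ⟨h.1.trans h'.1, h.2.1.trans h'.2.1, h'.2.2.trans h.2.2⟩
lemma Le2.le {P T : Tile} (h : P.Le2 T) : P.Le T := by
  rcases h with rfl | h
  · exact Le.refl _
  · exact ⟨h.1, h.2.1, h.2.2.trans P.om2_subset_om⟩

lemma Le.antisymm {P Q : Tile} (h : P.Le Q) (h' : Q.Le P) : P = Q := by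
  obtain ⟨i, k, m⟩ := P
  obtain ⟨i', k', m'⟩ := Q
  obtain rfl : i = i' := le_antisymm h.1 h'.1
  obtain ⟨y, hy⟩ := iv_nonempty i k
  obtain ⟨x, hx⟩ := om_nonempty i m
  obtain rfl := iv_eq_of_mem hy (h.2.1 hy)
  obtain rfl := om_eq_of_mem hx (h'.2.2 hx)
  rfl

/-- Two tiles that meet are comparable. -/
lemma le_of_mem {P T : Tile} (h : P.i ≤ T.i) {y : ℤ} (h1 : y ∈ P.iv) (h2 : y ∈ T.iv) {x : ℝ}
    (h3 : x ∈ P.om) (h4 : x ∈ T.om) : P.Le T :=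
  ⟨h, iv_nest h h1 h2, om_nest h h3 h4⟩

lemma om_subset_om2 {P T : Tile} (h : P.i + 2 ≤ T.i) {x : ℝ} (h3 : x ∈ P.om2) (h4 : x ∈ T.om) :
    T.om ⊆ P.om2 := om_nest h h3 h4

lemma w_pos (P : Tile) (y : ℤ) : 0 < P.w y := wt_pos _
lemma w_nonneg (P : Tile) (y : ℤ) : 0 ≤ P.w y := wt_nonneg _
lemma one_le_four_pow (i : ℕ) : (1 : ℝ) ≤ 4 ^ i := one_le_pow₀ (by norm_num)

lemma sum_w_le {n : ℕ} (hn : 2 ≤ n) (P : Tile) (A : Finset ℤ) : ∑ y ∈ A, P.w y ^ n ≤ 8 * 4 ^ P.i :=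
  sum_wt_pow_le hn _ (one_le_four_pow _) _ A
end Tile

/-- A family of tiles whose distinct levels are separated by two. -/
def Sparse (S : Finset Tile) : Prop := ∀ P ∈ S, ∀ Q ∈ S, P.i < Q.i → P.i + 2 ≤ Q.i

/-- The Hilbert space `ℓ²(ℤ)`. -/
noncomputable abbrev L2Z := lp (fun _ : ℤ => ℂ) 2

/-- `exp (2 π i x)`. -/
noncomputable def ee (x : ℝ) : ℂ := Complex.exp (2 * Real.pi * x * Complex.I)

lemma norm_ee (x : ℝ) : ‖ee x‖ = 1 := by
  unfold ee
  rw [show (2 * Real.pi * x * Complex.I : ℂ) = ((2 * Real.pi * x : ℝ) : ℂ) * Complex.I by push_cast; ring]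
  exact Complex.norm_exp_ofReal_mul_I _

lemma ee_add (x y : ℝ) : ee (x + y) = ee x * ee y := by
  unfold ee; rw [← Complex.exp_add]; push_cast; ring_nf

lemma ee_zero : ee 0 = 1 := by simp [ee]

lemma ee_mul_neg (x : ℝ) : ee x * ee (-x) = 1 := by rw [← ee_add, add_neg_cancel, ee_zero]

/-- A family of functions adapted to tiles. -/
structure Packets (C0 : ℝ) (v : Tile → L2Z) : Prop where
  decay : ∀ P y, ‖v P y‖ ≤ C0 * (2 ^ P.i)⁻¹ * P.w y ^ 10
  orth : ∀ P Q, Disjoint P.spt Q.spt → inner ℂ (v P) (v Q) = 0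

/-- Pairs of families of wave packets with the regularity needed for the model operator. -/
structure WavePackets (C0 : ℝ) (φ ψ : Tile → L2Z) : Prop where
  nonneg : 0 ≤ C0
  packets_left : Packets C0 φ
  packets_right : Packets C0 ψ
  lip : ∀ (P : Tile) (ξ : ℝ), ξ ∈ P.om → ∀ (y z : ℤ) (r : ℝ), 0 ≤ r →
    (∀ x : ℝ, x ∈ Set.uIcc (y : ℝ) z → wt ((x - P.k * 4 ^ P.i) / 4 ^ P.i) ≤ r) →
    ‖φ P y * ee (-(ξ * y)) - φ P z * ee (-(ξ * z))‖ ≤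
      C0 * (2 ^ P.i)⁻¹ * (|(y : ℝ) - z| / 4 ^ P.i) * r ^ 10
  lowpass : ∀ (i : ℕ) (m : ℤ), ∃ κ : ℤ → ℂ, (∀ y : ℤ, ‖κ y‖ ≤ C0 * (4 ^ i)⁻¹ * wt (y / 4 ^ i) ^ 2) ∧
    ∀ P : Tile, (i ≤ P.i → P.om ⊆ om i m → ∀ y, ∑' z, ψ P z * κ (y - z) = ψ P y) ∧
      (P.i + 2 ≤ i → om i m ⊆ P.om2 → ∀ y, ∑' z, ψ P z * κ (y - z) = 0)

lemma norm_inner_le_of_sum_le (f g : L2Z) (B : ℝ) (hB : ∀ A : Finset ℤ, ∑ z ∈ A, ‖f z‖ * ‖g z‖ ≤ B) :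
    ‖inner ℂ f g‖ ≤ B := by
  rw [lp.inner_eq_tsum]
  have hs : Summable fun z => ‖f z‖ * ‖g z‖ :=
    summable_of_sum_le (fun _ => by positivity) hB
  have he : ∀ z, ‖inner ℂ (f z) (g z)‖ ≤ ‖f z‖ * ‖g z‖ := fun z => norm_inner_le_norm _ _
  have hs' : Summable fun z => ‖inner ℂ (f z) (g z)‖ := Summable.of_nonneg_of_le (fun _ => norm_nonneg _) he hs
  exact (norm_tsum_le_tsum_norm hs').trans ((hs'.tsum_le_tsum he hs).trans
    (hs.tsum_le_of_sum_le hB))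

lemma sum_sq_le_norm_sq (f : L2Z) (A : Finset ℤ) : ∑ z ∈ A, ‖f z‖ ^ 2 ≤ ‖f‖ ^ 2 := by
  have := lp.sum_rpow_le_norm_rpow (p := 2) (by norm_num) f A
  simpa using this

namespace Packets
variable {C0 : ℝ} {v : Tile → L2Z}

lemma gram (h : Packets C0 v) (hC : 0 ≤ C0) (P Q : Tile) (hi : Q.i ≤ P.i) :
    ‖inner ℂ (v P) (v Q)‖ ≤ 8 * C0 ^ 2 * (2 ^ Q.i / 2 ^ P.i) * P.w (Q.k * 4 ^ Q.i) ^ 8 := by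
  refine norm_inner_le_of_sum_le _ _ _ fun A => ?_
  have key : ∀ z, P.w z * Q.w z ≤ P.w (Q.k * 4 ^ Q.i) := by
    intro z
    refine wt_mul_le ?_
    have h4 : (0:ℝ) < 4 ^ P.i := by positivity
    have h4' : (0:ℝ) < 4 ^ Q.i := by positivity
    push_cast
    rw [show ((Q.k:ℝ) * 4 ^ Q.i - P.k * 4 ^ P.i) / 4 ^ P.i = (z - P.k * 4 ^ P.i) / 4 ^ P.i - (z - Q.k * 4 ^ Q.i) / 4 ^ P.i by
      ring]
    refine (abs_sub _ _).trans ?_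
    refine add_le_add le_rfl ?_
    rw [abs_div, abs_div, abs_of_pos h4, abs_of_pos h4']
    gcongr
    norm_num
  calc ∑ z ∈ A, ‖v P z‖ * ‖v Q z‖
      ≤ ∑ z ∈ A, (C0 * (2 ^ P.i)⁻¹ * P.w z ^ 10) * (C0 * (2 ^ Q.i)⁻¹ * Q.w z ^ 10) := by
        gcongr with z _
        · exact h.decay P z
        · exact h.decay Q z
    _ ≤ ∑ z ∈ A, (C0 ^ 2 * (2 ^ P.i)⁻¹ * (2 ^ Q.i)⁻¹ * P.w (Q.k * 4 ^ Q.i) ^ 8) * Q.w z ^ 2 := by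
        refine Finset.sum_le_sum fun z _ => ?_
        have h1 : P.w z ^ 10 * Q.w z ^ 10 ≤ P.w (Q.k * 4 ^ Q.i) ^ 8 * Q.w z ^ 2 := by
          calc P.w z ^ 10 * Q.w z ^ 10 = P.w z ^ 2 * ((P.w z * Q.w z) ^ 8 * Q.w z ^ 2) := by ring
            _ ≤ 1 * ((P.w z * Q.w z) ^ 8 * Q.w z ^ 2) := by
                have := P.w_nonneg z; have := Q.w_nonneg z
                gcongr; exact wt_pow_le_one _ _
            _ ≤ 1 * (P.w (Q.k * 4 ^ Q.i) ^ 8 * Q.w z ^ 2) := by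
                have := P.w_nonneg z; have := Q.w_nonneg z
                gcongr; exact key z
            _ = _ := one_mul _
        calc _ = (C0 ^ 2 * (2 ^ P.i)⁻¹ * (2 ^ Q.i)⁻¹) * (P.w z ^ 10 * Q.w z ^ 10) := by ring
          _ ≤ (C0 ^ 2 * (2 ^ P.i)⁻¹ * (2 ^ Q.i)⁻¹) * (P.w (Q.k * 4 ^ Q.i) ^ 8 * Q.w z ^ 2) := by gcongr
          _ = _ := by ring
    _ ≤ (C0 ^ 2 * (2 ^ P.i)⁻¹ * (2 ^ Q.i)⁻¹ * P.w (Q.k * 4 ^ Q.i) ^ 8) * (8 * 4 ^ Q.i) := by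
        rw [← Finset.mul_sum]
        have := P.w_nonneg (Q.k * 4 ^ Q.i)
        gcongr; exact Q.sum_w_le le_rfl A
    _ = _ := by
        rw [show (4:ℝ) ^ Q.i = 2 ^ Q.i * 2 ^ Q.i by rw [← mul_pow]; norm_num]
        field_simp

lemma gram_row (h : Packets C0 v) (hC : 0 ≤ C0) (P : Tile) (S : Finset Tile)
    (hS : ∀ Q ∈ S, ¬ (Q.i = P.i ∧ Q.m = P.m) → Disjoint P.spt Q.spt) :
    ∑ Q ∈ S, ‖inner ℂ (v P) (v Q)‖ ≤ 64 * C0 ^ 2 := by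
  classical
  have h1 : ∑ Q ∈ S, ‖inner ℂ (v P) (v Q)‖ = ∑ Q ∈ S with (Q.i = P.i ∧ Q.m = P.m), ‖inner ℂ (v P) (v Q)‖ := by
    rw [Finset.sum_filter]
    refine Finset.sum_congr rfl fun Q hQ => ?_
    split_ifs with hc
    · rfl
    · rw [h.orth _ _ (hS Q hQ hc), norm_zero]
  rw [h1]
  have h2 : Set.InjOn Tile.k (S.filter fun Q => Q.i = P.i ∧ Q.m = P.m : Finset Tile) := by
    rintro ⟨i, k, m⟩ hQ ⟨i', k', m'⟩ hQ' hk
    simp at hQ hQ' hk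
    simp [hQ, hQ', hk]
  calc _ ≤ ∑ Q ∈ S with (Q.i = P.i ∧ Q.m = P.m), 8 * C0 ^ 2 * wt (((Q.k : ℝ) - P.k) / 1) ^ 8 := by
        gcongr with Q hQ
        simp only [Finset.mem_filter] at hQ
        refine (h.gram hC P Q hQ.2.1.le).trans (le_of_eq ?_)
        rw [hQ.2.1, div_self (by positivity), mul_one]
        unfold Tile.w; congr 3; push_cast
        have : (4:ℝ) ^ P.i ≠ 0 := by positivity
        field_simp
    _ = 8 * C0 ^ 2 * ∑ k ∈ (S.filter fun Q => Q.i = P.i ∧ Q.m = P.m).image Tile.k, wt (((k : ℝ) - P.k) / 1) ^ 8 := by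
        rw [Finset.sum_image h2, Finset.mul_sum]
    _ ≤ 8 * C0 ^ 2 * (8 * 1) := by gcongr; exact sum_wt_pow_le (by norm_num) 1 le_rfl _ _
    _ = _ := by ring

end Packets

/-- Families of tiles whose wave packets are lacunary in frequency. -/
def Lacunary (S : Finset Tile) : Prop :=
  ∀ P ∈ S, ∀ Q ∈ S, (P.i = Q.i → P.m = Q.m) ∧ (P.i < Q.i → Q.om ⊆ P.om2)

lemma Lacunary.mono {S S' : Finset Tile} (h : Lacunary S) (hs : S' ⊆ S) : Lacunary S' :=
  fun P hP Q hQ => h P (hs hP) Q (hs hQ)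

lemma Lacunary.disjoint {S : Finset Tile} (hS : Lacunary S) {P Q : Tile} (hP : P ∈ S) (hQ : Q ∈ S)
    (h : ¬ (Q.i = P.i ∧ Q.m = P.m)) : Disjoint P.spt Q.spt := by
  rcases lt_trichotomy P.i Q.i with hi | hi | hi
  · exact P.disjoint_spt_om2.mono_right (Q.spt_subset_om.trans ((hS P hP Q hQ).2 hi))
  · exact absurd ⟨hi.symm, ((hS P hP Q hQ).1 hi).symm⟩ h
  · exact (Q.disjoint_spt_om2.mono_right (P.spt_subset_om.trans ((hS Q hQ P hP).2 hi))).symm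

namespace Packets
variable {C0 : ℝ} {v : Tile → L2Z}

lemma schur_lacunary (h : Packets C0 v) (hC : 0 ≤ C0) {S : Finset Tile} (hS : Lacunary S) (a : Tile → ℝ) :
    ∑ P ∈ S, ∑ Q ∈ S, a P * a Q * ‖inner ℂ (v P) (v Q)‖ ≤ 64 * C0 ^ 2 * ∑ P ∈ S, a P ^ 2 :=
  schur_sum_le S a _ _ (fun _ _ => norm_nonneg _) (fun _ _ => norm_inner_symm _ _)
    fun P hP => h.gram_row hC P S fun _ hQ hn => hS.disjoint hP hQ hn

lemma bessel_lacunary (h : Packets C0 v) (hC : 0 ≤ C0) {S : Finset Tile} (hS : Lacunary S) (f : L2Z) :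
    ∑ P ∈ S, ‖inner ℂ (v P) f‖ ^ 2 ≤ 64 * C0 ^ 2 * ‖f‖ ^ 2 :=
  bessel_of_gram S v f _ (by positivity) (h.schur_lacunary hC hS _)

lemma norm_sum_lacunary (h : Packets C0 v) (hC : 0 ≤ C0) {S : Finset Tile} (hS : Lacunary S) (a : Tile → ℂ) :
    ‖∑ P ∈ S, a P • v P‖ ^ 2 ≤ 64 * C0 ^ 2 * ∑ P ∈ S, ‖a P‖ ^ 2 :=
  (norm_sq_sum_smul_le S v a).trans (h.schur_lacunary hC hS _)
end Packets

lemma Tile.lt_of_om_subset_om2 {P T : Tile} (hi : P.i ≤ T.i) (h : T.om ⊆ P.om2) : P.i < T.i := by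
  refine lt_of_le_of_ne hi fun he => ?_
  obtain ⟨i, k, n⟩ := P
  obtain ⟨i', k', n'⟩ := T
  obtain rfl : i = i' := he
  obtain ⟨x, hx⟩ := om_nonempty i n'
  obtain rfl := om_eq_of_mem hx (om2_subset_om ⟨i, k, n⟩ (h hx))
  obtain ⟨z, hz⟩ := spt_nonempty ⟨i, k, _⟩
  exact Set.disjoint_left.1 (disjoint_spt_om2 ⟨i, k, _⟩) hz (h (spt_subset_om ⟨i, k, _⟩ hz))

lemma lacunary_of_om_subset {S : Finset Tile} (hs : Sparse S) {X : Set ℝ} (hX : X.Nonempty)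
    (h : ∀ P ∈ S, X ⊆ P.om2) : Lacunary S := by
  obtain ⟨x, hx⟩ := hX
  intro P hP Q hQ
  have h1 := P.om2_subset_om (h P hP hx)
  have h2 := Q.om2_subset_om (h Q hQ hx)
  refine ⟨fun hi => ?_, fun hi => om_nest (hs P hP Q hQ hi) (h P hP hx) h2⟩
  unfold Tile.om at h1 h2
  rw [hi] at h1
  exact om_eq_of_mem h1 h2

lemma lacunary_of_le2 {S : Finset Tile} (hs : Sparse S) {T : Tile} (h : ∀ P ∈ S, P.Le2 T) :
    Lacunary S := by
  have h0 : ∀ P ∈ S, P = T ∨ (P.i < T.i ∧ T.om ⊆ P.om2) := by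
    intro P hP
    rcases h P hP with h | h
    · exact Or.inl h
    · exact Or.inr ⟨Tile.lt_of_om_subset_om2 h.1 h.2.2, h.2.2⟩
  obtain ⟨x, hx⟩ := om_nonempty T.i T.m
  intro P hP Q hQ
  rcases h0 P hP with rfl | hP' <;> rcases h0 Q hQ with rfl | hQ'
  · simp
  · exact ⟨fun h => by omega, fun h => by omega⟩
  · exact ⟨fun h => by omega, fun h => hP'.2⟩
  · have h1 := P.om2_subset_om (hP'.2 hx)
    have h2 := Q.om2_subset_om (hQ'.2 hx)
    refine ⟨fun hi => ?_, fun hi => om_nest (hs P hP Q hQ hi) (hP'.2 hx) h2⟩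
    unfold Tile.om at h1 h2
    rw [hi] at h1
    exact om_eq_of_mem h1 h2

/-- Three adjacent grid intervals. -/
noncomputable def tri (i : ℕ) (k : ℤ) : Finset ℤ := Finset.Ico ((k - 1) * 4 ^ i) ((k + 2) * 4 ^ i)

lemma mem_tri {i : ℕ} {k y : ℤ} : y ∈ tri i k ↔ (k - 1) * 4 ^ i ≤ y ∧ y < (k + 2) * 4 ^ i := by
  simp [tri]

lemma div_bounds (i : ℕ) (y : ℤ) : y / 4 ^ i * 4 ^ i ≤ y ∧ y < (y / 4 ^ i + 1) * 4 ^ i :=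
  mem_iv_iff.1 rfl

lemma iv_subset_tri (i : ℕ) (k : ℤ) : iv i k ⊆ tri i k := by
  intro y hy
  rw [mem_iv_iff] at hy
  simp only [Finset.mem_coe, mem_tri]
  have : (0:ℤ) < 4 ^ i := by positivity
  constructor <;> linarith

lemma mem_tri_of_abs_le {i : ℕ} {y z : ℤ} (h : |y - z| ≤ 4 ^ i) : z ∈ tri i (y / 4 ^ i) := by
  have := div_bounds i y
  rw [abs_le] at h
  rw [mem_tri]
  constructor <;> linarith

lemma abs_le_of_mem_tri {i : ℕ} {y z : ℤ} (h : z ∈ tri i (y / 4 ^ i)) : |y - z| ≤ 2 * 4 ^ i := by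
  have := div_bounds i y
  rw [mem_tri] at h
  rw [abs_le]
  constructor <;> linarith

lemma vitali_finset {ι α : Type*} (t : Finset ι) (B : ι → Set α) (n : ι → ℕ)
    (hne : ∀ a ∈ t, (B a).Nonempty) :
    ∃ u ⊆ t, (u : Set ι).PairwiseDisjoint B ∧ ∀ a ∈ t, ∃ b ∈ u, (B a ∩ B b).Nonempty ∧ n a ≤ n b := by
  classical
  obtain ⟨u, hu, hd, hc⟩ := Vitali.exists_disjoint_subfamily_covering_enlargement B (t : Set ι)
    (fun a => (4 : ℝ) ^ n a) 2 (by norm_num) (fun _ _ => by positivity)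
    (4 ^ (t.sup n)) (fun a ha => by
      have : n a ≤ t.sup n := Finset.le_sup ha
      gcongr; norm_num) hne
  have hf : u.Finite := t.finite_toSet.subset hu
  refine ⟨hf.toFinset, fun a ha => by simpa using hu (by simpa using ha), by simpa using hd, fun a ha => ?_⟩
  obtain ⟨b, hb, h1, h2⟩ := hc a ha
  refine ⟨b, by simpa using hb, h1, ?_⟩
  by_contra hlt
  push Not at hlt
  have : (4:ℝ) ^ (n b + 1) ≤ 4 ^ n a := pow_le_pow_right₀ (by norm_num) hlt
  rw [pow_succ] at this
  have : (0:ℝ) < 4 ^ n b := by positivity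
  linarith

lemma maximal_weak (u : ℤ → ℝ) (hu : ∀ z, 0 ≤ u z) (K : ℝ) (hK : ∀ s : Finset ℤ, ∑ z ∈ s, u z ≤ K)
    (lam : ℝ) (hl : 0 ≤ lam) (A : Finset ℤ)
    (hA : ∀ y ∈ A, ∃ i : ℕ, lam * 4 ^ i ≤ ∑ z ∈ tri i (y / 4 ^ i), u z) :
    lam * A.card ≤ 9 * K := by
  classical
  choose! n hn using hA
  obtain ⟨U, hU, hd, hc⟩ := vitali_finset A (fun y => (tri (n y) (y / 4 ^ n y) : Set ℤ)) n
    (fun y _ => ⟨y, iv_subset_tri _ _ rfl⟩)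
  have hcov : A ⊆ U.biUnion fun b => Finset.Icc (b - 4 * 4 ^ n b) (b + 4 * 4 ^ n b) := by
    intro y hy
    obtain ⟨b, hb, ⟨z, hz1, hz2⟩, hle⟩ := hc y hy
    have h1 := abs_le_of_mem_tri hz1
    have h2 := abs_le_of_mem_tri hz2
    have h3 : (4:ℤ) ^ n y ≤ 4 ^ n b := pow_le_pow_right₀ (by norm_num) hle
    rw [abs_le] at h1 h2
    simp only [Finset.mem_biUnion, Finset.mem_Icc]
    exact ⟨b, hb, by linarith, by linarith⟩
  have hcard : (A.card : ℝ) ≤ ∑ b ∈ U, 9 * (4:ℝ) ^ n b := by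
    have h1 := (Finset.card_le_card hcov).trans Finset.card_biUnion_le
    calc (A.card : ℝ) ≤ ∑ b ∈ U, ((Finset.Icc (b - 4 * 4 ^ n b) (b + 4 * 4 ^ n b)).card : ℝ) := by
          exact_mod_cast h1
      _ ≤ _ := by
          refine Finset.sum_le_sum fun b _ => ?_
          rw [Int.card_Icc]
          have e : b + 4 * 4 ^ n b + 1 - (b - 4 * 4 ^ n b) = ((8 * 4 ^ n b + 1 : ℕ) : ℤ) := by push_cast; ring
          rw [e, Int.toNat_natCast]
          push_cast
          linarith [Tile.one_le_four_pow (n b)]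
  calc lam * A.card ≤ lam * ∑ b ∈ U, 9 * (4:ℝ) ^ n b := by gcongr
    _ = 9 * ∑ b ∈ U, lam * 4 ^ n b := by rw [Finset.mul_sum, Finset.mul_sum]; exact Finset.sum_congr rfl fun _ _ => by ring
    _ ≤ 9 * ∑ b ∈ U, ∑ z ∈ tri (n b) (b / 4 ^ n b), u z := by
        gcongr with b hb; exact hn b (hU hb)
    _ = 9 * ∑ z ∈ U.biUnion fun b => tri (n b) (b / 4 ^ n b), u z := by
        rw [Finset.sum_biUnion]
        intro a ha b hb hab
        exact Finset.disjoint_coe.1 (hd ha hb hab)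
    _ ≤ 9 * K := by gcongr; exact hK _

lemma card_tri (i : ℕ) (k : ℤ) : ((tri i k).card : ℝ) = 3 * 4 ^ i := by
  rw [tri, Int.card_Ico, show (k + 2) * 4 ^ i - (k - 1) * 4 ^ i = ((3 * 4 ^ i : ℕ) : ℤ) by push_cast; ring,
    Int.toNat_natCast]
  push_cast; ring

/-- The weak type (2,2) bound for anything dominated by the maximal function of `u`. -/
lemma maximal_weak_two (u : ℤ → ℝ) (hu : ∀ z, 0 ≤ u z) (K : ℝ) (hK : ∀ s : Finset ℤ, ∑ z ∈ s, u z ^ 2 ≤ K)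
    (lam : ℝ) (hl : 0 < lam) (A : Finset ℤ) (m : ℤ → ℝ)
    (hm : ∀ y ∈ A, ∀ l : ℝ, 0 ≤ l → (∀ i, ∑ z ∈ tri i (y / 4 ^ i), u z ≤ l * 4 ^ i) → m y ≤ l)
    (hA : ∀ y ∈ A, 2 * lam < m y) : A.card ≤ 27 * K / lam ^ 2 := by
  classical
  set v : ℤ → ℝ := fun z => if lam / 3 < u z then u z else 0 with hv
  have hv2 : ∀ z, v z ≤ 3 / lam * u z ^ 2 := by
    intro z; simp only [hv]; split_ifs with h
    · rw [div_mul_eq_mul_div, le_div_iff₀ hl]; nlinarith [hu z]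
    · positivity
  have huv : ∀ z, u z ≤ lam / 3 + v z := by
    intro z; simp only [hv]; split_ifs with h <;> linarith
  have := maximal_weak v (fun z => by simp only [hv]; split_ifs; exacts [hu z, le_rfl]) (3 / lam * K)
    (fun s => (Finset.sum_le_sum fun z _ => hv2 z).trans (by rw [← Finset.mul_sum]; gcongr; exact hK s))
    lam hl.le A (fun y hy => by
      by_contra hcon
      push Not at hcon
      refine absurd (hm y hy (2 * lam) (by positivity) fun i => ?_) (not_le.2 (hA y hy))
      calc ∑ z ∈ tri i (y / 4 ^ i), u z ≤ ∑ z ∈ tri i (y / 4 ^ i), (lam / 3 + v z) :=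
            Finset.sum_le_sum fun z _ => huv z
        _ = 3 * 4 ^ i * (lam / 3) + ∑ z ∈ tri i (y / 4 ^ i), v z := by
            rw [Finset.sum_add_distrib, Finset.sum_const, nsmul_eq_mul, card_tri]
        _ ≤ 2 * lam * 4 ^ i := by linarith [hcon i])
  rw [le_div_iff₀ (by positivity)]
  rw [div_mul_eq_mul_div, mul_div_assoc', le_div_iff₀ hl] at this
  nlinarith

lemma layer_le (l x : ℝ) (hl : 0 < l) (N : ℕ) (h : x ≤ 2 ^ (N + 1) * l) :
    x ≤ 2 * l + ∑ j ∈ Finset.range N, 2 ^ (j + 1) * l * (if 2 * (2 ^ j * l) < x then 1 else 0) := by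
  induction N with
  | zero => simpa using h
  | succ N ih =>
    by_cases hx : x ≤ 2 ^ (N + 1) * l
    · refine (ih hx).trans ?_
      rw [Finset.sum_range_succ]
      have : (0:ℝ) ≤ 2 ^ (N + 1) * l * (if 2 * (2 ^ N * l) < x then 1 else 0) := by
        split_ifs <;> positivity
      linarith
    · push Not at hx
      have : ∀ j ∈ Finset.range (N + 1), (2:ℝ) ^ (j + 1) * l * (if 2 * (2 ^ j * l) < x then 1 else 0) = 2 * l * 2 ^ j := by
        intro j hj
        have hj' : j ≤ N := by simpa [Nat.lt_succ_iff] using hj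
        have : (2:ℝ) ^ j ≤ 2 ^ N := pow_le_pow_right₀ (by norm_num) hj'
        rw [if_pos]
        · rw [pow_succ]; ring
        · refine lt_of_le_of_lt ?_ hx
          rw [pow_succ]; nlinarith
      rw [Finset.sum_congr rfl this, ← Finset.mul_sum]
      have hg : ∑ j ∈ Finset.range (N + 1), (2:ℝ) ^ j = 2 ^ (N + 1) - 1 := by
        rw [geom_sum_eq (by norm_num)]; norm_num
      rw [hg]
      have := pow_succ (2:ℝ) (N + 1)
      rw [this] at h
      linarith

lemma sum_half_pow_le (N : ℕ) : ∑ j ∈ Finset.range N, ((1:ℝ) / 2) ^ j ≤ 2 := sum_geometric_two_le N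

/-- The maximal inequality in the form used for trees. -/
lemma maximal_sum (u : ℤ → ℝ) (hu : ∀ z, 0 ≤ u z) (K : ℝ) (hK : ∀ s : Finset ℤ, ∑ z ∈ s, u z ^ 2 ≤ K)
    (l : ℝ) (hl : 0 < l) (A : Finset ℤ) (m : ℤ → ℝ)
    (hm : ∀ y ∈ A, ∀ l : ℝ, 0 ≤ l → (∀ i, ∑ z ∈ tri i (y / 4 ^ i), u z ≤ l * 4 ^ i) → m y ≤ l) :
    ∑ y ∈ A, m y ≤ 2 * l * A.card + 108 * K / l := by
  classical
  have hK0 : 0 ≤ K := by simpa using hK ∅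
  obtain ⟨N, hN⟩ : ∃ N : ℕ, ∀ y ∈ A, m y ≤ 2 ^ (N + 1) * l := by
    have : ∀ y, ∃ N : ℕ, m y ≤ 2 ^ (N + 1) * l := fun y => by
      obtain ⟨N, hN⟩ := pow_unbounded_of_one_lt (m y / l) (one_lt_two)
      refine ⟨N, ?_⟩
      rw [div_lt_iff₀ hl] at hN
      rw [pow_succ]; nlinarith [pow_pos (two_pos : (0:ℝ) < 2) N]
    choose n hn using this
    refine ⟨A.sup n, fun y hy => (hn y).trans ?_⟩
    have : n y ≤ A.sup n := Finset.le_sup hy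
    gcongr; norm_num
  calc ∑ y ∈ A, m y ≤ ∑ y ∈ A, (2 * l + ∑ j ∈ Finset.range N, 2 ^ (j + 1) * l * (if 2 * (2 ^ j * l) < m y then 1 else 0)) :=
        Finset.sum_le_sum fun y hy => layer_le l _ hl N (hN y hy)
    _ = 2 * l * A.card + ∑ j ∈ Finset.range N, 2 ^ (j + 1) * l * ((A.filter fun y => 2 * (2 ^ j * l) < m y).card : ℝ) := by
        rw [Finset.sum_add_distrib, Finset.sum_const, nsmul_eq_mul, Finset.sum_comm]
        congr 1
        · ring
        · refine Finset.sum_congr rfl fun j _ => ?_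
          rw [← Finset.mul_sum, Finset.sum_boole]
    _ ≤ 2 * l * A.card + ∑ j ∈ Finset.range N, 2 ^ (j + 1) * l * (27 * K / (2 ^ j * l) ^ 2) := by
        gcongr with j _
        exact maximal_weak_two u hu K hK _ (by positivity) _ m (fun y hy => hm y (Finset.mem_filter.1 hy).1)
          (fun y hy => (Finset.mem_filter.1 hy).2)
    _ = 2 * l * A.card + 54 * K / l * ∑ j ∈ Finset.range N, (1 / 2) ^ j := by
        rw [Finset.mul_sum]
        congr 1
        refine Finset.sum_congr rfl fun j _ => ?_
        rw [pow_succ, div_pow, one_pow]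
        field_simp; ring
    _ ≤ 2 * l * A.card + 54 * K / l * 2 := by
        gcongr
        exact sum_half_pow_le N
    _ = _ := by ring

/-- Averages against a decaying kernel are controlled by averages over intervals. -/
lemma kernel_le (u : ℤ → ℝ) (hu : ∀ z, 0 ≤ u z) (i : ℕ) (y : ℤ) (l : ℝ) 
    (h : ∀ i', i ≤ i' → ∑ z ∈ tri i' (y / 4 ^ i'), u z ≤ l * 4 ^ i') (A : Finset ℤ) :
    ∑ z ∈ A, u z * wt (((y:ℝ) - z) / 4 ^ i) ^ 2 ≤ 32 * (l * 4 ^ i) := by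
  classical
  have hl : 0 ≤ l := by
    have h1 := (Finset.sum_nonneg fun z _ => hu z).trans (h i le_rfl)
    exact nonneg_of_mul_nonneg_left h1 (by positivity)
  have key : ∀ z : ℤ, ∃ n : ℕ, z ∈ tri (i + n) (y / 4 ^ (i + n)) ∧ wt (((y:ℝ) - z) / 4 ^ i) ^ 2 ≤ 16 * (1 / 16) ^ n := by
    intro z
    have hex : ∃ n : ℕ, |y - z| ≤ 4 ^ (i + n) := by
      obtain ⟨n, hn⟩ := pow_unbounded_of_one_lt |y - z| (show (1:ℤ) < 4 by norm_num)
      exact ⟨n, hn.le.trans (pow_le_pow_right₀ (by norm_num) (by omega))⟩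
    refine ⟨Nat.find hex, mem_tri_of_abs_le (Nat.find_spec hex), ?_⟩
    rcases hn : Nat.find hex with _ | n
    · refine (wt_pow_le_one _ _).trans (by norm_num)
    · have h1 := Nat.find_min hex (show n < Nat.find hex by omega)
      push Not at h1
      have h2 : (4:ℝ) ^ n ≤ |((y:ℝ) - z) / 4 ^ i| := by
        rw [abs_div, abs_of_pos (show (0:ℝ) < 4 ^ i by positivity), le_div_iff₀ (by positivity), ← pow_add, add_comm n]
        exact_mod_cast h1.le
      have h3 : wt (((y:ℝ) - z) / 4 ^ i) ≤ ((4:ℝ) ^ n)⁻¹ := by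
        unfold wt; gcongr; linarith
      calc wt (((y:ℝ) - z) / 4 ^ i) ^ 2 ≤ (((4:ℝ) ^ n)⁻¹) ^ 2 := by
            have := wt_nonneg (((y:ℝ) - z) / 4 ^ i); gcongr
        _ = 16 * (1 / 16) ^ (n + 1) := by
            rw [← inv_pow, ← pow_mul, mul_comm n 2, pow_mul, pow_succ]; norm_num; ring
  choose n hn1 hn2 using key
  set N := A.sup n + 1
  calc ∑ z ∈ A, u z * wt (((y:ℝ) - z) / 4 ^ i) ^ 2
      ≤ ∑ z ∈ A, ∑ j ∈ Finset.range N, u z * (16 * (1 / 16) ^ j) * (if z ∈ tri (i + j) (y / 4 ^ (i + j)) then 1 else 0) := by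
        refine Finset.sum_le_sum fun z hz => ?_
        have hmem : n z ∈ Finset.range N := by
          have : n z ≤ A.sup n := Finset.le_sup hz
          simp [N]; omega
        refine le_trans ?_ (Finset.single_le_sum (fun j _ => ?_) hmem)
        · rw [if_pos (hn1 z), mul_one]
          exact mul_le_mul_of_nonneg_left (hn2 z) (hu z)
        · have := hu z
          split_ifs <;> positivity
    _ = ∑ j ∈ Finset.range N, (16 * (1 / 16) ^ j) * ∑ z ∈ A with z ∈ tri (i + j) (y / 4 ^ (i + j)), u z := by
        rw [Finset.sum_comm]
        refine Finset.sum_congr rfl fun j _ => ?_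
        rw [Finset.mul_sum, Finset.sum_filter]
        refine Finset.sum_congr rfl fun z _ => ?_
        split_ifs <;> ring
    _ ≤ ∑ j ∈ Finset.range N, (16 * (1 / 16) ^ j) * (l * 4 ^ (i + j)) := by
        gcongr with j _
        refine (Finset.sum_le_sum_of_subset_of_nonneg ?_ fun z _ _ => hu z).trans (h (i + j) (by omega))
        intro z hz
        exact (Finset.mem_filter.1 hz).2
    _ ≤ ∑ j ∈ Finset.range N, 16 * (l * 4 ^ i) * (1 / 2) ^ j := by
        refine Finset.sum_le_sum fun j _ => ?_
        have h1 : ((1:ℝ) / 16) ^ j * 4 ^ j ≤ (1 / 2) ^ j := by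
          rw [← mul_pow]; gcongr; norm_num
        rw [pow_add]
        calc _ = 16 * (l * 4 ^ i) * ((1 / 16) ^ j * 4 ^ j) := by ring
          _ ≤ _ := by gcongr
    _ ≤ 16 * (l * 4 ^ i) * 2 := by
        rw [← Finset.mul_sum]; gcongr; exact sum_half_pow_le N
    _ = _ := by ring

/-- The mass of the set of points of `G` where `N` takes its value in `P.om`. -/
noncomputable def mass (N : ℤ → ℝ) (G : Finset ℤ) (P : Tile) : ℝ :=
  open Classical in (4 ^ P.i)⁻¹ * ∑ y ∈ G with N y ∈ P.om, P.w y ^ 5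

lemma mass_nonneg (N : ℤ → ℝ) (G : Finset ℤ) (P : Tile) : 0 ≤ mass N G P := by
  unfold mass
  exact mul_nonneg (by positivity) (Finset.sum_nonneg fun y _ => pow_nonneg (P.w_nonneg y) _)

lemma mass_le (N : ℤ → ℝ) (G : Finset ℤ) (P : Tile) : mass N G P ≤ 8 := by
  unfold mass
  rw [inv_mul_le_iff₀ (by positivity), mul_comm]
  exact P.sum_w_le (by norm_num) _

lemma exists_scale_wt (t : ℝ) : ∃ r : ℕ, (1 / 2 : ℝ) ^ (r + 1) ≤ wt t ∧ wt t ≤ (1 / 2) ^ r := by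
  obtain ⟨n, hn⟩ := exists_nat_pow_near_of_lt_one (wt_pos t) (wt_le_one t) (show (0:ℝ) < 1 / 2 by norm_num) (by norm_num)
  exact ⟨n, hn.1.le, hn.2⟩

/-- Points close to the tile at scale `2 ^ r`. -/
noncomputable def nearPts (G : Finset ℤ) (r : ℕ) (P : Tile) : Finset ℤ :=
  open Classical in G.filter fun y => (1 / 2 : ℝ) ^ (r + 1) ≤ P.w y

lemma mem_nearPts {G : Finset ℤ} {r : ℕ} {P : Tile} {y : ℤ} :
    y ∈ nearPts G r P ↔ y ∈ G ∧ (1 / 2 : ℝ) ^ (r + 1) ≤ P.w y := by simp [nearPts]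

lemma abs_sub_le_of_le_w {P : Tile} {r : ℕ} {y : ℤ} (h : (1 / 2 : ℝ) ^ (r + 1) ≤ P.w y) :
    |y - P.k * 4 ^ P.i| ≤ 2 ^ (r + 1) * 4 ^ P.i := by
  unfold Tile.w wt at h
  rw [one_div, inv_pow] at h
  have h1 := (inv_le_inv₀ (by positivity) (by positivity)).1 h
  have h4 : (0:ℝ) < 4 ^ P.i := by positivity
  rw [abs_div, abs_of_pos h4] at h1
  have h2 : |(y:ℝ) - P.k * 4 ^ P.i| / 4 ^ P.i ≤ 2 ^ (r + 1) := by linarith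
  rw [div_le_iff₀ h4] at h2
  exact_mod_cast h2

lemma exists_nearPts_of_mass (N : ℤ → ℝ) (G : Finset ℤ) (P : Tile) (δ : ℝ) (hδ : 0 < δ)
    (h : δ ≤ mass N G P) : 
    open Classical in
    ∃ r : ℕ, δ / 4 * 4 ^ P.i * 16 ^ r ≤ ((nearPts G r P).filter fun y => N y ∈ P.om).card := by
  classical
  by_contra hcon
  push Not at hcon
  choose r hr1 hr2 using fun y => exists_scale_wt (((y:ℤ) - P.k * 4 ^ P.i : ℝ) / 4 ^ P.i)
  set R := G.sup r + 1
  have : ∑ y ∈ G with N y ∈ P.om, P.w y ^ 5 ≤ δ / 2 * 4 ^ P.i := by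
    calc ∑ y ∈ G with N y ∈ P.om, P.w y ^ 5
        ≤ ∑ y ∈ G with N y ∈ P.om, ∑ j ∈ Finset.range R, (1 / 32) ^ j * (if (1 / 2 : ℝ) ^ (j + 1) ≤ P.w y then 1 else 0) := by
          refine Finset.sum_le_sum fun y hy => ?_
          have hmem : r y ∈ Finset.range R := by
            have : r y ≤ G.sup r := Finset.le_sup (Finset.mem_filter.1 hy).1
            simp [R]; omega
          refine le_trans ?_ (Finset.single_le_sum (fun j _ => ?_) hmem)
          · rw [if_pos (show (1 / 2 : ℝ) ^ (r y + 1) ≤ P.w y from hr1 y), mul_one]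
            calc P.w y ^ 5 ≤ ((1 / 2) ^ r y) ^ 5 := by
                  have := P.w_nonneg y
                  gcongr; exact hr2 y
              _ = _ := by rw [← pow_mul, mul_comm, pow_mul]; norm_num
          · split_ifs <;> positivity
      _ = ∑ j ∈ Finset.range R, (1 / 32) ^ j * (((nearPts G j P).filter fun y => N y ∈ P.om).card : ℝ) := by
          rw [Finset.sum_comm]
          refine Finset.sum_congr rfl fun j _ => ?_
          rw [← Finset.mul_sum, Finset.sum_boole, nearPts, Finset.filter_filter, Finset.filter_filter]
          simp only [and_comm]
      _ ≤ ∑ j ∈ Finset.range R, (1 / 32) ^ j * (δ / 4 * 4 ^ P.i * 16 ^ j) := by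
          gcongr with j _
          exact (hcon j).le
      _ = δ / 4 * 4 ^ P.i * ∑ j ∈ Finset.range R, (1 / 2) ^ j := by
          rw [Finset.mul_sum]
          refine Finset.sum_congr rfl fun j _ => ?_
          rw [show (1 / 2 : ℝ) = 1 / 32 * 16 by norm_num, mul_pow]; ring
      _ ≤ δ / 4 * 4 ^ P.i * 2 := by gcongr; exact sum_half_pow_le R
      _ = _ := by ring
  unfold mass at h
  rw [le_inv_mul_iff₀ (by positivity)] at h
  have h4 : (0:ℝ) < 4 ^ P.i := by positivity
  nlinarith

/-- Tiles that are pairwise incomparable. -/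
def Incomparable (S : Finset Tile) : Prop := ∀ P ∈ S, ∀ Q ∈ S, P.Le Q → P = Q

lemma Incomparable.disjoint_iv {S : Finset Tile} (hS : Incomparable S) {P Q : Tile} (hP : P ∈ S) (hQ : Q ∈ S)
    (hne : P ≠ Q) {x : ℝ} (hx : x ∈ P.om) (hx' : x ∈ Q.om) : Disjoint P.iv Q.iv := by
  rw [Set.disjoint_left]
  intro y hy hy'
  rcases le_total P.i Q.i with h | h
  · exact hne (hS P hP Q hQ (Tile.le_of_mem h hy hy' hx hx'))
  · exact hne (hS Q hQ P hP (Tile.le_of_mem h hy' hy hx' hx)).symm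

lemma card_ivF (i : ℕ) (k : ℤ) : ((Finset.Ico (k * 4 ^ i) ((k + 1) * 4 ^ i)).card : ℝ) = 4 ^ i := by
  rw [Int.card_Ico, show (k + 1) * 4 ^ i - k * 4 ^ i = ((4 ^ i : ℕ) : ℤ) by push_cast; ring,
    Int.toNat_natCast]
  push_cast; ring

/-- Tiles with disjoint time intervals contained in a given finite set. -/
lemma sum_len_le_card {S : Finset Tile} (A : Finset ℤ) (hd : ∀ P ∈ S, ∀ Q ∈ S, P ≠ Q → Disjoint P.iv Q.iv)
    (hA : ∀ P ∈ S, P.iv ⊆ A) : ∑ P ∈ S, (4:ℝ) ^ P.i ≤ A.card := by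
  classical
  set F : Tile → Finset ℤ := fun P => Finset.Ico (P.k * 4 ^ P.i) ((P.k + 1) * 4 ^ P.i) with hF
  have hFiv : ∀ P, (F P : Set ℤ) = P.iv := by
    intro P; ext y; simp only [hF, Finset.coe_Ico, Set.mem_Ico, Tile.iv]; exact mem_iv_iff.symm
  calc ∑ P ∈ S, (4:ℝ) ^ P.i = ((S.biUnion F).card : ℝ) := by
        rw [Finset.card_biUnion]
        · push_cast; exact Finset.sum_congr rfl fun P _ => (card_ivF P.i P.k).symm
        · intro P hP Q hQ hne
          rw [Function.onFun, ← Finset.disjoint_coe, hFiv, hFiv]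
          exact hd P hP Q hQ hne
    _ ≤ A.card := by
        norm_cast
        refine Finset.card_le_card (Finset.biUnion_subset.2 fun P hP => ?_)
        rw [← Finset.coe_subset, hFiv]
        exact hA P hP

lemma mass_scale (N : ℤ → ℝ) (G : Finset ℤ) (S : Finset Tile) (hS : Incomparable S) (δ : ℝ)
    (r : ℕ) (κ : ℝ) (hκ : (open Classical in ((S.biUnion (nearPts G r)).card : ℝ)) ≤ κ)
    (h : open Classical in ∀ P ∈ S, δ / 4 * 4 ^ P.i * 16 ^ r ≤ ((nearPts G r P).filter fun y => N y ∈ P.om).card) :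
    δ * ∑ P ∈ S, (4:ℝ) ^ P.i ≤ 128 * (1 / 8) ^ r * κ := by
  classical
  set B : Tile → Set (ℤ × ℝ) := fun P => {z | (1 / 2 : ℝ) ^ (r + 1) ≤ P.w z.1 ∧ z.2 ∈ P.om}
  obtain ⟨U, hU, hd, hc⟩ := vitali_finset S B Tile.i (fun P _ => by
    obtain ⟨x, hx⟩ := om_nonempty P.i P.m
    refine ⟨(P.k * 4 ^ P.i, x), ?_, hx⟩
    have : P.w (P.k * 4 ^ P.i) = 1 := by simp [Tile.w, wt]
    rw [this]; exact pow_le_one₀ (by norm_num) (by norm_num))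
  choose! b hb1 hb2 hb3 using hc
  have h1 : ∑ P ∈ U, δ / 4 * 4 ^ P.i * 16 ^ r ≤ κ := by
    calc ∑ P ∈ U, δ / 4 * 4 ^ P.i * 16 ^ r ≤ ∑ P ∈ U, (((nearPts G r P).filter fun y => N y ∈ P.om).card : ℝ) :=
          Finset.sum_le_sum fun P hP => h P (hU hP)
      _ = ((U.biUnion fun P => (nearPts G r P).filter fun y => N y ∈ P.om).card : ℝ) := by
          rw [Finset.card_biUnion]
          · push_cast; rfl
          · intro P hP Q hQ hne
            rw [Function.onFun, Finset.disjoint_left]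
            intro y hy hy'
            simp only [Finset.mem_filter, mem_nearPts] at hy hy'
            have h1 : (y, N y) ∈ B P := ⟨hy.1.2, hy.2⟩
            have h2 : (y, N y) ∈ B Q := ⟨hy'.1.2, hy'.2⟩
            exact Set.disjoint_left.1 (hd hP hQ hne) h1 h2
      _ ≤ ((S.biUnion (nearPts G r)).card : ℝ) := by
          norm_cast
          exact Finset.card_le_card ((Finset.biUnion_mono fun P _ => Finset.filter_subset _ _).trans
            (Finset.biUnion_subset_biUnion_of_subset_left _ hU))
      _ ≤ κ := hκ
  have h2 : ∀ T ∈ U, ∑ P ∈ S with b P = T, (4:ℝ) ^ P.i ≤ 2 ^ (r + 5) * 4 ^ T.i := by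
    intro T hT
    have hcomm : ∀ P ∈ S.filter (fun P => b P = T), T.om ⊆ P.om := by
      intro P hP
      obtain ⟨hPS, rfl⟩ := Finset.mem_filter.1 hP
      obtain ⟨z, hz1, hz2⟩ := hb2 P hPS
      exact om_nest (hb3 P hPS) hz1.2 hz2.2
    obtain ⟨x, hx⟩ := om_nonempty T.i T.m
    refine (sum_len_le_card (Finset.Icc (T.k * 4 ^ T.i - 2 ^ (r + 3) * 4 ^ T.i) (T.k * 4 ^ T.i + 2 ^ (r + 3) * 4 ^ T.i)) ?_ ?_).trans ?_
    · intro P hP Q hQ hne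
      exact hS.disjoint_iv (Finset.mem_filter.1 hP).1 (Finset.mem_filter.1 hQ).1 hne (hcomm P hP hx) (hcomm Q hQ hx)
    · intro P hP y hy
      obtain ⟨hPS, rfl⟩ := Finset.mem_filter.1 hP
      obtain ⟨z, hz1, hz2⟩ := hb2 P hPS
      have e1 := abs_sub_le_of_le_w hz1.1
      have e2 := abs_sub_le_of_le_w hz2.1
      have e3 : (4:ℤ) ^ P.i ≤ 4 ^ (b P).i := pow_le_pow_right₀ (by norm_num) (hb3 P hPS)
      have e4 := mem_iv_iff.1 hy
      have e5 : (2:ℤ) ^ (r + 1) * 4 ^ P.i ≤ 2 ^ (r + 1) * 4 ^ (b P).i := by gcongr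
      have e6 : (2:ℤ) ^ (r + 3) * 4 ^ (b P).i = 4 * (2 ^ (r + 1) * 4 ^ (b P).i) := by ring
      have e7 : (1:ℤ) * 4 ^ (b P).i ≤ 2 ^ (r + 1) * 4 ^ (b P).i := by gcongr; exact one_le_pow₀ (by norm_num)
      rw [abs_le] at e1 e2
      simp only [Finset.coe_Icc, Set.mem_Icc]
      constructor <;> nlinarith
    · rw [Int.card_Icc, show (T.k * 4 ^ T.i + 2 ^ (r + 3) * 4 ^ T.i + 1 - (T.k * 4 ^ T.i - 2 ^ (r + 3) * 4 ^ T.i) : ℤ)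
        = ((2 ^ (r + 4) * 4 ^ T.i + 1 : ℕ) : ℤ) by push_cast; ring, Int.toNat_natCast]
      push_cast
      have : (1:ℝ) ≤ 2 ^ (r + 4) * 4 ^ T.i := one_le_mul_of_one_le_of_one_le (one_le_pow₀ (by norm_num)) (one_le_pow₀ (by norm_num))
      rw [pow_succ (2:ℝ) (r + 4)]; linarith
  have h3 : ∑ P ∈ S, (4:ℝ) ^ P.i ≤ 2 ^ (r + 5) * ∑ T ∈ U, (4:ℝ) ^ T.i := by
    rw [← Finset.sum_fiberwise_of_maps_to (fun P hP => hb1 P hP), Finset.mul_sum]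
    exact Finset.sum_le_sum h2
  by_cases hδ : 0 ≤ δ
  · calc δ * ∑ P ∈ S, (4:ℝ) ^ P.i ≤ δ * (2 ^ (r + 5) * ∑ T ∈ U, (4:ℝ) ^ T.i) := by gcongr
      _ = 128 * (1 / 8) ^ r * ∑ P ∈ U, δ / 4 * 4 ^ P.i * 16 ^ r := by
          rw [← Finset.sum_mul, ← Finset.mul_sum, pow_add, show (16:ℝ) = 2 * 8 by norm_num, mul_pow, div_pow, one_pow]
          field_simp; ring
      _ ≤ _ := by gcongr
  · have : 0 ≤ κ := le_trans (by positivity) hκ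
    have h5 : 0 ≤ ∑ P ∈ S, (4:ℝ) ^ P.i := by positivity
    push Not at hδ
    exact (mul_nonpos_of_nonpos_of_nonneg hδ.le h5).trans (by positivity)

lemma mass_lemma_aux (N : ℤ → ℝ) (G : Finset ℤ) (S : Finset Tile) (hS : Incomparable S) (δ : ℝ) (hδ : 0 < δ)
    (h : ∀ P ∈ S, δ ≤ mass N G P) (κ : ℝ)
    (hκ : ∀ r, (open Classical in ((S.biUnion (nearPts G r)).card : ℝ)) ≤ 36 * 4 ^ r * κ) :
    δ * ∑ P ∈ S, (4:ℝ) ^ P.i ≤ 9216 * κ := by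
  classical
  have hκ0 : 0 ≤ κ := by
    have := (Nat.cast_nonneg _).trans (hκ 0)
    linarith
  choose! r hr using fun P hP => exists_nearPts_of_mass N G P δ hδ (h P hP)
  set R := S.sup r + 1
  have hmaps : ∀ P ∈ S, r P ∈ Finset.range R := by
    intro P hP
    have : r P ≤ S.sup r := Finset.le_sup hP
    simp [R]; omega
  rw [← Finset.sum_fiberwise_of_maps_to hmaps, Finset.mul_sum]
  calc ∑ j ∈ Finset.range R, δ * ∑ P ∈ S with r P = j, (4:ℝ) ^ P.i
      ≤ ∑ j ∈ Finset.range R, 128 * (1 / 8) ^ j * (36 * 4 ^ j * κ) := by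
        refine Finset.sum_le_sum fun j _ => ?_
        refine mass_scale N G _ (fun P hP Q hQ => hS P (Finset.mem_filter.1 hP).1 Q (Finset.mem_filter.1 hQ).1) δ j _ ?_ ?_
        · refine le_trans ?_ (hκ j)
          norm_cast
          exact Finset.card_le_card (Finset.biUnion_subset_biUnion_of_subset_left _ (Finset.filter_subset _ _))
        · intro P hP
          obtain ⟨hPS, rfl⟩ := Finset.mem_filter.1 hP
          exact hr P hPS
    _ = 4608 * κ * ∑ j ∈ Finset.range R, (1 / 2) ^ j := by
        rw [Finset.mul_sum]
        refine Finset.sum_congr rfl fun j _ => ?_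
        rw [show (1 / 2 : ℝ) = 1 / 8 * 4 by norm_num, mul_pow]; ring
    _ ≤ 4608 * κ * 2 := by gcongr; exact sum_half_pow_le R
    _ = _ := by ring

/-- The mass lemma. -/
lemma mass_lemma (N : ℤ → ℝ) (G : Finset ℤ) (S : Finset Tile) (hS : Incomparable S) (δ : ℝ) (hδ : 0 < δ)
    (h : ∀ P ∈ S, δ ≤ mass N G P) : δ * ∑ P ∈ S, (4:ℝ) ^ P.i ≤ 9216 * G.card := by
  classical
  refine mass_lemma_aux N G S hS δ hδ h _ fun r => ?_
  have h1 : ((S.biUnion (nearPts G r)).card : ℝ) ≤ 1 * G.card := by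
    rw [one_mul]; norm_cast
    exact Finset.card_le_card (Finset.biUnion_subset.2 fun P _ => Finset.filter_subset _ _)
  refine h1.trans ?_
  gcongr
  have : (1:ℝ) ≤ 4 ^ r := one_le_pow₀ (by norm_num)
  linarith

/-- The mass lemma for tiles localized to a finite set. -/
lemma mass_lemma_local (N : ℤ → ℝ) (G : Finset ℤ) (S : Finset Tile) (hS : Incomparable S) (δ : ℝ) (hδ : 0 < δ)
    (h : ∀ P ∈ S, δ ≤ mass N G P) (Ω : Finset ℤ) (hΩ : ∀ P ∈ S, P.iv ⊆ Ω) :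
    δ * ∑ P ∈ S, (4:ℝ) ^ P.i ≤ 9216 * Ω.card := by
  classical
  refine mass_lemma_aux N G S hS δ hδ h _ fun r => ?_
  have := maximal_weak (fun z => if z ∈ Ω then 1 else 0) (fun z => by positivity) Ω.card (fun s => by
    rw [Finset.sum_boole]; norm_cast
    exact Finset.card_le_card fun z hz => (Finset.mem_filter.1 hz).2) ((1 / 4) ^ (r + 1)) (by positivity)
    (S.biUnion (nearPts G r)) (fun y hy => by
      obtain ⟨P, hP, hy⟩ := Finset.mem_biUnion.1 hy
      refine ⟨P.i + (r + 1), ?_⟩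
      have e1 := abs_sub_le_of_le_w (mem_nearPts.1 hy).2
      rw [Finset.sum_boole, pow_add (4:ℝ) P.i, mul_comm ((4:ℝ) ^ P.i), ← mul_assoc, ← mul_pow,
        one_div_mul_cancel (by norm_num), one_pow, one_mul]
      rw [← card_ivF P.i P.k]
      norm_cast
      refine Finset.card_le_card fun z hz => ?_
      have hz' : z ∈ P.iv := by rw [Tile.iv, mem_iv_iff]; simpa using hz
      refine Finset.mem_filter.2 ⟨mem_tri_of_abs_le ?_, hΩ P hP hz'⟩
      have e2 := mem_iv_iff.1 hz'
      have e3 : (2:ℤ) ^ (r + 1) + 1 ≤ 4 ^ (r + 1) := by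
        have : ∀ n : ℕ, (2:ℤ) ^ (n + 1) + 1 ≤ 4 ^ (n + 1) := by
          intro n
          induction n with
          | zero => norm_num
          | succ n ih => rw [pow_succ, pow_succ (4:ℤ)]; linarith [show (0:ℤ) < 2 ^ (n + 1) by positivity]
        exact this r
      have e4 : (0:ℤ) < 4 ^ P.i := by positivity
      rw [pow_add]
      rw [abs_le] at e1 ⊢
      constructor <;> nlinarith)
  rw [div_pow, one_pow, one_div, inv_mul_le_iff₀ (by positivity), pow_succ] at this
  linarith

lemma tri_mono {n n' : ℕ} (h : n ≤ n') (y : ℤ) : tri n (y / 4 ^ n) ⊆ tri n' (y / 4 ^ n') := by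
  induction n', h using Nat.le_induction with
  | base => rfl
  | succ m _ ih =>
    refine ih.trans fun z hz => ?_
    rw [mem_tri] at *
    have e := ediv_pow_of_le (Nat.le_succ m) y
    rw [Nat.succ_eq_add_one, Nat.add_sub_cancel_left, pow_one] at e
    set k := y / 4 ^ m
    set k' := y / 4 ^ (m + 1)
    have h4 : (0:ℤ) < 4 ^ m := by positivity
    have h1 : 4 * k' ≤ k := by omega
    have h2 : k ≤ 4 * k' + 3 := by omega
    rw [pow_succ]
    constructor <;> nlinarith

lemma iv_subset_tri_of_mem {n : ℕ} {k z : ℤ} (hz : z ∈ tri n k) : iv n (z / 4 ^ n) ⊆ tri n k := by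
  intro x hx
  rw [mem_iv] at hx
  have h1 := div_bounds n z
  have h2 := div_bounds n x
  rw [hx] at h2
  rw [mem_tri] at hz
  rw [Finset.mem_coe, mem_tri]
  have h4 : (0:ℤ) < 4 ^ n := by positivity
  have h5 : k - 1 ≤ z / 4 ^ n := by
    have : k - 1 < z / 4 ^ n + 1 := lt_of_mul_lt_mul_right (hz.1.trans_lt h1.2) h4.le
    omega
  have h6 : z / 4 ^ n + 1 ≤ k + 2 := by
    have : z / 4 ^ n < k + 2 := lt_of_mul_lt_mul_right (h1.1.trans_lt hz.2) h4.le
    omega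
  constructor <;> nlinarith

lemma Tile.corner_mem (P : Tile) : P.k * 4 ^ P.i ∈ P.iv := by
  rw [Tile.iv, mem_iv_iff]
  have : (0:ℤ) < 4 ^ P.i := by positivity
  constructor <;> linarith

lemma Tile.iv_subset_tri {P : Tile} {n : ℕ} (h : P.i ≤ n) {k z : ℤ} (hz : z ∈ P.iv) (hk : z ∈ tri n k) :
    P.iv ⊆ tri n k :=
  (iv_nest h hz (mem_iv.2 rfl)).trans (iv_subset_tri_of_mem hk)

/-- The position `y` sees a tile of `S` at scale `n`. -/
def Near (S : Finset Tile) (T : Tile) (n : ℕ) (y : ℤ) : Prop :=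
  T.i < n ∨ ∃ P ∈ S, P.iv ⊆ tri n (y / 4 ^ n)

lemma Near.mono {S : Finset Tile} {T : Tile} {n n' : ℕ} {y : ℤ} (h : Near S T n y) (hn : n ≤ n') :
    Near S T n' y := by
  rcases h with h | ⟨P, hP, h⟩
  · exact Or.inl (h.trans_le hn)
  · exact Or.inr ⟨P, hP, h.trans (Finset.coe_subset.2 (tri_mono hn y))⟩

lemma exists_near (S : Finset Tile) (T : Tile) (y : ℤ) : ∃ n, Near S T n y := ⟨T.i + 1, Or.inl (by omega)⟩

/-- The least scale at which `y` sees a tile. -/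
noncomputable def lev (S : Finset Tile) (T : Tile) (y : ℤ) : ℕ :=
  open Classical in Nat.find (exists_near S T y)

section
variable {S : Finset Tile} {T : Tile} {y z : ℤ}

lemma lev_le : lev S T y ≤ T.i + 1 := by
  classical
  unfold lev; exact Nat.find_min' _ (Or.inl (by omega))

lemma near_lev : Near S T (lev S T y) y := by
  classical
  unfold lev; exact Nat.find_spec (exists_near S T y)

lemma not_near_of_lt {n : ℕ} (h : n < lev S T y) : ¬ Near S T n y := by
  classical
  unfold lev at h; exact Nat.find_min (exists_near S T y) h

lemma lev_le_of_near {n : ℕ} (h : Near S T n y) : lev S T y ≤ n := by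
  classical
  unfold lev; exact Nat.find_min' _ h

lemma near_congr {n : ℕ} (h : z / 4 ^ n = y / 4 ^ n) : Near S T n z ↔ Near S T n y := by
  unfold Near; rw [h]

lemma div_eq_of_div_eq {n n' : ℕ} (hn : n ≤ n') (h : z / 4 ^ n = y / 4 ^ n) : z / 4 ^ n' = y / 4 ^ n' := by
  rw [ediv_pow_of_le hn, ediv_pow_of_le hn y, h]

lemma lev_eq (h : z / 4 ^ (lev S T y - 1) = y / 4 ^ (lev S T y - 1)) : lev S T z = lev S T y := by
  apply le_antisymm
  · exact lev_le_of_near ((near_congr (div_eq_of_div_eq (by omega) h)).2 near_lev)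
  · by_contra hlt
    push Not at hlt
    have h1 : Near S T (lev S T y - 1) z := near_lev.mono (by omega)
    exact not_near_of_lt (by omega) ((near_congr h).1 h1)

lemma dist_le_of_lt_lev {P : Tile} (hP : P ∈ S) (h : P.i < lev S T y) :
    (4:ℝ) ^ (lev S T y - 1) ≤ |(y:ℝ) - P.k * 4 ^ P.i| := by
  have h1 : ¬ Near S T (lev S T y - 1) y := not_near_of_lt (by omega)
  have h2 : P.k * 4 ^ P.i ∉ tri (lev S T y - 1) (y / 4 ^ (lev S T y - 1)) := fun hc =>
    h1 (Or.inr ⟨P, hP, Tile.iv_subset_tri (by omega) P.corner_mem hc⟩)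
  have h3 : ¬ |y - P.k * 4 ^ P.i| ≤ 4 ^ (lev S T y - 1) := fun hc => h2 (mem_tri_of_abs_le hc)
  push Not at h3
  exact_mod_cast h3.le

lemma w_le_of_lt_lev {P : Tile} (hP : P ∈ S) (h : P.i < lev S T y) :
    P.w y ≤ 4 ^ P.i / 4 ^ (lev S T y - 1) := by
  have h1 := dist_le_of_lt_lev hP h
  unfold Tile.w wt
  have h4 : (0:ℝ) < 4 ^ P.i := by positivity
  rw [abs_div, abs_of_pos h4, show (4:ℝ) ^ P.i / 4 ^ (lev S T y - 1) = (4 ^ (lev S T y - 1) / 4 ^ P.i)⁻¹ from (inv_div _ _).symm]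
  apply inv_anti₀ (by positivity)
  have : (4:ℝ) ^ (lev S T y - 1) / 4 ^ P.i ≤ |(y:ℝ) - P.k * 4 ^ P.i| / 4 ^ P.i := by gcongr
  linarith

lemma w_le_two_mul {P : Tile} (hP : P ∈ S) (h : P.i < lev S T y)
    (hz : z / 4 ^ (lev S T y - 1) = y / 4 ^ (lev S T y - 1)) : P.w y ≤ 2 * P.w z := by
  have h1 := dist_le_of_lt_lev hP h
  have h2 : |(z:ℝ) - y| ≤ 4 ^ (lev S T y - 1) := by
    have a1 := div_bounds (lev S T y - 1) y
    have a2 := div_bounds (lev S T y - 1) z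
    rw [hz] at a2
    have : |z - y| ≤ 4 ^ (lev S T y - 1) := by rw [abs_le]; constructor <;> linarith
    exact_mod_cast this
  have h3 : |(z:ℝ) - P.k * 4 ^ P.i| ≤ 2 * |(y:ℝ) - P.k * 4 ^ P.i| := by
    have := abs_add_le ((z:ℝ) - y) (y - P.k * 4 ^ P.i)
    rw [show (z:ℝ) - y + (y - P.k * 4 ^ P.i) = z - P.k * 4 ^ P.i by ring] at this
    linarith
  unfold Tile.w wt
  have h4 : (0:ℝ) < 4 ^ P.i := by positivity
  rw [abs_div, abs_div, abs_of_pos h4, ← div_eq_mul_inv, inv_eq_one_div, div_le_div_iff₀ (by positivity) (by positivity)]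
  have : |(z:ℝ) - P.k * 4 ^ P.i| / 4 ^ P.i ≤ 2 * (|(y:ℝ) - P.k * 4 ^ P.i| / 4 ^ P.i) := by
    rw [← mul_div_assoc]; gcongr
  linarith

/-- Averaging a sum over the partition into the intervals attached to `lev`. -/
lemma sum_le_of_lev (Y Z : Finset ℤ) (c b m D : ℤ → ℝ) (hc : ∀ y ∈ Y, 0 ≤ c y) (hm : ∀ z ∈ Z, 0 ≤ m z)
    (hZ : ∀ y ∈ Y, ∀ z, z / 4 ^ (lev S T y - 1) = y / 4 ^ (lev S T y - 1) → z ∈ Z)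
    (hb : ∀ y ∈ Y, ∀ z, z / 4 ^ (lev S T y - 1) = y / 4 ^ (lev S T y - 1) → b y ≤ m z)
    (hD : ∀ z ∈ Z, ∑ y ∈ Y with y / 4 ^ (lev S T z - 1) = z / 4 ^ (lev S T z - 1), c y ≤ D z * 4 ^ (lev S T z - 1)) :
    ∑ y ∈ Y, c y * b y ≤ ∑ z ∈ Z, D z * m z := by
  classical
  set J : ℤ → Finset ℤ := fun y => Finset.Ico (y / 4 ^ (lev S T y - 1) * 4 ^ (lev S T y - 1))
    ((y / 4 ^ (lev S T y - 1) + 1) * 4 ^ (lev S T y - 1)) with hJ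
  have hmem : ∀ y z, z ∈ J y ↔ z / 4 ^ (lev S T y - 1) = y / 4 ^ (lev S T y - 1) := by
    intro y z; rw [hJ]; simp only [Finset.mem_Ico]; rw [← mem_iv_iff, mem_iv]
  have hcard : ∀ y, ((J y).card : ℝ) = 4 ^ (lev S T y - 1) := fun y => card_ivF _ _
  have hsymm : ∀ y z, z ∈ J y ↔ y ∈ J z := by
    have : ∀ y z, z ∈ J y → y ∈ J z := by
      intro y z h
      rw [hmem] at *
      rw [lev_eq h]; exact h.symm
    exact fun y z => ⟨this y z, this z y⟩
  calc ∑ y ∈ Y, c y * b y = ∑ y ∈ Y, ∑ z ∈ J y, c y * b y / 4 ^ (lev S T y - 1) := by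
        refine Finset.sum_congr rfl fun y _ => ?_
        rw [Finset.sum_const, nsmul_eq_mul, hcard]; field_simp
    _ ≤ ∑ y ∈ Y, ∑ z ∈ J y, c y * m z / 4 ^ (lev S T z - 1) := by
        refine Finset.sum_le_sum fun y hy => Finset.sum_le_sum fun z hz => ?_
        rw [lev_eq ((hmem y z).1 hz)]
        have := hc y hy
        gcongr
        exact hb y hy z ((hmem y z).1 hz)
    _ = ∑ y ∈ Y, ∑ z ∈ Z with z ∈ J y, c y * m z / 4 ^ (lev S T z - 1) := by
        refine Finset.sum_congr rfl fun y hy => Finset.sum_congr ?_ fun _ _ => rfl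
        ext z; simp only [Finset.mem_filter]
        exact ⟨fun h => ⟨hZ y hy z ((hmem y z).1 h), h⟩, fun h => h.2⟩
    _ = ∑ z ∈ Z, ∑ y ∈ Y with y ∈ J z, c y * m z / 4 ^ (lev S T z - 1) := by
        simp only [Finset.sum_filter]
        rw [Finset.sum_comm]
        refine Finset.sum_congr rfl fun z _ => Finset.sum_congr rfl fun y _ => ?_
        simp only [hsymm y z]
    _ ≤ ∑ z ∈ Z, D z * m z := by
        refine Finset.sum_le_sum fun z hz => ?_
        rw [← Finset.sum_div, ← Finset.sum_mul, div_le_iff₀ (by positivity)]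
        have h1 := hD z hz
        have h2 := hm z hz
        have h3 : (Y.filter fun y => y ∈ J z) = Y.filter fun y => y / 4 ^ (lev S T z - 1) = z / 4 ^ (lev S T z - 1) :=
          Finset.filter_congr fun y _ => hmem z y
        rw [h3]
        nlinarith
end

lemma sum_four_pow_le (n : ℕ) : ∑ i ∈ Finset.range (n + 1), (4:ℝ) ^ i / 4 ^ n ≤ 2 := by
  rw [← Finset.sum_div, div_le_iff₀ (by positivity), geom_sum_eq (by norm_num), pow_succ]
  have : (0:ℝ) < 4 ^ n := by positivity
  rw [div_le_iff₀ (by norm_num)]; linarith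

/-- The hypotheses on a tree. -/
structure IsTree (N : ℤ → ℝ) (G : Finset ℤ) (S : Finset Tile) (T : Tile) (δ : ℝ) : Prop where
  le : ∀ P ∈ S, P.Le T
  sparse : Sparse S
  mass_le : ∀ P ∈ S, ∀ P', P.Le P' → P'.Le T → mass N G P' ≤ δ

namespace IsTree
variable {N : ℤ → ℝ} {G : Finset ℤ} {S : Finset Tile} {T : Tile} {δ : ℝ}

lemma sum_w_le (h : IsTree N G S T δ) {P : Tile} (hP : P ∈ S) {Y : Finset ℤ} (hY : ∀ y ∈ Y, y ∈ G ∧ N y ∈ P.om) :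
    ∑ y ∈ Y, P.w y ^ 5 ≤ δ * 4 ^ P.i := by
  classical
  have h1 := h.mass_le P hP P (Tile.Le.refl P) (h.le P hP)
  unfold mass at h1
  rw [inv_mul_le_iff₀ (by positivity), mul_comm] at h1
  exact (Finset.sum_le_sum_of_subset_of_nonneg (fun y hy => Finset.mem_filter.2 (hY y hy))
    fun y _ _ => pow_nonneg (P.w_nonneg y) _).trans h1

lemma delta_nonneg (h : IsTree N G S T δ) {P : Tile} (hP : P ∈ S) : 0 ≤ δ :=
  (mass_nonneg N G P).trans (h.mass_le P hP P (Tile.Le.refl P) (h.le P hP))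

lemma eq_of_i_k (h : IsTree N G S T δ) {P Q : Tile} (hP : P ∈ S) (hQ : Q ∈ S) (hi : P.i = Q.i) (hk : P.k = Q.k) :
    P = Q := by
  obtain ⟨x, hx⟩ := om_nonempty T.i T.m
  have h1 := (h.le P hP).2.2 hx
  have h2 := (h.le Q hQ).2.2 hx
  unfold Tile.om at h1 h2
  rw [hi] at h1
  have := om_eq_of_mem h1 h2
  cases P; cases Q; simp_all

lemma sum_scale_w_le (h : IsTree N G S T δ) (i : ℕ) (z : ℤ) (S' : Finset Tile) (hS' : ∀ P ∈ S', P ∈ S ∧ P.i = i)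
    {n : ℕ} (hn : 2 ≤ n) : ∑ P ∈ S', P.w z ^ n ≤ 8 := by
  classical
  have hinj : Set.InjOn Tile.k (S' : Set Tile) := fun P hP Q hQ hk =>
    h.eq_of_i_k (hS' P hP).1 (hS' Q hQ).1 ((hS' P hP).2.trans (hS' Q hQ).2.symm) hk
  calc ∑ P ∈ S', P.w z ^ n = ∑ P ∈ S', wt (((P.k:ℝ) - z / 4 ^ i) / 1) ^ n := by
        refine Finset.sum_congr rfl fun P hP => ?_
        unfold Tile.w; rw [(hS' P hP).2, ← wt_neg]
        congr 2
        have : (4:ℝ) ^ i ≠ 0 := by positivity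
        field_simp; ring
    _ = ∑ k ∈ S'.image Tile.k, wt (((k:ℝ) - z / 4 ^ i) / 1) ^ n := by rw [Finset.sum_image hinj]
    _ ≤ 8 * 1 := sum_wt_pow_le hn 1 le_rfl _ _
    _ = 8 := by norm_num

lemma sum_scale_len_le (h : IsTree N G S T δ) (i : ℕ) (S' : Finset Tile) (hS' : ∀ P ∈ S', P ∈ S ∧ P.i = i) :
    ∑ P ∈ S', (4:ℝ) ^ P.i ≤ 4 ^ T.i := by
  rw [← card_ivF T.i T.k]
  refine sum_len_le_card _ (fun P hP Q hQ hne => ?_) fun P hP => ?_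
  · rw [Set.disjoint_left]
    intro y hy hy'
    unfold Tile.iv at hy hy'
    rw [(hS' P hP).2] at hy; rw [(hS' Q hQ).2] at hy'
    exact hne (h.eq_of_i_k (hS' P hP).1 (hS' Q hQ).1 ((hS' P hP).2.trans (hS' Q hQ).2.symm) (iv_eq_of_mem hy hy'))
  · intro y hy
    have := mem_iv_iff.1 ((h.le P (hS' P hP).1).2.1 hy)
    simpa using this

/-- Contribution of the tiles that are far away from the support of the tree. -/
lemma far_sum (h : IsTree N G S T δ) (hne : S.Nonempty) :
    open Classical in
    ∑ P ∈ S, ∑ y ∈ G with (N y ∈ P.om ∧ lev S T y = T.i + 1), P.w y ^ 10 ≤ 2 * δ * 4 ^ T.i := by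
  classical
  have hδ : 0 ≤ δ := h.delta_nonneg hne.choose_spec
  have hmaps : ∀ P ∈ S, P.i ∈ Finset.range (T.i + 1) := fun P hP => by
    have := (h.le P hP).1
    simp; omega
  calc ∑ P ∈ S, ∑ y ∈ G with (N y ∈ P.om ∧ lev S T y = T.i + 1), P.w y ^ 10
      ≤ ∑ P ∈ S, (4 ^ P.i / 4 ^ T.i) * (δ * 4 ^ P.i) := by
        refine Finset.sum_le_sum fun P hP => ?_
        calc ∑ y ∈ G with (N y ∈ P.om ∧ lev S T y = T.i + 1), P.w y ^ 10
            ≤ ∑ y ∈ G with (N y ∈ P.om ∧ lev S T y = T.i + 1), (4 ^ P.i / 4 ^ T.i) * P.w y ^ 5 := by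
              refine Finset.sum_le_sum fun y hy => ?_
              obtain ⟨_, _, hy⟩ := Finset.mem_filter.1 hy
              have h1 : P.w y ≤ 4 ^ P.i / 4 ^ T.i := by
                have := w_le_of_lt_lev (y := y) hP (by rw [hy]; have := (h.le P hP).1; omega : P.i < lev S T y)
                rwa [hy, Nat.add_sub_cancel] at this
              have h0 := P.w_nonneg y
              calc P.w y ^ 10 = P.w y ^ 4 * (P.w y * P.w y ^ 5) := by ring
                _ ≤ 1 * ((4 ^ P.i / 4 ^ T.i) * P.w y ^ 5) := by
                    gcongr
                    exact wt_pow_le_one _ _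
                _ = _ := one_mul _
          _ ≤ _ := by
              rw [← Finset.mul_sum]
              gcongr
              exact h.sum_w_le hP fun y hy => by
                have := Finset.mem_filter.1 hy
                exact ⟨this.1, this.2.1⟩
    _ = ∑ i ∈ Finset.range (T.i + 1), ∑ P ∈ S with P.i = i, (4 ^ P.i / 4 ^ T.i) * (δ * 4 ^ P.i) :=
        (Finset.sum_fiberwise_of_maps_to hmaps _).symm
    _ ≤ ∑ i ∈ Finset.range (T.i + 1), (4 ^ i / 4 ^ T.i) * (δ * 4 ^ T.i) := by
        refine Finset.sum_le_sum fun i _ => ?_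
        have := h.sum_scale_len_le i (S.filter fun P => P.i = i) (fun P hP => Finset.mem_filter.1 hP)
        calc ∑ P ∈ S with P.i = i, ((4:ℝ) ^ P.i / 4 ^ T.i) * (δ * 4 ^ P.i)
            = ∑ P ∈ S with P.i = i, (4 ^ i / 4 ^ T.i * δ) * 4 ^ P.i := by
              refine Finset.sum_congr rfl fun P hP => ?_
              rw [(Finset.mem_filter.1 hP).2]; ring
          _ ≤ (4 ^ i / 4 ^ T.i * δ) * 4 ^ T.i := by rw [← Finset.mul_sum]; gcongr
          _ = _ := by ring
    _ ≤ 2 * (δ * 4 ^ T.i) := by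
        rw [← Finset.sum_mul]; gcongr; exact sum_four_pow_le _
    _ = _ := by ring

/-- The points that see the tree at scale at most the scale of the top. -/
noncomputable def nearSet (S : Finset Tile) (T : Tile) : Finset ℤ :=
  (tri T.i T.k).filter fun y => lev S T y ≤ T.i

lemma mem_nearSet (h : IsTree N G S T δ) {y : ℤ} : y ∈ nearSet S T ↔ lev S T y ≤ T.i := by
  refine ⟨fun hy => (Finset.mem_filter.1 hy).2, fun hy => Finset.mem_filter.2 ⟨?_, hy⟩⟩
  rcases (near_lev (S := S) (T := T) (y := y)).mono hy with h1 | ⟨P, hP, h1⟩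
  · omega
  · have h2 := h1 P.corner_mem
    have h3 := (h.le P hP).2.1 P.corner_mem
    set c := P.k * 4 ^ P.i
    rw [Tile.iv, mem_iv] at h3
    rw [Finset.mem_coe, mem_tri] at h2
    have b1 := div_bounds T.i y
    have b2 := div_bounds T.i c
    rw [h3] at b2
    rw [mem_tri]
    have h4 : (0:ℤ) < 4 ^ T.i := by positivity
    have e1 : y / 4 ^ T.i - 1 < T.k + 1 := lt_of_mul_lt_mul_right (h2.1.trans_lt b2.2) h4.le
    have e2 : T.k < y / 4 ^ T.i + 2 := lt_of_mul_lt_mul_right (b2.1.trans_lt h2.2) h4.le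
    have e3 : y / 4 ^ T.i + 1 ≤ T.k + 2 := by omega
    have e4 : T.k - 1 ≤ y / 4 ^ T.i := by omega
    constructor <;> nlinarith

lemma card_nearSet : ((nearSet S T).card : ℝ) ≤ 3 * 4 ^ T.i := by
  rw [← card_tri T.i T.k]; norm_cast; exact Finset.card_le_card (Finset.filter_subset _ _)

/-- Contribution of the tiles that are short compared with their distance to the point. -/
lemma short_sum (h : IsTree N G S T δ) (hne : S.Nonempty) :
    open Classical in
    ∑ P ∈ S, ∑ y ∈ G with (N y ∈ P.om ∧ lev S T y ≤ T.i ∧ P.i < lev S T y), P.w y ^ 10 ≤ 1536 * δ * 4 ^ T.i := by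
  classical
  have hδ : 0 ≤ δ := h.delta_nonneg hne.choose_spec
  calc ∑ P ∈ S, ∑ y ∈ G with (N y ∈ P.om ∧ lev S T y ≤ T.i ∧ P.i < lev S T y), P.w y ^ 10
      ≤ ∑ P ∈ S, ∑ z ∈ nearSet S T with P.i < lev S T z,
          (δ * (4 ^ P.i / 4 ^ (lev S T z - 1))) * (32 * P.w z ^ 5) := by
        refine Finset.sum_le_sum fun P hP => ?_
        set Y := G.filter fun y => (N y ∈ P.om ∧ lev S T y ≤ T.i ∧ P.i < lev S T y)
        have hYm : ∀ y ∈ Y, y ∈ G ∧ N y ∈ P.om ∧ lev S T y ≤ T.i ∧ P.i < lev S T y := fun y hy =>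
          Finset.mem_filter.1 hy
        calc ∑ y ∈ Y, P.w y ^ 10 = ∑ y ∈ Y, P.w y ^ 5 * P.w y ^ 5 :=
              Finset.sum_congr rfl fun y _ => by ring
          _ ≤ _ := by
            refine sum_le_of_lev (S := S) (T := T) Y _ (fun y => P.w y ^ 5) (fun y => P.w y ^ 5)
              (fun z => 32 * P.w z ^ 5) (fun z => δ * (4 ^ P.i / 4 ^ (lev S T z - 1))) ?_ ?_ ?_ ?_ ?_
            · exact fun y _ => pow_nonneg (P.w_nonneg y) _
            · exact fun z _ => mul_nonneg (by norm_num) (pow_nonneg (P.w_nonneg z) _)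
            · intro y hy z hz
              rw [Finset.mem_filter, h.mem_nearSet, lev_eq hz]
              exact (hYm y hy).2.2
            · intro y hy z hz
              have h1 := w_le_two_mul hP (hYm y hy).2.2.2 hz
              have h0 := P.w_nonneg y
              calc P.w y ^ 5 ≤ (2 * P.w z) ^ 5 := by gcongr
                _ = _ := by rw [mul_pow]; norm_num
            · intro z _
              rw [mul_assoc, div_mul_cancel₀ _ (by positivity)]
              exact h.sum_w_le hP fun y hy => by
                have := hYm y (Finset.mem_filter.1 hy).1
                exact ⟨this.1, this.2.1⟩
    _ = ∑ z ∈ nearSet S T, ∑ P ∈ S with P.i < lev S T z,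
          (δ * (4 ^ P.i / 4 ^ (lev S T z - 1))) * (32 * P.w z ^ 5) := by
        simp only [Finset.sum_filter]
        rw [Finset.sum_comm]
    _ ≤ ∑ z ∈ nearSet S T, 512 * δ := by
        refine Finset.sum_le_sum fun z _ => ?_
        set n := lev S T z - 1 with hn
        have hmaps : ∀ P ∈ S.filter (fun P => P.i < lev S T z), P.i ∈ Finset.range (n + 1) := fun P hP => by
          have := (Finset.mem_filter.1 hP).2
          simp; omega
        rw [← Finset.sum_fiberwise_of_maps_to hmaps]
        calc ∑ i ∈ Finset.range (n + 1), ∑ P ∈ S.filter (fun P => P.i < lev S T z) with P.i = i,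
              (δ * (4 ^ P.i / 4 ^ n)) * (32 * P.w z ^ 5)
            ≤ ∑ i ∈ Finset.range (n + 1), 256 * δ * (4 ^ i / 4 ^ n) := by
              refine Finset.sum_le_sum fun i _ => ?_
              have h1 := h.sum_scale_w_le i z ((S.filter (fun P => P.i < lev S T z)).filter fun P => P.i = i)
                (fun P hP => ⟨(Finset.mem_filter.1 (Finset.mem_filter.1 hP).1).1, (Finset.mem_filter.1 hP).2⟩)
                (show 2 ≤ 5 by norm_num)
              calc _ = ∑ P ∈ S.filter (fun P => P.i < lev S T z) with P.i = i, 
                    (32 * δ * (4 ^ i / 4 ^ n)) * P.w z ^ 5 := by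
                      refine Finset.sum_congr rfl fun P hP => ?_
                      rw [(Finset.mem_filter.1 hP).2]; ring
                _ ≤ (32 * δ * (4 ^ i / 4 ^ n)) * 8 := by rw [← Finset.mul_sum]; gcongr
                _ = _ := by ring
          _ ≤ 256 * δ * 2 := by rw [← Finset.mul_sum]; gcongr; exact sum_four_pow_le n
          _ = _ := by ring
    _ = 512 * δ * (nearSet S T).card := by rw [Finset.sum_const, nsmul_eq_mul]; ring
    _ ≤ 512 * δ * (3 * 4 ^ T.i) := by gcongr; exact card_nearSet
    _ = _ := by ring
end IsTree

namespace WavePackets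
variable {C0 : ℝ} {φ ψ : Tile → L2Z}

lemma summable_mul (f : L2Z) (κ : ℤ → ℂ) (i : ℕ) (C : ℝ)
    (hκ : ∀ y : ℤ, ‖κ y‖ ≤ C * (4 ^ i)⁻¹ * wt (y / 4 ^ i) ^ 2) (y : ℤ) :
    Summable fun z => f z * κ (y - z) := by
  have h4 := Tile.one_le_four_pow i
  have hC : 0 ≤ C := by
    have := (norm_nonneg _).trans (hκ 0)
    simp only [Int.cast_zero, zero_div, wt, abs_zero, add_zero, inv_one, one_pow, mul_one] at this
    exact nonneg_of_mul_nonneg_left this (by positivity)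
  refine Summable.of_norm (summable_of_sum_le (c := ‖f‖ ^ 2 + C ^ 2 * (8 * 4 ^ i)) (fun _ => norm_nonneg _) fun A => ?_)
  calc ∑ z ∈ A, ‖f z * κ (y - z)‖ ≤ ∑ z ∈ A, (‖f z‖ ^ 2 + C ^ 2 * wt ((z - (y:ℝ)) / 4 ^ i) ^ 2) := by
        refine Finset.sum_le_sum fun z _ => ?_
        rw [norm_mul]
        have h1 : ‖κ (y - z)‖ ≤ C * wt ((z - (y:ℝ)) / 4 ^ i) := by
          refine (hκ (y - z)).trans ?_
          have e : wt (((y - z : ℤ) : ℝ) / 4 ^ i) = wt ((z - (y:ℝ)) / 4 ^ i) := by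
            rw [← wt_neg]; push_cast; congr 1; ring
          rw [e]
          have h0 := wt_nonneg ((z - (y:ℝ)) / 4 ^ i)
          have h2 := wt_le_one ((z - (y:ℝ)) / 4 ^ i)
          have h3 : ((4:ℝ) ^ i)⁻¹ ≤ 1 := inv_le_one_of_one_le₀ h4
          calc C * (4 ^ i)⁻¹ * wt ((z - (y:ℝ)) / 4 ^ i) ^ 2 ≤ C * 1 * (1 * wt ((z - (y:ℝ)) / 4 ^ i)) := by
                rw [sq]; gcongr
            _ = _ := by ring
        have h2 := norm_nonneg (f z)
        have h3 := norm_nonneg (κ (y - z))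
        rw [← mul_pow]
        have h4 : ‖κ (y - z)‖ ^ 2 ≤ (C * wt ((z - (y:ℝ)) / 4 ^ i)) ^ 2 := by gcongr
        nlinarith [sq_nonneg (‖f z‖ - ‖κ (y - z)‖)]
    _ ≤ _ := by
        rw [Finset.sum_add_distrib, ← Finset.mul_sum]
        gcongr
        · exact sum_sq_le_norm_sq f A
        · exact sum_wt_sq_le _ h4 _ _

lemma sum_smul_apply (S : Finset Tile) (a : Tile → ℂ) (z : ℤ) :
    (∑ P ∈ S, a P • ψ P : L2Z) z = ∑ P ∈ S, a P * ψ P z := by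
  rw [lp.coeFn_sum, Finset.sum_apply]; rfl

/-- The truncations of a lacunary sum at a scale are controlled by averages of the full sum. -/
lemma trunc_le (hW : WavePackets C0 φ ψ) {S : Finset Tile} (hS : Lacunary S) (hs : Sparse S) {X : Set ℝ}
    (hX : X.Nonempty) (hXS : ∀ P ∈ S, X ⊆ P.om) (a : Tile → ℂ) (y : ℤ) (j : ℕ) (l : ℝ)
    (hl : ∀ i', j ≤ i' → ∑ z ∈ tri i' (y / 4 ^ i'), ‖(∑ P ∈ S, a P • ψ P : L2Z) z‖ ≤ l * 4 ^ i') :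
    ‖∑ P ∈ S with j ≤ P.i, a P * ψ P y‖ ≤ 32 * C0 * l := by
  classical
  obtain ⟨x, hx⟩ := hX
  set h : L2Z := ∑ P ∈ S, a P • ψ P with hh
  have hl0 : 0 ≤ l := by
    have h1 := (Finset.sum_nonneg fun z _ => norm_nonneg _).trans (hl j le_rfl)
    exact nonneg_of_mul_nonneg_left h1 (by positivity)
  have hC := hW.nonneg
  rcases (S.filter fun P => j ≤ P.i).eq_empty_or_nonempty with h0 | h0
  · rw [h0]; simp; positivity
  · obtain ⟨P0, hP0, hmin⟩ := Finset.exists_min_image _ Tile.i h0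
    obtain ⟨hP0S, hj⟩ := Finset.mem_filter.1 hP0
    obtain ⟨κ, hκ, hκ'⟩ := hW.lowpass P0.i P0.m
    have hsum : ∀ P : Tile, Summable fun z => ψ P z * κ (y - z) := fun P => summable_mul _ κ _ _ hκ y
    have e : ∑ P ∈ S with j ≤ P.i, a P * ψ P y = ∑' z, h z * κ (y - z) := by
      calc ∑ P ∈ S with j ≤ P.i, a P * ψ P y = ∑ P ∈ S, a P * ∑' z, ψ P z * κ (y - z) := by
            rw [Finset.sum_filter]
            refine Finset.sum_congr rfl fun P hP => ?_
            split_ifs with hj'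
            · have : P0.i ≤ P.i := hmin P (Finset.mem_filter.2 ⟨hP, hj'⟩)
              rw [(hκ' P).1 this (om_nest this (hXS P0 hP0S hx) (hXS P hP hx))]
            · have : P.i < P0.i := by omega
              rw [(hκ' P).2 (hs P hP P0 hP0S this) ((hS P hP P0 hP0S).2 this), mul_zero]
        _ = ∑ P ∈ S, ∑' z, a P * (ψ P z * κ (y - z)) :=
            Finset.sum_congr rfl fun P _ => tsum_mul_left.symm
        _ = ∑' z, ∑ P ∈ S, a P * (ψ P z * κ (y - z)) :=
            (Summable.tsum_finsetSum fun P _ => (hsum P).mul_left _).symm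
        _ = _ := by
            refine tsum_congr fun z => ?_
            rw [hh, sum_smul_apply, Finset.sum_mul]
            exact Finset.sum_congr rfl fun P _ => by ring
    rw [e]
    have hs' := (summable_mul h κ _ _ hκ y).norm
    refine (norm_tsum_le_tsum_norm hs').trans (hs'.tsum_le_of_sum_le fun A => ?_)
    calc ∑ z ∈ A, ‖h z * κ (y - z)‖ ≤ ∑ z ∈ A, C0 * (4 ^ P0.i)⁻¹ * (‖h z‖ * wt (((y:ℝ) - z) / 4 ^ P0.i) ^ 2) := by
          refine Finset.sum_le_sum fun z _ => ?_
          rw [norm_mul]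
          have := hκ (y - z)
          push_cast at this
          calc ‖h z‖ * ‖κ (y - z)‖ ≤ ‖h z‖ * (C0 * (4 ^ P0.i)⁻¹ * wt (((y:ℝ) - z) / 4 ^ P0.i) ^ 2) := by gcongr
            _ = _ := by ring
      _ ≤ C0 * (4 ^ P0.i)⁻¹ * (32 * (l * 4 ^ P0.i)) := by
          rw [← Finset.mul_sum]
          gcongr
          exact kernel_le (fun z => ‖h z‖) (fun _ => norm_nonneg _) P0.i y l
            (fun i' hi' => hl i' (hj.trans hi')) A
      _ = _ := by field_simp

/-- The sum over the tiles of a lacunary family above a scale whose test interval contains a point. -/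
lemma trunc_om2_le (hW : WavePackets C0 φ ψ) {S : Finset Tile} (hS : Lacunary S) (hs : Sparse S) {X : Set ℝ}
    (hX : X.Nonempty) (hXS : ∀ P ∈ S, X ⊆ P.om) (a : Tile → ℂ) (y : ℤ) (j : ℕ) (ξ l : ℝ)
    (hl : ∀ i', j ≤ i' → ∑ z ∈ tri i' (y / 4 ^ i'), ‖(∑ P ∈ S, a P • ψ P : L2Z) z‖ ≤ l * 4 ^ i') :
    open Classical in
    ‖∑ P ∈ S with (j ≤ P.i ∧ ξ ∈ P.om2), a P * ψ P y‖ ≤ 64 * C0 * l := by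
  classical
  have hl0 : 0 ≤ l := by
    have h1 := (Finset.sum_nonneg fun z _ => norm_nonneg _).trans (hl j le_rfl)
    exact nonneg_of_mul_nonneg_left h1 (by positivity)
  have hC := hW.nonneg
  have key : ∀ P ∈ S, ∀ Q ∈ S, P.i ≤ Q.i → ξ ∈ Q.om2 → ξ ∈ P.om2 := by
    intro P hP Q hQ hi hξ
    rcases hi.eq_or_lt with hi | hi
    · have := (hS P hP Q hQ).1 hi
      unfold Tile.om2 at *
      rwa [hi, this]
    · exact (hS P hP Q hQ).2 hi (Q.om2_subset_om hξ)
  have h1 := hW.trunc_le hS hs hX hXS a y j l hl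
  rcases (S.filter fun P => j ≤ P.i ∧ ξ ∉ P.om2).eq_empty_or_nonempty with h0 | h0
  · have : (S.filter fun P => j ≤ P.i ∧ ξ ∈ P.om2) = S.filter fun P => j ≤ P.i := by
      refine Finset.filter_congr fun P hP => ⟨fun h => h.1, fun h => ⟨h, ?_⟩⟩
      by_contra hc
      have : P ∈ (S.filter fun P => j ≤ P.i ∧ ξ ∉ P.om2) := Finset.mem_filter.2 ⟨hP, h, hc⟩
      rw [h0] at this
      exact absurd this (Finset.notMem_empty _)
    rw [this]
    nlinarith [mul_nonneg hC hl0]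
  · obtain ⟨P0, hP0, hmin⟩ := Finset.exists_min_image _ Tile.i h0
    obtain ⟨hP0S, hj, hξ⟩ := Finset.mem_filter.1 hP0
    have h2 := hW.trunc_le hS hs hX hXS a y P0.i l fun i' hi' => hl i' (hj.trans hi')
    have e : ∑ P ∈ S with j ≤ P.i, a P * ψ P y =
        ∑ P ∈ S with (j ≤ P.i ∧ ξ ∈ P.om2), a P * ψ P y + ∑ P ∈ S with P0.i ≤ P.i, a P * ψ P y := by
      simp only [Finset.sum_filter]
      rw [← Finset.sum_add_distrib]
      refine Finset.sum_congr rfl fun P hP => ?_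
      by_cases hp : P0.i ≤ P.i
      · have hn : ξ ∉ P.om2 := fun hc => hξ (key P0 hP0S P hP hp hc)
        simp [hp, hn, hj.trans hp]
      · by_cases hj' : j ≤ P.i
        · have hn : ξ ∈ P.om2 := by
            by_contra hc
            exact hp (hmin P (Finset.mem_filter.2 ⟨hP, hj', hc⟩))
          simp [hp, hn, hj']
        · simp [hp, hj']
    have e2 : ∑ P ∈ S with (j ≤ P.i ∧ ξ ∈ P.om2), a P * ψ P y =
        ∑ P ∈ S with j ≤ P.i, a P * ψ P y - ∑ P ∈ S with P0.i ≤ P.i, a P * ψ P y := by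
      rw [e]; ring
    rw [e2]
    refine (norm_sub_le _ _).trans ?_
    linarith
end WavePackets

namespace IsTree
variable {N : ℤ → ℝ} {G : Finset ℤ} {S : Finset Tile} {T : Tile} {δ : ℝ}

/-- The points at which tiles of the tree at least as long as the local scale may be tested. -/
noncomputable def longSet (N : ℤ → ℝ) (G : Finset ℤ) (S : Finset Tile) (T : Tile) : Finset ℤ :=
  open Classical in G.filter fun y => lev S T y ≤ T.i ∧ T.om ⊆ om (lev S T y) ⌊N y * 4 ^ lev S T y⌋

lemma card_longSet_le (h : IsTree N G S T δ) {z : ℤ} (hz : lev S T z ≤ T.i) :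
    (((longSet N G S T).filter fun y => y / 4 ^ (lev S T z - 1) = z / 4 ^ (lev S T z - 1)).card : ℝ)
      ≤ 972 * δ * 4 ^ (lev S T z - 1) := by
  classical
  set n := lev S T z with hn
  obtain ⟨x, hx⟩ := om_nonempty T.i T.m
  rcases (near_lev (S := S) (T := T) (y := z)) with h1 | ⟨P, hP, h1⟩
  · omega
  rw [← hn] at h1
  have hPT := h.le P hP
  have hδ : 0 ≤ δ := h.delta_nonneg hP
  have hPn : P.i ≤ n := by
    have h2 := h1 P.corner_mem
    have h3 : P.k * 4 ^ P.i + (4 ^ P.i - 1) ∈ P.iv := by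
      rw [Tile.iv, mem_iv_iff]
      have : (0:ℤ) < 4 ^ P.i := by positivity
      constructor <;> linarith
    have h4 := h1 h3
    rw [Finset.mem_coe, mem_tri] at h2 h4
    by_contra hc
    have h5 : (4:ℤ) ^ (n + 1) ≤ 4 ^ P.i := pow_le_pow_right₀ (by norm_num) (by omega)
    rw [pow_succ] at h5
    have : (0:ℤ) < 4 ^ n := by positivity
    linarith [h4.2, h2.1]
  set c := P.k * 4 ^ P.i with hc
  let P' : Tile := ⟨n, c / 4 ^ n, ⌊x * 4 ^ n⌋⟩
  have hxP' : x ∈ P'.om := rfl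
  have hcP' : c ∈ P'.iv := rfl
  have hle1 : P.Le P' := Tile.le_of_mem hPn P.corner_mem hcP' (hPT.2.2 hx) hxP'
  have hle2 : P'.Le T := Tile.le_of_mem hz hcP' (hPT.2.1 P.corner_mem) hxP' hx
  have hmass := h.mass_le P hP P' hle1 hle2
  unfold mass at hmass
  rw [inv_mul_le_iff₀ (by positivity)] at hmass
  have hct := h1 P.corner_mem
  rw [Finset.mem_coe, mem_tri] at hct
  have hcb := div_bounds n c
  have hkey : ∀ y ∈ (longSet N G S T).filter (fun y => y / 4 ^ (n - 1) = z / 4 ^ (n - 1)),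
      y ∈ G.filter (fun y => N y ∈ P'.om) ∧ 1 / 3 ≤ P'.w y := by
    intro y hy
    obtain ⟨hy1, hy2⟩ := Finset.mem_filter.1 hy
    obtain ⟨hyG, hyl, hyo⟩ := Finset.mem_filter.1 hy1
    have hlev : lev S T y = n := by rw [hn]; exact lev_eq hy2
    rw [hlev] at hyo
    have hyn : y / 4 ^ n = z / 4 ^ n := div_eq_of_div_eq (Nat.sub_le _ _) hy2
    constructor
    · refine Finset.mem_filter.2 ⟨hyG, ?_⟩
      exact (hyo hx).symm
    · have b1 := div_bounds n y
      rw [hyn] at b1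
      have h4 : (0:ℤ) < 4 ^ n := by positivity
      have e1 : z / 4 ^ n - 1 < c / 4 ^ n + 1 := lt_of_mul_lt_mul_right (hct.1.trans_lt hcb.2) h4.le
      have e2 : c / 4 ^ n < z / 4 ^ n + 2 := lt_of_mul_lt_mul_right (hcb.1.trans_lt hct.2) h4.le
      have e3 : z / 4 ^ n - 1 ≤ c / 4 ^ n := by omega
      have e4 : c / 4 ^ n ≤ z / 4 ^ n + 1 := by omega
      have hd : |y - c / 4 ^ n * 4 ^ n| ≤ 2 * 4 ^ n := by
        rw [abs_le]; constructor <;> nlinarith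
      have hd' : |(y:ℝ) - (c / 4 ^ n : ℤ) * 4 ^ n| ≤ 2 * 4 ^ n := by exact_mod_cast hd
      have h4' : (0:ℝ) < 4 ^ n := by positivity
      change 1 / 3 ≤ wt _
      unfold wt
      rw [one_div]
      refine inv_anti₀ (by positivity) ?_
      rw [abs_div, abs_of_pos h4']
      have : |(y:ℝ) - (c / 4 ^ n : ℤ) * 4 ^ n| / 4 ^ n ≤ 2 := by rw [div_le_iff₀ h4']; exact hd'
      linarith
  set Y := (longSet N G S T).filter (fun y => y / 4 ^ (n - 1) = z / 4 ^ (n - 1))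
  have h5 : (Y.card : ℝ) * (1 / 3) ^ 5 ≤ ∑ y ∈ G with N y ∈ P'.om, P'.w y ^ 5 := by
    calc (Y.card : ℝ) * (1 / 3) ^ 5 = ∑ y ∈ Y, (1 / 3) ^ 5 := by rw [Finset.sum_const, nsmul_eq_mul]
      _ ≤ ∑ y ∈ Y, P'.w y ^ 5 := Finset.sum_le_sum fun y hy => by
          have := (hkey y hy).2
          gcongr
      _ ≤ _ := Finset.sum_le_sum_of_subset_of_nonneg (fun y hy => (hkey y hy).1)
          fun y _ _ => pow_nonneg (P'.w_nonneg y) _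
  have h6 : (Y.card : ℝ) * (1 / 3) ^ 5 ≤ 4 ^ n * δ := h5.trans hmass
  have h7 : (4:ℝ) ^ n ≤ 4 * 4 ^ (n - 1) := by
    rw [← pow_succ']
    exact pow_le_pow_right₀ (by norm_num) (by omega)
  have : 4 ^ n * δ ≤ 4 * 4 ^ (n - 1) * δ := by gcongr
  linarith

/-- Tiles whose test interval misses the top frequency act at one scale at each point. -/
lemma sum_one_part_le (h : IsTree N G S T δ) (y : ℤ) (S' : Finset Tile)
    (hS' : ∀ P ∈ S', P ∈ S ∧ ¬ T.om ⊆ P.om2 ∧ N y ∈ P.om2) : ∑ P ∈ S', P.w y ^ 10 ≤ 8 := by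
  rcases S'.eq_empty_or_nonempty with rfl | ⟨P0, hP0⟩
  · simp
  have key : ∀ P ∈ S', ∀ Q ∈ S', ¬ P.i < Q.i := by
    intro P hP Q hQ hi
    have h1 := hS' P hP
    have h2 := hS' Q hQ
    exact h1.2.1 ((h.le Q h2.1).2.2.trans
      (Tile.om_subset_om2 (h.sparse P h1.1 Q h2.1 hi) h1.2.2 (Q.om2_subset_om h2.2.2)))
  exact h.sum_scale_w_le P0.i y S' (fun P hP => ⟨(hS' P hP).1, by
    have := key P hP P0 hP0; have := key P0 hP0 P hP; omega⟩) (by norm_num)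

/-- The tree estimate. -/
lemma sum_le {C0 : ℝ} {φ ψ : Tile → L2Z} (h : IsTree N G S T δ) (hne : S.Nonempty) (hW : WavePackets C0 φ ψ) (hC : 0 < C0)
    {σ : ℝ} (hσ : 0 < σ) (a : Tile → ℂ) (ha : ∀ P ∈ S, ‖a P‖ ≤ σ * 2 ^ P.i)
    (ha2 : open Classical in ∑ P ∈ S with T.om ⊆ P.om2, ‖a P‖ ^ 2 ≤ σ ^ 2 * 4 ^ T.i) :
    open Classical in
    ∑ y ∈ G, ‖∑ P ∈ S with N y ∈ P.om2, a P * ψ P y‖ ≤ (C0 * (10 ^ 6 + 10 ^ 9 * C0 ^ 2)) * δ * σ * 4 ^ T.i := by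
  classical
  have hδ : 0 ≤ δ := h.delta_nonneg hne.choose_spec
  have hpt : ∀ P ∈ S, ∀ y, ‖a P * ψ P y‖ ≤ C0 * σ * P.w y ^ 10 := by
    intro P hP y
    rw [norm_mul]
    calc ‖a P‖ * ‖ψ P y‖ ≤ (σ * 2 ^ P.i) * (C0 * (2 ^ P.i)⁻¹ * P.w y ^ 10) := by
          have := P.w_nonneg y
          gcongr
          · exact ha P hP
          · exact hW.packets_right.decay P y
      _ = _ := by field_simp
  have hCσ : 0 ≤ C0 * σ := by positivity
  set L : ℤ → ℂ := fun y => ∑ P ∈ S with (N y ∈ P.om2 ∧ lev S T y ≤ P.i), a P * ψ P y with hL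
  have hsplit : ∀ y ∈ G, ‖∑ P ∈ S with N y ∈ P.om2, a P * ψ P y‖ ≤
      (∑ P ∈ S, if N y ∈ P.om ∧ lev S T y = T.i + 1 then C0 * σ * P.w y ^ 10 else 0) +
      (∑ P ∈ S, if N y ∈ P.om ∧ lev S T y ≤ T.i ∧ P.i < lev S T y then C0 * σ * P.w y ^ 10 else 0) +
      (if y ∈ longSet N G S T then ‖L y‖ else 0) := by
    intro y hy
    have hlev : lev S T y ≤ T.i + 1 := lev_le
    have e : ∑ P ∈ S with N y ∈ P.om2, a P * ψ P y =
        ∑ P ∈ S with (N y ∈ P.om2 ∧ P.i < lev S T y), a P * ψ P y + L y := by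
      rw [hL]
      simp only [Finset.sum_filter]
      rw [← Finset.sum_add_distrib]
      refine Finset.sum_congr rfl fun P _ => ?_
      rcases lt_or_ge P.i (lev S T y) with hp | hp
      · simp [hp, not_le.2 hp]
      · simp [hp, not_lt.2 hp]
    rw [e]
    refine (norm_add_le _ _).trans (add_le_add ?_ ?_)
    · refine (norm_sum_le _ _).trans ?_
      rw [Finset.sum_filter, ← Finset.sum_add_distrib]
      refine Finset.sum_le_sum fun P hP => ?_
      have hp0 : 0 ≤ C0 * σ * P.w y ^ 10 := mul_nonneg hCσ (pow_nonneg (P.w_nonneg y) _)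
      split_ifs with c1 c2 c3 c3 c2 c3 c3 <;> try linarith [hpt P hP y]
      exfalso
      have := P.om2_subset_om c1.1
      by_cases c4 : lev S T y = T.i + 1
      · exact c2 ⟨this, c4⟩
      · exact c3 ⟨this, by omega, c1.2⟩
    · split_ifs with c1
      · exact le_rfl
      · have : L y = 0 := by
          rw [hL]
          refine Finset.sum_eq_zero fun P hP => ?_
          obtain ⟨hPS, hN, hi⟩ := Finset.mem_filter.1 hP
          exfalso
          refine c1 (Finset.mem_filter.2 ⟨hy, hi.trans (h.le P hPS).1, ?_⟩)
          exact (h.le P hPS).2.2.trans (om_nest hi (x := N y) rfl (P.om2_subset_om hN))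
        rw [this, norm_zero]
  have hfar := h.far_sum hne
  have hshort := h.short_sum hne
  have hlong : ∑ y ∈ longSet N G S T, ‖L y‖ ≤ 972 * δ * ((24 * C0 + 64 * C0 * (6 + 6912 * C0 ^ 2)) * σ * 4 ^ T.i) := by
    obtain ⟨x, hx⟩ := om_nonempty T.i T.m
    set S2 := S.filter fun P => T.om ⊆ P.om2 with hS2
    have hS2S : S2 ⊆ S := Finset.filter_subset _ _
    have hsp2 : Sparse S2 := fun P hP Q hQ => h.sparse P (hS2S hP) Q (hS2S hQ)
    have hlac : Lacunary S2 := lacunary_of_om_subset hsp2 ⟨x, hx⟩ fun P hP => (Finset.mem_filter.1 hP).2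
    set H : L2Z := ∑ P ∈ S2, a P • ψ P with hH
    set L2 : ℤ → ℂ := fun y => ∑ P ∈ S2 with (lev S T y ≤ P.i ∧ N y ∈ P.om2), a P * ψ P y with hL2
    have hLL : ∀ y, ‖L y‖ ≤ 8 * (C0 * σ) + ‖L2 y‖ := by
      intro y
      have e : L y = ∑ P ∈ S with ((N y ∈ P.om2 ∧ lev S T y ≤ P.i) ∧ ¬ T.om ⊆ P.om2), a P * ψ P y + L2 y := by
        rw [hL, hL2, hS2]
        simp only [Finset.filter_filter]
        simp only [Finset.sum_filter]
        rw [← Finset.sum_add_distrib]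
        refine Finset.sum_congr rfl fun P _ => ?_
        by_cases hp : T.om ⊆ P.om2
        · simp [hp, and_comm]
        · simp [hp]
      rw [e]
      refine (norm_add_le _ _).trans (add_le_add ?_ le_rfl)
      refine (norm_sum_le _ _).trans ?_
      have := h.sum_one_part_le y (S.filter fun P => (N y ∈ P.om2 ∧ lev S T y ≤ P.i) ∧ ¬ T.om ⊆ P.om2) fun P hP => by
        have := Finset.mem_filter.1 hP
        exact ⟨this.1, this.2.2, this.2.1.1⟩
      calc _ ≤ ∑ P ∈ S with ((N y ∈ P.om2 ∧ lev S T y ≤ P.i) ∧ ¬ T.om ⊆ P.om2), C0 * σ * P.w y ^ 10 :=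
            Finset.sum_le_sum fun P hP => hpt P (Finset.mem_filter.1 hP).1 y
        _ ≤ C0 * σ * 8 := by rw [← Finset.mul_sum]; gcongr
        _ = _ := by ring
    have hL2b : ∀ y l, (∀ i', lev S T y ≤ i' → ∑ z ∈ tri i' (y / 4 ^ i'), ‖H z‖ ≤ l * 4 ^ i') → ‖L2 y‖ ≤ 64 * C0 * l :=
      fun y l hl => hW.trunc_om2_le hlac hsp2 ⟨x, hx⟩ (fun P hP => (h.le P (hS2S hP)).2.2) a y _ (N y) l hl
    let J : ℤ → Finset ℤ := fun z => (longSet N G S T).filter fun y => y / 4 ^ (lev S T z - 1) = z / 4 ^ (lev S T z - 1)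
    set m : ℤ → ℝ := fun z => ((J z).sup fun y => ‖L2 y‖₊ / (64 * C0.toNNReal) : NNReal) with hm
    have hC' : (0 : NNReal) < 64 * C0.toNNReal := by
      have := Real.toNNReal_pos.2 hC
      positivity
    have hmL : ∀ z, ∀ y ∈ J z, ‖L2 y‖ ≤ 64 * C0 * m z := by
      intro z y hy
      have h1 : ‖L2 y‖₊ / (64 * C0.toNNReal) ≤ (J z).sup fun y => ‖L2 y‖₊ / (64 * C0.toNNReal) :=
        Finset.le_sup (f := fun y => ‖L2 y‖₊ / (64 * C0.toNNReal)) hy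
      rw [div_le_iff₀ hC', ← NNReal.coe_le_coe] at h1
      push_cast at h1
      rw [Real.coe_toNNReal _ hC.le] at h1
      rw [mul_comm]
      exact h1
    have hmax := maximal_sum (fun z => ‖H z‖) (fun _ => norm_nonneg _) (64 * C0 ^ 2 * (σ ^ 2 * 4 ^ T.i))
      (fun A => (sum_sq_le_norm_sq H A).trans ((hW.packets_right.norm_sum_lacunary hC.le hlac a).trans (by gcongr)))
      σ hσ (nearSet S T) m (by
        intro z hz l hl0 hl
        rw [hm]
        have : ((J z).sup fun y => ‖L2 y‖₊ / (64 * C0.toNNReal)) ≤ l.toNNReal := by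
          refine Finset.sup_le fun y hy => ?_
          obtain ⟨hyY, hyz⟩ := Finset.mem_filter.1 hy
          rw [div_le_iff₀ hC', ← NNReal.coe_le_coe]
          push_cast
          rw [Real.coe_toNNReal _ hC.le, Real.coe_toNNReal _ hl0, mul_comm l]
          refine hL2b y l fun i' hi' => ?_
          rw [lev_eq hyz] at hi'
          rw [div_eq_of_div_eq (by omega) hyz]
          exact hl i'
        rw [← Real.coe_toNNReal l hl0]
        exact_mod_cast this)
    have hcard := card_nearSet (S := S) (T := T)
    have h1 := sum_le_of_lev (S := S) (T := T) (longSet N G S T) (nearSet S T) (fun _ => 1) (fun y => ‖L y‖)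
      (fun z => 8 * (C0 * σ) + 64 * C0 * m z) (fun _ => 972 * δ) (fun _ _ => zero_le_one)
      (fun z _ => by have : 0 ≤ m z := NNReal.coe_nonneg _
                     positivity)
      (fun y hy z hz => by
        rw [h.mem_nearSet, lev_eq hz]; exact (Finset.mem_filter.1 hy).2.1)
      (fun y hy z hz => (hLL y).trans (add_le_add le_rfl (hmL z y (Finset.mem_filter.2 ⟨hy, by
        rw [lev_eq hz]; exact hz.symm⟩))))
      (fun z hz => by
        rw [Finset.sum_const, nsmul_eq_mul, mul_one]
        exact h.card_longSet_le (h.mem_nearSet.1 hz))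
    simp only [one_mul] at h1
    refine h1.trans ?_
    rw [← Finset.mul_sum, Finset.sum_add_distrib, Finset.sum_const, nsmul_eq_mul, ← Finset.mul_sum]
    gcongr
    have e1 : 108 * (64 * C0 ^ 2 * (σ ^ 2 * 4 ^ T.i)) / σ = 6912 * C0 ^ 2 * σ * 4 ^ T.i := by
      field_simp; ring
    rw [e1] at hmax
    have e2 : ∑ z ∈ nearSet S T, m z ≤ 2 * σ * (3 * 4 ^ T.i) + 6912 * C0 ^ 2 * σ * 4 ^ T.i := hmax.trans (by gcongr)
    calc ((nearSet S T).card : ℝ) * (8 * (C0 * σ)) + 64 * C0 * ∑ z ∈ nearSet S T, m z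
        ≤ (3 * 4 ^ T.i) * (8 * (C0 * σ)) + 64 * C0 * (2 * σ * (3 * 4 ^ T.i) + 6912 * C0 ^ 2 * σ * 4 ^ T.i) := by
          gcongr
      _ = _ := by ring
  have e1 : ∑ y ∈ G, ∑ P ∈ S, (if N y ∈ P.om ∧ lev S T y = T.i + 1 then C0 * σ * P.w y ^ 10 else 0) ≤
      C0 * σ * (2 * δ * 4 ^ T.i) := by
    rw [Finset.sum_comm]
    calc _ = C0 * σ * ∑ P ∈ S, ∑ y ∈ G with (N y ∈ P.om ∧ lev S T y = T.i + 1), P.w y ^ 10 := by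
          rw [Finset.mul_sum]
          refine Finset.sum_congr rfl fun P _ => ?_
          rw [← Finset.sum_filter, Finset.mul_sum]
      _ ≤ _ := by gcongr
  have e2 : ∑ y ∈ G, ∑ P ∈ S, (if N y ∈ P.om ∧ lev S T y ≤ T.i ∧ P.i < lev S T y then C0 * σ * P.w y ^ 10 else 0) ≤
      C0 * σ * (1536 * δ * 4 ^ T.i) := by
    rw [Finset.sum_comm]
    calc _ = C0 * σ * ∑ P ∈ S, ∑ y ∈ G with (N y ∈ P.om ∧ lev S T y ≤ T.i ∧ P.i < lev S T y), P.w y ^ 10 := by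
          rw [Finset.mul_sum]
          refine Finset.sum_congr rfl fun P _ => ?_
          rw [← Finset.sum_filter, Finset.mul_sum]
      _ ≤ _ := by gcongr
  have e3 : ∑ y ∈ G, (if y ∈ longSet N G S T then ‖L y‖ else 0) = ∑ y ∈ longSet N G S T, ‖L y‖ := by
    rw [← Finset.sum_filter]
    refine Finset.sum_congr ?_ fun _ _ => rfl
    ext y
    rw [Finset.mem_filter]
    exact ⟨fun h => h.2, fun h => ⟨(Finset.mem_filter.1 h).1, h⟩⟩
  refine (Finset.sum_le_sum hsplit).trans ?_
  rw [Finset.sum_add_distrib, Finset.sum_add_distrib, e3]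
  refine (add_le_add (add_le_add e1 e2) hlong).trans ?_
  have hpos : 0 ≤ δ * σ * 4 ^ T.i * C0 := by positivity
  have hpos2 : 0 ≤ δ * σ * 4 ^ T.i * C0 * C0 ^ 2 := by positivity
  nlinarith
end IsTree

namespace Tile
/-- The lower half of the frequency interval. -/
def low (P : Tile) : Set ℝ := {x | (P.m : ℝ) ≤ x * 4 ^ P.i ∧ x * 4 ^ P.i < P.m + 1 / 2}

lemma spt_subset_low (P : Tile) : P.spt ⊆ P.low := by
  intro x hx
  simp only [spt, low, Set.mem_ofPred_eq] at *
  constructor <;> linarith [hx.1, hx.2]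

lemma disjoint_low_om2 (P : Tile) : Disjoint P.low P.om2 := by
  rw [Set.disjoint_left]
  intro x hx hx'
  simp only [low, om2, _root_.mem_om_iff, Set.mem_ofPred_eq] at *
  rw [pow_add] at hx'
  push_cast at hx'
  linarith [hx.2, hx'.1]

lemma om_subset_low {P Q : Tile} (h : P.i < Q.i) {x : ℝ} (h1 : x ∈ P.low) (h2 : x ∈ Q.om) : Q.om ⊆ P.low := by
  intro z hz
  have hi : P.i + 1 ≤ Q.i := h
  have h3 : z ∈ _root_.om (P.i + 1) ⌊x * 4 ^ (P.i + 1)⌋ := om_nest hi (x := x) rfl h2 hz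
  rw [mem_om_iff] at h3
  simp only [low, Set.mem_ofPred_eq] at *
  have e : x * 4 ^ (P.i + 1) = 4 * (x * 4 ^ P.i) := by rw [pow_succ]; ring
  have e' : z * 4 ^ (P.i + 1) = 4 * (z * 4 ^ P.i) := by rw [pow_succ]; ring
  rw [e, e'] at h3
  have a1 : 4 * P.m ≤ ⌊4 * (x * 4 ^ P.i)⌋ := by
    rw [Int.le_floor]; push_cast; linarith
  have a2 : ⌊4 * (x * 4 ^ P.i)⌋ < 4 * P.m + 2 := by
    rw [Int.floor_lt]; push_cast; linarith
  have a1' : 4 * (P.m : ℝ) ≤ ⌊4 * (x * 4 ^ P.i)⌋ := by exact_mod_cast a1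
  have a2' : (⌊4 * (x * 4 ^ P.i)⌋ : ℝ) + 1 ≤ 4 * P.m + 2 := by exact_mod_cast a2
  constructor <;> linarith [h3.1, h3.2]

lemma eq_of_le_of_le {P Q T : Tile} (hP : P.Le T) (hQ : Q.Le T) (hi : P.i = Q.i) (hk : P.k = Q.k) : P = Q := by
  obtain ⟨x, hx⟩ := om_nonempty T.i T.m
  obtain ⟨i, k, m⟩ := P
  obtain ⟨i', k', m'⟩ := Q
  obtain rfl : i = i' := hi
  obtain rfl : k = k' := hk
  obtain rfl := om_eq_of_mem (hP.2.2 hx) (hQ.2.2 hx)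
  rfl

/-- The points of the spatial interval. -/
noncomputable def pts (P : Tile) : Finset ℤ := Finset.Ico (P.k * 4 ^ P.i) ((P.k + 1) * 4 ^ P.i)

lemma mem_pts {P : Tile} {y : ℤ} : y ∈ P.pts ↔ y ∈ P.iv := by
  rw [pts, Finset.mem_Ico, Tile.iv, mem_iv_iff]

lemma card_pts (P : Tile) : (P.pts.card : ℝ) = 4 ^ P.i := card_ivF _ _

lemma sum_scale_w_le_of_inj (S : Finset Tile) (i : ℕ) (hi : ∀ P ∈ S, P.i = i)
    (hinj : ∀ P ∈ S, ∀ Q ∈ S, P.k = Q.k → P = Q) (z : ℤ) {n : ℕ} (hn : 2 ≤ n) : ∑ P ∈ S, P.w z ^ n ≤ 8 := by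
  classical
  calc ∑ P ∈ S, P.w z ^ n = ∑ P ∈ S, wt (((P.k:ℝ) - z / 4 ^ i) / 1) ^ n := by
        refine Finset.sum_congr rfl fun P hP => ?_
        unfold Tile.w
        rw [hi P hP, ← wt_neg]
        congr 2
        field_simp; ring
    _ = ∑ k ∈ S.image Tile.k, wt (((k:ℝ) - z / 4 ^ i) / 1) ^ n := by
        rw [Finset.sum_image (fun P hP Q hQ hk => hinj P hP Q hQ hk)]
    _ ≤ 8 * 1 := sum_wt_pow_le hn 1 le_rfl _ _
    _ = 8 := by norm_num

/-- The tails of a tree outside the top interval. -/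
lemma tree_tail (T : Tile) (S : Finset Tile) (hS : ∀ P ∈ S, P.Le T) (Y : Finset ℤ) (hY : ∀ y ∈ Y, y ∉ T.iv) :
    ∑ P ∈ S, ∑ y ∈ Y, P.w y ^ 4 ≤ 256 * 4 ^ T.i := by
  classical
  set a : ℝ := T.k * 4 ^ T.i with ha
  set b : ℝ := (T.k + 1) * 4 ^ T.i with hb
  have hmaps : ∀ P ∈ S, P.i ∈ Finset.range (T.i + 1) := fun P hP => by
    have := (hS P hP).1
    simp; omega
  have key : ∀ P ∈ S, ∀ y ∈ Y, P.w y ^ 4 ≤ P.w y ^ 2 * (wt ((y - a) / 4 ^ P.i) ^ 2 + wt ((y - b) / 4 ^ P.i) ^ 2) := by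
    intro P hP y hy
    have h0 := P.w_nonneg y
    have h4 : (0:ℝ) < 4 ^ P.i := by positivity
    have h1 := (hS P hP).2.1 P.corner_mem
    have h1' : P.k * 4 ^ P.i + (4 ^ P.i - 1) ∈ T.iv := (hS P hP).2.1 (by
      rw [Tile.iv, mem_iv_iff]
      have : (0:ℤ) < 4 ^ P.i := by positivity
      constructor <;> linarith)
    rw [Tile.iv, mem_iv_iff] at h1 h1'
    have h2 : a ≤ P.k * 4 ^ P.i := by rw [ha]; exact_mod_cast h1.1
    have h3 : (P.k : ℝ) * 4 ^ P.i + 4 ^ P.i ≤ b := by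
      have : P.k * 4 ^ P.i + 4 ^ P.i ≤ (T.k + 1) * 4 ^ T.i := by linarith [h1'.2]
      rw [hb]; exact_mod_cast this
    have h5 : (y:ℝ) < a ∨ b ≤ y := by
      have := hY y hy
      rw [Tile.iv, mem_iv_iff, not_and_or, not_le, not_lt] at this
      rcases this with h | h
      · left; rw [ha]; exact_mod_cast h
      · right; rw [hb]; exact_mod_cast h
    have hcomp : ∀ c : ℝ, |(y:ℝ) - c| ≤ |(y:ℝ) - P.k * 4 ^ P.i| → P.w y ≤ wt ((y - c) / 4 ^ P.i) := by
      intro c hc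
      refine wt_anti ?_
      rw [abs_div, abs_div]; gcongr
    have e : P.w y ^ 4 = P.w y ^ 2 * P.w y ^ 2 := by ring
    rw [e]
    gcongr
    rcases h5 with h | h
    · have := hcomp a (by rw [abs_of_neg (by linarith), abs_of_neg (by linarith)]; linarith)
      have h6 : P.w y ^ 2 ≤ wt ((y - a) / 4 ^ P.i) ^ 2 := by gcongr
      nlinarith [sq_nonneg (wt ((y - b) / 4 ^ P.i))]
    · have := hcomp b (by rw [abs_of_nonneg (by linarith), abs_of_nonneg (by linarith)]; linarith)
      have h6 : P.w y ^ 2 ≤ wt ((y - b) / 4 ^ P.i) ^ 2 := by gcongr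
      nlinarith [sq_nonneg (wt ((y - a) / 4 ^ P.i))]
  calc ∑ P ∈ S, ∑ y ∈ Y, P.w y ^ 4
      ≤ ∑ P ∈ S, ∑ y ∈ Y, P.w y ^ 2 * (wt ((y - a) / 4 ^ P.i) ^ 2 + wt ((y - b) / 4 ^ P.i) ^ 2) :=
        Finset.sum_le_sum fun P hP => Finset.sum_le_sum fun y hy => key P hP y hy
    _ = ∑ i ∈ Finset.range (T.i + 1), ∑ P ∈ S with P.i = i, ∑ y ∈ Y,
          P.w y ^ 2 * (wt ((y - a) / 4 ^ P.i) ^ 2 + wt ((y - b) / 4 ^ P.i) ^ 2) :=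
        (Finset.sum_fiberwise_of_maps_to hmaps _).symm
    _ ≤ ∑ i ∈ Finset.range (T.i + 1), 8 * (16 * 4 ^ i) := by
        refine Finset.sum_le_sum fun i _ => ?_
        rw [Finset.sum_comm]
        calc ∑ y ∈ Y, ∑ P ∈ S with P.i = i, P.w y ^ 2 * (wt ((y - a) / 4 ^ P.i) ^ 2 + wt ((y - b) / 4 ^ P.i) ^ 2)
            = ∑ y ∈ Y, (∑ P ∈ S with P.i = i, P.w y ^ 2) * (wt ((y - a) / 4 ^ i) ^ 2 + wt ((y - b) / 4 ^ i) ^ 2) := by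
              refine Finset.sum_congr rfl fun y _ => ?_
              rw [Finset.sum_mul]
              refine Finset.sum_congr rfl fun P hP => ?_
              rw [(Finset.mem_filter.1 hP).2]
          _ ≤ ∑ y ∈ Y, 8 * (wt ((y - a) / 4 ^ i) ^ 2 + wt ((y - b) / 4 ^ i) ^ 2) := by
              gcongr with y _
              exact sum_scale_w_le_of_inj _ i (fun P hP => (Finset.mem_filter.1 hP).2) (fun P hP Q hQ hk =>
                eq_of_le_of_le (hS P (Finset.mem_filter.1 hP).1) (hS Q (Finset.mem_filter.1 hQ).1)
                  ((Finset.mem_filter.1 hP).2.trans (Finset.mem_filter.1 hQ).2.symm) hk) y le_rfl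
          _ ≤ 8 * (16 * 4 ^ i) := by
              rw [← Finset.mul_sum, Finset.sum_add_distrib]
              have h1 := sum_wt_sq_le (4 ^ i) (one_le_four_pow i) a Y
              have h2 := sum_wt_sq_le (4 ^ i) (one_le_four_pow i) b Y
              linarith
    _ = 128 * 4 ^ T.i * ∑ i ∈ Finset.range (T.i + 1), (4:ℝ) ^ i / 4 ^ T.i := by
        rw [Finset.mul_sum]
        refine Finset.sum_congr rfl fun i _ => ?_
        field_simp; ring
    _ ≤ 128 * 4 ^ T.i * 2 := by gcongr; exact sum_four_pow_le _
    _ = _ := by ring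

lemma w_corner_le {P Q : Tile} (h : Q.i ≤ P.i) {y : ℤ} (hy : y ∈ Q.iv) : P.w (Q.k * 4 ^ Q.i) ≤ 2 * P.w y := by
  rw [Tile.iv, mem_iv_iff] at hy
  have h1 : |(y:ℝ) - Q.k * 4 ^ Q.i| ≤ 4 ^ Q.i := by
    have : |y - Q.k * 4 ^ Q.i| ≤ 4 ^ Q.i := by rw [abs_le]; constructor <;> linarith [hy.1, hy.2]
    exact_mod_cast this
  have h2 : (4:ℝ) ^ Q.i ≤ 4 ^ P.i := pow_le_pow_right₀ (by norm_num) h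
  have h4 : (0:ℝ) < 4 ^ P.i := by positivity
  unfold Tile.w wt
  rw [← div_eq_mul_inv, inv_eq_one_div, div_le_div_iff₀ (by positivity) (by positivity), abs_div, abs_div, abs_of_pos h4]
  have h3 := abs_add_le ((y:ℝ) - Q.k * 4 ^ Q.i) (Q.k * 4 ^ Q.i - P.k * 4 ^ P.i)
  rw [show (y:ℝ) - Q.k * 4 ^ Q.i + (Q.k * 4 ^ Q.i - P.k * 4 ^ P.i) = y - P.k * 4 ^ P.i by ring] at h3
  have : |(y:ℝ) - P.k * 4 ^ P.i| / 4 ^ P.i ≤ 1 + |(Q.k:ℝ) * 4 ^ Q.i - P.k * 4 ^ P.i| / 4 ^ P.i := by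
    rw [div_le_iff₀ h4, add_mul, div_mul_cancel₀ _ h4.ne']; linarith
  have h5 : 0 ≤ |(Q.k:ℝ) * 4 ^ Q.i - P.k * 4 ^ P.i| / 4 ^ P.i := by positivity
  push_cast
  linarith
end Tile

/-- A collection of strongly disjoint 2-trees. -/
structure Forest (𝒯 : Finset Tile) (tr : Tile → Finset Tile) : Prop where
  le2 : ∀ T ∈ 𝒯, ∀ P ∈ tr T, P.Le2 T
  sparse : ∀ T ∈ 𝒯, ∀ T' ∈ 𝒯, ∀ P ∈ tr T, ∀ Q ∈ tr T', P.i < Q.i → P.i + 2 ≤ Q.i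
  disj : ∀ T ∈ 𝒯, ∀ T' ∈ 𝒯, T ≠ T' → Disjoint (tr T) (tr T')
  strong : ∀ T ∈ 𝒯, ∀ T' ∈ 𝒯, T ≠ T' → ∀ P ∈ tr T, ∀ Q ∈ tr T', Q.i < P.i → P.om ⊆ Q.low → Disjoint Q.iv T.iv

namespace Forest
variable {𝒯 : Finset Tile} {tr : Tile → Finset Tile}

lemma lacunary (h : Forest 𝒯 tr) {T : Tile} (hT : T ∈ 𝒯) : Lacunary (tr T) :=
  lacunary_of_le2 (fun P hP Q hQ => h.sparse T hT T hT P hP Q hQ) (h.le2 T hT)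

/-- The smaller tiles of other trees interacting with a given tile are disjoint and outside the top. -/
lemma sum_interact_le (h : Forest 𝒯 tr) {T P : Tile} (hT : T ∈ 𝒯) (hP : P ∈ tr T) (U : Finset Tile)
    (hU : ∀ Q ∈ U, Q.i < P.i ∧ P.om ⊆ Q.low ∧ ∃ T' ∈ 𝒯, Q ∈ tr T') (Y : Finset ℤ)
    (hY : ∀ Q ∈ U, ∀ y ∈ Q.iv, y ∉ T.iv → y ∈ Y) :
    ∑ Q ∈ U, (4:ℝ) ^ Q.i * P.w (Q.k * 4 ^ Q.i) ^ 8 ≤ 256 * ∑ y ∈ Y, P.w y ^ 8 := by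
  classical
  obtain ⟨x, hx⟩ := om_nonempty P.i P.m
  have hnT : ∀ Q ∈ U, Q ∉ tr T := by
    intro Q hQ hc
    obtain ⟨h1, h2, _⟩ := hU Q hQ
    exact Set.disjoint_left.1 Q.disjoint_low_om2 (h2 hx) ((h.lacunary hT Q hc P hP).2 h1 hx)
  have hdT : ∀ Q ∈ U, Disjoint Q.iv T.iv := by
    intro Q hQ
    obtain ⟨h1, h2, T', hT', hQT'⟩ := hU Q hQ
    refine h.strong T hT T' hT' ?_ P hP Q hQT' h1 h2
    rintro rfl
    exact hnT Q hQ hQT'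
  have hdisj : ∀ Q ∈ U, ∀ Q' ∈ U, Q.i < Q'.i → Disjoint Q.iv Q'.iv := by
    intro Q hQ Q' hQ' hi
    obtain ⟨h1, h2, T', hT', hQT'⟩ := hU Q hQ
    obtain ⟨h1', h2', T'', hT'', hQT''⟩ := hU Q' hQ'
    have hlow : Q'.om ⊆ Q.low := Tile.om_subset_low hi (h2 hx) (by
      have := h2' hx
      simp only [Tile.low, Set.mem_ofPred_eq] at this
      rw [Tile.om, mem_om_iff]; constructor <;> linarith [this.1, this.2])
    obtain ⟨x', hx'⟩ := om_nonempty Q'.i Q'.m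
    have hne : T'' ≠ T' := by
      rintro rfl
      exact Set.disjoint_left.1 Q.disjoint_low_om2 (hlow hx') ((h.lacunary hT' Q hQT' Q' hQT'').2 hi hx')
    exact (h.strong T'' hT'' T' hT' hne Q' hQT'' Q hQT' hi hlow).mono_right (h.le2 T'' hT'' Q' hQT'').le.2.1
  have hdisj' : (U : Set Tile).PairwiseDisjoint Tile.pts := by
    intro Q hQ Q' hQ' hne
    rw [Function.onFun, Finset.disjoint_left]
    intro y hy hy'
    rw [Tile.mem_pts] at hy hy'
    rcases lt_trichotomy Q.i Q'.i with hi | hi | hi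
    · exact Set.disjoint_left.1 (hdisj Q hQ Q' hQ' hi) hy hy'
    · apply hne
      have h2 := (hU Q hQ).2.1 hx
      have h2' := (hU Q' hQ').2.1 hx
      obtain ⟨i, k, m⟩ := Q
      obtain ⟨i', k', m'⟩ := Q'
      obtain rfl : i = i' := hi
      obtain rfl := iv_eq_of_mem hy hy'
      have : m = m' := om_eq_of_mem (i := i) (y := x)
        (by rw [mem_om_iff]; simp only [Tile.low, Set.mem_ofPred_eq] at h2; constructor <;> linarith [h2.1, h2.2])
        (by rw [mem_om_iff]; simp only [Tile.low, Set.mem_ofPred_eq] at h2'; constructor <;> linarith [h2'.1, h2'.2])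
      rw [this]
    · exact Set.disjoint_left.1 (hdisj Q' hQ' Q hQ hi) hy' hy
  calc ∑ Q ∈ U, (4:ℝ) ^ Q.i * P.w (Q.k * 4 ^ Q.i) ^ 8 = ∑ Q ∈ U, ∑ y ∈ Q.pts, P.w (Q.k * 4 ^ Q.i) ^ 8 := by
        refine Finset.sum_congr rfl fun Q _ => ?_
        rw [Finset.sum_const, nsmul_eq_mul, Tile.card_pts]
    _ ≤ ∑ Q ∈ U, ∑ y ∈ Q.pts, 256 * P.w y ^ 8 := by
        refine Finset.sum_le_sum fun Q hQ => Finset.sum_le_sum fun y hy => ?_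
        have h1 := Tile.w_corner_le (hU Q hQ).1.le (Tile.mem_pts.1 hy)
        calc P.w (Q.k * 4 ^ Q.i) ^ 8 ≤ (2 * P.w y) ^ 8 := by
              have := P.w_nonneg (Q.k * 4 ^ Q.i)
              gcongr
          _ = _ := by ring
    _ = ∑ y ∈ U.biUnion Tile.pts, 256 * P.w y ^ 8 := (Finset.sum_biUnion hdisj').symm
    _ ≤ ∑ y ∈ Y, 256 * P.w y ^ 8 := by
        refine Finset.sum_le_sum_of_subset_of_nonneg (fun y hy => ?_) fun y _ _ => 
          mul_nonneg (by norm_num) (pow_nonneg (P.w_nonneg y) _)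
        obtain ⟨Q, hQ, hy⟩ := Finset.mem_biUnion.1 hy
        rw [Tile.mem_pts] at hy
        exact hY Q hQ y hy (Set.disjoint_left.1 (hdT Q hQ) hy)
    _ = _ := by rw [Finset.mul_sum]
end Forest

namespace Forest
variable {𝒯 : Finset Tile} {tr : Tile → Finset Tile} {C0 : ℝ} {v : Tile → L2Z}

/-- Almost orthogonality of a forest of comparable density. -/
lemma bessel (h : Forest 𝒯 tr) (hv : Packets C0 v) (hC : 0 ≤ C0) (f : L2Z) {σ : ℝ} (hσ : 0 ≤ σ)
    (hub : ∀ T ∈ 𝒯, ∀ P ∈ tr T, ‖inner ℂ (v P) f‖ ≤ σ * 2 ^ P.i)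
    (hlb : ∀ T ∈ 𝒯, σ ^ 2 * 4 ^ T.i ≤ 4 * ∑ P ∈ tr T, ‖inner ℂ (v P) f‖ ^ 2) :
    ∑ T ∈ 𝒯, ∑ P ∈ tr T, ‖inner ℂ (v P) f‖ ^ 2 ≤ 2 ^ 23 * C0 ^ 2 * ‖f‖ ^ 2 := by
  classical
  have hdisj : (𝒯 : Set Tile).PairwiseDisjoint tr := fun T hT T' hT' hne => h.disj T hT T' hT' hne
  set R := 𝒯.biUnion tr with hR
  rw [← Finset.sum_biUnion hdisj, ← hR]
  set A : Tile → ℝ := fun P => ‖inner ℂ (v P) f‖ with hA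
  have hA0 : ∀ P, 0 ≤ A P := fun P => norm_nonneg _
  set E := ∑ P ∈ R, A P ^ 2 with hE
  have hE0 : 0 ≤ E := Finset.sum_nonneg fun P _ => sq_nonneg _
  refine bessel_of_gram R v f _ (by positivity) ?_
  change ∑ P ∈ R, ∑ Q ∈ R, A P * A Q * ‖inner ℂ (v P) (v Q)‖ ≤ 2 ^ 23 * C0 ^ 2 * E
  set X := ∑ P ∈ R, ∑ Q ∈ R, (if Q.i < P.i then A P * A Q * ‖inner ℂ (v P) (v Q)‖ else 0) with hX
  have hX' : ∑ P ∈ R, ∑ Q ∈ R, (if P.i < Q.i then A P * A Q * ‖inner ℂ (v P) (v Q)‖ else 0) = X := by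
    rw [hX, Finset.sum_comm]
    refine Finset.sum_congr rfl fun P _ => Finset.sum_congr rfl fun Q _ => ?_
    rw [norm_inner_symm, mul_comm (A P)]
  have hdiag : ∑ P ∈ R, ∑ Q ∈ R, A P * A Q * (if P.i = Q.i then ‖inner ℂ (v P) (v Q)‖ else 0) ≤ 64 * C0 ^ 2 * E := by
    refine schur_sum_le R A _ _ (fun P Q => by split_ifs <;> positivity) (fun P Q => by
      rw [norm_inner_symm]; simp only [eq_comm]) fun P hP => ?_
    rw [← Finset.sum_filter]
    refine hv.gram_row hC P _ fun Q hQ hn => ?_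
    have hi := (Finset.mem_filter.1 hQ).2
    refine Disjoint.mono P.spt_subset_om Q.spt_subset_om (Set.disjoint_left.2 fun x hx hx' => hn ⟨hi.symm, ?_⟩)
    unfold Tile.om at hx hx'
    rw [hi] at hx
    exact om_eq_of_mem hx' hx
  have hXle : X ≤ 2 ^ 21 * C0 ^ 2 * E := by
    calc X = ∑ T ∈ 𝒯, ∑ P ∈ tr T, ∑ Q ∈ R, (if Q.i < P.i then A P * A Q * ‖inner ℂ (v P) (v Q)‖ else 0) := by
          rw [hX, hR, Finset.sum_biUnion hdisj]
      _ ≤ ∑ T ∈ 𝒯, 2 ^ 19 * C0 ^ 2 * (σ ^ 2 * 4 ^ T.i) := by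
          refine Finset.sum_le_sum fun T hT => ?_
          set Y := (R.biUnion Tile.pts).filter fun y => y ∉ T.iv with hY
          calc _ ≤ ∑ P ∈ tr T, 2 ^ 11 * C0 ^ 2 * σ ^ 2 * ∑ y ∈ Y, P.w y ^ 4 := by
                refine Finset.sum_le_sum fun P hP => ?_
                set U := R.filter fun Q => Q.i < P.i ∧ P.om ⊆ Q.low with hU
                have h_int := h.sum_interact_le hT hP U (fun Q hQ => by
                  obtain ⟨hQR, h1, h2⟩ := Finset.mem_filter.1 hQ
                  exact ⟨h1, h2, Finset.mem_biUnion.1 hQR⟩) Y (fun Q hQ y hy hyT =>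
                    Finset.mem_filter.2 ⟨Finset.mem_biUnion.2 ⟨Q, (Finset.mem_filter.1 hQ).1, Tile.mem_pts.2 hy⟩, hyT⟩)
                calc ∑ Q ∈ R, (if Q.i < P.i then A P * A Q * ‖inner ℂ (v P) (v Q)‖ else 0)
                    ≤ ∑ Q ∈ U, A P * A Q * ‖inner ℂ (v P) (v Q)‖ := by
                      rw [hU, Finset.sum_filter]
                      refine Finset.sum_le_sum fun Q hQ => ?_
                      by_cases h1 : Q.i < P.i
                      · by_cases h2 : P.om ⊆ Q.low
                        · simp [h1, h2]
                        · have : inner ℂ (v P) (v Q) = 0 := hv.orth P Q (Set.disjoint_left.2 fun x hx hx' =>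
                            h2 (Tile.om_subset_low h1 (Q.spt_subset_low hx') (P.spt_subset_om hx)))
                          simp [h1, h2, this]
                      · simp [h1]
                  _ ≤ ∑ Q ∈ U, (8 * C0 ^ 2 * σ ^ 2) * (4 ^ Q.i * P.w (Q.k * 4 ^ Q.i) ^ 8) := by
                      refine Finset.sum_le_sum fun Q hQ => ?_
                      obtain ⟨hQR, h1, h2⟩ := Finset.mem_filter.1 hQ
                      obtain ⟨T', hT', hQT'⟩ := Finset.mem_biUnion.1 hQR
                      have hw := P.w_nonneg (Q.k * 4 ^ Q.i)
                      calc A P * A Q * ‖inner ℂ (v P) (v Q)‖ ≤ (σ * 2 ^ P.i) * (σ * 2 ^ Q.i) *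
                            (8 * C0 ^ 2 * (2 ^ Q.i / 2 ^ P.i) * P.w (Q.k * 4 ^ Q.i) ^ 8) := by
                            gcongr
                            · exact hub T hT P hP
                            · exact hub T' hT' Q hQT'
                            · exact hv.gram hC P Q h1.le
                        _ = _ := by
                            rw [show (4:ℝ) ^ Q.i = 2 ^ Q.i * 2 ^ Q.i by rw [← mul_pow]; norm_num]
                            field_simp
                  _ ≤ (8 * C0 ^ 2 * σ ^ 2) * (256 * ∑ y ∈ Y, P.w y ^ 8) := by
                      rw [← Finset.mul_sum]; gcongr
                  _ ≤ (8 * C0 ^ 2 * σ ^ 2) * (256 * ∑ y ∈ Y, P.w y ^ 4) := by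
                      refine mul_le_mul_of_nonneg_left (mul_le_mul_of_nonneg_left
                        (Finset.sum_le_sum fun y _ => wt_pow_le (by norm_num : 4 ≤ 8) _) (by norm_num)) (by positivity)
                  _ = _ := by ring
            _ ≤ 2 ^ 11 * C0 ^ 2 * σ ^ 2 * (256 * 4 ^ T.i) := by
                rw [← Finset.mul_sum]
                gcongr
                exact Tile.tree_tail T (tr T) (fun P hP => (h.le2 T hT P hP).le) Y fun y hy => (Finset.mem_filter.1 hy).2
            _ = _ := by ring
      _ ≤ ∑ T ∈ 𝒯, 2 ^ 19 * C0 ^ 2 * (4 * ∑ P ∈ tr T, A P ^ 2) := by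
          exact Finset.sum_le_sum fun T hT => mul_le_mul_of_nonneg_left (hlb T hT) (by positivity)
      _ = _ := by
          rw [← Finset.mul_sum, ← Finset.mul_sum, ← Finset.sum_biUnion hdisj, ← hR]; ring
  have hsplit : ∑ P ∈ R, ∑ Q ∈ R, A P * A Q * ‖inner ℂ (v P) (v Q)‖ =
      ∑ P ∈ R, ∑ Q ∈ R, A P * A Q * (if P.i = Q.i then ‖inner ℂ (v P) (v Q)‖ else 0) + X +
      ∑ P ∈ R, ∑ Q ∈ R, (if P.i < Q.i then A P * A Q * ‖inner ℂ (v P) (v Q)‖ else 0) := by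
    rw [hX, ← Finset.sum_add_distrib, ← Finset.sum_add_distrib]
    refine Finset.sum_congr rfl fun P _ => ?_
    rw [← Finset.sum_add_distrib, ← Finset.sum_add_distrib]
    refine Finset.sum_congr rfl fun Q _ => ?_
    rcases lt_trichotomy P.i Q.i with hi | hi | hi
    · simp [hi, hi.ne, hi.not_gt]
    · simp [hi]
    · simp [hi, hi.ne', hi.not_gt]
  rw [hsplit, hX']
  nlinarith [mul_nonneg (sq_nonneg C0) hE0]
end Forest

/-- The midpoint of the frequency interval. -/
noncomputable def Tile.mid (T : Tile) : ℝ := (T.m + 1 / 2) / 4 ^ T.i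

lemma Tile.mid_mem_om (T : Tile) : T.mid ∈ T.om := by
  rw [Tile.om, mem_om_iff, Tile.mid, div_mul_cancel₀ _ (by positivity)]
  constructor <;> linarith

lemma Tile.mid_le_of_mem_om2 {P : Tile} {x : ℝ} (hx : x ∈ P.om2) : P.mid ≤ x := by
  simp only [om2, _root_.mem_om_iff] at hx
  rw [pow_add] at hx
  push_cast at hx
  rw [Tile.mid, div_le_iff₀ (by positivity)]
  linarith [hx.1]

lemma Tile.lt_mid_of_mem_low {P : Tile} {x : ℝ} (hx : x ∈ P.low) : x < P.mid := by
  rw [Tile.mid, lt_div_iff₀ (by positivity)]; exact hx.2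

lemma Tile.Le2.mid_le {P T : Tile} (h : P.Le2 T) : P.mid ≤ T.mid := by
  rcases h with rfl | h
  · exact le_rfl
  · exact Tile.mid_le_of_mem_om2 (h.2.2 T.mid_mem_om)

lemma Tile.low_subset_om (P : Tile) : P.low ⊆ P.om := by
  intro x hx
  simp only [Tile.low, Set.mem_ofPred_eq] at hx
  rw [Tile.om, mem_om_iff]; constructor <;> linarith [hx.1, hx.2]

/-- The square sum of the coefficients of the 2-tree with a given top. -/
noncomputable def energy (A : Tile → ℝ) (𝒬 : Finset Tile) (T : Tile) : ℝ :=
  open Classical in ∑ P ∈ 𝒬 with P.Le2 T, A P ^ 2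

lemma energy_mono {A : Tile → ℝ} {𝒬 𝒬' : Finset Tile} (h : 𝒬' ⊆ 𝒬) (T : Tile) : energy A 𝒬' T ≤ energy A 𝒬 T := by
  classical
  exact Finset.sum_le_sum_of_subset_of_nonneg (Finset.filter_subset_filter _ h) fun _ _ _ => sq_nonneg _

/-- Greedy selection of trees with large energy. -/
lemma exists_forest (A : Tile → ℝ) (b : ℝ) (𝒬 : Finset Tile) (hs : Sparse 𝒬) :
    ∃ (𝒬' 𝒯 : Finset Tile) (tr : Tile → Finset Tile), 𝒬' ⊆ 𝒬 ∧ 𝒯 ⊆ 𝒬 ∧ (∀ T ∈ 𝒯, tr T ⊆ 𝒬) ∧ Forest 𝒯 tr ∧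
      (∀ T ∈ 𝒯, b * 4 ^ T.i < ∑ P ∈ tr T, A P ^ 2) ∧ (∀ T ∈ 𝒬', energy A 𝒬' T ≤ b * 4 ^ T.i) ∧
      ∀ P ∈ 𝒬, P ∉ 𝒬' → ∃ T ∈ 𝒯, P.Le T := by
  classical
  induction 𝒬 using Finset.strongInduction with
  | H 𝒬 ih =>
    rcases (𝒬.filter fun T => b * 4 ^ T.i < energy A 𝒬 T).eq_empty_or_nonempty with h0 | h0
    · refine ⟨𝒬, ∅, fun _ => ∅, subset_rfl, by simp, by simp, ⟨by simp, by simp, by simp, by simp⟩, by simp, fun T hT => ?_,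
        fun P hP hn => absurd hP hn⟩
      by_contra hc
      have : T ∈ 𝒬.filter fun T => b * 4 ^ T.i < energy A 𝒬 T := Finset.mem_filter.2 ⟨hT, not_le.1 hc⟩
      rw [h0] at this
      exact Finset.notMem_empty _ this
    · obtain ⟨T, hT, hmin⟩ := Finset.exists_min_image _ Tile.mid h0
      obtain ⟨hTP, hTb⟩ := Finset.mem_filter.1 hT
      set 𝒬1 := 𝒬.filter fun P => ¬ P.Le T with h𝒬1
      have hsub : 𝒬1 ⊆ 𝒬 := Finset.filter_subset _ _
      have hlt : 𝒬1 ⊂ 𝒬 := Finset.filter_ssubset.2 ⟨T, hTP, not_not.2 (Tile.Le.refl T)⟩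
      obtain ⟨𝒬', 𝒯, tr, h1, h2, h3, h4, h5, h6, h7⟩ := ih 𝒬1 hlt fun P hP Q hQ => hs P (hsub hP) Q (hsub hQ)
      have hTn : T ∉ 𝒯 := fun hc => (Finset.mem_filter.1 (h2 hc)).2 (Tile.Le.refl T)
      set t0 := 𝒬.filter fun P => P.Le2 T with ht0
      have ht0m : ∀ P ∈ t0, P ∈ 𝒬 ∧ P.Le2 T := fun P hP => Finset.mem_filter.1 hP
      have hupT : Function.update tr T t0 T = t0 := Function.update_self _ _ _
      have hup : ∀ T' ∈ 𝒯, Function.update tr T t0 T' = tr T' := fun T' hT' =>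
        Function.update_of_ne (by rintro rfl; exact hTn hT') _ _
      have hall : ∀ T' ∈ insert T 𝒯, Function.update tr T t0 T' ⊆ 𝒬 := by
        intro T' hT'
        rcases Finset.mem_insert.1 hT' with rfl | hT'
        · rw [hupT]; exact Finset.filter_subset _ _
        · rw [hup T' hT']; exact (h3 T' hT').trans hsub
      have hdis : ∀ T' ∈ 𝒯, Disjoint t0 (tr T') := fun T' hT' => Finset.disjoint_left.2 fun P hP hP' =>
        (Finset.mem_filter.1 (h3 T' hT' hP')).2 (ht0m P hP).2.le
      have hmid : ∀ T' ∈ 𝒯, T.mid ≤ T'.mid := fun T' hT' => by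
        refine hmin T' (Finset.mem_filter.2 ⟨hsub (h2 hT'), (h5 T' hT').trans_le ?_⟩)
        refine Finset.sum_le_sum_of_subset_of_nonneg (fun P hP => ?_) fun _ _ _ => sq_nonneg _
        exact Finset.mem_filter.2 ⟨hsub (h3 T' hT' hP), h4.le2 T' hT' P hP⟩
      refine ⟨𝒬', insert T 𝒯, Function.update tr T t0, h1.trans hsub, Finset.insert_subset hTP (h2.trans hsub), hall,
        ⟨?_, ?_, ?_, ?_⟩, ?_, h6, ?_⟩
      · intro T' hT' P hP
        rcases Finset.mem_insert.1 hT' with rfl | hT'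
        · rw [hupT] at hP; exact (ht0m P hP).2
        · rw [hup T' hT'] at hP; exact h4.le2 T' hT' P hP
      · intro T' hT' T'' hT'' P hP Q hQ
        exact hs P (hall T' hT' hP) Q (hall T'' hT'' hQ)
      · intro T' hT' T'' hT'' hne
        rcases Finset.mem_insert.1 hT' with rfl | hU' <;> rcases Finset.mem_insert.1 hT'' with rfl | hU''
        · exact absurd rfl hne
        · rw [hupT, hup T'' hU'']; exact hdis T'' hU''
        · rw [hupT, hup T' hU']; exact (hdis T' hU').symm
        · rw [hup T' hU', hup T'' hU'']; exact h4.disj T' hU' T'' hU'' hne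
      · intro T' hT' T'' hT'' hne P hP Q hQ hi hom
        rcases Finset.mem_insert.1 hT' with rfl | hU' <;> rcases Finset.mem_insert.1 hT'' with rfl | hU''
        · exact absurd rfl hne
        · rw [hupT] at hP
          rw [hup T'' hU''] at hQ
          have hPT := (ht0m P hP).2.le
          have hQn := (Finset.mem_filter.1 (h3 T'' hU'' hQ)).2
          refine Set.disjoint_left.2 fun y hy hy' => hQn ?_
          have hi' : Q.i ≤ T'.i := hi.le.trans hPT.1
          obtain ⟨x, hx⟩ := om_nonempty T'.i T'.m
          exact Tile.le_of_mem hi' hy hy' (Q.low_subset_om (hom (hPT.2.2 hx))) hx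
        · exfalso
          rw [hupT] at hQ
          rw [hup T' hU'] at hP
          have a1 : Q.mid ≤ T''.mid := (ht0m Q hQ).2.mid_le
          have a2 := hmid T' hU'
          have a3 := (h4.le2 T' hU' P hP).le.2.2 T'.mid_mem_om
          have a4 := Tile.lt_mid_of_mem_low (hom a3)
          linarith
        · rw [hup T' hU'] at hP
          rw [hup T'' hU''] at hQ
          exact h4.strong T' hU' T'' hU'' hne P hP Q hQ hi hom
      · intro T' hT'
        rcases Finset.mem_insert.1 hT' with rfl | hT'
        · rw [hupT]; exact hTb
        · rw [hup T' hT']; exact h5 T' hT'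
      · intro P hP hn
        by_cases hPT : P.Le T
        · exact ⟨T, Finset.mem_insert_self _ _, hPT⟩
        · obtain ⟨T', hT', hle⟩ := h7 P (Finset.mem_filter.2 ⟨hP, hPT⟩) hn
          exact ⟨T', Finset.mem_insert_of_mem hT', hle⟩

lemma norm_le_of_energy {A : Tile → ℝ} (hA : ∀ P, 0 ≤ A P) {𝒬 : Finset Tile} {σ : ℝ} (hσ : 0 ≤ σ) {P : Tile} (hP : P ∈ 𝒬)
    (h : energy A 𝒬 P ≤ σ ^ 2 * 4 ^ P.i) : A P ≤ σ * 2 ^ P.i := by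
  classical
  have h1 : A P ^ 2 ≤ energy A 𝒬 P :=
    Finset.single_le_sum (f := fun P => A P ^ 2) (fun _ _ => sq_nonneg _) (Finset.mem_filter.2 ⟨hP, Or.inl rfl⟩)
  have h2 : A P ^ 2 ≤ (σ * 2 ^ P.i) ^ 2 := by
    refine (h1.trans h).trans_eq ?_
    rw [mul_pow, ← pow_mul, mul_comm P.i 2, pow_mul]; norm_num
  exact (pow_le_pow_iff_left₀ (hA P) (by positivity) (by norm_num)).1 h2

/-- Splitting off the tiles of large energy. -/
lemma energy_lemma {C0 : ℝ} {v : Tile → L2Z} (hv : Packets C0 v) (hC : 0 ≤ C0) (f : L2Z) {σ : ℝ} (hσ : 0 < σ) (𝒬 : Finset Tile)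
    (hs : Sparse 𝒬) (he : ∀ T ∈ 𝒬, energy (fun P => ‖inner ℂ (v P) f‖) 𝒬 T ≤ σ ^ 2 * 4 ^ T.i) :
    ∃ 𝒬' 𝒯 : Finset Tile, 𝒬' ⊆ 𝒬 ∧ 𝒯 ⊆ 𝒬 ∧
      (∀ T ∈ 𝒬', energy (fun P => ‖inner ℂ (v P) f‖) 𝒬' T ≤ (σ / 2) ^ 2 * 4 ^ T.i) ∧
      (∀ P ∈ 𝒬, P ∉ 𝒬' → ∃ T ∈ 𝒯, P.Le T) ∧
      σ ^ 2 * ∑ T ∈ 𝒯, (4:ℝ) ^ T.i ≤ 2 ^ 25 * C0 ^ 2 * ‖f‖ ^ 2 := by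
  obtain ⟨𝒬', 𝒯, tr, h1, h2, h3, h4, h5, h6, h7⟩ := exists_forest (fun P => ‖inner ℂ (v P) f‖) ((σ / 2) ^ 2) 𝒬 hs
  refine ⟨𝒬', 𝒯, h1, h2, h6, h7, ?_⟩
  have hlb : ∀ T ∈ 𝒯, σ ^ 2 * 4 ^ T.i ≤ 4 * ∑ P ∈ tr T, ‖inner ℂ (v P) f‖ ^ 2 := fun T hT => by
    have := (h5 T hT).le
    linarith
  have := h4.bessel hv hC f hσ.le (fun T hT P hP =>
    norm_le_of_energy (A := fun P => ‖inner ℂ (v P) f‖) (fun _ => norm_nonneg _) hσ.le (h3 T hT hP) (he P (h3 T hT hP))) hlb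
  calc σ ^ 2 * ∑ T ∈ 𝒯, (4:ℝ) ^ T.i ≤ 4 * ∑ T ∈ 𝒯, ∑ P ∈ tr T, ‖inner ℂ (v P) f‖ ^ 2 := by
        rw [Finset.mul_sum, Finset.mul_sum]; exact Finset.sum_le_sum hlb
    _ ≤ _ := by linarith

/-- The element of `ℓ²(ℤ)` that agrees with `g` on `Z` and vanishes elsewhere. -/
noncomputable def fin2 (Z : Finset ℤ) (g : ℤ → ℂ) : L2Z := ∑ y ∈ Z, lp.single 2 y (g y)

lemma inner_fin2 (Z : Finset ℤ) (g : ℤ → ℂ) (v : L2Z) : inner ℂ v (fin2 Z g) = ∑ y ∈ Z, g y * (starRingEnd ℂ) (v y) := by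
  unfold fin2
  rw [inner_sum]
  refine Finset.sum_congr rfl fun y _ => ?_
  rw [lp.inner_single_right]; rfl

lemma norm_fin2_sq (Z : Finset ℤ) (g : ℤ → ℂ) : ‖fin2 Z g‖ ^ 2 = ∑ y ∈ Z, ‖g y‖ ^ 2 := by
  have := lp.norm_sum_single (p := 2) (E := fun _ : ℤ => ℂ) (by norm_num) g Z
  simpa [fin2] using this

lemma mem_tri_div {n : ℕ} {y z : ℤ} : z ∈ tri n (y / 4 ^ n) ↔ y / 4 ^ n - 1 ≤ z / 4 ^ n ∧ z / 4 ^ n ≤ y / 4 ^ n + 1 := by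
  rw [mem_tri, Int.le_ediv_iff_mul_le (by positivity), ← Int.lt_add_one_iff (a := z / 4 ^ n), Int.ediv_lt_iff_lt_mul (by positivity), add_assoc]
  rfl

lemma mem_tri_symm {n : ℕ} {y z : ℤ} : z ∈ tri n (y / 4 ^ n) ↔ y ∈ tri n (z / 4 ^ n) := by
  rw [mem_tri_div, mem_tri_div]; omega

section
variable (S : Finset Tile) (T : Tile)

/-- The interval attached to `lev`. -/
noncomputable def levIv (y : ℤ) : Finset ℤ := Finset.Ico (y / 4 ^ (lev S T y - 1) * 4 ^ (lev S T y - 1))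
    ((y / 4 ^ (lev S T y - 1) + 1) * 4 ^ (lev S T y - 1))

/-- Averages over the intervals attached to `lev`. -/
noncomputable def levAvg (h : ℤ → ℂ) (y : ℤ) : ℂ := (4 ^ (lev S T y - 1) : ℂ)⁻¹ * ∑ z ∈ levIv S T y, h z

variable {S T} {y z : ℤ}

lemma mem_levIv : z ∈ levIv S T y ↔ z / 4 ^ (lev S T y - 1) = y / 4 ^ (lev S T y - 1) := by
  rw [levIv, Finset.mem_Ico, ← mem_iv_iff, mem_iv]

lemma lev_of_mem (h : z ∈ levIv S T y) : lev S T z = lev S T y := lev_eq (mem_levIv.1 h)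

lemma card_levIv : ((levIv S T y).card : ℝ) = 4 ^ (lev S T y - 1) := card_ivF _ _

lemma mem_levIv_symm : z ∈ levIv S T y ↔ y ∈ levIv S T z := by
  have : ∀ y z, z ∈ levIv S T y → y ∈ levIv S T z := by
    intro y z h
    rw [mem_levIv, lev_of_mem h]; exact (mem_levIv.1 h).symm
  exact ⟨this y z, this z y⟩

lemma sum_mul_levAvg (Z : Finset ℤ) (hZ : ∀ y ∈ Z, levIv S T y ⊆ Z) (F h : ℤ → ℂ) :
    ∑ y ∈ Z, F y * levAvg S T h y = ∑ y ∈ Z, levAvg S T F y * h y := by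
  classical
  have e : ∀ y ∈ Z, ∀ G : ℤ → ℂ, ∑ z ∈ levIv S T y, G z = ∑ z ∈ Z, if z ∈ levIv S T y then G z else 0 := by
    intro y hy G
    rw [← Finset.sum_filter]
    refine Finset.sum_congr ?_ fun _ _ => rfl
    ext z; simp only [Finset.mem_filter]
    exact ⟨fun h => ⟨hZ y hy h, h⟩, fun h => h.2⟩
  calc ∑ y ∈ Z, F y * levAvg S T h y
      = ∑ y ∈ Z, ∑ z ∈ Z, if z ∈ levIv S T y then (4 ^ (lev S T y - 1) : ℂ)⁻¹ * F y * h z else 0 := by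
        refine Finset.sum_congr rfl fun y hy => ?_
        rw [levAvg, Finset.mul_sum, Finset.mul_sum, e y hy]
        refine Finset.sum_congr rfl fun z _ => ?_
        split_ifs <;> ring
    _ = ∑ z ∈ Z, ∑ y ∈ Z, if y ∈ levIv S T z then (4 ^ (lev S T z - 1) : ℂ)⁻¹ * F y * h z else 0 := by
        rw [Finset.sum_comm]
        refine Finset.sum_congr rfl fun z _ => Finset.sum_congr rfl fun y _ => ?_
        by_cases hm : z ∈ levIv S T y
        · rw [if_pos hm, if_pos (mem_levIv_symm.1 hm), lev_of_mem hm]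
        · rw [if_neg hm, if_neg fun hc => hm (mem_levIv_symm.1 hc)]
    _ = _ := by
        refine Finset.sum_congr rfl fun y hy => ?_
        rw [levAvg, mul_assoc, Finset.sum_mul, Finset.mul_sum, e y hy]
        refine Finset.sum_congr rfl fun z _ => ?_
        split_ifs <;> ring

lemma norm_levAvg_le (h : ℤ → ℂ) (B : ℝ) (hB : ∑ z ∈ levIv S T y, ‖h z‖ ≤ B * 4 ^ (lev S T y - 1)) :
    ‖levAvg S T h y‖ ≤ B := by
  rw [levAvg, norm_mul, norm_inv, norm_pow, Complex.norm_ofNat, inv_mul_le_iff₀ (by positivity), mul_comm]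
  exact (norm_sum_le _ _).trans hB

lemma norm_sub_levAvg_le (h : ℤ → ℂ) (B : ℝ) (hB : ∀ z ∈ levIv S T y, ‖h y - h z‖ ≤ B) :
    ‖h y - levAvg S T h y‖ ≤ B := by
  have : h y - levAvg S T h y = levAvg S T (fun z => h y - h z) y := by
    have hc : ((levIv S T y).card : ℂ) = 4 ^ (lev S T y - 1) := by exact_mod_cast (card_levIv (S := S) (T := T) (y := y))
    unfold levAvg
    rw [Finset.sum_sub_distrib, Finset.sum_const, nsmul_eq_mul, mul_sub, hc, inv_mul_cancel_left₀ (by simp)]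
  rw [this]
  refine norm_levAvg_le _ _ ?_
  calc ∑ z ∈ levIv S T y, ‖h y - h z‖ ≤ ∑ z ∈ levIv S T y, B := Finset.sum_le_sum hB
    _ = _ := by rw [Finset.sum_const, nsmul_eq_mul, card_levIv, mul_comm]

/-- The points that see the tree at a scale at most that of the top. -/
noncomputable def nearTop (S : Finset Tile) (T : Tile) : Finset ℤ :=
  open Classical in (tri T.i T.k).filter fun y => lev S T y ≤ T.i

lemma mem_nearTop (hS : ∀ P ∈ S, P.Le T) : y ∈ nearTop S T ↔ lev S T y ≤ T.i := by
  classical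
  unfold nearTop
  rw [Finset.mem_filter]
  refine ⟨fun h => h.2, fun h => ⟨?_, h⟩⟩
  have hn : Near S T T.i y := near_lev.mono h
  rcases hn with hn | ⟨P, hP, hn⟩
  · omega
  · have h1 := hn P.corner_mem
    have h2 : P.k * 4 ^ P.i / 4 ^ T.i = T.k := (hS P hP).2.1 P.corner_mem
    rw [Finset.mem_coe, mem_tri_symm, h2] at h1
    exact h1

lemma levIv_subset_nearTop (hS : ∀ P ∈ S, P.Le T) (hy : y ∈ nearTop S T) : levIv S T y ⊆ nearTop S T := by
  intro z hz
  rw [mem_nearTop hS] at *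
  rw [lev_of_mem hz]; exact hy

lemma sum_levIv_le (hS : ∀ P ∈ S, P.Le T) (u : ℤ → ℝ) (hu : ∀ z, 0 ≤ u z) {A : ℝ}
    (hA : ∀ P ∈ S, ∀ n, P.i ≤ n → ∑ z ∈ tri n (P.k * 4 ^ P.i / 4 ^ n), u z ≤ A * 4 ^ n) (hy : y ∈ nearTop S T) :
    ∑ z ∈ levIv S T y, u z ≤ 4 * A * 4 ^ (lev S T y - 1) := by
  rw [mem_nearTop hS] at hy
  rcases near_lev (S := S) (T := T) (y := y) with hn | ⟨P, hP, hn⟩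
  · omega
  set n := lev S T y with hnd
  have hA0 : 0 ≤ A := by
    have := (Finset.sum_nonneg fun z _ => hu z).trans (hA P hP P.i le_rfl)
    exact nonneg_of_mul_nonneg_left this (by positivity)
  have hi : P.i ≤ n := by
    by_contra hlt
    push Not at hlt
    have h1 := Finset.card_le_card (show Finset.Ico (P.k * 4 ^ P.i) ((P.k + 1) * 4 ^ P.i) ⊆ tri n (y / 4 ^ n) from
      fun z hz => hn (mem_iv_iff.2 (Finset.mem_Ico.1 hz)))
    have h2 := card_ivF P.i P.k
    have h3 := card_tri n (y / 4 ^ n)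
    have h4 : (4:ℝ) ^ P.i ≤ 3 * 4 ^ n := by rw [← h2, ← h3]; exact_mod_cast h1
    have h5 : (4:ℝ) ^ (n + 1) ≤ 4 ^ P.i := pow_le_pow_right₀ (by norm_num) hlt
    have h6 : (0:ℝ) < 4 ^ n := by positivity
    rw [pow_succ] at h5
    linarith
  have hsub : levIv S T y ⊆ tri n (P.k * 4 ^ P.i / 4 ^ n) := by
    intro z hz
    have h1 := hn P.corner_mem
    rw [Finset.mem_coe, mem_tri_symm] at h1
    exact iv_subset_tri_of_mem h1 (mem_iv.2 (div_eq_of_div_eq (by omega) (mem_levIv.1 hz)))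
  calc ∑ z ∈ levIv S T y, u z ≤ A * 4 ^ n :=
        (Finset.sum_le_sum_of_subset_of_nonneg hsub fun z _ _ => hu z).trans (hA P hP n hi)
    _ ≤ A * (4 * 4 ^ (n - 1)) := by
        gcongr
        rw [← pow_succ']
        exact pow_le_pow_right₀ (by norm_num) (by omega)
    _ = _ := by ring

/-- On the interval attached to `y`, the weight of a tile of the tree is comparable to its value at `y`. -/
lemma wt_le_of_mem_levIv {P : Tile} (hP : P ∈ S) (hz : z ∈ levIv S T y) {x : ℝ} (hx : x ∈ Set.uIcc (y:ℝ) z) :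
    wt ((x - P.k * 4 ^ P.i) / 4 ^ P.i) ≤ 3 * P.w y := by
  set e := lev S T y - 1 with he
  have h4 : (0:ℝ) < 4 ^ P.i := by positivity
  have hyz : |(z:ℝ) - y| ≤ 4 ^ e := by
    have a1 := div_bounds e y
    have a2 := div_bounds e z
    rw [mem_levIv.1 hz] at a2
    have : |z - y| ≤ 4 ^ e := by rw [abs_le]; constructor <;> linarith
    exact_mod_cast this
  have hsum : |x - y| + |x - z| = |(z:ℝ) - y| := by
    rcases le_total (y:ℝ) z with h | h
    · rw [Set.uIcc_of_le h] at hx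
      rw [abs_of_nonneg (by linarith [hx.1]), abs_of_nonpos (by linarith [hx.2]), abs_of_nonneg (by linarith)]; ring
    · rw [Set.uIcc_of_ge h] at hx
      rw [abs_of_nonpos (by linarith [hx.2]), abs_of_nonneg (by linarith [hx.1]), abs_of_nonpos (by linarith)]; ring
  set c : ℝ := P.k * 4 ^ P.i with hc
  have key : |(y:ℝ) - c| ≤ 3 * |x - c| + 2 * 4 ^ P.i := by
    have t1 : |(y:ℝ) - c| ≤ |x - y| + |x - c| := by
      rw [show (y:ℝ) - c = -(x - y) + (x - c) by ring]
      exact (abs_add_le _ _).trans_eq (by rw [abs_neg])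
    have t2 : |(z:ℝ) - c| ≤ |x - z| + |x - c| := by
      rw [show (z:ℝ) - c = -(x - z) + (x - c) by ring]
      exact (abs_add_le _ _).trans_eq (by rw [abs_neg])
    have t3 := abs_nonneg (x - z)
    have t4 := abs_nonneg (x - y)
    have t5 := abs_nonneg (x - c)
    by_cases h : P.i < lev S T y
    · have d1 : (4:ℝ) ^ e ≤ |(y:ℝ) - c| := dist_le_of_lt_lev hP h
      have d2 : (4:ℝ) ^ e ≤ |(z:ℝ) - c| := by
        have := dist_le_of_lt_lev (y := z) hP (by rw [lev_of_mem hz]; exact h)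
        rwa [lev_of_mem hz] at this
      linarith
    · have : (4:ℝ) ^ e ≤ 4 ^ P.i := pow_le_pow_right₀ (by norm_num) (by omega)
      linarith
  unfold Tile.w wt
  rw [← hc, abs_div, abs_div, abs_of_pos h4, ← div_eq_mul_inv, inv_eq_one_div, div_le_div_iff₀ (by positivity) (by positivity)]
  have : |(y:ℝ) - c| / 4 ^ P.i ≤ 3 * (|x - c| / 4 ^ P.i) + 2 := by
    rw [div_le_iff₀ h4, add_mul, mul_assoc, div_mul_cancel₀ _ h4.ne']; exact key
  linarith
end

section
variable {S : Finset Tile} {T : Tile}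

lemma eq_of_le_of_corner (hS : ∀ P ∈ S, P.Le T) : ∀ P ∈ S, ∀ Q ∈ S, P.i = Q.i → P.k = Q.k → P = Q := by
  intro P hP Q hQ hi hk
  obtain ⟨x, hx⟩ := om_nonempty T.i T.m
  have h1 := (hS P hP).2.2 hx
  have h2 := (hS Q hQ).2.2 hx
  unfold Tile.om at h1 h2
  rw [hi] at h1
  have := om_eq_of_mem h1 h2
  cases P; cases Q; simp_all

lemma sum_len_mul_le (hS : ∀ P ∈ S, P.Le T) : ∑ P ∈ S, (4:ℝ) ^ P.i / 4 ^ T.i * 4 ^ P.i ≤ 2 * 4 ^ T.i := by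
  classical
  have hmaps : ∀ P ∈ S, P.i ∈ Finset.range (T.i + 1) := fun P hP => by
    have := (hS P hP).1
    simp; omega
  rw [← Finset.sum_fiberwise_of_maps_to hmaps]
  calc ∑ i ∈ Finset.range (T.i + 1), ∑ P ∈ S with P.i = i, (4:ℝ) ^ P.i / 4 ^ T.i * 4 ^ P.i
      ≤ ∑ i ∈ Finset.range (T.i + 1), (4:ℝ) ^ i / 4 ^ T.i * 4 ^ T.i := by
        refine Finset.sum_le_sum fun i _ => ?_
        have hlen : ∑ P ∈ S with P.i = i, (4:ℝ) ^ P.i ≤ 4 ^ T.i := by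
          rw [← card_ivF T.i T.k]
          refine sum_len_le_card _ (fun P hP Q hQ hne => ?_) fun P hP y hy => ?_
          · obtain ⟨hP, hPi⟩ := Finset.mem_filter.1 hP
            obtain ⟨hQ, hQi⟩ := Finset.mem_filter.1 hQ
            rw [Set.disjoint_left]
            intro y hy hy'
            unfold Tile.iv at hy hy'
            rw [hPi] at hy; rw [hQi] at hy'
            exact hne (eq_of_le_of_corner hS P hP Q hQ (hPi.trans hQi.symm) (iv_eq_of_mem hy hy'))
          · have := mem_iv_iff.1 ((hS P (Finset.mem_filter.1 hP).1).2.1 hy)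
            simpa using this
        calc ∑ P ∈ S with P.i = i, (4:ℝ) ^ P.i / 4 ^ T.i * 4 ^ P.i
            = ∑ P ∈ S with P.i = i, (4:ℝ) ^ i / 4 ^ T.i * 4 ^ P.i :=
              Finset.sum_congr rfl fun P hP => by rw [(Finset.mem_filter.1 hP).2]
          _ ≤ _ := by rw [← Finset.mul_sum]; gcongr
    _ ≤ _ := by rw [← Finset.sum_mul]; gcongr; exact sum_four_pow_le _

/-- Decay in the difference of scales. -/
noncomputable def sgap (a b : ℕ) : ℝ := if a ≤ b then 4 ^ a / 4 ^ b else 4 ^ b / 4 ^ a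

lemma sgap_nonneg (a b : ℕ) : 0 ≤ sgap a b := by unfold sgap; split_ifs <;> positivity

lemma sgap_le_one (a b : ℕ) : sgap a b ≤ 1 := by
  unfold sgap
  split_ifs with h
  · exact div_le_one_of_le₀ (pow_le_pow_right₀ (by norm_num) h) (by positivity)
  · exact div_le_one_of_le₀ (pow_le_pow_right₀ (by norm_num) (by omega)) (by positivity)

lemma sum_sgap_le (a n : ℕ) : ∑ b ∈ Finset.range n, sgap a b ≤ 4 := by
  have hlow : ∑ b ∈ Finset.range n with ¬ a ≤ b, sgap a b ≤ 2 := by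
    calc ∑ b ∈ Finset.range n with ¬ a ≤ b, sgap a b = ∑ b ∈ Finset.range n with ¬ a ≤ b, (4:ℝ) ^ b / 4 ^ a :=
          Finset.sum_congr rfl fun b hb => if_neg (Finset.mem_filter.1 hb).2
      _ ≤ ∑ b ∈ Finset.range (a + 1), (4:ℝ) ^ b / 4 ^ a := by
          refine Finset.sum_le_sum_of_subset_of_nonneg (fun b hb => ?_) fun _ _ _ => by positivity
          have := (Finset.mem_filter.1 hb).2
          simp; omega
      _ ≤ 2 := sum_four_pow_le a
  have hhigh : ∑ b ∈ Finset.range n with a ≤ b, sgap a b ≤ 2 := by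
    calc ∑ b ∈ Finset.range n with a ≤ b, sgap a b ≤ ∑ b ∈ Finset.range n with a ≤ b, ((1:ℝ) / 2) ^ (b - a) := by
          refine Finset.sum_le_sum fun b hb => ?_
          have hab := (Finset.mem_filter.1 hb).2
          rw [sgap, if_pos hab, div_le_iff₀ (by positivity)]
          obtain ⟨c, rfl⟩ := Nat.exists_eq_add_of_le hab
          rw [Nat.add_sub_cancel_left, pow_add, mul_left_comm, ← mul_pow]
          have : (1:ℝ) ≤ (1 / 2 * 4) ^ c := one_le_pow₀ (by norm_num)
          have : (0:ℝ) < 4 ^ a := by positivity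
          nlinarith
      _ = ∑ c ∈ (Finset.range n |>.filter fun b => a ≤ b).image (fun b => b - a), ((1:ℝ) / 2) ^ c := by
          rw [Finset.sum_image]
          intro b hb b' hb' h
          have h1 := (Finset.mem_filter.1 hb).2
          have h2 := (Finset.mem_filter.1 hb').2
          simp only at h
          omega
      _ ≤ ∑ c ∈ Finset.range n, ((1:ℝ) / 2) ^ c := by
          refine Finset.sum_le_sum_of_subset_of_nonneg (fun c hc => ?_) fun _ _ _ => by positivity
          obtain ⟨b, hb, rfl⟩ := Finset.mem_image.1 hc
          have := (Finset.mem_filter.1 hb).1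
          simp at this ⊢; omega
      _ ≤ 2 := sum_half_pow_le n
  have := Finset.sum_filter_add_sum_filter_not (Finset.range n) (fun b => a ≤ b) (fun b => sgap a b)
  linarith

lemma scale_mul_w_le {P : Tile} (hP : P ∈ S) (y : ℤ) :
    4 ^ (lev S T y - 1) / 4 ^ P.i * P.w y ^ 10 ≤ sgap (lev S T y - 1) P.i * P.w y ^ 2 := by
  set e := lev S T y - 1 with he
  have hw := P.w_nonneg y
  by_cases h : e ≤ P.i
  · rw [sgap, if_pos h]
    refine mul_le_mul_of_nonneg_left ?_ (by positivity)
    exact wt_pow_le (by norm_num : 2 ≤ 10) _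
  · rw [sgap, if_neg h]
    have h1 : P.w y ≤ 4 ^ P.i / 4 ^ e := w_le_of_lt_lev hP (by omega)
    have h2 : P.w y ^ 10 ≤ (4 ^ P.i / 4 ^ e) ^ 2 * P.w y ^ 2 := by
      calc P.w y ^ 10 ≤ P.w y ^ 4 := wt_pow_le (by norm_num : 4 ≤ 10) _
        _ = P.w y ^ 2 * P.w y ^ 2 := by ring
        _ ≤ _ := by gcongr
    calc (4:ℝ) ^ e / 4 ^ P.i * P.w y ^ 10 ≤ 4 ^ e / 4 ^ P.i * ((4 ^ P.i / 4 ^ e) ^ 2 * P.w y ^ 2) := by gcongr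
      _ = _ := by field_simp

/-- The sum over a tree of squares of pairings that are controlled by a smooth average. -/
lemma sum_sq_smooth_le (hS : ∀ P ∈ S, P.Le T) (hne : S.Nonempty) (u : ℤ → ℝ) (hu : ∀ z, 0 ≤ u z) {A : ℝ}
    (hA : ∀ P ∈ S, ∀ n, P.i ≤ n → ∑ z ∈ tri n (P.k * 4 ^ P.i / 4 ^ n), u z ≤ A * 4 ^ n) :
    ∑ P ∈ S, ((2 ^ P.i)⁻¹ * ∑ y ∈ nearTop S T, u y * (sgap (lev S T y - 1) P.i * P.w y ^ 2)) ^ 2 ≤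
      1024 * A ^ 2 * 4 ^ T.i := by
  classical
  obtain ⟨P0, hP0⟩ := hne
  have hA0 : 0 ≤ A := by
    have := (Finset.sum_nonneg fun z _ => hu z).trans (hA P0 hP0 P0.i le_rfl)
    exact nonneg_of_mul_nonneg_left this (by positivity)
  set β : Tile → ℝ := fun P => ∑ y ∈ nearTop S T, u y * (sgap (lev S T y - 1) P.i * P.w y ^ 2) with hβ
  have hnn : ∀ (P : Tile) y, 0 ≤ u y * (sgap (lev S T y - 1) P.i * P.w y ^ 2) := fun P y =>
    mul_nonneg (hu y) (mul_nonneg (sgap_nonneg _ _) (sq_nonneg _))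
  have hβ0 : ∀ P, 0 ≤ β P := fun P => Finset.sum_nonneg fun y _ => hnn P y
  have hβ1 : ∀ P ∈ S, β P ≤ 32 * A * 4 ^ P.i := by
    intro P hP
    have := kernel_le u hu P.i (P.k * 4 ^ P.i) A (fun n hn => hA P hP n hn) (nearTop S T)
    rw [mul_assoc]
    refine le_trans (Finset.sum_le_sum fun y _ => ?_) this
    refine mul_le_mul_of_nonneg_left ?_ (hu y)
    have e : wt ((((P.k * 4 ^ P.i : ℤ) : ℝ) - y) / 4 ^ P.i) = P.w y := by
      unfold Tile.w
      rw [← wt_neg]; push_cast; congr 1; ring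
    rw [e]
    exact mul_le_of_le_one_left (sq_nonneg _) (sgap_le_one _ _)
  have hmaps : ∀ P ∈ S, P.i ∈ Finset.range (T.i + 1) := fun P hP => by
    have := (hS P hP).1
    simp; omega
  have hpt : ∀ y, ∑ P ∈ S, sgap (lev S T y - 1) P.i * P.w y ^ 2 ≤ 32 := by
    intro y
    rw [← Finset.sum_fiberwise_of_maps_to hmaps]
    calc ∑ i ∈ Finset.range (T.i + 1), ∑ P ∈ S with P.i = i, sgap (lev S T y - 1) P.i * P.w y ^ 2
        ≤ ∑ i ∈ Finset.range (T.i + 1), sgap (lev S T y - 1) i * 8 := by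
          refine Finset.sum_le_sum fun i _ => ?_
          have := Tile.sum_scale_w_le_of_inj (S.filter fun P => P.i = i) i (fun P hP => (Finset.mem_filter.1 hP).2)
            (fun P hP Q hQ hk => eq_of_le_of_corner hS P (Finset.mem_filter.1 hP).1 Q (Finset.mem_filter.1 hQ).1
              ((Finset.mem_filter.1 hP).2.trans (Finset.mem_filter.1 hQ).2.symm) hk) y (n := 2) le_rfl
          calc ∑ P ∈ S with P.i = i, sgap (lev S T y - 1) P.i * P.w y ^ 2
              = sgap (lev S T y - 1) i * ∑ P ∈ S with P.i = i, P.w y ^ 2 := by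
                rw [Finset.mul_sum]
                exact Finset.sum_congr rfl fun P hP => by rw [(Finset.mem_filter.1 hP).2]
            _ ≤ _ := mul_le_mul_of_nonneg_left this (sgap_nonneg _ _)
      _ ≤ 4 * 8 := by rw [← Finset.sum_mul]; gcongr; exact sum_sgap_le _ _
      _ = 32 := by norm_num
  have hu1 : ∑ y ∈ nearTop S T, u y ≤ A * 4 ^ T.i := by
    have h := hA P0 hP0 T.i (hS P0 hP0).1
    have h2 : P0.k * 4 ^ P0.i / 4 ^ T.i = T.k := (hS P0 hP0).2.1 P0.corner_mem
    rw [h2] at h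
    exact (Finset.sum_le_sum_of_subset_of_nonneg (Finset.filter_subset _ _) fun z _ _ => hu z).trans h
  calc ∑ P ∈ S, ((2 ^ P.i)⁻¹ * β P) ^ 2 ≤ ∑ P ∈ S, 32 * A * β P := by
        refine Finset.sum_le_sum fun P hP => ?_
        have h4 : (4:ℝ) ^ P.i = 2 ^ P.i * 2 ^ P.i := by rw [← mul_pow]; norm_num
        calc ((2 ^ P.i)⁻¹ * β P) ^ 2 = (4 ^ P.i)⁻¹ * β P * β P := by rw [h4, mul_inv]; ring
          _ ≤ (4 ^ P.i)⁻¹ * (32 * A * 4 ^ P.i) * β P := by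
              gcongr
              · exact hβ0 P
              · exact hβ1 P hP
          _ = _ := by field_simp
    _ = 32 * A * ∑ y ∈ nearTop S T, u y * ∑ P ∈ S, sgap (lev S T y - 1) P.i * P.w y ^ 2 := by
        rw [← Finset.mul_sum, hβ, Finset.sum_comm]
        simp only [Finset.mul_sum]
    _ ≤ 32 * A * ∑ y ∈ nearTop S T, u y * 32 := by
        gcongr with y _
        · exact hu y
        · exact hpt y
    _ = 1024 * A * ∑ y ∈ nearTop S T, u y := by rw [← Finset.sum_mul]; ring
    _ ≤ 1024 * A * (A * 4 ^ T.i) := by gcongr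
    _ = _ := by ring

/-- Square sums of the coefficients over a 2-tree are controlled by the averages of the function. -/
lemma energy_le_of_density {C0 : ℝ} {φ ψ : Tile → L2Z} (hW : WavePackets C0 φ ψ) (hS2 : ∀ P ∈ S, P.Le2 T) (hs : Sparse S)
    (hne : S.Nonempty) (f : ℤ → ℂ) (F : Finset ℤ) (hf : ∀ y ∉ F, f y = 0) {A : ℝ}
    (hA : ∀ P ∈ S, ∀ n, P.i ≤ n → ∑ z ∈ tri n (P.k * 4 ^ P.i / 4 ^ n), ‖f z‖ ≤ A * 4 ^ n) :
    ∑ P ∈ S, ‖inner ℂ (φ P) (fin2 F f)‖ ^ 2 ≤ 10 ^ 14 * C0 ^ 2 * A ^ 2 * 4 ^ T.i := by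
  classical
  have hS : ∀ P ∈ S, P.Le T := fun P hP => (hS2 P hP).le
  have hC := hW.nonneg
  obtain ⟨P0, hP0⟩ := id hne
  have hA0 : 0 ≤ A := by
    have := (Finset.sum_nonneg fun z _ => norm_nonneg (f z)).trans (hA P0 hP0 P0.i le_rfl)
    exact nonneg_of_mul_nonneg_left this (by positivity)
  set ξ := T.mid with hξ
  set Z := nearTop S T with hZ
  set f' : ℤ → ℂ := fun y => f y * ee (-(ξ * y)) with hf'
  set g : ℤ → ℂ := fun y => levAvg S T f' y * ee (ξ * y) with hg
  set h : Tile → ℤ → ℂ := fun P y => (starRingEnd ℂ) (φ P y * ee (-(ξ * y))) with hh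
  have hnf' : ∀ y, ‖f' y‖ = ‖f y‖ := fun y => by rw [hf']; simp only [norm_mul, norm_ee, mul_one]
  have hconj : ∀ x, (starRingEnd ℂ) (ee x) = ee (-x) := fun x => by
    unfold ee; rw [← Complex.exp_conj]; simp [Complex.conj_ofNat]
  have hfh : ∀ P y, f y * (starRingEnd ℂ) (φ P y) = f' y * h P y := by
    intro P y
    simp only [hf', hh, map_mul, hconj, neg_neg]
    linear_combination (-(f y * (starRingEnd ℂ) (φ P y))) * ee_mul_neg (ξ * y)
  have hgh : ∀ P y, levAvg S T f' y * h P y = g y * (starRingEnd ℂ) (φ P y) := by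
    intro P y
    simp only [hg, hh, map_mul, hconj, neg_neg]; ring
  set X1 : Tile → ℂ := fun P => ∑ y ∈ F.filter (fun y => y ∉ Z), f y * (starRingEnd ℂ) (φ P y) with hX1
  set X2 : Tile → ℂ := fun P => inner ℂ (φ P) (fin2 Z g) with hX2
  set X3 : Tile → ℂ := fun P => ∑ y ∈ Z, f' y * (h P y - levAvg S T (h P) y) with hX3
  have hdec : ∀ P, inner ℂ (φ P) (fin2 F f) = X1 P + X2 P + X3 P := by
    intro P
    have e1 : inner ℂ (φ P) (fin2 F f) = X1 P + ∑ y ∈ Z, f' y * h P y := by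
      rw [inner_fin2, ← Finset.sum_filter_add_sum_filter_not F (fun y => y ∉ Z)]
      congr 1
      simp only [not_not, hfh]
      refine Finset.sum_subset (fun y hy => (Finset.mem_filter.1 hy).2) fun y hy hn => ?_
      have : y ∉ F := fun hc => hn (Finset.mem_filter.2 ⟨hc, hy⟩)
      simp [hf', hf y this]
    have e2 : X2 P = ∑ y ∈ Z, f' y * levAvg S T (h P) y := by
      rw [sum_mul_levAvg Z (fun y hy => levIv_subset_nearTop hS hy), hX2]
      simp only [inner_fin2, hgh]
    rw [e1, e2, add_assoc, ← Finset.sum_add_distrib]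
    congr 1
    exact Finset.sum_congr rfl fun y _ => by ring
  have b1 : ∑ P ∈ S, ‖X1 P‖ ^ 2 ≤ 2048 * C0 ^ 2 * A ^ 2 * 4 ^ T.i := by
    calc ∑ P ∈ S, ‖X1 P‖ ^ 2 ≤ ∑ P ∈ S, 1024 * C0 ^ 2 * A ^ 2 * (4 ^ P.i / 4 ^ T.i * 4 ^ P.i) := by
          refine Finset.sum_le_sum fun P hP => ?_
          have e : ∀ y : ℤ, wt ((((P.k * 4 ^ P.i : ℤ) : ℝ) - y) / 4 ^ P.i) = P.w y := fun y => by
            unfold Tile.w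
            rw [← wt_neg]; push_cast; congr 1; ring
          have hk := kernel_le (fun y => ‖f y‖) (fun _ => norm_nonneg _) P.i (P.k * 4 ^ P.i) A
            (fun n hn => hA P hP n hn) (F.filter (fun y => y ∉ Z))
          simp only [e] at hk
          have hx : ‖X1 P‖ ≤ 32 * C0 * A * 2 ^ P.i * (4 ^ P.i / 4 ^ T.i) := by
            calc ‖X1 P‖ ≤ ∑ y ∈ F.filter (fun y => y ∉ Z), C0 * (2 ^ P.i)⁻¹ * (4 ^ P.i / 4 ^ T.i) * (‖f y‖ * P.w y ^ 2) := by
                  refine (norm_sum_le _ _).trans (Finset.sum_le_sum fun y hy => ?_)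
                  have hy2 := (Finset.mem_filter.1 hy).2
                  rw [hZ, mem_nearTop hS] at hy2
                  have hle := (hS P hP).1
                  have hl : lev S T y = T.i + 1 := le_antisymm lev_le (by omega)
                  have hw : P.w y ≤ 4 ^ P.i / 4 ^ T.i := by
                    have := w_le_of_lt_lev (y := y) hP (by rw [hl]; omega : P.i < lev S T y)
                    rwa [hl, Nat.add_sub_cancel] at this
                  have hw0 := P.w_nonneg y
                  rw [norm_mul, RCLike.norm_conj]
                  have hw3 : P.w y ^ 10 ≤ P.w y ^ 3 := wt_pow_le (by norm_num : 3 ≤ 10) _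
                  calc ‖f y‖ * ‖φ P y‖ ≤ ‖f y‖ * (C0 * (2 ^ P.i)⁻¹ * (P.w y * P.w y ^ 2)) := by
                        refine mul_le_mul_of_nonneg_left ((hW.packets_left.decay P y).trans ?_) (norm_nonneg _)
                        rw [← pow_succ']
                        exact mul_le_mul_of_nonneg_left hw3 (by positivity)
                    _ ≤ ‖f y‖ * (C0 * (2 ^ P.i)⁻¹ * ((4 ^ P.i / 4 ^ T.i) * P.w y ^ 2)) := by gcongr
                    _ = _ := by ring
              _ ≤ C0 * (2 ^ P.i)⁻¹ * (4 ^ P.i / 4 ^ T.i) * (32 * (A * 4 ^ P.i)) := by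
                  rw [← Finset.mul_sum]; gcongr
              _ = _ := by
                  rw [show (4:ℝ) ^ P.i = 2 ^ P.i * 2 ^ P.i by rw [← mul_pow]; norm_num]
                  field_simp
          calc ‖X1 P‖ ^ 2 ≤ (32 * C0 * A * 2 ^ P.i * (4 ^ P.i / 4 ^ T.i)) ^ 2 := by gcongr
            _ = 1024 * C0 ^ 2 * A ^ 2 * (4 ^ P.i / 4 ^ T.i * 4 ^ P.i) * (4 ^ P.i / 4 ^ T.i) := by
                rw [show (4:ℝ) ^ P.i = 2 ^ P.i * 2 ^ P.i by rw [← mul_pow]; norm_num]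
                ring
            _ ≤ 1024 * C0 ^ 2 * A ^ 2 * (4 ^ P.i / 4 ^ T.i * 4 ^ P.i) * 1 := by
                gcongr
                exact div_le_one_of_le₀ (pow_le_pow_right₀ (by norm_num) (hS P hP).1) (by positivity)
            _ = _ := mul_one _
      _ ≤ 1024 * C0 ^ 2 * A ^ 2 * (2 * 4 ^ T.i) := by
          rw [← Finset.mul_sum]; gcongr; exact sum_len_mul_le hS
      _ = _ := by ring
  have b2 : ∑ P ∈ S, ‖X2 P‖ ^ 2 ≤ 3072 * C0 ^ 2 * A ^ 2 * 4 ^ T.i := by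
    have h1 := hW.packets_left.bessel_lacunary hC (lacunary_of_le2 hs hS2) (fin2 Z g)
    have h2 : ‖fin2 Z g‖ ^ 2 ≤ 48 * A ^ 2 * 4 ^ T.i := by
      rw [norm_fin2_sq]
      calc ∑ y ∈ Z, ‖g y‖ ^ 2 ≤ ∑ y ∈ Z, (4 * A) ^ 2 := by
            refine Finset.sum_le_sum fun y hy => ?_
            have : ‖g y‖ ≤ 4 * A := by
              simp only [hg, norm_mul, norm_ee, mul_one]
              refine norm_levAvg_le _ _ ?_
              simp only [hnf']
              exact sum_levIv_le hS _ (fun _ => norm_nonneg _) hA hy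
            gcongr
        _ = (Z.card : ℝ) * (4 * A) ^ 2 := by rw [Finset.sum_const, nsmul_eq_mul]
        _ ≤ (3 * 4 ^ T.i) * (4 * A) ^ 2 := by
            gcongr
            rw [← card_tri T.i T.k]
            exact_mod_cast Finset.card_le_card (Finset.filter_subset _ _)
        _ = _ := by ring
    calc ∑ P ∈ S, ‖X2 P‖ ^ 2 ≤ 64 * C0 ^ 2 * (48 * A ^ 2 * 4 ^ T.i) := h1.trans (by gcongr)
      _ = _ := by ring
  have b3 : ∑ P ∈ S, ‖X3 P‖ ^ 2 ≤ (C0 * 3 ^ 10) ^ 2 * (1024 * A ^ 2 * 4 ^ T.i) := by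
    refine le_trans ?_ (mul_le_mul_of_nonneg_left (sum_sq_smooth_le hS hne (fun y => ‖f y‖) (fun _ => norm_nonneg _) hA)
      (sq_nonneg (C0 * 3 ^ 10)))
    rw [Finset.mul_sum]
    refine Finset.sum_le_sum fun P hP => ?_
    rw [← mul_pow]
    refine pow_le_pow_left₀ (norm_nonneg _) ?_ 2
    rw [← mul_assoc, Finset.mul_sum]
    refine (norm_sum_le _ _).trans (Finset.sum_le_sum fun y hy => ?_)
    rw [norm_mul, hnf']
    have hlip : ‖h P y - levAvg S T (h P) y‖ ≤ C0 * (2 ^ P.i)⁻¹ * (4 ^ (lev S T y - 1) / 4 ^ P.i) * (3 * P.w y) ^ 10 := by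
      refine norm_sub_levAvg_le _ _ fun z hz => ?_
      have hl := hW.lip P ξ ((hS P hP).2.2 T.mid_mem_om) y z (3 * P.w y) (by have := P.w_nonneg y; positivity)
        (fun x hx => wt_le_of_mem_levIv hP hz hx)
      simp only [hh]
      rw [← map_sub, RCLike.norm_conj]
      refine hl.trans ?_
      have hyz : |(y:ℝ) - z| ≤ 4 ^ (lev S T y - 1) := by
        have a1 := div_bounds (lev S T y - 1) y
        have a2 := div_bounds (lev S T y - 1) z
        rw [mem_levIv.1 hz] at a2
        have : |y - z| ≤ 4 ^ (lev S T y - 1) := by rw [abs_le]; constructor <;> linarith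
        exact_mod_cast this
      have := P.w_nonneg y
      gcongr
    calc ‖f y‖ * ‖h P y - levAvg S T (h P) y‖
        ≤ ‖f y‖ * (C0 * (2 ^ P.i)⁻¹ * (4 ^ (lev S T y - 1) / 4 ^ P.i) * (3 * P.w y) ^ 10) := by gcongr
      _ = C0 * 3 ^ 10 * (2 ^ P.i)⁻¹ * (‖f y‖ * (4 ^ (lev S T y - 1) / 4 ^ P.i * P.w y ^ 10)) := by ring
      _ ≤ C0 * 3 ^ 10 * (2 ^ P.i)⁻¹ * (‖f y‖ * (sgap (lev S T y - 1) P.i * P.w y ^ 2)) := by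
          gcongr C0 * 3 ^ 10 * (2 ^ P.i)⁻¹ * (‖f y‖ * ?_)
          exact scale_mul_w_le hP y
  calc ∑ P ∈ S, ‖inner ℂ (φ P) (fin2 F f)‖ ^ 2
      ≤ ∑ P ∈ S, (3 * ‖X1 P‖ ^ 2 + 3 * ‖X2 P‖ ^ 2 + 3 * ‖X3 P‖ ^ 2) := by
        refine Finset.sum_le_sum fun P _ => ?_
        rw [hdec]
        have hn := norm_add₃_le (a := X1 P) (b := X2 P) (c := X3 P)
        have h0 := norm_nonneg (X1 P + X2 P + X3 P)
        nlinarith [sq_nonneg (‖X1 P‖ - ‖X2 P‖), sq_nonneg (‖X1 P‖ - ‖X3 P‖), sq_nonneg (‖X2 P‖ - ‖X3 P‖)]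
    _ = 3 * ∑ P ∈ S, ‖X1 P‖ ^ 2 + 3 * ∑ P ∈ S, ‖X2 P‖ ^ 2 + 3 * ∑ P ∈ S, ‖X3 P‖ ^ 2 := by
        rw [Finset.sum_add_distrib, Finset.sum_add_distrib, ← Finset.mul_sum, ← Finset.mul_sum, ← Finset.mul_sum]
    _ ≤ 3 * (2048 * C0 ^ 2 * A ^ 2 * 4 ^ T.i) + 3 * (3072 * C0 ^ 2 * A ^ 2 * 4 ^ T.i) +
        3 * ((C0 * 3 ^ 10) ^ 2 * (1024 * A ^ 2 * 4 ^ T.i)) := by gcongr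
    _ ≤ _ := by
        have : 0 ≤ C0 ^ 2 * A ^ 2 * 4 ^ T.i := by positivity
        nlinarith
end

lemma Tile.Le.eq_of_i_le {P Q : Tile} (h : P.Le Q) (hi : Q.i ≤ P.i) : P = Q := by
  obtain ⟨y, hy⟩ := iv_nonempty P.i P.k
  obtain ⟨x, hx⟩ := om_nonempty Q.i Q.m
  exact h.antisymm (Tile.le_of_mem hi (h.2.1 hy) hy hx (h.2.2 hx))

lemma exists_maximal_tile (S : Finset Tile) {P : Tile} (hP : P ∈ S) :
    ∃ P' ∈ S, P.Le P' ∧ ∀ Q ∈ S, P'.Le Q → P' = Q := by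
  classical
  obtain ⟨P', hP', hmax⟩ := Finset.exists_max_image (S.filter fun Q => P.Le Q) Tile.i
    ⟨P, Finset.mem_filter.2 ⟨hP, Tile.Le.refl P⟩⟩
  obtain ⟨h1, h2⟩ := Finset.mem_filter.1 hP'
  exact ⟨P', h1, h2, fun Q hQ hle => hle.eq_of_i_le (hmax Q (Finset.mem_filter.2 ⟨hQ, h2.trans hle⟩))⟩

lemma exists_tops (S : Finset Tile) :
    ∃ S' ⊆ S, Incomparable S' ∧ ∀ P ∈ S, ∃ P' ∈ S', P.Le P' := by
  classical
  refine ⟨S.filter fun P => ∀ Q ∈ S, P.Le Q → P = Q, Finset.filter_subset _ _, fun P hP Q hQ hle =>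
    (Finset.mem_filter.1 hP).2 Q (Finset.mem_filter.1 hQ).1 hle, fun P hP => ?_⟩
  obtain ⟨P', h1, h2, h3⟩ := exists_maximal_tile S hP
  exact ⟨P', Finset.mem_filter.2 ⟨h1, h3⟩, h2⟩

lemma sum_sq_le_of_energy {A : Tile → ℝ} {b : ℝ} (hb : 0 ≤ b) {Q : Finset Tile} (hs : Sparse Q)
    (he : ∀ T ∈ Q, energy A Q T ≤ b * 4 ^ T.i) {S : Finset Tile} (hSQ : S ⊆ Q) {T : Tile}
    (hS : ∀ P ∈ S, P.Le T ∧ T.om ⊆ P.om2) : ∑ P ∈ S, A P ^ 2 ≤ b * 4 ^ T.i := by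
  classical
  obtain ⟨x, hx⟩ := om_nonempty T.i T.m
  obtain ⟨S', hS', hinc, htop⟩ := exists_tops S
  choose! p hp hple using htop
  have hxom : ∀ P ∈ S, x ∈ P.om := fun P hP => (hS P hP).1.2.2 hx
  rw [← Finset.sum_fiberwise_of_maps_to hp]
  calc ∑ j ∈ S', ∑ P ∈ S with p P = j, A P ^ 2 ≤ ∑ j ∈ S', b * 4 ^ j.i := by
        refine Finset.sum_le_sum fun j hj => le_trans ?_ (he j (hSQ (hS' hj)))
        refine Finset.sum_le_sum_of_subset_of_nonneg (fun P hP => ?_) fun _ _ _ => sq_nonneg _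
        obtain ⟨hPS, rfl⟩ := Finset.mem_filter.1 hP
        refine Finset.mem_filter.2 ⟨hSQ hPS, ?_⟩
        by_cases hi : P.i < (p P).i
        · refine Or.inr ⟨hi.le, (hple P hPS).2.1, ?_⟩
          exact Tile.om_subset_om2 (hs P (hSQ hPS) _ (hSQ (hS' hj)) hi) ((hS P hPS).2 hx) (hxom _ (hS' hj))
        · exact Or.inl ((hple P hPS).eq_of_i_le (not_lt.1 hi))
    _ ≤ b * 4 ^ T.i := by
        rw [← Finset.mul_sum]
        refine mul_le_mul_of_nonneg_left ?_ hb
        rw [← card_ivF T.i T.k]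
        refine sum_len_le_card _ (fun P hP R hR hne => hinc.disjoint_iv hP hR hne (hxom P (hS' hP)) (hxom R (hS' hR)))
          fun P hP => ?_
        intro y hy
        simpa [mem_iv_iff] using mem_iv_iff.1 ((hS P (hS' hP)).1.2.1 hy)

/-- The size of the model operator attached to a family of tiles. -/
noncomputable def form (N : ℤ → ℝ) (G : Finset ℤ) (a : Tile → ℂ) (ψ : Tile → L2Z) (Q : Finset Tile) : ℝ :=
  open Classical in ∑ y ∈ G, ‖∑ P ∈ Q with N y ∈ P.om2, a P * ψ P y‖

section form
variable {N : ℤ → ℝ} {G : Finset ℤ} {a : Tile → ℂ} {ψ : Tile → L2Z}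

lemma form_empty : form N G a ψ ∅ = 0 := by simp [form]

lemma form_le_sum_fiber {ι : Type*} [DecidableEq ι] {Q : Finset Tile} {I : Finset ι} {g : Tile → ι} (hg : ∀ P ∈ Q, g P ∈ I) :
    form N G a ψ Q ≤ ∑ t ∈ I, form N G a ψ (Q.filter fun P => g P = t) := by
  classical
  unfold form
  rw [Finset.sum_comm]
  refine Finset.sum_le_sum fun y _ => ?_
  rw [← Finset.sum_fiberwise_of_maps_to (fun P hP => hg P (Finset.mem_filter.1 hP).1)]
  refine (norm_sum_le _ _).trans (le_of_eq (Finset.sum_congr rfl fun t _ => ?_))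
  rw [Finset.filter_comm]

lemma form_filter (Q : Finset Tile) (p : Tile → Prop) [DecidablePred p]
    (hp : ∀ P ∈ Q, ¬ p P → a P = 0 ∨ ∀ y ∈ G, N y ∉ P.om2) : form N G a ψ (Q.filter p) = form N G a ψ Q := by
  classical
  unfold form
  refine Finset.sum_congr rfl fun y hy => ?_
  congr 1
  refine Finset.sum_subset (Finset.filter_subset_filter _ (Finset.filter_subset _ _)) fun P hP hn => ?_
  obtain ⟨h1, h2⟩ := Finset.mem_filter.1 hP
  have : ¬ p P := fun h => hn (Finset.mem_filter.2 ⟨Finset.mem_filter.2 ⟨h1, h⟩, h2⟩)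
  rcases hp P h1 this with h | h
  · rw [h, zero_mul]
  · exact absurd h2 (h y hy)
end form

/-- The constant of the tree estimate. -/
noncomputable def treeC (C0 : ℝ) : ℝ := C0 * (10 ^ 6 + 10 ^ 9 * C0 ^ 2)

lemma treeC_pos {C0 : ℝ} (h : 0 < C0) : 0 < treeC C0 := by unfold treeC; positivity

/-- A family of tiles of controlled mass and energy, covered by trees. -/
lemma form_le_of_cover {C0 : ℝ} {φ ψ : Tile → L2Z} (hW : WavePackets C0 φ ψ) (hC : 0 < C0) {N : ℤ → ℝ} {G : Finset ℤ}
    {a : Tile → ℂ} {Q : Finset Tile} (hs : Sparse Q) {σ δ : ℝ} (hσ : 0 < σ) (hδ : 0 ≤ δ)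
    (he : ∀ T ∈ Q, energy (fun P => ‖a P‖) Q T ≤ σ ^ 2 * 4 ^ T.i) {Ω : Set ℤ}
    (hm : ∀ P ∈ Q, ∀ P' : Tile, P.Le P' → P'.iv ⊆ Ω → mass N G P' ≤ δ) {𝒯 : Finset Tile}
    (hΩ : ∀ T ∈ 𝒯, T.iv ⊆ Ω) (hcov : ∀ P ∈ Q, ∃ T ∈ 𝒯, P.Le T) :
    form N G a ψ Q ≤ treeC C0 * δ * σ * ∑ T ∈ 𝒯, (4:ℝ) ^ T.i := by
  classical
  choose! t ht hle using hcov
  refine (form_le_sum_fiber ht).trans ?_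
  rw [Finset.mul_sum]
  refine Finset.sum_le_sum fun T hT => ?_
  set S := Q.filter fun P => t P = T with hS
  have hSQ : S ⊆ Q := Finset.filter_subset _ _
  have hST : ∀ P ∈ S, P.Le T := fun P hP => by
    obtain ⟨h1, rfl⟩ := Finset.mem_filter.1 hP
    exact hle P h1
  rcases S.eq_empty_or_nonempty with h0 | h0
  · rw [h0, form_empty]
    have := treeC_pos hC
    positivity
  · have htree : IsTree N G S T δ := ⟨hST, fun P hP R hR => hs P (hSQ hP) R (hSQ hR), fun P hP P' h1 h2 =>
      hm P (hSQ hP) P' h1 (h2.2.1.trans (hΩ T hT))⟩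
    exact htree.sum_le h0 hW hC hσ a (fun P hP => norm_le_of_energy (A := fun P => ‖a P‖) (fun _ => norm_nonneg _) hσ.le
      (hSQ hP) (he P (hSQ hP))) (sum_sq_le_of_energy (sq_nonneg σ) hs he
        (S := S.filter fun P => T.om ⊆ P.om2) ((Finset.filter_subset _ _).trans hSQ)
        fun P hP => ⟨hST P (Finset.mem_filter.1 hP).1, (Finset.mem_filter.1 hP).2⟩)

/-- Summation of a geometric iteration. -/
lemma le_of_halving {Φ : Finset Tile → ℝ} (h0 : Φ ∅ = 0) (P : ℝ → Finset Tile → Prop) {D θ ε : ℝ} (hθ : 0 < θ) (hD : 0 ≤ D)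
    (hε : 0 < ε) (hstep : ∀ δ > 0, ∀ Q, P δ Q → ∃ Q', P (δ / 2) Q' ∧ Φ Q ≤ D * δ ^ θ + Φ Q')
    (hend : ∀ δ > 0, ∀ Q, P δ Q → Q.Nonempty → ε ≤ δ) {δ : ℝ} (hδ : 0 < δ) {Q : Finset Tile} (hQ : P δ Q) :
    Φ Q ≤ D * δ ^ θ * (1 - 2 ^ (-θ))⁻¹ := by
  have h2 : (2:ℝ) ^ (-θ) < 1 := Real.rpow_lt_one_of_one_lt_of_neg (by norm_num) (by linarith)
  have hc : 0 < 1 - (2:ℝ) ^ (-θ) := by linarith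
  obtain ⟨n, hn⟩ : ∃ n : ℕ, δ < ε * 2 ^ n := by
    obtain ⟨n, hn⟩ := pow_unbounded_of_one_lt (δ / ε) (by norm_num : (1:ℝ) < 2)
    exact ⟨n, by rwa [div_lt_iff₀' hε] at hn⟩
  induction n generalizing δ Q with
  | zero =>
    rcases Q.eq_empty_or_nonempty with rfl | hne
    · rw [h0]; positivity
    · exact absurd (hend δ hδ Q hQ hne) (by simpa using hn)
  | succ n ih =>
    obtain ⟨Q', h1, h2⟩ := hstep δ hδ Q hQ
    have h3 := ih (half_pos hδ) h1 (by rw [pow_succ] at hn; linarith)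
    have h4 : (δ / 2) ^ θ = δ ^ θ * 2 ^ (-θ) := by
      rw [Real.div_rpow hδ.le (by norm_num), Real.rpow_neg (by norm_num), div_eq_mul_inv]
    rw [h4] at h3
    refine (h2.trans (add_le_add le_rfl h3)).trans (le_of_eq ?_)
    field_simp
    ring

/-- Interpolation between two bounds. -/
lemma mul_le_interp {δ σ X κ t θ : ℝ} (hδ : 0 < δ) (hσ : 0 < σ) (ht : 0 ≤ t) (hθ : 0 ≤ θ) (hθ1 : θ ≤ 1)
    (h1 : σ ^ 2 * t ≤ X) (h2 : δ * t ≤ κ) :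
    δ * σ * t ≤ X ^ θ * κ ^ (1 - θ) * σ ^ (1 - 2 * θ) * δ ^ θ := by
  have e1 : t = t ^ θ * t ^ (1 - θ) := by
    rcases ht.eq_or_lt with rfl | ht
    · rcases hθ.eq_or_lt with rfl | h
      · simp
      · rw [Real.zero_rpow h.ne', zero_mul]
    · rw [← Real.rpow_add ht]; simp
  have e2 : σ = (σ ^ 2) ^ θ * σ ^ (1 - 2 * θ) := by
    rw [← Real.rpow_natCast σ 2, ← Real.rpow_mul hσ.le, ← Real.rpow_add hσ]; simp
  have e3 : δ = δ ^ (1 - θ) * δ ^ θ := by rw [← Real.rpow_add hδ]; simp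
  calc δ * σ * t = (δ ^ (1 - θ) * δ ^ θ) * ((σ ^ 2) ^ θ * σ ^ (1 - 2 * θ)) * (t ^ θ * t ^ (1 - θ)) := by
        rw [← e1, ← e2, ← e3]
    _ = (σ ^ 2 * t) ^ θ * (δ * t) ^ (1 - θ) * σ ^ (1 - 2 * θ) * δ ^ θ := by
        rw [Real.mul_rpow (by positivity) ht, Real.mul_rpow hδ.le ht]; ring
    _ ≤ _ := by
        have hX : 0 ≤ X := le_trans (by positivity) h1
        gcongr

section step
variable {C0 : ℝ} {φ ψ : Tile → L2Z} {N : ℤ → ℝ} {G : Finset ℤ} {a : Tile → ℂ}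

lemma form_le_add (Q Q' : Finset Tile) (h : Q' ⊆ Q) : form N G a ψ Q ≤ form N G a ψ (Q \ Q') + form N G a ψ Q' := by
  classical
  have := form_le_sum_fiber (N := N) (G := G) (a := a) (ψ := ψ) (Q := Q) (I := Finset.univ) (g := fun P => decide (P ∈ Q'))
    (fun P _ => Finset.mem_univ _)
  refine this.trans (le_of_eq ?_)
  rw [Fintype.sum_bool, add_comm]
  congr 2
  · ext P; simp [Finset.mem_sdiff]
  · ext P; simp; exact fun hP => h hP

lemma energy_cond_mono {A : Tile → ℝ} {Q Q' : Finset Tile} (h : Q' ⊆ Q) {b : ℝ} (he : ∀ T ∈ Q, energy A Q T ≤ b * 4 ^ T.i) :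
    ∀ T ∈ Q', energy A Q' T ≤ b * 4 ^ T.i := fun T hT => (energy_mono h T).trans (he T (h hT))

/-- Summation over the masses, for tiles of controlled energy covered by few trees. -/
lemma form_le_of_mass (hW : WavePackets C0 φ ψ) (hC : 0 < C0) {Ω : Set ℤ} {κ : ℝ}
    (hκ : ∀ δ > 0, ∀ S, Incomparable S → (∀ P ∈ S, P.iv ⊆ Ω ∧ δ ≤ mass N G P) → δ * ∑ P ∈ S, (4:ℝ) ^ P.i ≤ κ)
    {Q : Finset Tile} (hs : Sparse Q) (hΩ : ∀ P ∈ Q, P.iv ⊆ Ω) (hm : ∀ P ∈ Q, 0 < mass N G P)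
    {σ X θ : ℝ} (hσ : 0 < σ) (hθ : 0 < θ) (hθ1 : θ ≤ 1)
    (he : ∀ T ∈ Q, energy (fun P => ‖a P‖) Q T ≤ σ ^ 2 * 4 ^ T.i) {𝒯 : Finset Tile} (h𝒯 : ∀ T ∈ 𝒯, T.iv ⊆ Ω)
    (hcov : ∀ P ∈ Q, ∃ T ∈ 𝒯, P.Le T) (hX : σ ^ 2 * ∑ T ∈ 𝒯, (4:ℝ) ^ T.i ≤ X) :
    form N G a ψ Q ≤ (treeC C0 * 2 * 8 ^ θ * (1 - 2 ^ (-θ))⁻¹) * (X ^ θ * κ ^ (1 - θ) * σ ^ (1 - 2 * θ)) := by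
  classical
  have hT := treeC_pos hC
  have hκ0 : 0 ≤ κ := by simpa using hκ 1 one_pos ∅ (fun _ h => absurd h (Finset.notMem_empty _)) (by simp)
  have hX0 : 0 ≤ X := le_trans (by positivity) hX
  rcases Q.eq_empty_or_nonempty with rfl | hne
  · rw [form_empty]
    have h2 : (2:ℝ) ^ (-θ) < 1 := Real.rpow_lt_one_of_one_lt_of_neg (by norm_num) (by linarith)
    have hc : 0 < 1 - (2:ℝ) ^ (-θ) := by linarith
    positivity
  obtain ⟨P0, hP0, hmin⟩ := Finset.exists_min_image Q (mass N G) hne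
  have key := le_of_halving (Φ := form N G a ψ) form_empty
    (fun δ Q' => Q' ⊆ Q ∧ ∀ P ∈ Q', ∀ P' : Tile, P.Le P' → P'.iv ⊆ Ω → mass N G P' ≤ δ)
    (D := treeC C0 * 2 * (X ^ θ * κ ^ (1 - θ) * σ ^ (1 - 2 * θ))) hθ (by positivity) (hm P0 hP0) ?_ ?_
    (δ := 8) (by norm_num) (Q := Q) ⟨subset_rfl, fun P _ P' _ _ => mass_le N G P'⟩
  · refine key.trans (le_of_eq ?_); ring
  · rintro δ hδ Q1 ⟨h1, h2⟩
    set Q' := Q1.filter fun P => ∀ P' : Tile, P.Le P' → P'.iv ⊆ Ω → mass N G P' ≤ δ / 2 with hQ'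
    refine ⟨Q', ⟨(Finset.filter_subset _ _).trans h1, fun P hP => (Finset.mem_filter.1 hP).2⟩,
      (form_le_add Q1 Q' (Finset.filter_subset _ _)).trans (add_le_add ?_ le_rfl)⟩
    have hch : ∀ P ∈ Q1 \ Q', ∃ P' : Tile, P.Le P' ∧ P'.iv ⊆ Ω ∧ δ / 2 < mass N G P' := by
      intro P hP
      obtain ⟨h3, h4⟩ := Finset.mem_sdiff.1 hP
      by_contra hn
      push Not at hn
      exact h4 (Finset.mem_filter.2 ⟨h3, hn⟩)
    choose! u hu using hch
    obtain ⟨S, hS, hinc, htop⟩ := exists_tops ((Q1 \ Q').image u)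
    have hSu : ∀ T ∈ S, T.iv ⊆ Ω ∧ δ / 2 ≤ mass N G T := fun T hT => by
      obtain ⟨P, hP, rfl⟩ := Finset.mem_image.1 (hS hT)
      exact ⟨(hu P hP).2.1, (hu P hP).2.2.le⟩
    have hsub : Q1 \ Q' ⊆ Q1 := Finset.sdiff_subset
    have hs' : Sparse (Q1 \ Q') := fun P hP R hR => hs P (h1 (hsub hP)) R (h1 (hsub hR))
    have hb1 := form_le_of_cover hW hC hs' hσ hδ.le (energy_cond_mono (hsub.trans h1) he)
      (fun P hP => h2 P (hsub hP)) h𝒯 (fun P hP => hcov P (h1 (hsub hP)))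
    have hb2 := form_le_of_cover hW hC hs' hσ hδ.le (energy_cond_mono (hsub.trans h1) he)
      (fun P hP => h2 P (hsub hP)) (fun T hT => (hSu T hT).1) (fun P hP => by
        obtain ⟨T, hT, hle⟩ := htop (u P) (Finset.mem_image_of_mem u hP)
        exact ⟨T, hT, (hu P hP).1.trans hle⟩)
    have hcount := hκ (δ / 2) (half_pos hδ) S hinc hSu
    set t := min (∑ T ∈ 𝒯, (4:ℝ) ^ T.i) (∑ T ∈ S, (4:ℝ) ^ T.i) with ht
    have ht0 : 0 ≤ t := le_min (by positivity) (by positivity)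
    have hb : form N G a ψ (Q1 \ Q') ≤ treeC C0 * (2 * (δ / 2 * σ * t)) := by
      rcases min_choice (∑ T ∈ 𝒯, (4:ℝ) ^ T.i) (∑ T ∈ S, (4:ℝ) ^ T.i) with h | h
      · rw [ht, h]; exact hb1.trans (le_of_eq (by ring))
      · rw [ht, h]; exact hb2.trans (le_of_eq (by ring))
    have hi := mul_le_interp (half_pos hδ) hσ ht0 hθ.le hθ1
      ((mul_le_mul_of_nonneg_left (min_le_left _ _) (sq_nonneg σ)).trans hX)
      ((mul_le_mul_of_nonneg_left (min_le_right _ _) (half_pos hδ).le).trans hcount)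
    calc _ ≤ treeC C0 * (2 * (X ^ θ * κ ^ (1 - θ) * σ ^ (1 - 2 * θ) * (δ / 2) ^ θ)) := hb.trans (by gcongr)
      _ ≤ treeC C0 * (2 * (X ^ θ * κ ^ (1 - θ) * σ ^ (1 - 2 * θ) * δ ^ θ)) := by
          gcongr; linarith
      _ = _ := by ring
  · rintro δ hδ Q1 ⟨h1, h2⟩ ⟨P, hP⟩
    exact (hmin P (h1 hP)).trans (h2 P hP P (Tile.Le.refl P) (hΩ P (h1 hP)))

/-- Summation over masses and energies. -/
lemma form_le_of_energy (hW : WavePackets C0 φ ψ) (hC : 0 < C0) {Ω : Set ℤ} {κ : ℝ}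
    (hκ : ∀ δ > 0, ∀ S, Incomparable S → (∀ P ∈ S, P.iv ⊆ Ω ∧ δ ≤ mass N G P) → δ * ∑ P ∈ S, (4:ℝ) ^ P.i ≤ κ)
    {Q : Finset Tile} (hs : Sparse Q) (hΩ : ∀ P ∈ Q, P.iv ⊆ Ω) (u : L2Z)
    {σ θ : ℝ} (hσ : 0 < σ) (hθ : 0 < θ) (hθ1 : θ < 1 / 2)
    (he : ∀ T ∈ Q, energy (fun P => ‖inner ℂ (φ P) u‖) Q T ≤ σ ^ 2 * 4 ^ T.i) :
    form N G (fun P => inner ℂ (φ P) u) ψ Q ≤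
      (treeC C0 * 2 * 8 ^ θ * (1 - 2 ^ (-θ))⁻¹ * (1 - 2 ^ (-(1 - 2 * θ)))⁻¹) *
        ((2 ^ 25 * C0 ^ 2 * ‖u‖ ^ 2) ^ θ * κ ^ (1 - θ) * σ ^ (1 - 2 * θ)) := by
  classical
  have hT := treeC_pos hC
  have hκ0 : 0 ≤ κ := by simpa using hκ 1 one_pos ∅ (fun _ h => absurd h (Finset.notMem_empty _)) (by simp)
  have hc : 0 < 1 - (2:ℝ) ^ (-θ) := by
    have : (2:ℝ) ^ (-θ) < 1 := Real.rpow_lt_one_of_one_lt_of_neg (by norm_num) (by linarith)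
    linarith
  have hc' : 0 < 1 - (2:ℝ) ^ (-(1 - 2 * θ)) := by
    have : (2:ℝ) ^ (-(1 - 2 * θ)) < 1 := Real.rpow_lt_one_of_one_lt_of_neg (by norm_num) (by linarith)
    linarith
  set a : Tile → ℂ := fun P => inner ℂ (φ P) u with ha
  set p : Tile → Prop := fun P => a P ≠ 0 ∧ 0 < mass N G P with hp
  set Q0 := Q.filter p with hQ0
  have hQQ : Q0 ⊆ Q := Finset.filter_subset _ _
  have hform : form N G a ψ Q0 = form N G a ψ Q := by
    refine form_filter Q p fun P hP hn => ?_
    by_cases h0 : a P = 0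
    · exact Or.inl h0
    · refine Or.inr fun y hy hyP => hn ⟨h0, ?_⟩
      unfold mass
      refine mul_pos (by positivity) (Finset.sum_pos (fun z _ => pow_pos (P.w_pos z) _)
        ⟨y, Finset.mem_filter.2 ⟨hy, P.om2_subset_om hyP⟩⟩)
  rw [← hform]
  set X := 2 ^ 25 * C0 ^ 2 * ‖u‖ ^ 2 with hX
  have hX0 : 0 ≤ X := by positivity
  rcases Q0.eq_empty_or_nonempty with h0 | hne
  · rw [h0, form_empty]; positivity
  obtain ⟨P0, hP0, hmin⟩ := Finset.exists_min_image Q0 (fun P => ‖a P‖ / 2 ^ P.i) hne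
  have hs0 : Sparse Q0 := fun P hP R hR => hs P (hQQ hP) R (hQQ hR)
  have key := le_of_halving (Φ := form N G a ψ) form_empty
    (fun σ Q' => Q' ⊆ Q0 ∧ ∀ T ∈ Q', energy (fun P => ‖a P‖) Q' T ≤ σ ^ 2 * 4 ^ T.i)
    (D := treeC C0 * 2 * 8 ^ θ * (1 - 2 ^ (-θ))⁻¹ * (X ^ θ * κ ^ (1 - θ))) (θ := 1 - 2 * θ) (ε := ‖a P0‖ / 2 ^ P0.i)
    (by linarith) (by positivity) ?_ ?_ ?_ hσ (Q := Q0) ⟨subset_rfl, energy_cond_mono hQQ he⟩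
  · refine key.trans (le_of_eq ?_); ring
  · have := (Finset.mem_filter.1 hP0).2.1
    positivity
  · rintro σ hσ Q1 ⟨h1, h2⟩
    have hs1 : Sparse Q1 := fun P hP R hR => hs0 P (h1 hP) R (h1 hR)
    obtain ⟨Q', 𝒯, e1, e2, e3, e4, e5⟩ := energy_lemma hW.packets_left hW.nonneg u hσ Q1 hs1 h2
    refine ⟨Q', ⟨e1.trans h1, e3⟩, (form_le_add Q1 Q' e1).trans (add_le_add ?_ le_rfl)⟩
    have hsub : Q1 \ Q' ⊆ Q1 := Finset.sdiff_subset
    have := form_le_of_mass hW hC hκ (fun P hP R hR => hs1 P (hsub hP) R (hsub hR)) (fun P hP => hΩ P (hQQ (h1 (hsub hP))))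
      (fun P hP => (Finset.mem_filter.1 (h1 (hsub hP))).2.2) hσ hθ (by linarith) (energy_cond_mono hsub h2)
      (fun T hT => hΩ T (hQQ (h1 (e2 hT)))) (fun P hP => e4 P (hsub hP) (Finset.mem_sdiff.1 hP).2) e5
    refine this.trans (le_of_eq ?_)
    ring
  · rintro σ hσ Q1 ⟨h1, h2⟩ ⟨P, hP⟩
    refine (hmin P (h1 hP)).trans ?_
    rw [div_le_iff₀ (by positivity)]
    exact norm_le_of_energy (A := fun P => ‖a P‖) (fun _ => norm_nonneg _) hσ.le hP (h2 P hP)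
end step

/-- The constant in the summation over masses and energies. -/
noncomputable def levelC (C0 θ : ℝ) : ℝ :=
  treeC C0 * 2 * 8 ^ θ * (1 - 2 ^ (-θ))⁻¹ * (1 - 2 ^ (-(1 - 2 * θ)))⁻¹ * ((2 ^ 25 * C0 ^ 2) ^ θ * (10 ^ 7 * C0) ^ (1 - 2 * θ))

lemma levelC_pos {C0 θ : ℝ} (hC : 0 < C0) (hθ : 0 < θ) (hθ1 : θ < 1 / 2) : 0 < levelC C0 θ := by
  have hc : 0 < 1 - (2:ℝ) ^ (-θ) := by
    have : (2:ℝ) ^ (-θ) < 1 := Real.rpow_lt_one_of_one_lt_of_neg (by norm_num) (by linarith)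
    linarith
  have hc' : 0 < 1 - (2:ℝ) ^ (-(1 - 2 * θ)) := by
    have : (2:ℝ) ^ (-(1 - 2 * θ)) < 1 := Real.rpow_lt_one_of_one_lt_of_neg (by norm_num) (by linarith)
    linarith
  have := treeC_pos hC
  unfold levelC
  positivity

section restricted
variable {C0 : ℝ} {φ ψ : Tile → L2Z} {N : ℤ → ℝ} {G F : Finset ℤ} {Q : Finset Tile} {f : ℤ → ℂ}

lemma form_le_of_density (hW : WavePackets C0 φ ψ) (hC : 0 < C0) {Ω : Set ℤ} {κ : ℝ}
    (hκ : ∀ δ > 0, ∀ S, Incomparable S → (∀ P ∈ S, P.iv ⊆ Ω ∧ δ ≤ mass N G P) → δ * ∑ P ∈ S, (4:ℝ) ^ P.i ≤ κ)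
    (hs : Sparse Q) (hΩ : ∀ P ∈ Q, P.iv ⊆ Ω) (hf : ∀ y ∉ F, f y = 0)
    {A θ : ℝ} (hA0 : 0 < A) (hθ : 0 < θ) (hθ1 : θ < 1 / 2)
    (hA : ∀ P ∈ Q, ∀ n, P.i ≤ n → ∑ z ∈ tri n (P.k * 4 ^ P.i / 4 ^ n), ‖f z‖ ≤ A * 4 ^ n) :
    form N G (fun P => inner ℂ (φ P) (fin2 F f)) ψ Q ≤
      levelC C0 θ * ((∑ y ∈ F, ‖f y‖ ^ 2) ^ θ * κ ^ (1 - θ) * A ^ (1 - 2 * θ)) := by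
  classical
  have := form_le_of_energy hW hC hκ hs hΩ (fin2 F f) (σ := 10 ^ 7 * C0 * A) (by positivity) hθ hθ1 (fun T hT => by
    have h := energy_le_of_density hW (S := Q.filter fun P => P.Le2 T) (T := T) (fun P hP => (Finset.mem_filter.1 hP).2)
      (fun P hP R hR => hs P (Finset.mem_filter.1 hP).1 R (Finset.mem_filter.1 hR).1)
      ⟨T, Finset.mem_filter.2 ⟨hT, Or.inl rfl⟩⟩ f F hf (fun P hP => hA P (Finset.mem_filter.1 hP).1)
    refine le_of_le_of_eq ?_ (show 10 ^ 14 * C0 ^ 2 * A ^ 2 * 4 ^ T.i = (10 ^ 7 * C0 * A) ^ 2 * 4 ^ T.i by ring)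
    unfold energy
    convert h)
  refine this.trans (le_of_eq ?_)
  rw [norm_fin2_sq, Real.mul_rpow (by positivity) (by positivity), Real.mul_rpow (by positivity) hA0.le]
  unfold levelC
  ring

lemma sum_tri_le (hf : ∀ y, ‖f y‖ ≤ 1) (n : ℕ) (k : ℤ) : ∑ z ∈ tri n k, ‖f z‖ ≤ 3 * 4 ^ n := by
  rw [← card_tri n k]
  refine (Finset.sum_le_sum fun z _ => hf z).trans ?_
  simp

lemma sum_sq_le_card (hf : ∀ y, ‖f y‖ ≤ 1) : ∑ y ∈ F, ‖f y‖ ^ 2 ≤ F.card := by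
  refine (Finset.sum_le_sum fun z _ => pow_le_one₀ (norm_nonneg _) (hf z)).trans ?_
  simp

/-- The restricted bound for large support of `f`. -/
lemma form_le_three_eighths (hW : WavePackets C0 φ ψ) (hC : 0 < C0) (hs : Sparse Q) (hf : ∀ y ∉ F, f y = 0) (hf1 : ∀ y, ‖f y‖ ≤ 1) :
    form N G (fun P => inner ℂ (φ P) (fin2 F f)) ψ Q ≤
      levelC C0 (3 / 8) * (9216 ^ (5 / 8 : ℝ) * 3 ^ (1 / 4 : ℝ)) * ((F.card : ℝ) ^ (3 / 8 : ℝ) * (G.card : ℝ) ^ (5 / 8 : ℝ)) := by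
  have hl := levelC_pos hC (θ := 3 / 8) (by norm_num) (by norm_num)
  have := form_le_of_density (N := N) (G := G) hW hC (Ω := Set.univ) (κ := 9216 * G.card) (fun δ hδ S hS h => mass_lemma N G S hS δ hδ fun P hP => (h P hP).2)
    hs (fun P _ => Set.subset_univ _) hf (A := 3) (θ := 3 / 8) (by norm_num) (by norm_num) (by norm_num)
    (fun P _ n _ => sum_tri_le hf1 n _)
  refine this.trans ?_
  rw [show (1 - 3 / 8 : ℝ) = 5 / 8 by norm_num, show (1 - 2 * (3 / 8) : ℝ) = 1 / 4 by norm_num,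
    Real.mul_rpow (by norm_num) (by positivity)]
  calc _ ≤ levelC C0 (3 / 8) * ((F.card : ℝ) ^ (3 / 8 : ℝ) * (9216 ^ (5 / 8 : ℝ) * (G.card : ℝ) ^ (5 / 8 : ℝ)) * 3 ^ (1 / 4 : ℝ)) := by
        gcongr
        exact sum_sq_le_card hf1
    _ = _ := by ring

/-- The restricted bound for small support of `f`. -/
lemma form_le_five_eighths (hW : WavePackets C0 φ ψ) (hC : 0 < C0) (hs : Sparse Q) (hf : ∀ y ∉ F, f y = 0) (hf1 : ∀ y, ‖f y‖ ≤ 1) :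
    form N G (fun P => inner ℂ (φ P) (fin2 F f)) ψ Q ≤
      levelC C0 (1 / 8) * (9216 ^ (3 / 8 : ℝ) * (9216 * 18) ^ (1 / 2 : ℝ)) * 3 ^ (1 / 4 : ℝ) * (1 - 2 ^ (-(1 / 4 : ℝ)))⁻¹ *
        ((F.card : ℝ) ^ (5 / 8 : ℝ) * (G.card : ℝ) ^ (3 / 8 : ℝ)) := by
  classical
  have hl := levelC_pos hC (θ := 1 / 8) (by norm_num) (by norm_num)
  have hc : 0 < 1 - (2:ℝ) ^ (-(1 / 4 : ℝ)) := by
    have : (2:ℝ) ^ (-(1 / 4 : ℝ)) < 1 := Real.rpow_lt_one_of_one_lt_of_neg (by norm_num) (by norm_num)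
    linarith
  set a : Tile → ℂ := fun P => inner ℂ (φ P) (fin2 F f) with ha
  rcases Q.eq_empty_or_nonempty with h0 | hne
  · rw [h0, form_empty]; positivity
  by_cases hf0 : ∀ z, f z = 0
  · have : form N G a ψ Q = 0 := by
      unfold form
      refine Finset.sum_eq_zero fun y _ => ?_
      rw [norm_eq_zero]
      refine Finset.sum_eq_zero fun P _ => ?_
      have : a P = 0 := by simp [ha, inner_fin2, hf0]
      rw [this, zero_mul]
    rw [this]; positivity
  push Not at hf0
  obtain ⟨z0, hz0⟩ := hf0
  have hn : ∀ P : Tile, ∃ n, P.i ≤ n ∧ 0 < ∑ z ∈ tri n (P.k * 4 ^ P.i / 4 ^ n), ‖f z‖ := by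
    intro P
    obtain ⟨n, hn⟩ := pow_unbounded_of_one_lt |P.k * 4 ^ P.i - z0| (by norm_num : (1:ℤ) < 4)
    refine ⟨max n P.i, le_max_right _ _, Finset.sum_pos' (fun z _ => norm_nonneg _) ⟨z0, ?_, by positivity⟩⟩
    exact mem_tri_of_abs_le (hn.le.trans (pow_le_pow_right₀ (by norm_num) (le_max_left _ _)))
  choose n hn1 hn2 using hn
  obtain ⟨P0, hP0, hmin⟩ := Finset.exists_min_image Q (fun P => (∑ z ∈ tri (n P) (P.k * 4 ^ P.i / 4 ^ n P), ‖f z‖) / 4 ^ n P) hne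
  have key := le_of_halving (Φ := form N G a ψ) form_empty
    (fun δ Q' => Q' ⊆ Q ∧ ∀ P ∈ Q', ∀ n, P.i ≤ n → ∑ z ∈ tri n (P.k * 4 ^ P.i / 4 ^ n), ‖f z‖ ≤ δ * 4 ^ n)
    (D := levelC C0 (1 / 8) * (9216 ^ (3 / 8 : ℝ) * (9216 * 18) ^ (1 / 2 : ℝ)) * ((F.card : ℝ) ^ (5 / 8 : ℝ) * (G.card : ℝ) ^ (3 / 8 : ℝ)))
    (θ := 1 / 4) (ε := (∑ z ∈ tri (n P0) (P0.k * 4 ^ P0.i / 4 ^ n P0), ‖f z‖) / 4 ^ n P0)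
    (by norm_num) (by positivity) (div_pos (hn2 P0) (by positivity)) ?_ ?_ (δ := 3) (by norm_num)
    (Q := Q) ⟨subset_rfl, fun P _ n _ => sum_tri_le hf1 n _⟩
  · refine key.trans (le_of_eq ?_); ring
  · rintro δ hδ Q1 ⟨h1, h2⟩
    set Q' := Q1.filter fun P => ∀ n, P.i ≤ n → ∑ z ∈ tri n (P.k * 4 ^ P.i / 4 ^ n), ‖f z‖ ≤ δ / 2 * 4 ^ n with hQ'
    refine ⟨Q', ⟨(Finset.filter_subset _ _).trans h1, fun P hP => (Finset.mem_filter.1 hP).2⟩,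
      (form_le_add Q1 Q' (Finset.filter_subset _ _)).trans (add_le_add ?_ le_rfl)⟩
    have hsub : Q1 \ Q' ⊆ Q1 := Finset.sdiff_subset
    have hch : ∀ P ∈ Q1 \ Q', ∃ n, P.i ≤ n ∧ δ / 2 * 4 ^ n < ∑ z ∈ tri n (P.k * 4 ^ P.i / 4 ^ n), ‖f z‖ := by
      intro P hP
      obtain ⟨h3, h4⟩ := Finset.mem_sdiff.1 hP
      by_contra hn
      push Not at hn
      exact h4 (Finset.mem_filter.2 ⟨h3, hn⟩)
    set Ω : Finset ℤ := (Q1 \ Q').biUnion fun P => Finset.Ico (P.k * 4 ^ P.i) ((P.k + 1) * 4 ^ P.i) with hΩ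
    have hcard : δ / 2 * Ω.card ≤ 9 * F.card := by
      refine maximal_weak (fun z => ‖f z‖) (fun z => norm_nonneg _) F.card (fun s => ?_) (δ / 2) (half_pos hδ).le Ω fun y hy => ?_
      · calc ∑ z ∈ s, ‖f z‖ ≤ ∑ z ∈ s, if z ∈ F then 1 else 0 := by
              refine Finset.sum_le_sum fun z _ => ?_
              split_ifs with hz
              · exact hf1 z
              · rw [hf z hz, norm_zero]
          _ ≤ F.card := by
              rw [Finset.sum_boole]; norm_cast
              exact Finset.card_le_card fun z hz => (Finset.mem_filter.1 hz).2
      · obtain ⟨P, hP, hy⟩ := Finset.mem_biUnion.1 hy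
        obtain ⟨n, hn, hlt⟩ := hch P hP
        refine ⟨n, hlt.le.trans (le_of_eq ?_)⟩
        have e : y / 4 ^ P.i = P.k := mem_iv.1 (mem_iv_iff.2 (Finset.mem_Ico.1 hy))
        have e' : P.k * 4 ^ P.i / 4 ^ P.i = P.k := Int.mul_ediv_cancel _ (by positivity)
        rw [ediv_pow_of_le hn (P.k * 4 ^ P.i), e', ediv_pow_of_le hn y, e]
    have hcard' : (Ω.card : ℝ) ≤ 18 * F.card / δ := by
      rw [le_div_iff₀ hδ]; linarith
    have hb := form_le_of_density (N := N) (G := G) hW hC (Ω := (Ω : Set ℤ)) (κ := min (9216 * G.card) (9216 * Ω.card))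
      (fun δ hδ S hS h => le_min (mass_lemma N G S hS δ hδ fun P hP => (h P hP).2)
        (mass_lemma_local N G S hS δ hδ (fun P hP => (h P hP).2) Ω fun P hP => (h P hP).1))
      (fun P hP R hR => hs P (h1 (hsub hP)) R (h1 (hsub hR))) (fun P hP y hy => by
        refine Finset.mem_coe.2 (Finset.mem_biUnion.2 ⟨P, hP, Finset.mem_Ico.2 (mem_iv_iff.1 hy)⟩)) hf hδ
      (θ := 1 / 8) (by norm_num) (by norm_num) (fun P hP => h2 P (hsub hP))
    refine hb.trans ?_
    set κ := min (9216 * (G.card : ℝ)) (9216 * Ω.card) with hκ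
    have hκ0 : 0 ≤ κ := le_min (by positivity) (by positivity)
    have e1 : κ ^ (7 / 8 : ℝ) ≤ (9216 * (G.card : ℝ)) ^ (3 / 8 : ℝ) * (9216 * (18 * F.card / δ)) ^ (1 / 2 : ℝ) := by
      rw [show (7 / 8 : ℝ) = 3 / 8 + 1 / 2 by norm_num, Real.rpow_add_of_nonneg hκ0 (by norm_num) (by norm_num)]
      gcongr
      · exact min_le_left _ _
      · exact (min_le_right _ _).trans (by gcongr)
    have e2 : (9216 * (18 * (F.card : ℝ) / δ)) ^ (1 / 2 : ℝ) * δ ^ (3 / 4 : ℝ) = (9216 * 18) ^ (1 / 2 : ℝ) * (F.card : ℝ) ^ (1 / 2 : ℝ) * δ ^ (1 / 4 : ℝ) := by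
      rw [show 9216 * (18 * (F.card : ℝ) / δ) = 9216 * 18 * F.card / δ by ring, Real.div_rpow (by positivity) hδ.le,
        Real.mul_rpow (by norm_num) (by positivity), show (3 / 4 : ℝ) = 1 / 2 + 1 / 4 by norm_num, Real.rpow_add hδ]
      field_simp
    have e3 : (F.card : ℝ) ^ (5 / 8 : ℝ) = (F.card : ℝ) ^ (1 / 8 : ℝ) * (F.card : ℝ) ^ (1 / 2 : ℝ) := by
      rw [← Real.rpow_add_of_nonneg (by positivity) (by norm_num) (by norm_num)]; norm_num
    rw [show (1 - 1 / 8 : ℝ) = 7 / 8 by norm_num, show (1 - 2 * (1 / 8) : ℝ) = 3 / 4 by norm_num]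
    calc _ ≤ levelC C0 (1 / 8) * ((F.card : ℝ) ^ (1 / 8 : ℝ) * ((9216 * (G.card : ℝ)) ^ (3 / 8 : ℝ) * (9216 * (18 * F.card / δ)) ^ (1 / 2 : ℝ)) * δ ^ (3 / 4 : ℝ)) := by
          gcongr
          exact sum_sq_le_card hf1
      _ = levelC C0 (1 / 8) * ((F.card : ℝ) ^ (1 / 8 : ℝ) * (9216 * (G.card : ℝ)) ^ (3 / 8 : ℝ) * ((9216 * (18 * F.card / δ)) ^ (1 / 2 : ℝ) * δ ^ (3 / 4 : ℝ))) := by ring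
      _ = _ := by
          rw [e2, e3, Real.mul_rpow (by norm_num) (by positivity)]; ring
  · rintro δ hδ Q1 ⟨h1, h2⟩ ⟨P, hP⟩
    refine (hmin P (h1 hP)).trans ?_
    rw [div_le_iff₀ (by positivity)]
    exact h2 P hP _ (hn1 P)

/-- The restricted weak type bounds of the model operator. -/
theorem exists_restricted (hC : 0 < C0) : ∃ K : ℝ, 0 < K ∧ ∀ (φ ψ : Tile → L2Z), WavePackets C0 φ ψ → ∀ (N : ℤ → ℝ) (G F : Finset ℤ)
    (Q : Finset Tile) (f : ℤ → ℂ), Sparse Q → (∀ y ∉ F, f y = 0) → (∀ y, ‖f y‖ ≤ 1) →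
    form N G (fun P => inner ℂ (φ P) (fin2 F f)) ψ Q ≤ K * ((F.card : ℝ) ^ (3 / 8 : ℝ) * (G.card : ℝ) ^ (5 / 8 : ℝ)) ∧
    form N G (fun P => inner ℂ (φ P) (fin2 F f)) ψ Q ≤ K * ((F.card : ℝ) ^ (5 / 8 : ℝ) * (G.card : ℝ) ^ (3 / 8 : ℝ)) := by
  refine ⟨max (levelC C0 (3 / 8) * (9216 ^ (5 / 8 : ℝ) * 3 ^ (1 / 4 : ℝ))) (levelC C0 (1 / 8) * (9216 ^ (3 / 8 : ℝ) *
    (9216 * 18) ^ (1 / 2 : ℝ)) * 3 ^ (1 / 4 : ℝ) * (1 - 2 ^ (-(1 / 4 : ℝ)))⁻¹), lt_max_of_lt_left ?_, fun φ ψ hW N G F Q f hs hf hf1 => ⟨?_, ?_⟩⟩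
  · have hl := levelC_pos hC (θ := 3 / 8) (by norm_num) (by norm_num)
    positivity
  · exact (form_le_three_eighths hW hC hs hf hf1).trans (by gcongr; exact le_max_left _ _)
  · exact (form_le_five_eighths hW hC hs hf hf1).trans (by gcongr; exact le_max_right _ _)
end restricted

lemma rpow_mul_le_absorb {α β L s : ℝ} (hα : 0 ≤ α) (hβ : 0 ≤ β) (hL : 1 ≤ L) (hs : 1 / 3 ≤ s) (hs1 : s ≤ 1) :
    α ^ s * β ^ (1 - s) ≤ L ^ 2 * α + β / L := by
  have hL0 : 0 < L := by linarith
  have h1 : α ^ s * β ^ (1 - s) ≤ (L ^ 2 * α) ^ s * (β / L) ^ (1 - s) := by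
    rw [Real.mul_rpow (by positivity) hα, Real.div_rpow hβ hL0.le]
    have : 1 ≤ (L ^ 2) ^ s / L ^ (1 - s) := by
      rw [← Real.rpow_natCast L 2, ← Real.rpow_mul hL0.le, ← Real.rpow_sub hL0]
      refine Real.one_le_rpow hL ?_
      push_cast; linarith
    calc α ^ s * β ^ (1 - s) ≤ α ^ s * β ^ (1 - s) * ((L ^ 2) ^ s / L ^ (1 - s)) :=
          le_mul_of_one_le_right (by positivity) this
      _ = _ := by field_simp
  refine h1.trans ((Real.geom_mean_le_arith_mean2_weighted (by linarith) (by linarith) (by positivity) (by positivity)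
    (by ring)).trans ?_)
  have e1 : 0 ≤ L ^ 2 * α := by positivity
  have e2 : 0 ≤ β / L := by positivity
  nlinarith

lemma sum_geom_natAbs_le {q : ℝ} (hq : 0 ≤ q) (hq1 : q < 1) (I : Finset ℤ) (l : ℤ) :
    ∑ k ∈ I, q ^ (k - l).natAbs ≤ 2 * (1 - q)⁻¹ := by
  classical
  have key : ∀ J : Finset ℤ, (∀ x ∈ J, ∀ y ∈ J, (x - l).natAbs = (y - l).natAbs → x = y) → ∑ k ∈ J, q ^ (k - l).natAbs ≤ (1 - q)⁻¹ := by
    intro J hJ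
    rw [← Finset.sum_image (f := fun n => q ^ n) (g := fun k : ℤ => (k - l).natAbs) (fun x hx y hy h => hJ x hx y hy h)]
    rw [← tsum_geometric_of_lt_one hq hq1]
    exact (summable_geometric_of_lt_one hq hq1).sum_le_tsum _ fun n _ => by positivity
  rw [← Finset.sum_filter_add_sum_filter_not I (fun k => l ≤ k), two_mul]
  refine add_le_add (key _ fun x hx y hy h => ?_) (key _ fun x hx y hy h => ?_) <;>
  · have := (Finset.mem_filter.1 hx).2
    have := (Finset.mem_filter.1 hy).2
    omega

lemma level_term_le {x z K L : ℝ} (hx : 0 ≤ x) (hz : 0 ≤ z) (hL : 1 ≤ L) (k l : ℤ) {b : ℝ}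
    (h1 : b ≤ K * (x ^ (3 / 8 : ℝ) * z ^ (5 / 8 : ℝ))) (h2 : b ≤ K * (x ^ (5 / 8 : ℝ) * z ^ (3 / 8 : ℝ))) (hK : 0 ≤ K) :
    (2:ℝ) ^ (l + 1) * ((2:ℝ) ^ (k + 1) * b) ≤ 4 * K * ((2 ^ (-(1 / 4 : ℝ))) ^ (k - l).natAbs *
      (L ^ 2 * (((2:ℝ) ^ k) ^ 2 * x) + (((2:ℝ) ^ l) ^ 2 * z) / L)) := by
  have h20 : (0:ℝ) < 2 := by norm_num
  have hkey : ∀ s : ℝ, 1 / 3 ≤ s → s ≤ 1 → ∀ (k l : ℤ) (n : ℕ), (1 - 2 * s) * (k - l) = n * (1 / 4) * (-1) →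
      (2:ℝ) ^ l * (2:ℝ) ^ k * (x ^ s * z ^ (1 - s)) ≤ (2 ^ (-(1 / 4 : ℝ))) ^ n *
      (L ^ 2 * (((2:ℝ) ^ k) ^ 2 * x) + (((2:ℝ) ^ l) ^ 2 * z) / L) := by
    intro s hs hs1 k l n hn
    refine le_trans (le_of_eq ?_) (mul_le_mul_of_nonneg_left (rpow_mul_le_absorb (α := ((2:ℝ) ^ k) ^ 2 * x) (β := ((2:ℝ) ^ l) ^ 2 * z)
      (by positivity) (by positivity) hL hs hs1) (by positivity))
    rw [Real.mul_rpow (by positivity) hx, Real.mul_rpow (by positivity) hz]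
    rw [← Real.rpow_intCast, ← Real.rpow_intCast, ← Real.rpow_natCast, ← Real.rpow_natCast, ← Real.rpow_natCast,
      ← Real.rpow_mul h20.le, ← Real.rpow_mul h20.le, ← Real.rpow_mul h20.le, ← Real.rpow_mul h20.le, ← Real.rpow_mul h20.le]
    have : (2:ℝ) ^ (l:ℝ) * 2 ^ (k:ℝ) = 2 ^ (-(1 / 4) * (n:ℝ)) * (2 ^ ((k:ℝ) * (2:ℕ) * s) * 2 ^ ((l:ℝ) * (2:ℕ) * (1 - s))) := by
      rw [← Real.rpow_add h20, ← Real.rpow_add h20, ← Real.rpow_add h20]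
      congr 1
      push_cast
      linarith
    rw [this]; ring
  rw [zpow_add₀ (by norm_num), zpow_add₀ (by norm_num)]
  rcases le_total k l with h | h
  · have e := hkey (3 / 8) (by norm_num) (by norm_num) k l (k - l).natAbs (by
      have : ((k - l).natAbs : ℝ) = -(k - l) := by
        have h' : (k:ℝ) ≤ l := by exact_mod_cast h
        rw [Nat.cast_natAbs, Int.cast_abs, Int.cast_sub, abs_of_nonpos (by linarith)]
      rw [this]; ring)
    rw [show (1 - 3 / 8 : ℝ) = 5 / 8 by norm_num] at e
    calc (2:ℝ) ^ l * 2 ^ (1:ℤ) * (2 ^ k * 2 ^ (1:ℤ) * b) ≤ (2:ℝ) ^ l * 2 ^ (1:ℤ) * (2 ^ k * 2 ^ (1:ℤ) * (K * (x ^ (3 / 8 : ℝ) * z ^ (5 / 8 : ℝ)))) := by gcongr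
      _ = 4 * K * ((2:ℝ) ^ l * (2:ℝ) ^ k * (x ^ (3 / 8 : ℝ) * z ^ (5 / 8 : ℝ))) := by norm_num; ring
      _ ≤ _ := by gcongr
  · have e := hkey (5 / 8) (by norm_num) (by norm_num) k l (k - l).natAbs (by
      have : ((k - l).natAbs : ℝ) = k - l := by
        have h' : (l:ℝ) ≤ k := by exact_mod_cast h
        rw [Nat.cast_natAbs, Int.cast_abs, Int.cast_sub, abs_of_nonneg (by linarith)]
      rw [this]; ring)
    rw [show (1 - 5 / 8 : ℝ) = 3 / 8 by norm_num] at e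
    calc (2:ℝ) ^ l * 2 ^ (1:ℤ) * (2 ^ k * 2 ^ (1:ℤ) * b) ≤ (2:ℝ) ^ l * 2 ^ (1:ℤ) * (2 ^ k * 2 ^ (1:ℤ) * (K * (x ^ (5 / 8 : ℝ) * z ^ (3 / 8 : ℝ)))) := by gcongr
      _ = 4 * K * ((2:ℝ) ^ l * (2:ℝ) ^ k * (x ^ (5 / 8 : ℝ) * z ^ (3 / 8 : ℝ))) := by norm_num; ring
      _ ≤ _ := by gcongr

/-- The linearized model operator. -/
noncomputable def modelOp (N : ℤ → ℝ) (φ ψ : Tile → L2Z) (Q : Finset Tile) (u : L2Z) (y : ℤ) : ℂ :=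
  open Classical in ∑ P ∈ Q with N y ∈ P.om2, inner ℂ (φ P) u * ψ P y

lemma modelOp_sum {ι : Type*} (N : ℤ → ℝ) (φ ψ : Tile → L2Z) (Q : Finset Tile) (I : Finset ι) (u : ι → L2Z) (y : ℤ) :
    modelOp N φ ψ Q (∑ k ∈ I, u k) y = ∑ k ∈ I, modelOp N φ ψ Q (u k) y := by
  unfold modelOp
  simp_rw [inner_sum, Finset.sum_mul]
  exact Finset.sum_comm

lemma modelOp_smul (N : ℤ → ℝ) (φ ψ : Tile → L2Z) (Q : Finset Tile) (c : ℂ) (u : L2Z) (y : ℤ) :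
    modelOp N φ ψ Q (c • u) y = c * modelOp N φ ψ Q u y := by
  unfold modelOp
  simp_rw [inner_smul_right, Finset.mul_sum, mul_assoc]

lemma fin2_congr {Z : Finset ℤ} {f g : ℤ → ℂ} (h : ∀ y ∈ Z, f y = g y) : fin2 Z f = fin2 Z g :=
  Finset.sum_congr rfl fun y hy => by rw [h y hy]

lemma fin2_smul (Z : Finset ℤ) (c : ℂ) (g : ℤ → ℂ) : fin2 Z (fun y => c * g y) = c • fin2 Z g := by
  unfold fin2
  rw [Finset.smul_sum]
  refine Finset.sum_congr rfl fun y _ => ?_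
  rw [← lp.single_smul]; rfl

/-- The `ℓ²` bound for the model operator on finitely supported sequences. -/
theorem exists_model_bound {C0 : ℝ} (hC : 0 < C0) : ∃ K : ℝ, 0 < K ∧ ∀ (φ ψ : Tile → L2Z), WavePackets C0 φ ψ →
    ∀ (N : ℤ → ℝ) (G F : Finset ℤ) (Q : Finset Tile) (f : ℤ → ℂ), Sparse Q →
    ∑ y ∈ G, ‖modelOp N φ ψ Q (fin2 F f) y‖ ^ 2 ≤ K * ∑ y ∈ F, ‖f y‖ ^ 2 := by
  classical
  obtain ⟨K, hK, hR⟩ := exists_restricted hC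
  set q : ℝ := 2 ^ (-(1 / 4 : ℝ)) with hq
  have hq0 : 0 ≤ q := by positivity
  have hq1 : q < 1 := Real.rpow_lt_one_of_one_lt_of_neg (by norm_num) (by norm_num)
  set c := 4 * K * (2 * (1 - q)⁻¹) with hc
  have hq1' : 0 < 1 - q := by linarith
  have hc0 : 0 < c := by positivity
  set L := max 1 (2 * c) with hL
  have hL1 : 1 ≤ L := le_max_left _ _
  refine ⟨2 * c * L ^ 2, by positivity, fun φ ψ hW N G F Q f hs => ?_⟩
  set F' := F.filter fun y => f y ≠ 0 with hF'
  have hfF : fin2 F f = fin2 F' f := by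
    unfold fin2
    rw [hF', Finset.sum_filter]
    refine Finset.sum_congr rfl fun y _ => ?_
    split_ifs with h
    · rfl
    · rw [not_not.1 h, lp.single_zero]
  set t := modelOp N φ ψ Q (fin2 F f) with ht
  set G' := G.filter fun y => t y ≠ 0 with hG'
  set lf : ℤ → ℤ := fun y => Int.log 2 ‖f y‖ with hlf
  set lt : ℤ → ℤ := fun y => Int.log 2 ‖t y‖ with hlt
  set Fk : ℤ → Finset ℤ := fun k => F'.filter fun y => lf y = k with hFk
  set Gl : ℤ → Finset ℤ := fun l => G'.filter fun y => lt y = l with hGl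
  have hu : fin2 F f = ∑ k ∈ F'.image lf, fin2 (Fk k) f := by
    rw [hfF]
    unfold fin2
    exact (Finset.sum_fiberwise_of_maps_to (fun y hy => Finset.mem_image_of_mem lf hy) _).symm
  have hS : ∑ y ∈ G, ‖t y‖ ^ 2 = ∑ l ∈ G'.image lt, ∑ y ∈ Gl l, ‖t y‖ ^ 2 := by
    rw [Finset.sum_fiberwise_of_maps_to (fun y hy => Finset.mem_image_of_mem lt hy), hG', Finset.sum_filter]
    refine Finset.sum_congr rfl fun y _ => ?_
    split_ifs with h
    · rfl
    · rw [not_not.1 h]; simp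
  have hpiece : ∀ k l, ∑ y ∈ Gl l, ‖t y‖ * ‖modelOp N φ ψ Q (fin2 (Fk k) f) y‖ ≤ 4 * K * (q ^ (k - l).natAbs *
      (L ^ 2 * (((2:ℝ) ^ k) ^ 2 * (Fk k).card) + (((2:ℝ) ^ l) ^ 2 * (Gl l).card) / L)) := by
    intro k l
    set g : ℤ → ℂ := fun y => if y ∈ Fk k then ((2:ℂ) ^ (k + 1))⁻¹ * f y else 0 with hg
    have hg0 : ∀ y ∉ Fk k, g y = 0 := fun y hy => by simp [hg, hy]
    have h2 : (0:ℝ) < 2 ^ (k + 1) := by positivity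
    have hg1 : ∀ y, ‖g y‖ ≤ 1 := fun y => by
      by_cases hy : y ∈ Fk k
      · simp only [hg, hy, if_true, norm_mul, norm_inv, norm_zpow, Complex.norm_ofNat]
        rw [inv_mul_le_iff₀ h2, mul_one]
        obtain ⟨h3, rfl⟩ := Finset.mem_filter.1 hy
        exact (Int.lt_zpow_succ_log_self (b := 2) (by norm_num) ‖f y‖).le
      · rw [hg0 y hy]; simp
    have hfg : fin2 (Fk k) f = ((2:ℂ) ^ (k + 1)) • fin2 (Fk k) g := by
      rw [← fin2_smul]
      refine fin2_congr fun y hy => ?_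
      simp only [hg, hy, if_true]
      rw [mul_inv_cancel_left₀ (zpow_ne_zero _ (by norm_num))]
    have hR' := hR φ ψ hW N (Gl l) (Fk k) Q g hs hg0 hg1
    refine le_trans ?_ (level_term_le (x := ((Fk k).card : ℝ)) (z := ((Gl l).card : ℝ)) (by positivity) (by positivity) hL1 k l hR'.1 hR'.2 hK.le)
    unfold form
    rw [Finset.mul_sum, Finset.mul_sum]
    refine Finset.sum_le_sum fun y hy => ?_
    rw [hfg, modelOp_smul, norm_mul, norm_zpow, Complex.norm_ofNat]
    obtain ⟨h3, rfl⟩ := Finset.mem_filter.1 hy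
    refine mul_le_mul (Int.lt_zpow_succ_log_self (b := 2) (by norm_num) ‖t y‖).le le_rfl (by positivity) (by positivity)
  have hrow : ∀ l, ∑ k ∈ F'.image lf, q ^ (k - l).natAbs ≤ 2 * (1 - q)⁻¹ := fun l => sum_geom_natAbs_le hq0 hq1 _ l
  have hcol : ∀ k, ∑ l ∈ G'.image lt, q ^ (k - l).natAbs ≤ 2 * (1 - q)⁻¹ := fun k => by
    refine le_of_eq_of_le (Finset.sum_congr rfl fun l _ => ?_) (sum_geom_natAbs_le hq0 hq1 (G'.image lt) k)
    congr 1; omega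
  have hα : ∑ k ∈ F'.image lf, ((2:ℝ) ^ k) ^ 2 * (Fk k).card ≤ ∑ y ∈ F, ‖f y‖ ^ 2 := by
    calc _ ≤ ∑ k ∈ F'.image lf, ∑ y ∈ Fk k, ‖f y‖ ^ 2 := by
          refine Finset.sum_le_sum fun k _ => ?_
          rw [mul_comm, ← nsmul_eq_mul]
          refine Finset.card_nsmul_le_sum _ _ _ fun y hy => ?_
          obtain ⟨h3, rfl⟩ := Finset.mem_filter.1 hy
          have h4 := norm_pos_iff.2 (Finset.mem_filter.1 h3).2
          gcongr
          exact Int.zpow_log_le_self (b := 2) (by norm_num) h4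
      _ = ∑ y ∈ F', ‖f y‖ ^ 2 := Finset.sum_fiberwise_of_maps_to (fun y hy => Finset.mem_image_of_mem lf hy) _
      _ ≤ _ := Finset.sum_le_sum_of_subset_of_nonneg (Finset.filter_subset _ _) fun _ _ _ => by positivity
  have hβ : ∑ l ∈ G'.image lt, ((2:ℝ) ^ l) ^ 2 * (Gl l).card ≤ ∑ y ∈ G, ‖t y‖ ^ 2 := by
    rw [hS]
    refine Finset.sum_le_sum fun l _ => ?_
    rw [mul_comm, ← nsmul_eq_mul]
    refine Finset.card_nsmul_le_sum _ _ _ fun y hy => ?_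
    obtain ⟨h3, rfl⟩ := Finset.mem_filter.1 hy
    have h4 := norm_pos_iff.2 (Finset.mem_filter.1 h3).2
    gcongr
    exact Int.zpow_log_le_self (b := 2) (by norm_num) h4
  have hmain : ∑ y ∈ G, ‖t y‖ ^ 2 ≤ c * (L ^ 2 * ∑ y ∈ F, ‖f y‖ ^ 2 + (∑ y ∈ G, ‖t y‖ ^ 2) / L) := by
    calc ∑ y ∈ G, ‖t y‖ ^ 2 ≤ ∑ l ∈ G'.image lt, ∑ k ∈ F'.image lf, ∑ y ∈ Gl l, ‖t y‖ * ‖modelOp N φ ψ Q (fin2 (Fk k) f) y‖ := by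
          rw [hS]
          refine Finset.sum_le_sum fun l _ => ?_
          rw [Finset.sum_comm]
          refine Finset.sum_le_sum fun y _ => ?_
          rw [← Finset.mul_sum, sq]
          refine mul_le_mul_of_nonneg_left ?_ (norm_nonneg _)
          conv_lhs => rw [ht, hu, modelOp_sum]
          exact norm_sum_le _ _
      _ ≤ ∑ l ∈ G'.image lt, ∑ k ∈ F'.image lf, 4 * K * (q ^ (k - l).natAbs *
            (L ^ 2 * (((2:ℝ) ^ k) ^ 2 * (Fk k).card) + (((2:ℝ) ^ l) ^ 2 * (Gl l).card) / L)) :=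
          Finset.sum_le_sum fun l _ => Finset.sum_le_sum fun k _ => hpiece k l
      _ = 4 * K * (L ^ 2 * ∑ k ∈ F'.image lf, (((2:ℝ) ^ k) ^ 2 * (Fk k).card) * ∑ l ∈ G'.image lt, q ^ (k - l).natAbs +
            (∑ l ∈ G'.image lt, (((2:ℝ) ^ l) ^ 2 * (Gl l).card) * ∑ k ∈ F'.image lf, q ^ (k - l).natAbs) / L) := by
          simp_rw [mul_add, Finset.sum_add_distrib]
          congr 1
          · rw [Finset.sum_comm]
            simp_rw [Finset.mul_sum]
            refine Finset.sum_congr rfl fun k _ => Finset.sum_congr rfl fun l _ => ?_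
            ring
          · simp_rw [Finset.mul_sum, Finset.sum_div, Finset.mul_sum]
            refine Finset.sum_congr rfl fun k _ => Finset.sum_congr rfl fun l _ => ?_
            ring
      _ ≤ 4 * K * (L ^ 2 * ∑ k ∈ F'.image lf, (((2:ℝ) ^ k) ^ 2 * (Fk k).card) * (2 * (1 - q)⁻¹) +
            (∑ l ∈ G'.image lt, (((2:ℝ) ^ l) ^ 2 * (Gl l).card) * (2 * (1 - q)⁻¹)) / L) := by
          gcongr with k hk l hl
          · exact hcol k
          · exact hrow l
      _ = c * (L ^ 2 * ∑ k ∈ F'.image lf, (((2:ℝ) ^ k) ^ 2 * (Fk k).card) +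
            (∑ l ∈ G'.image lt, (((2:ℝ) ^ l) ^ 2 * (Gl l).card)) / L) := by
          rw [← Finset.sum_mul, ← Finset.sum_mul, hc]; ring
      _ ≤ _ := by gcongr
  have hL2 : c * ((∑ y ∈ G, ‖t y‖ ^ 2) / L) ≤ (∑ y ∈ G, ‖t y‖ ^ 2) / 2 := by
    have h0 : 0 ≤ ∑ y ∈ G, ‖t y‖ ^ 2 := Finset.sum_nonneg fun _ _ => by positivity
    rw [mul_div_assoc', div_le_div_iff₀ (by linarith) (by norm_num)]
    nlinarith [le_max_right 1 (2 * c)]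
  linarith

/-- The `ℓ²` bound for the model operator. -/
theorem exists_modelOp_bound {C0 : ℝ} (hC : 0 < C0) : ∃ K : ℝ, 0 < K ∧ ∀ (φ ψ : Tile → L2Z), WavePackets C0 φ ψ →
    ∀ (N : ℤ → ℝ) (G : Finset ℤ) (Q : Finset Tile) (u : L2Z), Sparse Q →
    ∑ y ∈ G, ‖modelOp N φ ψ Q u y‖ ^ 2 ≤ K * ‖u‖ ^ 2 := by
  classical
  obtain ⟨K, hK, h⟩ := exists_model_bound hC
  refine ⟨K, hK, fun φ ψ hW N G Q u hs => ?_⟩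
  have hlim : Filter.Tendsto (fun F : Finset ℤ => fin2 F u) Filter.atTop (nhds u) :=
    lp.hasSum_single (by norm_num) u
  have hcont : Continuous fun u : L2Z => ∑ y ∈ G, ‖modelOp N φ ψ Q u y‖ ^ 2 := by
    unfold modelOp
    fun_prop
  refine le_of_tendsto_of_tendsto ((hcont.tendsto u).comp hlim) ((tendsto_const_nhds (x := K)).mul (hlim.norm.pow 2))
    (Filter.Eventually.of_forall fun F => ?_)
  simp only [Function.comp_apply]
  rw [norm_fin2_sq]
  exact h φ ψ hW N G F Q u hs

/-- The Fourier coefficients of a function on `[0, 1]`. -/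
noncomputable def coef (U : ℝ → ℂ) (y : ℤ) : ℂ := ∫ t in (0:ℝ)..1, U t * ee (y * t)

open scoped ComplexConjugate in
lemma conj_ee (x : ℝ) : conj (ee x) = ee (-x) := by
  unfold ee
  rw [← Complex.exp_conj]
  simp [Complex.conj_ofNat]

open scoped ComplexConjugate in
lemma conj_intervalIntegral {a b : ℝ} (f : ℝ → ℂ) :
    conj (∫ t in a..b, f t) = ∫ t in a..b, conj (f t) := by
  simp only [intervalIntegral, map_sub]
  rw [integral_conj, integral_conj]

open scoped ComplexConjugate in
lemma coef_eq_conj_fourierCoeff (U : ℝ → ℂ) (y : ℤ) :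
    coef U y = conj (fourierCoeff (AddCircle.liftIoc 1 0 (fun t => conj (U t))) y) := by
  rw [fourierCoeff_liftIoc_eq, fourierCoeffOn_eq_integral]
  simp only [zero_add, sub_zero, div_one, one_smul]
  rw [conj_intervalIntegral, coef]
  refine intervalIntegral.integral_congr fun t _ => ?_
  simp only [smul_eq_mul, map_mul, Complex.conj_conj]
  rw [mul_comm]
  congr 1
  rw [fourier_coe_apply, ← Complex.exp_conj, ee]
  congr 1
  simp [Complex.conj_ofNat]
  ring

open scoped ComplexConjugate in
lemma hasSum_conj_coef_mul_coef {U V : ℝ → ℂ} (hU : MemLp U 2 (volume.restrict (Set.Ioc 0 1)))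
    (hV : MemLp V 2 (volume.restrict (Set.Ioc 0 1))) :
    HasSum (fun y => conj (coef U y) * coef V y) (∫ t in (0:ℝ)..1, conj (U t) * V t) := by
  have e : ∀ {W : ℝ → ℂ}, MemLp W 2 (volume.restrict (Set.Ioc (0:ℝ) 1)) →
      MemLp (AddCircle.liftIoc 1 0 (fun t => conj (W t))) 2 (@AddCircle.haarAddCircle 1 _) := by
    intro W hW
    have h0 : MemLp (fun t => conj (W t)) 2 (volume.restrict (Set.Ioc (0:ℝ) (0 + 1))) := by
      rw [zero_add]
      exact hW.star
    exact h0.memLp_liftIoc.haarAddCircle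
  have h := lp.hasSum_inner (𝕜 := ℂ) (fourierBasis.repr (e hV).toLp) (fourierBasis.repr (e hU).toLp)
  rw [LinearIsometryEquiv.inner_map_map] at h
  convert! h using 1
  · funext y
    rw [fourierBasis_repr, fourierBasis_repr, fourierCoeff_congr_ae (e hV).coeFn_toLp,
      fourierCoeff_congr_ae (e hU).coeFn_toLp, coef_eq_conj_fourierCoeff, coef_eq_conj_fourierCoeff]
    simp 
  · rw [L2.inner_def]
    have h1 := AddCircle.integral_liftIoc_eq_intervalIntegral (T := 1) (t := 0) (f := fun t => conj (U t) * V t)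
    rw [zero_add] at h1
    have h2 := AddCircle.integral_haarAddCircle (T := 1) (f := AddCircle.liftIoc 1 0 fun t => conj (U t) * V t)
    rw [inv_one, one_smul] at h2
    rw [← h1, ← h2]
    apply integral_congr_ae
    filter_upwards [(e hU).coeFn_toLp, (e hV).coeFn_toLp] with x h1 h2
    rw [h1, h2]
    have a1 := AddCircle.liftIoc_comp_apply (p := 1) (a := (0:ℝ)) (x := x) (f := fun t => (U t, V t)) (g := fun z => conj z.1 * z.2)
    have a2 := AddCircle.liftIoc_comp_apply (p := 1) (a := (0:ℝ)) (x := x) (f := fun t => (U t, V t)) (g := fun z => conj z.1)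
    have a3 := AddCircle.liftIoc_comp_apply (p := 1) (a := (0:ℝ)) (x := x) (f := fun t => (U t, V t)) (g := fun z => conj z.2)
    simp only [Function.comp_def] at a1 a2 a3
    rw [a1, a2, a3]
    simp [mul_comm]

lemma memℓp_coef {U : ℝ → ℂ} (hU : MemLp U 2 (volume.restrict (Set.Ioc 0 1))) : Memℓp (coef U) 2 := by
  refine memℓp_gen ?_
  have := (hasSum_conj_coef_mul_coef hU hU).summable.norm
  simpa [sq] using this

open Classical in
/-- The Fourier coefficients of a square integrable function, as an element of `ℓ²`. -/
noncomputable def coefL (U : ℝ → ℂ) : L2Z := if h : Memℓp (coef U) 2 then ⟨coef U, h⟩ else 0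

lemma coefL_apply {U : ℝ → ℂ} (hU : MemLp U 2 (volume.restrict (Set.Ioc 0 1))) (y : ℤ) :
    coefL U y = ∫ t in (0:ℝ)..1, U t * ee (y * t) := by
  rw [coefL, dif_pos (memℓp_coef hU)]
  rfl

open scoped ComplexConjugate in
lemma inner_coefL {U V : ℝ → ℂ} (hU : MemLp U 2 (volume.restrict (Set.Ioc 0 1)))
    (hV : MemLp V 2 (volume.restrict (Set.Ioc 0 1))) :
    inner ℂ (coefL U) (coefL V) = ∫ t in (0:ℝ)..1, conj (U t) * V t := by
  rw [lp.inner_eq_tsum, ← (hasSum_conj_coef_mul_coef hU hV).tsum_eq]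
  refine tsum_congr fun y => ?_
  rw [coefL_apply hU, coefL_apply hV, RCLike.inner_apply', coef, coef]

lemma norm_coefL_sq {U : ℝ → ℂ} (hU : MemLp U 2 (volume.restrict (Set.Ioc 0 1))) :
    ‖coefL U‖ ^ 2 = ∫ t in (0:ℝ)..1, ‖U t‖ ^ 2 := by
  have h := inner_coefL hU hU
  rw [inner_self_eq_norm_sq_to_K] at h
  have : (∫ t in (0:ℝ)..1, (starRingEnd ℂ) (U t) * U t) = ((∫ t in (0:ℝ)..1, ‖U t‖ ^ 2 : ℝ) : ℂ) := by
    rw [← intervalIntegral.integral_ofReal]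
    refine intervalIntegral.integral_congr fun t _ => ?_
    simp [Complex.conj_mul']
  rw [this] at h
  exact Complex.ofReal_injective (by simpa using h)

/-- A smooth function equal to `1` on `(-∞, -1/2]` and to `0` on `[-1/4, ∞)`. -/
noncomputable def rampR (x : ℝ) : ℝ := Real.smoothTransition (-4 * x - 1)

lemma rampR_one {x : ℝ} (h : x ≤ -1 / 2) : rampR x = 1 := Real.smoothTransition.one_of_one_le (by linarith)

lemma rampR_zero {x : ℝ} (h : -1 / 4 ≤ x) : rampR x = 0 := Real.smoothTransition.zero_of_nonpos (by linarith)

lemma rampR_contDiff : ContDiff ℝ (⊤ : ℕ∞) rampR :=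
  Real.smoothTransition.contDiff.comp ((contDiff_const.mul contDiff_id).sub contDiff_const)

/-- The profile whose averages over translates telescope to a step function. -/
noncomputable def bumpT (x : ℝ) : ℝ :=
  rampR (4 * x) - 1 / 4 * (rampR x + rampR (x + 1 / 4) + rampR (x + 1 / 2) + rampR (x + 3 / 4))

/-- The frequency profile of the second family of wave packets. -/
noncomputable def bumpB (τ : ℝ) : ℝ := bumpT (4 * τ - 2)

/-- The frequency profile of the first family of wave packets. -/
noncomputable def bumpA (τ : ℝ) : ℝ := Real.smoothTransition (16 * τ - 1) * Real.smoothTransition (63 - 128 * τ)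

/-- The frequency profile of a low pass filter. -/
noncomputable def bumpL (τ : ℝ) : ℝ := Real.smoothTransition (8 * τ + 1) * Real.smoothTransition (9 - 8 * τ)

lemma bumpT_of_le {x : ℝ} (h : x ≤ -5 / 4) : bumpT x = 0 := by
  unfold bumpT
  rw [rampR_one, rampR_one, rampR_one, rampR_one, rampR_one] <;> linarith

lemma bumpT_of_ge {x : ℝ} (h : -1 / 16 ≤ x) : bumpT x = 0 := by
  unfold bumpT
  rw [rampR_zero, rampR_zero, rampR_zero, rampR_zero, rampR_zero] <;> linarith

lemma bumpB_support {τ : ℝ} (h : bumpB τ ≠ 0) : 3 / 16 < τ ∧ τ < 31 / 64 := by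
  constructor
  · by_contra! hc
    exact h (bumpT_of_le (by linarith))
  · by_contra! hc
    exact h (bumpT_of_ge (by linarith))

lemma bumpA_support {τ : ℝ} (h : bumpA τ ≠ 0) : 1 / 16 < τ ∧ τ < 63 / 128 := by
  unfold bumpA at h
  constructor
  · by_contra! hc
    exact h (by rw [Real.smoothTransition.zero_of_nonpos (by linarith), zero_mul])
  · by_contra! hc
    exact h (by rw [Real.smoothTransition.zero_of_nonpos (x := 63 - 128 * τ) (by linarith), mul_zero])

lemma bumpL_support {τ : ℝ} (h : bumpL τ ≠ 0) : -1 / 8 < τ ∧ τ < 9 / 8 := by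
  unfold bumpL at h
  constructor
  · by_contra! hc
    exact h (by rw [Real.smoothTransition.zero_of_nonpos (by linarith), zero_mul])
  · by_contra! hc
    exact h (by rw [Real.smoothTransition.zero_of_nonpos (x := 9 - 8 * τ) (by linarith), mul_zero])

lemma bumpA_mul_bumpB (τ : ℝ) : bumpA τ * bumpB τ = bumpB τ := by
  by_cases h : bumpB τ = 0
  · simp [h]
  obtain ⟨h1, h2⟩ := bumpB_support h
  unfold bumpA
  rw [Real.smoothTransition.one_of_one_le (by linarith), Real.smoothTransition.one_of_one_le (by linarith)]
  simp

lemma bumpL_eq_one {τ : ℝ} (h0 : 0 ≤ τ) (h1 : τ ≤ 1) : bumpL τ = 1 := by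
  unfold bumpL
  rw [Real.smoothTransition.one_of_one_le (by linarith), Real.smoothTransition.one_of_one_le (by linarith), one_mul]

lemma bumpB_contDiff : ContDiff ℝ (⊤ : ℕ∞) bumpB := by
  have hT : ContDiff ℝ (⊤ : ℕ∞) bumpT := by
    unfold bumpT
    have := rampR_contDiff
    fun_prop
  unfold bumpB
  fun_prop

lemma bumpA_contDiff : ContDiff ℝ (⊤ : ℕ∞) bumpA := by
  have : ContDiff ℝ (⊤ : ℕ∞) Real.smoothTransition := Real.smoothTransition.contDiff
  unfold bumpA
  fun_prop

lemma bumpL_contDiff : ContDiff ℝ (⊤ : ℕ∞) bumpL := by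
  have : ContDiff ℝ (⊤ : ℕ∞) Real.smoothTransition := Real.smoothTransition.contDiff
  unfold bumpL
  fun_prop

/-- The inverse Fourier transform of a real function. -/
noncomputable def chk (χ : ℝ → ℝ) (x : ℝ) : ℂ := ∫ τ, (χ τ : ℂ) * ee (x * τ)

lemma exists_chk_bound {χ : ℝ → ℝ} {a b : ℝ} (hs : ContDiff ℝ (⊤ : ℕ∞) χ) (hc : ∀ τ, χ τ ≠ 0 → a < τ ∧ τ < b) :
    ∃ C : ℝ, 0 < C ∧ ∀ x, ‖chk χ x‖ ≤ C * wt x ^ 10 ∧ HasDerivAt (chk χ) (deriv (chk χ) x) x ∧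
      ‖deriv (chk χ) x‖ ≤ C * wt x ^ 10 := by
  have hcs : HasCompactSupport (fun τ => (χ τ : ℂ)) := by
    refine HasCompactSupport.intro (K := Set.Icc a b) isCompact_Icc fun x hx => ?_
    by_contra h
    have := hc x (by simpa using h)
    exact hx ⟨this.1.le, this.2.le⟩
  let f : SchwartzMap ℝ ℂ := hcs.toSchwartzMap (Complex.ofRealCLM.contDiff.comp hs)
  let F : SchwartzMap ℝ ℂ := FourierTransformInv.fourierInv f
  have hF : (F : ℝ → ℂ) = chk χ := by
    funext x
    change (FourierTransformInv.fourierInv f : SchwartzMap ℝ ℂ) x = _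
    rw [SchwartzMap.fourierInv_coe, Real.fourierInv_eq', chk]
    refine integral_congr_ae (Filter.Eventually.of_forall fun τ => ?_)
    simp only [smul_eq_mul]
    rw [mul_comm]
    congr 1
    rw [ee]
    congr 1
    simp
  rw [← hF]
  have hb : ∀ k : ℕ, ∃ C : ℝ, 0 < C ∧ ∀ x, ‖iteratedDeriv k F x‖ ≤ C * wt x ^ 10 := by
    intro k
    refine ⟨|2 ^ 10 * (Finset.Iic (10, k)).sup (fun m : ℕ × ℕ => SchwartzMap.seminorm ℝ m.1 m.2) F| + 1, by positivity, fun x => ?_⟩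
    have := SchwartzMap.one_add_le_sup_seminorm_apply (𝕜 := ℝ) (m := (10, k)) (k := 10) (n := k) le_rfl le_rfl F x
    rw [norm_iteratedFDeriv_eq_norm_iteratedDeriv] at this
    have h0 : 0 < 1 + |x| := by positivity
    rw [Real.norm_eq_abs] at this
    rw [wt, inv_pow, ← div_eq_mul_inv, le_div_iff₀ (by positivity), mul_comm]
    exact this.trans ((le_abs_self _).trans (by simp))
  obtain ⟨C1, hC1, h1⟩ := hb 0
  obtain ⟨C2, hC2, h2⟩ := hb 1
  refine ⟨C1 + C2, by positivity, fun x => ⟨?_, F.hasDerivAt x, ?_⟩⟩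
  · have := h1 x
    rw [iteratedDeriv_zero] at this
    have h3 : 0 ≤ C2 * wt x ^ 10 := by have := wt_nonneg x; positivity
    linarith
  · have := h2 x
    rw [iteratedDeriv_one] at this
    have h3 : 0 ≤ C1 * wt x ^ 10 := by have := wt_nonneg x; positivity
    linarith

/-- Frequency intervals contained in the middle half of `[0, 1]`. -/
def GoodIdx (i : ℕ) (m : ℤ) : Prop := 1 ≤ i ∧ 4 ^ i ≤ 4 * m ∧ 4 * (m + 1) ≤ 3 * 4 ^ i

lemma GoodIdx.bounds {i : ℕ} {m : ℤ} (h : GoodIdx i m) {t : ℝ} (h0 : -1 / 8 < 4 ^ i * t - m) (h1 : 4 ^ i * t - m < 9 / 8) :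
    0 < t ∧ t < 1 := by
  obtain ⟨hi, hl, hr⟩ := h
  have hl' : (4:ℝ) ^ i ≤ 4 * m := by exact_mod_cast hl
  have hr' : (4:ℝ) * (m + 1) ≤ 3 * 4 ^ i := by exact_mod_cast hr
  have h4 : (4:ℝ) ≤ 4 ^ i := by
    calc (4:ℝ) = 4 ^ 1 := (pow_one _).symm
      _ ≤ 4 ^ i := pow_le_pow_right₀ (by norm_num) hi
  constructor
  · have : 0 < 4 ^ i * t := by linarith
    exact pos_of_mul_pos_right this (by positivity)
  · have : (4:ℝ) ^ i * t < 4 ^ i * 1 := by linarith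
    exact lt_of_mul_lt_mul_left this (by positivity)

lemma ee_int (n : ℤ) : ee n = 1 := by
  unfold ee
  rw [Complex.exp_eq_one_iff]
  exact ⟨n, by push_cast; ring⟩

lemma continuous_ee : Continuous ee := by unfold ee; fun_prop

lemma memLp_of_continuous {U : ℝ → ℂ} (h : Continuous U) : MemLp U 2 (volume.restrict (Set.Ioc 0 1)) := by
  obtain ⟨C, hC⟩ := (isCompact_Icc (a := (0:ℝ)) (b := 1)).exists_bound_of_continuousOn h.continuousOn
  refine MemLp.of_bound h.aestronglyMeasurable C ?_
  refine (ae_restrict_iff' measurableSet_Ioc).2 (Filter.Eventually.of_forall fun x hx => hC x ⟨hx.1.le, hx.2⟩)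

lemma integral_scaled {χ : ℝ → ℝ} (hs : ∀ τ, χ τ ≠ 0 → -1 / 8 < τ ∧ τ < 9 / 8) {i : ℕ} {m : ℤ} (h : GoodIdx i m) (x : ℝ) :
    ∫ t in (0:ℝ)..1, (χ (4 ^ i * t - m) : ℂ) * ee (x * t) = (4 ^ i)⁻¹ * ee (m * x / 4 ^ i) * chk χ (x / 4 ^ i) := by
  have h4 : (0:ℝ) < 4 ^ i := by positivity
  rw [intervalIntegral.integral_eq_integral_of_support_subset]
  · have e1 : ∀ t : ℝ, (χ (4 ^ i * t - m) : ℂ) * ee (x * t) =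
        (fun s => (fun τ => (χ τ : ℂ) * ee (x * ((τ + m) / 4 ^ i))) (s - m)) (4 ^ i * t) := by
      intro t
      simp only [sub_add_cancel]
      rw [mul_div_cancel_left₀ _ h4.ne']
    rw [integral_congr_ae (Filter.Eventually.of_forall e1), Measure.integral_comp_mul_left (fun s => (fun τ => (χ τ : ℂ) * ee (x * ((τ + m) / 4 ^ i))) (s - m)), integral_sub_right_eq_self (fun τ => (χ τ : ℂ) * ee (x * ((τ + m) / 4 ^ i))),
      abs_of_pos (by positivity), chk, mul_assoc, ← integral_const_mul]
    rw [Complex.real_smul]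
    push_cast
    congr 1
    refine integral_congr_ae (Filter.Eventually.of_forall fun τ => ?_)
    simp only
    rw [mul_left_comm, ← ee_add]
    congr 2
    ring
  · intro t ht
    have h1 : χ (4 ^ i * t - m) ≠ 0 := by
      intro h0
      exact ht (by simp [h0])
    have := h.bounds (hs _ h1).1 (hs _ h1).2
    exact ⟨this.1, this.2.le⟩

/-- The function on the frequency side underlying a wave packet. -/
noncomputable def packU (χ : ℝ → ℝ) (P : Tile) (t : ℝ) : ℂ :=
  2 ^ P.i * χ (4 ^ P.i * t - P.m) * ee (-(P.k * 4 ^ P.i * t))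

open Classical in
/-- The wave packet with profile `χ`. -/
noncomputable def pack (χ : ℝ → ℝ) (P : Tile) : L2Z := if GoodIdx P.i P.m then coefL (packU χ P) else 0

lemma pack_of_good (χ : ℝ → ℝ) {P : Tile} (h : GoodIdx P.i P.m) : pack χ P = coefL (packU χ P) := if_pos h

lemma pack_of_not (χ : ℝ → ℝ) {P : Tile} (h : ¬ GoodIdx P.i P.m) : pack χ P = 0 := if_neg h

lemma continuous_packU {χ : ℝ → ℝ} (h : Continuous χ) (P : Tile) : Continuous (packU χ P) := by
  unfold packU
  have := continuous_ee
  fun_prop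

lemma pack_apply {χ : ℝ → ℝ} (hχ : Continuous χ) (hs : ∀ τ, χ τ ≠ 0 → -1 / 8 < τ ∧ τ < 9 / 8) {P : Tile}
    (h : GoodIdx P.i P.m) (y : ℤ) :
    pack χ P y = (2 ^ P.i)⁻¹ * ee (P.m * (y - P.k * 4 ^ P.i) / 4 ^ P.i) * chk χ ((y - P.k * 4 ^ P.i) / 4 ^ P.i) := by
  rw [pack_of_good χ h, coefL_apply (memLp_of_continuous (continuous_packU hχ P))]
  have e : ∀ t : ℝ, packU χ P t * ee (y * t) = 2 ^ P.i * ((χ (4 ^ P.i * t - P.m) : ℂ) * ee ((y - P.k * 4 ^ P.i) * t)) := by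
    intro t
    rw [packU, mul_assoc, mul_assoc, mul_assoc, ← ee_add]
    ring_nf
  simp_rw [e]
  rw [intervalIntegral.integral_const_mul, integral_scaled hs h]
  have : (4:ℂ) ^ P.i = 2 ^ P.i * 2 ^ P.i := by rw [← mul_pow]; norm_num
  rw [this]
  field_simp

lemma pack_packets {χ : ℝ → ℝ} (hχ : Continuous χ) (hs : ∀ τ, χ τ ≠ 0 → 1 / 16 < τ ∧ τ < 63 / 128)
    {C : ℝ} (hC : 0 < C) (hb : ∀ x, ‖chk χ x‖ ≤ C * wt x ^ 10) : Packets C (pack χ) := by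
  have hs' : ∀ τ, χ τ ≠ 0 → -1 / 8 < τ ∧ τ < 9 / 8 := fun τ h => by
    have := hs τ h
    constructor <;> linarith [this.1, this.2]
  constructor
  · intro P y
    by_cases h : GoodIdx P.i P.m
    · rw [pack_apply hχ hs' h, norm_mul, norm_mul, norm_ee, mul_one, Tile.w, mul_comm C, mul_assoc]
      simp only [norm_inv, norm_pow, Complex.norm_ofNat]
      gcongr
      exact hb _
    · rw [pack_of_not χ h]
      simp only [lp.coeFn_zero, Pi.zero_apply, norm_zero]
      have : 0 ≤ P.w y := wt_nonneg _
      positivity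
  · intro P Q hd
    by_cases hP : GoodIdx P.i P.m
    · by_cases hQ : GoodIdx Q.i Q.m
      · rw [pack_of_good χ hP, pack_of_good χ hQ, inner_coefL (memLp_of_continuous (continuous_packU hχ P))
          (memLp_of_continuous (continuous_packU hχ Q))]
        rw [← intervalIntegral.integral_zero (a := 0) (b := 1) (E := ℂ) (μ := volume)]
        refine intervalIntegral.integral_congr fun t _ => ?_
        simp only [packU]
        by_cases h1 : χ (4 ^ P.i * t - P.m) = 0
        · simp [h1]
        by_cases h2 : χ (4 ^ Q.i * t - Q.m) = 0
        · simp [h2]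
        exfalso
        have hd' : t ∈ P.spt → t ∉ Q.spt := fun h => Set.disjoint_left.1 hd h
        refine hd' ?_ ?_
        · have := hs _ h1
          constructor <;> linarith [this.1, this.2]
        · have := hs _ h2
          constructor <;> linarith [this.1, this.2]
      · rw [pack_of_not χ hQ, inner_zero_right]
    · rw [pack_of_not χ hP, inner_zero_left]

lemma pack_lip {χ : ℝ → ℝ} (hχ : Continuous χ) (hs : ∀ τ, χ τ ≠ 0 → 1 / 16 < τ ∧ τ < 63 / 128)
    {C : ℝ} (hC : 0 < C) (hb : ∀ x, ‖chk χ x‖ ≤ C * wt x ^ 10 ∧ HasDerivAt (chk χ) (deriv (chk χ) x) x ∧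
      ‖deriv (chk χ) x‖ ≤ C * wt x ^ 10) (P : Tile) (ξ : ℝ) (hξ : ξ ∈ P.om) (y z : ℤ) (r : ℝ)
    (hw : ∀ x : ℝ, x ∈ Set.uIcc (y : ℝ) z → wt ((x - P.k * 4 ^ P.i) / 4 ^ P.i) ≤ r) :
    ‖pack χ P y * ee (-(ξ * y)) - pack χ P z * ee (-(ξ * z))‖ ≤
      8 * C * (2 ^ P.i)⁻¹ * (|(y : ℝ) - z| / 4 ^ P.i) * r ^ 10 := by
  by_cases h : GoodIdx P.i P.m
  swap
  · rw [pack_of_not χ h]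
    simp only [lp.coeFn_zero, Pi.zero_apply, zero_mul, sub_zero, norm_zero]
    have := pow_nonneg ((wt_nonneg _).trans (hw y Set.left_mem_uIcc)) 10
    positivity
  have hs' : ∀ τ, χ τ ≠ 0 → -1 / 8 < τ ∧ τ < 9 / 8 := fun τ h => by
    have := hs τ h
    constructor <;> linarith [this.1, this.2]
  have h4 : (0:ℝ) < 4 ^ P.i := by positivity
  set s : ℝ := ξ * 4 ^ P.i - P.m with hsd
  obtain ⟨hs0, hs1⟩ := mem_om_iff.1 hξ
  have hs0 : 0 ≤ s := by linarith
  have hs1 : s ≤ 1 := by linarith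
  have e : ∀ y : ℤ, pack χ P y * ee (-(ξ * y)) = (2 ^ P.i)⁻¹ * ee (-(ξ * P.k * 4 ^ P.i)) *
      (chk χ ((y - P.k * 4 ^ P.i) / 4 ^ P.i) * ee (-(s * ((y - P.k * 4 ^ P.i) / 4 ^ P.i)))) := by
    intro y
    rw [pack_apply hχ hs' h]
    have : ee (P.m * (y - P.k * 4 ^ P.i) / 4 ^ P.i) * ee (-(ξ * y)) = ee (-(ξ * P.k * 4 ^ P.i)) *
        ee (-(s * ((y - P.k * 4 ^ P.i) / 4 ^ P.i))) := by
      rw [← ee_add, ← ee_add, hsd]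
      congr 1
      field_simp
      ring
    linear_combination ((2 ^ P.i)⁻¹ * chk χ ((y - P.k * 4 ^ P.i) / 4 ^ P.i)) * this
  rw [e, e, ← mul_sub, norm_mul, norm_mul, norm_ee, mul_one]
  simp only [norm_inv, norm_pow, Complex.norm_ofNat]
  have hee : ∀ x : ℝ, HasDerivAt (fun x : ℝ => ee (-(s * x))) (ee (-(s * x)) * (-(2 * Real.pi * s * Complex.I))) x := by
    intro x
    unfold ee
    have h1 : HasDerivAt (fun x : ℝ => (2 * Real.pi * ((-(s * x) : ℝ) : ℂ) * Complex.I)) (-(2 * Real.pi * s * Complex.I)) x := by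
      have h2 : HasDerivAt (fun x : ℝ => (x : ℂ)) 1 x := Complex.ofRealCLM.hasDerivAt
      have h3 := h2.const_mul (-(2 * Real.pi * s * Complex.I))
      rw [mul_one] at h3
      refine h3.congr_of_eventuallyEq (Filter.Eventually.of_forall fun x => ?_)
      push_cast
      ring
    exact h1.cexp
  have key := Convex.norm_image_sub_le_of_norm_hasDerivWithin_le (C := 8 * C * r ^ 10)
    (s := Set.uIcc (((y:ℝ) - P.k * 4 ^ P.i) / 4 ^ P.i) (((z:ℝ) - P.k * 4 ^ P.i) / 4 ^ P.i))
    (f := fun x => chk χ x * ee (-(s * x)))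
    (fun x _ => ((hb x).2.1.mul (hee x)).hasDerivWithinAt) ?_ (convex_uIcc _ _) Set.right_mem_uIcc Set.left_mem_uIcc
  · refine (mul_le_mul_of_nonneg_left key (by positivity)).trans (le_of_eq ?_)
    rw [← sub_div, sub_sub_sub_cancel_right, Real.norm_eq_abs, abs_div, abs_of_pos h4]
    ring
  · intro x hx
    have hwx : wt x ≤ r := by
      have := hw (x * 4 ^ P.i + P.k * 4 ^ P.i) ?_
      · rwa [add_sub_cancel_right, mul_div_cancel_right₀ _ h4.ne'] at this
      · rw [Set.mem_uIcc] at hx ⊢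
        rw [div_le_iff₀ h4, le_div_iff₀ h4, div_le_iff₀ h4, le_div_iff₀ h4] at hx
        rcases hx with hx | hx
        · left; constructor <;> linarith [hx.1, hx.2]
        · right; constructor <;> linarith [hx.1, hx.2]
    have hwr : wt x ^ 10 ≤ r ^ 10 := pow_le_pow_left₀ (wt_nonneg x) hwx 10
    have h1 := (hb x).1
    have h2 := (hb x).2.2
    have hr10 : 0 ≤ r ^ 10 := (pow_nonneg (wt_nonneg x) 10).trans hwr
    refine (norm_add_le _ _).trans ?_
    rw [norm_mul, norm_mul, norm_mul, norm_ee, mul_one, one_mul]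
    have h3 : ‖(-(2 * Real.pi * s * Complex.I) : ℂ)‖ ≤ 7 := by
      simp only [norm_neg, norm_mul, Complex.norm_ofNat, Complex.norm_real, Complex.norm_I, mul_one, Real.norm_eq_abs,
        abs_of_pos Real.pi_pos, abs_of_nonneg hs0]
      have := Real.pi_lt_d2
      nlinarith [Real.pi_pos]
    have h5 : C * wt x ^ 10 ≤ C * r ^ 10 := by gcongr
    have h6 : ‖chk χ x‖ * ‖(-(2 * Real.pi * s * Complex.I) : ℂ)‖ ≤ (C * r ^ 10) * 7 :=
      mul_le_mul (h1.trans h5) h3 (norm_nonneg _) (by positivity)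
    linarith

lemma GoodIdx.of_om_subset {i j : ℕ} {m n : ℤ} (h : GoodIdx i m) (hs : om j n ⊆ om i m) (hij : i ≤ j) : GoodIdx j n := by
  obtain ⟨hi, hl, hr⟩ := h
  have h4 : (0:ℝ) < 4 ^ j := by positivity
  have h0 : ((n:ℝ) / 4 ^ j) ∈ om j n := by
    rw [mem_om_iff, div_mul_cancel₀ _ h4.ne']; constructor <;> linarith
  obtain ⟨h1, h2⟩ := mem_om_iff.1 (hs h0)
  obtain ⟨l, rfl⟩ := Nat.exists_eq_add_of_le hij
  have e : (n:ℝ) / 4 ^ (i + l) * 4 ^ i = n / 4 ^ l := by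
    rw [pow_add]; field_simp
  rw [e] at h1 h2
  have hl0 : (0:ℝ) < 4 ^ l := by positivity
  rw [le_div_iff₀ hl0] at h1
  rw [div_lt_iff₀ hl0] at h2
  have h1' : m * 4 ^ l ≤ n := by exact_mod_cast h1
  have h2' : n < (m + 1) * 4 ^ l := by exact_mod_cast h2
  have hl0' : (0:ℤ) < 4 ^ l := by positivity
  refine ⟨by omega, ?_, ?_⟩
  · rw [pow_add]; nlinarith
  · rw [pow_add]; nlinarith

lemma GoodIdx.of_subset_om {i j : ℕ} {m n : ℤ} (h : GoodIdx j n) (hs : om j n ⊆ om i m) (hij : i ≤ j) (hi : 1 ≤ i) :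
    GoodIdx i m := by
  obtain ⟨hj, hl, hr⟩ := h
  have h4 : (0:ℝ) < 4 ^ j := by positivity
  have h0 : ((n:ℝ) / 4 ^ j) ∈ om j n := by
    rw [mem_om_iff, div_mul_cancel₀ _ h4.ne']; constructor <;> linarith
  obtain ⟨h1, h2⟩ := mem_om_iff.1 (hs h0)
  obtain ⟨l, rfl⟩ := Nat.exists_eq_add_of_le hij
  have e : (n:ℝ) / 4 ^ (i + l) * 4 ^ i = n / 4 ^ l := by
    rw [pow_add]; field_simp
  rw [e] at h1 h2
  have hl0 : (0:ℝ) < 4 ^ l := by positivity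
  rw [le_div_iff₀ hl0] at h1
  rw [div_lt_iff₀ hl0] at h2
  have h1' : m * 4 ^ l ≤ n := by exact_mod_cast h1
  have h2' : n < (m + 1) * 4 ^ l := by exact_mod_cast h2
  have hl0' : (0:ℤ) < 4 ^ l := by positivity
  obtain ⟨q, rfl⟩ := Nat.exists_eq_add_of_le hi
  rw [pow_add] at hl hr
  have e4 : (4:ℤ) ^ (1 + q) = 4 * 4 ^ q := by rw [pow_add, pow_one]
  rw [e4] at hl hr
  refine ⟨by omega, ?_, ?_⟩
  · rw [e4]
    have : (4:ℤ) ^ q * 4 ^ l < (m + 1) * 4 ^ l := by nlinarith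
    have := lt_of_mul_lt_mul_right this hl0'.le
    omega
  · rw [e4]
    have : m * 4 ^ l < 3 * 4 ^ q * 4 ^ l := by nlinarith
    have := lt_of_mul_lt_mul_right this hl0'.le
    omega

open scoped ComplexConjugate in
lemma tsum_pack_mul_coef {χ χ' : ℝ → ℝ} (hχ : Continuous χ) (hχ' : Continuous χ') {P : Tile} (h : GoodIdx P.i P.m)
    (i : ℕ) (m : ℤ) (y : ℤ) :
    ∑' z, pack χ P z * coef (fun t => (χ' (4 ^ i * t - m) : ℂ)) (y - z) =
      ∫ t in (0:ℝ)..1, χ' (4 ^ i * t - m) * packU χ P t * ee (y * t) := by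
  set W : ℝ → ℂ := fun t => χ' (4 ^ i * t - m) * ee (-(y * t)) with hW
  have hWc : Continuous W := by
    have := continuous_ee
    rw [hW]; fun_prop
  have h1 := inner_coefL (memLp_of_continuous hWc) (memLp_of_continuous (continuous_packU hχ P))
  rw [lp.inner_eq_tsum] at h1
  rw [pack_of_good χ h]
  calc _ = ∑' z, inner ℂ (coefL W z) (coefL (packU χ P) z) := by
        refine tsum_congr fun z => ?_
        rw [RCLike.inner_apply', mul_comm]
        congr 1
        rw [coefL_apply (memLp_of_continuous hWc), coef, conj_intervalIntegral]
        refine intervalIntegral.integral_congr fun t _ => ?_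
        simp only [hW, map_mul, conj_ee, Complex.conj_ofReal, neg_neg]
        rw [mul_assoc, ← ee_add]
        push_cast
        ring_nf
    _ = _ := h1
    _ = _ := by
        refine intervalIntegral.integral_congr fun t _ => ?_
        simp only [hW, map_mul, conj_ee, Complex.conj_ofReal, neg_neg]
        ring

lemma exists_lowpass {C : ℝ} (hC : 1 ≤ C) (hb : ∀ x, ‖chk bumpL x‖ ≤ C * wt x ^ 10) (i : ℕ) (m : ℤ) :
    ∃ κ : ℤ → ℂ, (∀ y : ℤ, ‖κ y‖ ≤ C * (4 ^ i)⁻¹ * wt (y / 4 ^ i) ^ 2) ∧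
    ∀ P : Tile, (i ≤ P.i → P.om ⊆ om i m → ∀ y, ∑' z, pack bumpB P z * κ (y - z) = pack bumpB P y) ∧
      (P.i + 2 ≤ i → om i m ⊆ P.om2 → ∀ y, ∑' z, pack bumpB P z * κ (y - z) = 0) := by
  have hB := bumpB_contDiff.continuous
  by_cases hg : GoodIdx i m
  · refine ⟨coef fun t => (bumpL (4 ^ i * t - m) : ℂ), fun y => ?_, fun P => ⟨fun hi hs y => ?_, fun hi hs y => ?_⟩⟩
    · rw [coef, integral_scaled (fun τ h => bumpL_support h) hg, norm_mul, norm_mul, norm_ee, mul_one, mul_comm C, mul_assoc]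
      simp only [norm_inv, norm_pow, Complex.norm_ofNat]
      gcongr
      refine (hb _).trans ?_
      exact mul_le_mul_of_nonneg_left (wt_pow_le (by norm_num : 2 ≤ 10) _) (by linarith)
    · have hP := hg.of_om_subset hs hi
      rw [tsum_pack_mul_coef hB bumpL_contDiff.continuous hP, pack_of_good _ hP,
        coefL_apply (memLp_of_continuous (continuous_packU hB P))]
      refine intervalIntegral.integral_congr fun t _ => ?_
      simp only [packU]
      by_cases h0 : bumpB (4 ^ P.i * t - P.m) = 0
      · simp [h0]
      have h1 := bumpB_support h0
      have ht : t ∈ P.om := mem_om_iff.2 ⟨by linarith, by linarith⟩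
      have h2 := mem_om_iff.1 (hs ht)
      rw [bumpL_eq_one (by linarith) (by linarith)]
      simp
    · by_cases hP : GoodIdx P.i P.m
      · rw [tsum_pack_mul_coef hB bumpL_contDiff.continuous hP,
          ← intervalIntegral.integral_zero (a := 0) (b := 1) (E := ℂ) (μ := volume)]
        refine intervalIntegral.integral_congr fun t _ => ?_
        simp only [packU]
        by_cases h0 : bumpB (4 ^ P.i * t - P.m) = 0
        · simp [h0]
        by_cases h1 : bumpL (4 ^ i * t - m) = 0
        · simp [h1]
        exfalso
        have h2 := bumpB_support h0
        have h3 := bumpL_support h1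
        have h4 : (0:ℝ) < 4 ^ i := by positivity
        have h5 : ((m:ℝ) / 4 ^ i) ∈ om i m := by
          rw [mem_om_iff, div_mul_cancel₀ _ h4.ne']; constructor <;> linarith
        have h6 := (mem_om_iff.1 (hs h5)).1
        obtain ⟨l, rfl⟩ := Nat.exists_eq_add_of_le hi
        push_cast at h6
        have h7 : (m:ℝ) / 4 ^ (P.i + 2 + l) * 4 ^ (P.i + 2) = m / 4 ^ l := by
          rw [pow_add]; field_simp
        rw [h7, le_div_iff₀ (by positivity)] at h6
        have h8 : (4:ℝ) ^ (P.i + 2 + l) = 16 * 4 ^ P.i * 4 ^ l := by rw [pow_add, pow_add]; ring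
        rw [h8] at h3
        have h9 : (1:ℝ) ≤ 4 ^ l := one_le_pow₀ (by norm_num)
        nlinarith
      · rw [pack_of_not _ hP]
        simp
  · by_cases hi0 : i = 0
    · subst hi0
      refine ⟨fun y => if y = 0 then 1 else 0, fun y => ?_, fun P => ⟨fun _ _ y => ?_, fun hi => by omega⟩⟩
      · by_cases hy : y = 0
        · subst hy
          simpa [wt] using hC
        · simp only [if_neg hy, norm_zero]
          have : 0 ≤ C := by linarith
          positivity
      · rw [tsum_eq_single y]
        · simp
        · intro z hz
          simp only [if_neg (show ¬ y - z = 0 by omega), mul_zero]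
    · refine ⟨0, fun y => ?_, fun P => ⟨fun hi hs y => ?_, fun hi hs y => ?_⟩⟩
      · simp only [Pi.zero_apply, norm_zero]
        have : 0 ≤ C := by linarith
        positivity
      · rw [pack_of_not _ fun hP : GoodIdx P.i P.m => hg (hP.of_subset_om hs hi (by omega))]
        simp
      · simp

theorem exists_wavePackets : ∃ C : ℝ, 0 < C ∧ WavePackets C (pack bumpA) (pack bumpB) := by
  obtain ⟨Ca, hCa, ha⟩ := exists_chk_bound bumpA_contDiff fun τ h => bumpA_support h
  obtain ⟨Cb, hCb, hb⟩ := exists_chk_bound bumpB_contDiff fun τ h => bumpB_support h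
  obtain ⟨Cl, hCl, hl⟩ := exists_chk_bound bumpL_contDiff fun τ h => bumpL_support h
  have hbs : ∀ τ, bumpB τ ≠ 0 → 1 / 16 < τ ∧ τ < 63 / 128 := fun τ h => by
    have := bumpB_support h
    constructor <;> linarith [this.1, this.2]
  have mono : ∀ {D x : ℝ} {u : ℂ}, ‖u‖ ≤ D * wt x ^ 10 → D ≤ 8 * Ca + Cb + Cl + 1 → ‖u‖ ≤ (8 * Ca + Cb + Cl + 1) * wt x ^ 10 :=
    fun h hD => h.trans (mul_le_mul_of_nonneg_right hD (pow_nonneg (wt_nonneg _) 10))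
  refine ⟨8 * Ca + Cb + Cl + 1, by positivity, by positivity, ?_, ?_, ?_, ?_⟩
  · exact pack_packets bumpA_contDiff.continuous (fun τ h => bumpA_support h) (by positivity)
      fun x => mono (ha x).1 (by linarith)
  · exact pack_packets bumpB_contDiff.continuous hbs (by positivity) fun x => mono (hb x).1 (by linarith)
  · intro P ξ hξ y z r hr hw
    refine (pack_lip bumpA_contDiff.continuous (fun τ h => bumpA_support h) hCa ha P ξ hξ y z r hw).trans ?_
    gcongr
    linarith
  · exact exists_lowpass (by linarith) fun x => mono (hl x).1 (by linarith)

lemma memLp_of_bdd {U : ℝ → ℂ} (hm : Measurable U) {M : ℝ} (hb : ∀ t, ‖U t‖ ≤ M) :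
    MemLp U 2 (volume.restrict (Set.Ioc 0 1)) :=
  MemLp.of_bound hm.aestronglyMeasurable M (Filter.Eventually.of_forall hb)

lemma GoodIdx.integral_eq {i : ℕ} {m : ℤ} (h : GoodIdx i m) {f : ℝ → ℂ} (hf : ∀ t, f t ≠ 0 → 0 < 4 ^ i * t - m ∧ 4 ^ i * t - m < 1) :
    ∫ t in (0:ℝ)..1, f t = (4 ^ i)⁻¹ * ∫ τ in (0:ℝ)..1, f ((τ + m) / 4 ^ i) := by
  have h4 : (0:ℝ) < 4 ^ i := by positivity
  rw [intervalIntegral.integral_eq_integral_of_support_subset, intervalIntegral.integral_eq_integral_of_support_subset]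
  · have e1 : ∀ t : ℝ, f t = (fun s => (fun τ => f ((τ + m) / 4 ^ i)) (s - m)) (4 ^ i * t) := by
      intro t
      simp only [sub_add_cancel]
      rw [mul_div_cancel_left₀ _ h4.ne']
    rw [integral_congr_ae (Filter.Eventually.of_forall e1), Measure.integral_comp_mul_left (fun s => (fun τ => f ((τ + m) / 4 ^ i)) (s - m)),
      integral_sub_right_eq_self (fun τ => f ((τ + m) / 4 ^ i)), abs_of_pos (by positivity), Complex.real_smul]
    push_cast
    rfl
  · intro τ hτ
    have := hf _ hτ
    rw [mul_div_cancel₀ _ h4.ne'] at this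
    simp only [add_sub_cancel_right] at this
    exact ⟨this.1, this.2.le⟩
  · intro t ht
    have := hf _ ht
    have := h.bounds (by linarith [this.1] : -1 / 8 < 4 ^ i * t - m) (by linarith [this.2])
    exact ⟨this.1, this.2.le⟩

lemma exists_bound_bump {χ : ℝ → ℝ} (hχ : Continuous χ) {a b : ℝ} (hs : ∀ τ, χ τ ≠ 0 → a < τ ∧ τ < b) :
    ∃ C, ∀ τ, |χ τ| ≤ C := by
  obtain ⟨C, hC⟩ := (isCompact_Icc (a := a) (b := b)).exists_bound_of_continuousOn hχ.continuousOn
  refine ⟨max C 0, fun τ => ?_⟩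
  by_cases h : χ τ = 0
  · simp [h]
  · exact (hC τ ⟨(hs τ h).1.le, (hs τ h).2.le⟩).trans (le_max_left _ _)

open scoped ComplexConjugate in
lemma hasSum_packets {i : ℕ} {m : ℤ} (h : GoodIdx i m) {U : ℝ → ℂ} (hm : Measurable U) {M : ℝ} (hb : ∀ t, ‖U t‖ ≤ M) (y : ℤ) :
    HasSum (fun k : ℤ => inner ℂ (pack bumpA ⟨i, k, m⟩) (coefL U) * pack bumpB ⟨i, k, m⟩ y)
      (∫ t in (0:ℝ)..1, bumpB (4 ^ i * t - m) * U t * ee (y * t)) := by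
  have hU := memLp_of_bdd hm hb
  have hA := bumpA_contDiff.continuous
  have hB := bumpB_contDiff.continuous
  have h4 : (4:ℝ) ^ i ≠ 0 := by positivity
  have hA01 : ∀ τ, bumpA τ ≠ 0 → 0 < τ ∧ τ < 1 := fun τ h => by
    have := bumpA_support h
    constructor <;> linarith [this.1, this.2]
  have hB01 : ∀ τ, bumpB τ ≠ 0 → 0 < τ ∧ τ < 1 := fun τ h => by
    have := bumpB_support h
    constructor <;> linarith [this.1, this.2]
  obtain ⟨Ca, hCa⟩ := exists_bound_bump hA hA01
  set B : ℝ → ℂ := fun τ => bumpB τ * ee (-(y * ((τ + m) / 4 ^ i))) with hBdef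
  set V : ℝ → ℂ := fun τ => bumpA τ * U ((τ + m) / 4 ^ i) with hVdef
  have hBm : MemLp B 2 (volume.restrict (Set.Ioc 0 1)) := by
    refine memLp_of_continuous ?_
    have := continuous_ee
    rw [hBdef]; fun_prop
  have hVm : MemLp V 2 (volume.restrict (Set.Ioc 0 1)) := by
    refine memLp_of_bdd (M := Ca * M) ?_ fun τ => ?_
    · have := hA.measurable
      rw [hVdef]; fun_prop
    · rw [hVdef, norm_mul, Complex.norm_real, Real.norm_eq_abs]
      exact mul_le_mul (hCa _) (hb _) (norm_nonneg _) ((abs_nonneg _).trans (hCa 0))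
  have key := (hasSum_conj_coef_mul_coef hBm hVm).mul_left ((4 ^ i)⁻¹ : ℂ)
  have h22 : ((4:ℂ) ^ i)⁻¹ * 2 ^ i = (2 ^ i)⁻¹ := by
    have : (4:ℂ) ^ i = 2 ^ i * 2 ^ i := by rw [← mul_pow]; norm_num
    rw [this]; field_simp
  have e3 : ∀ (k : ℤ) (τ : ℝ), ee (k * 4 ^ i * ((τ + m) / 4 ^ i)) = ee (k * τ) := by
    intro k τ
    rw [show (k * 4 ^ i * ((τ + m) / 4 ^ i) : ℝ) = k * τ + ((k * m : ℤ) : ℝ) by push_cast; field_simp, ee_add, ee_int, mul_one]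
  convert! key using 1
  · funext k
    have e1 : inner ℂ (pack bumpA ⟨i, k, m⟩) (coefL U) = (2 ^ i)⁻¹ * coef V k := by
      rw [pack_of_good _ (P := ⟨i, k, m⟩) h, inner_coefL (memLp_of_continuous (continuous_packU hA _)) hU,
        h.integral_eq, coef, ← h22, mul_assoc, ← intervalIntegral.integral_const_mul (2 ^ i : ℂ)]
      · congr 1
        refine intervalIntegral.integral_congr fun τ _ => ?_
        simp only [packU, hVdef]
        rw [mul_div_cancel₀ _ h4, add_sub_cancel_right, map_mul, conj_ee, map_mul, Complex.conj_ofReal, map_pow,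
          Complex.conj_ofNat, neg_neg, e3]
        ring
      · intro t ht
        refine hA01 _ fun h0 => ht ?_
        simp [packU, h0]
    have e2 : pack bumpB ⟨i, k, m⟩ y = (2 ^ i)⁻¹ * conj (coef B k) := by
      rw [pack_of_good _ (P := ⟨i, k, m⟩) h, coefL_apply (memLp_of_continuous (continuous_packU hB _)),
        h.integral_eq, coef, ← h22, mul_assoc, conj_intervalIntegral, ← intervalIntegral.integral_const_mul (2 ^ i : ℂ)]
      · congr 1
        refine intervalIntegral.integral_congr fun τ _ => ?_
        simp only [packU, hBdef]
        rw [mul_div_cancel₀ _ h4, add_sub_cancel_right, map_mul, conj_ee, map_mul, Complex.conj_ofReal, conj_ee,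
          neg_neg, ← conj_ee (k * 4 ^ i * ((τ + m) / 4 ^ i)), e3, conj_ee]
        ring
      · intro t ht
        refine hB01 _ fun h0 => ht ?_
        simp [packU, h0]
    rw [e1, e2]
    have : ((4:ℂ) ^ i)⁻¹ = (2 ^ i)⁻¹ * (2 ^ i)⁻¹ := by rw [← mul_inv, ← mul_pow]; norm_num
    rw [this]
    ring
  · rw [h.integral_eq]
    · congr 1
      refine intervalIntegral.integral_congr fun τ _ => ?_
      simp only [hBdef, hVdef]
      rw [mul_div_cancel₀ _ h4, add_sub_cancel_right, map_mul, Complex.conj_ofReal, conj_ee, neg_neg]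
      have := bumpA_mul_bumpB τ
      have h2 : (bumpA τ : ℂ) * bumpB τ = bumpB τ := by exact_mod_cast this
      linear_combination (-(ee (y * ((τ + m) / 4 ^ i)) * U ((τ + m) / 4 ^ i))) * h2
    · intro t ht
      refine hB01 _ fun h0 => ht ?_
      simp [h0]

/-- The kernel of the model operator at one scale. -/
noncomputable def Bk (j : ℕ) (t N : ℝ) : ℝ :=
  open Classical in
  if 1 / 2 ≤ Int.fract (N * 4 ^ j) ∧ Int.fract (N * 4 ^ j) < 9 / 16 then
    bumpB (4 ^ j * (t - N) + Int.fract (N * 4 ^ j)) else 0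

lemma Bk_of_mem {j : ℕ} {N : ℝ} (h : N ∈ om (j + 2) (16 * ⌊N * 4 ^ j⌋ + 8)) (t : ℝ) :
    Bk j t N = bumpB (4 ^ j * t - ⌊N * 4 ^ j⌋) := by
  obtain ⟨h1, h2⟩ := mem_om_iff.1 h
  rw [pow_add] at h1 h2
  push_cast at h1 h2
  rw [Bk, if_pos]
  · congr 1
    rw [Int.fract]; ring
  · rw [Int.fract]
    constructor <;> linarith

lemma Bk_of_not_mem {j : ℕ} {N : ℝ} (h : N ∉ om (j + 2) (16 * ⌊N * 4 ^ j⌋ + 8)) (t : ℝ) : Bk j t N = 0 := by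
  rw [Bk, if_neg]
  rintro ⟨h1, h2⟩
  rw [Int.fract] at h1 h2
  refine h (mem_om_iff.2 ?_)
  rw [pow_add]
  push_cast
  constructor <;> linarith

lemma mem_om_unique {j : ℕ} {m : ℤ} {N : ℝ} (h : N ∈ om (j + 2) (16 * m + 8)) : m = ⌊N * 4 ^ j⌋ := by
  obtain ⟨h1, h2⟩ := mem_om_iff.1 h
  rw [pow_add] at h1 h2
  push_cast at h1 h2
  exact (Int.floor_eq_iff.2 ⟨by linarith, by linarith⟩).symm

lemma goodIdx_floor {j : ℕ} (hj : 1 ≤ j) {N : ℝ} (h0 : 1 / 4 ≤ N) (h1 : N < 3 / 4) : GoodIdx j ⌊N * 4 ^ j⌋ := by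
  obtain ⟨q, rfl⟩ := Nat.exists_eq_add_of_le hj
  have e4 : (4:ℤ) ^ (1 + q) = 4 * 4 ^ q := by rw [pow_add, pow_one]
  have hq : (0:ℝ) < 4 ^ q := by positivity
  have hl : (4:ℤ) ^ q ≤ ⌊N * 4 ^ (1 + q)⌋ := by
    rw [Int.le_floor, pow_add]; push_cast; nlinarith
  have hr : ⌊N * 4 ^ (1 + q)⌋ < 3 * 4 ^ q := by
    rw [Int.floor_lt, pow_add]; push_cast; nlinarith
  refine ⟨hj, ?_, ?_⟩ <;> rw [e4] <;> omega

lemma measurable_Bk (j : ℕ) : Measurable fun p : ℝ × ℝ => Bk j p.1 p.2 := by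
  unfold Bk
  have hf : Measurable fun p : ℝ × ℝ => Int.fract (p.2 * 4 ^ j) := by fun_prop
  refine Measurable.ite ?_ ?_ measurable_const
  · exact (measurableSet_le measurable_const hf).inter (measurableSet_lt hf measurable_const)
  · have := bumpB_contDiff.continuous.measurable
    fun_prop

lemma exists_abs_Bk_le : ∃ C : ℝ, ∀ j t N, |Bk j t N| ≤ C := by
  obtain ⟨C, hC⟩ := exists_bound_bump bumpB_contDiff.continuous fun τ h => bumpB_support h
  refine ⟨C, fun j t N => ?_⟩
  unfold Bk
  split_ifs
  · exact hC _
  · rw [abs_zero]; exact (abs_nonneg _).trans (hC 0)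

/-- The boundedness of the frequency side form of the model operator, for scales in a fixed parity class. -/
theorem exists_scale_bound_of_parity : ∃ K : ℝ, 0 < K ∧ ∀ (c : ℕ) (I : Finset ℕ), (∀ i ∈ I, 1 ≤ i) → (∀ i ∈ I, i % 2 = c) →
    ∀ (N : ℤ → ℝ) (G : Finset ℤ), (∀ y ∈ G, 1 / 4 ≤ N y ∧ N y < 3 / 4) →
    ∀ (U : ℝ → ℂ) (M : ℝ), Measurable U → (∀ t, ‖U t‖ ≤ M) →
    ∑ y ∈ G, ‖∑ i ∈ I, ∫ t in (0:ℝ)..1, Bk i t (N y) * U t * ee (y * t)‖ ^ 2 ≤ K * ∫ t in (0:ℝ)..1, ‖U t‖ ^ 2 := by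
  classical
  obtain ⟨C, hC, hW⟩ := exists_wavePackets
  obtain ⟨K, hK, hmain⟩ := exists_modelOp_bound hC
  refine ⟨K, hK, fun c I hI hpar N G hN U M hU hb => ?_⟩
  set A : Finset ℤ := (I ×ˢ G).image fun p => ⌊N p.2 * 4 ^ p.1⌋ with hA
  set Q : Finset ℤ → Finset Tile := fun S => ((I ×ˢ A) ×ˢ S).image fun p => ⟨p.1.1, p.2, p.1.2⟩ with hQ
  have hsparse : ∀ S, Sparse (Q S) := by
    intro S P hP P' hP' hlt
    simp only [hQ, Finset.mem_image, Finset.mem_product] at hP hP'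
    obtain ⟨p, hp, rfl⟩ := hP
    obtain ⟨p', hp', rfl⟩ := hP'
    have h1 := hpar _ hp.1.1
    have h2 := hpar _ hp'.1.1
    simp only at hlt ⊢
    omega
  have hexp : ∀ y ∈ G, ∀ S, modelOp N (pack bumpA) (pack bumpB) (Q S) (coefL U) y =
      ∑ i ∈ I, if N y ∈ om (i + 2) (16 * ⌊N y * 4 ^ i⌋ + 8) then
        ∑ k ∈ S, inner ℂ (pack bumpA ⟨i, k, ⌊N y * 4 ^ i⌋⟩) (coefL U) * pack bumpB ⟨i, k, ⌊N y * 4 ^ i⌋⟩ y else 0 := by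
    intro y hy S
    unfold modelOp
    rw [Finset.sum_filter, hQ, Finset.sum_image, Finset.sum_product, Finset.sum_product]
    · refine Finset.sum_congr rfl fun i hi => ?_
      rw [Finset.sum_eq_single ⌊N y * 4 ^ i⌋]
      · by_cases h : N y ∈ om (i + 2) (16 * ⌊N y * 4 ^ i⌋ + 8)
        · rw [if_pos h]
          exact Finset.sum_congr rfl fun k _ => if_pos h
        · rw [if_neg h]
          exact Finset.sum_eq_zero fun k _ => if_neg h
      · intro m _ hm
        refine Finset.sum_eq_zero fun k _ => if_neg fun h => hm (mem_om_unique h)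
      · intro h
        exact absurd (Finset.mem_image.2 ⟨(i, y), Finset.mem_product.2 ⟨hi, hy⟩, rfl⟩) h
    · rintro ⟨⟨i, m⟩, k⟩ _ ⟨⟨i', m'⟩, k'⟩ _ h
      simp only [Tile.mk.injEq] at h
      simp [h.1, h.2.1, h.2.2]
  have htend : ∀ y ∈ G, Filter.Tendsto (fun S => modelOp N (pack bumpA) (pack bumpB) (Q S) (coefL U) y) Filter.atTop
      (nhds (∑ i ∈ I, ∫ t in (0:ℝ)..1, Bk i t (N y) * U t * ee (y * t))) := by
    intro y hy
    simp_rw [hexp y hy]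
    refine tendsto_finsetSum _ fun i hi => ?_
    split_ifs with h
    · simp_rw [Bk_of_mem h]
      have := hasSum_packets (goodIdx_floor (hI i hi) (hN y hy).1 (hN y hy).2) hU hb y
      simpa [HasSum] using this
    · simp_rw [Bk_of_not_mem h]
      simp
  have hlim := tendsto_finsetSum G fun y hy => ((htend y hy).norm.pow 2)
  refine le_of_tendsto' hlim fun S => ?_
  rw [← norm_coefL_sq (memLp_of_bdd hU hb)]
  exact hmain _ _ hW N G (Q S) (coefL U) (hsparse S)

theorem exists_scale_bound : ∃ K : ℝ, 0 < K ∧ ∀ (I : Finset ℕ), (∀ i ∈ I, 1 ≤ i) →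
    ∀ (N : ℤ → ℝ) (G : Finset ℤ), (∀ y ∈ G, 1 / 4 ≤ N y ∧ N y < 3 / 4) →
    ∀ (U : ℝ → ℂ) (M : ℝ), Measurable U → (∀ t, ‖U t‖ ≤ M) →
    ∑ y ∈ G, ‖∫ t in (0:ℝ)..1, (∑ i ∈ I, Bk i t (N y) : ℝ) * U t * ee (y * t)‖ ^ 2 ≤ K * ∫ t in (0:ℝ)..1, ‖U t‖ ^ 2 := by
  classical
  obtain ⟨K, hK, hmain⟩ := exists_scale_bound_of_parity
  refine ⟨4 * K, by positivity, fun I hI N G hN U M hU hb => ?_⟩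
  have h0 := hmain 0 (I.filter fun i => i % 2 = 0) (fun i hi => hI i (Finset.mem_filter.1 hi).1)
    (fun i hi => (Finset.mem_filter.1 hi).2) N G hN U M hU hb
  have h1 := hmain 1 (I.filter fun i => ¬ i % 2 = 0) (fun i hi => hI i (Finset.mem_filter.1 hi).1)
    (fun i hi => by have := (Finset.mem_filter.1 hi).2; omega) N G hN U M hU hb
  have h_int : ∀ (y : ℤ) (i : ℕ), IntervalIntegrable (fun t => (Bk i t (N y) : ℂ) * U t * ee (y * t)) volume 0 1 := by
    intro y i
    obtain ⟨C, hC⟩ := exists_abs_Bk_le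
    have hm : Measurable fun t => (Bk i t (N y) : ℂ) * U t * ee (y * t) := by
      have h1 : Measurable fun t => Bk i t (N y) := (measurable_Bk i).comp (measurable_id.prodMk measurable_const)
      have h2 := continuous_ee.measurable
      fun_prop
    rw [intervalIntegrable_iff]
    refine Measure.integrableOn_of_bounded (M := C * M) (by simp) hm.aestronglyMeasurable (Filter.Eventually.of_forall fun t => ?_)
    rw [norm_mul, norm_mul, norm_ee, mul_one, Complex.norm_real, Real.norm_eq_abs]
    exact mul_le_mul (hC _ _ _) (hb _) (norm_nonneg _) ((abs_nonneg _).trans (hC 0 0 0))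
  calc _ = ∑ y ∈ G, ‖(∑ i ∈ I with i % 2 = 0, ∫ t in (0:ℝ)..1, Bk i t (N y) * U t * ee (y * t)) +
        ∑ i ∈ I with ¬ i % 2 = 0, ∫ t in (0:ℝ)..1, Bk i t (N y) * U t * ee (y * t)‖ ^ 2 := by
        refine Finset.sum_congr rfl fun y _ => ?_
        rw [Finset.sum_filter_add_sum_filter_not, ← intervalIntegral.integral_finsetSum fun i _ => h_int y i]
        congr 2
        refine intervalIntegral.integral_congr fun t _ => ?_
        push_cast
        rw [Finset.sum_mul, Finset.sum_mul]
    _ ≤ ∑ y ∈ G, (2 * ‖∑ i ∈ I with i % 2 = 0, ∫ t in (0:ℝ)..1, Bk i t (N y) * U t * ee (y * t)‖ ^ 2 +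
        2 * ‖∑ i ∈ I with ¬ i % 2 = 0, ∫ t in (0:ℝ)..1, Bk i t (N y) * U t * ee (y * t)‖ ^ 2) := by
        refine Finset.sum_le_sum fun y _ => ?_
        refine (pow_le_pow_left₀ (norm_nonneg _) (norm_add_le _ _) 2).trans ?_
        nlinarith [sq_nonneg (‖∑ i ∈ I with i % 2 = 0, ∫ t in (0:ℝ)..1, Bk i t (N y) * U t * ee (y * t)‖ -
          ‖∑ i ∈ I with ¬ i % 2 = 0, ∫ t in (0:ℝ)..1, Bk i t (N y) * U t * ee (y * t)‖)]
    _ ≤ _ := by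
        rw [Finset.sum_add_distrib, ← Finset.mul_sum, ← Finset.mul_sum]
        linarith

/-- The averaged ramp at scale `i`. -/
noncomputable def avgR (i : ℕ) (x : ℝ) : ℝ := ∫ s in (0:ℝ)..1, rampR (4 ^ i * x + s)

lemma continuous_rampR : Continuous rampR := rampR_contDiff.continuous

lemma integral_bumpT (i : ℕ) (x : ℝ) :
    ∫ s in (0:ℝ)..1, bumpT (4 ^ i * x + s / 4) = avgR (i + 1) x - avgR i x := by
  have hc := continuous_rampR
  have hi : ∀ f : ℝ → ℝ, Continuous f → ∀ a b, IntervalIntegrable f volume a b := fun f hf a b => hf.intervalIntegrable a b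
  set X := 4 ^ i * x with hX
  have h1 : ∀ c : ℝ, ∫ s in (0:ℝ)..1, rampR (X + s / 4 + c) = 4 * ∫ s in c..(c + 1 / 4), rampR (X + s) := by
    intro c
    have := intervalIntegral.integral_comp_div_add (a := 0) (b := 1) (fun s => rampR (X + s)) (c := 4) (by norm_num) c
    rw [show (0:ℝ) / 4 + c = c by ring, show (1:ℝ) / 4 + c = c + 1 / 4 by ring] at this
    rw [← smul_eq_mul, ← this]
    refine intervalIntegral.integral_congr fun s _ => ?_
    simp only [add_assoc]
  have e : ∀ s : ℝ, bumpT (X + s / 4) = rampR (4 * X + s) - 1 / 4 * (rampR (X + s / 4 + 0) + rampR (X + s / 4 + 1 / 4) +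
      rampR (X + s / 4 + 1 / 2) + rampR (X + s / 4 + 3 / 4)) := by
    intro s
    rw [bumpT, add_zero]
    congr 2
    ring
  simp_rw [e]
  rw [intervalIntegral.integral_sub (hi _ (by fun_prop) _ _) (hi _ (by fun_prop) _ _), intervalIntegral.integral_const_mul,
    intervalIntegral.integral_add (hi _ (by fun_prop) _ _) (hi _ (by fun_prop) _ _),
    intervalIntegral.integral_add (hi _ (by fun_prop) _ _) (hi _ (by fun_prop) _ _),
    intervalIntegral.integral_add (hi _ (by fun_prop) _ _) (hi _ (by fun_prop) _ _), h1, h1, h1, h1]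
  have g1 : Continuous fun s => rampR (X + s) := by fun_prop
  have a1 := intervalIntegral.integral_add_adjacent_intervals (hi _ g1 0 (1 / 4)) (hi _ g1 (1 / 4) (1 / 2))
  have a2 := intervalIntegral.integral_add_adjacent_intervals (hi _ g1 0 (1 / 2)) (hi _ g1 (1 / 2) (3 / 4))
  have a3 := intervalIntegral.integral_add_adjacent_intervals (hi _ g1 0 (3 / 4)) (hi _ g1 (3 / 4) 1)
  rw [show (0:ℝ) + 1 / 4 = 1 / 4 by norm_num, show (1 / 4 : ℝ) + 1 / 4 = 1 / 2 by norm_num,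
    show (1 / 2 : ℝ) + 1 / 4 = 3 / 4 by norm_num, show (3 / 4 : ℝ) + 1 / 4 = 1 by norm_num]
  rw [avgR, avgR, ← hX, pow_succ, show (4:ℝ) ^ i * 4 * x = 4 * X by rw [hX]; ring]
  linarith

lemma integral_Bk {j : ℕ} (hj : 1 ≤ j) (t N : ℝ) :
    ∫ s in (0:ℝ)..(1 / 4), Bk j (t - s) (N - s) = 1 / 64 * (avgR (j + 2) (t - N) - avgR (j + 1) (t - N)) := by
  classical
  obtain ⟨q, rfl⟩ := Nat.exists_eq_add_of_le hj
  set Φ : ℝ → ℝ := fun u => if 1 / 2 ≤ u ∧ u < 9 / 16 then bumpB (4 ^ (1 + q) * (t - N) + u) else 0 with hΦ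
  have h4 : (0:ℝ) < 4 ^ (1 + q) := by positivity
  have hper : Function.Periodic (fun v => Φ (Int.fract v)) 1 := fun v => by simp
  calc _ = ∫ s in (0:ℝ)..(1 / 4), (fun v => Φ (Int.fract v)) (N * 4 ^ (1 + q) - 4 ^ (1 + q) * s) := by
        refine intervalIntegral.integral_congr fun s _ => ?_
        simp only [Bk, hΦ]
        rw [sub_sub_sub_cancel_right, sub_mul, mul_comm s]
    _ = (4 ^ (1 + q))⁻¹ * ∫ v in (N * 4 ^ (1 + q) - 4 ^ q)..(N * 4 ^ (1 + q) - 4 ^ q + (4 ^ q : ℕ) • (1:ℝ)), Φ (Int.fract v) := by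
        rw [intervalIntegral.integral_comp_sub_mul (fun v => Φ (Int.fract v)) h4.ne', smul_eq_mul]
        congr 2
        · rw [pow_add]; ring
        · rw [nsmul_eq_mul]; push_cast; ring
    _ = 1 / 4 * ∫ v in (0:ℝ)..1, Φ (Int.fract v) := by
        have h_int : ∀ a b : ℝ, IntervalIntegrable (fun v => Φ (Int.fract v)) volume a b := by
          intro a b
          obtain ⟨C, hC⟩ := exists_bound_bump bumpB_contDiff.continuous fun τ h => bumpB_support h
          have hm : Measurable Φ := by
            refine Measurable.ite ?_ ?_ measurable_const
            · exact measurableSet_Ico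
            · have := bumpB_contDiff.continuous
              exact (by fun_prop : Continuous fun u => bumpB (4 ^ (1 + q) * (t - N) + u)).measurable
          refine IntervalIntegrable.mono_fun' (g := fun _ => |C|) intervalIntegrable_const
            (hm.comp measurable_fract).aestronglyMeasurable (Filter.Eventually.of_forall fun v => ?_)
          simp only [hΦ, Real.norm_eq_abs]
          split_ifs
          · exact (hC _).trans (le_abs_self C)
          · simp
        have := hper.intervalIntegral_add_zsmul_eq (4 ^ q : ℕ) (N * 4 ^ (1 + q) - 4 ^ q) h_int
        rw [natCast_zsmul, natCast_zsmul] at this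
        rw [this, hper.intervalIntegral_add_eq _ 0, zero_add, nsmul_eq_mul, ← mul_assoc]
        congr 1
        push_cast
        rw [pow_add]
        field_simp
    _ = 1 / 4 * ∫ v in (0:ℝ)..1, Φ v := by
        congr 1
        refine intervalIntegral.integral_congr_Ioo_of_le zero_le_one fun v hv => ?_
        rw [Int.fract_eq_self.2 ⟨hv.1.le, hv.2⟩]
    _ = 1 / 4 * ∫ v in (1 / 2 : ℝ)..(9 / 16), bumpB (4 ^ (1 + q) * (t - N) + v) := by
        congr 1
        have : Φ = (Set.Ico (1 / 2 : ℝ) (9 / 16)).indicator fun v => bumpB (4 ^ (1 + q) * (t - N) + v) := by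
          funext v
          simp [hΦ, Set.indicator_apply]
        rw [this, intervalIntegral.integral_of_le zero_le_one, integral_indicator measurableSet_Ico,
          Measure.restrict_restrict measurableSet_Ico, Set.inter_eq_left.2,
          intervalIntegral.integral_of_le (by norm_num), integral_Ico_eq_integral_Ioc]
        intro v hv
        exact ⟨by linarith [hv.1], by linarith [hv.2]⟩
    _ = 1 / 4 * (1 / 16 * ∫ s in (0:ℝ)..1, bumpT (4 ^ (1 + q + 1) * (t - N) + s / 4)) := by
        congr 1
        have := intervalIntegral.integral_comp_div_add (a := 0) (b := 1)
          (fun v => bumpB (4 ^ (1 + q) * (t - N) + v)) (c := 16) (by norm_num) (1 / 2)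
        rw [show (0:ℝ) / 16 + 1 / 2 = 1 / 2 by norm_num, show (1:ℝ) / 16 + 1 / 2 = 9 / 16 by norm_num,
          smul_eq_mul] at this
        rw [show (∫ s in (0:ℝ)..1, bumpT (4 ^ (1 + q + 1) * (t - N) + s / 4)) =
          ∫ s in (0:ℝ)..1, bumpB (4 ^ (1 + q) * (t - N) + (s / 16 + 1 / 2)) from ?_, this]
        · ring
        refine intervalIntegral.integral_congr fun s _ => ?_
        simp only [bumpB]
        congr 1
        rw [pow_succ _ (1 + q)]
        ring
    _ = _ := by
        rw [integral_bumpT]; ring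

/-- The kernel obtained by summing the scales `1, …, J`. -/
noncomputable def Sk (J : ℕ) (t N : ℝ) : ℝ := ∑ i ∈ Finset.Icc 1 J, Bk i t N

lemma measurable_Sk (J : ℕ) : Measurable fun p : ℝ × ℝ => Sk J p.1 p.2 := by
  unfold Sk
  exact Finset.measurable_fun_sum _ fun i _ => measurable_Bk i

lemma exists_abs_Sk_le (J : ℕ) : ∃ C : ℝ, ∀ t N, |Sk J t N| ≤ C := by
  obtain ⟨C, hC⟩ := exists_abs_Bk_le
  exact ⟨∑ i ∈ Finset.Icc 1 J, C, fun t N => (Finset.abs_sum_le_sum_abs _ _).trans (Finset.sum_le_sum fun i _ => hC i t N)⟩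

lemma integral_Sk (J : ℕ) (t N : ℝ) :
    ∫ s in (0:ℝ)..(1 / 4), Sk J (t - s) (N - s) = 1 / 64 * (avgR (J + 2) (t - N) - avgR 2 (t - N)) := by
  unfold Sk
  have h_int : ∀ i ∈ Finset.Icc 1 J, IntervalIntegrable (fun s => Bk i (t - s) (N - s)) volume 0 (1 / 4) := by
    intro i _
    obtain ⟨C, hC⟩ := exists_abs_Bk_le
    refine IntervalIntegrable.mono_fun' (g := fun _ => C) intervalIntegrable_const
      ((measurable_Bk i).comp ((measurable_const.sub measurable_id).prodMk
        (measurable_const.sub measurable_id))).aestronglyMeasurable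
      (Filter.Eventually.of_forall fun s => hC _ _ _)
  rw [intervalIntegral.integral_finsetSum h_int, Finset.sum_congr rfl fun i hi => integral_Bk (Finset.mem_Icc.1 hi).1 t N,
    ← Finset.mul_sum]
  congr 1
  clear h_int
  induction J with
  | zero => simp
  | succ J ih =>
    rw [Finset.sum_Icc_succ_top (by omega), ih]
    ring

lemma avgR_two_of_ge {x : ℝ} (hx : -1 / 64 ≤ x) : avgR 2 x = 0 := by
  unfold avgR
  rw [intervalIntegral.integral_congr (g := fun _ => (0:ℝ))]
  · simp
  · intro s hs
    rw [Set.uIcc_of_le zero_le_one] at hs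
    exact rampR_zero (by linarith [hs.1])

lemma avgR_of_nonneg (i : ℕ) {x : ℝ} (hx : 0 ≤ x) : avgR i x = 0 := by
  unfold avgR
  rw [intervalIntegral.integral_congr (g := fun _ => (0:ℝ))]
  · simp
  · intro s hs
    rw [Set.uIcc_of_le zero_le_one] at hs
    have : 0 ≤ (4:ℝ) ^ i * x := by positivity
    exact rampR_zero (by linarith [hs.1])

lemma abs_avgR_le (i : ℕ) (x : ℝ) : |avgR i x| ≤ 1 := by
  have := intervalIntegral.norm_integral_le_of_norm_le_const (f := fun s => rampR (4 ^ i * x + s)) (C := 1) (a := 0) (b := 1) fun s _ => by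
    rw [Real.norm_eq_abs, rampR, abs_le]
    exact ⟨by linarith [Real.smoothTransition.nonneg (-4 * (4 ^ i * x + s) - 1)], Real.smoothTransition.le_one _⟩
  simpa [avgR] using this

lemma continuous_avgR (i : ℕ) : Continuous (avgR i) := by
  have := continuous_rampR
  unfold avgR
  exact intervalIntegral.continuous_parametric_intervalIntegral_of_continuous' (by fun_prop) _ _

lemma tendsto_avgR (x : ℝ) :
    Filter.Tendsto (fun J => avgR (J + 2) x) Filter.atTop (nhds (if x < 0 then 1 else 0)) := by
  split_ifs with hx
  · refine tendsto_const_nhds.congr' ?_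
    obtain ⟨n, hn⟩ := pow_unbounded_of_one_lt (2 / -x) (show (1:ℝ) < 4 by norm_num)
    filter_upwards [Filter.eventually_ge_atTop n] with J hJ
    have h1 : (4:ℝ) ^ n ≤ 4 ^ (J + 2) := pow_le_pow_right₀ (by norm_num) (by omega)
    rw [div_lt_iff₀ (by linarith)] at hn
    have h2 : (4:ℝ) ^ (J + 2) * x ≤ -2 := by nlinarith
    symm
    unfold avgR
    rw [intervalIntegral.integral_congr (g := fun _ => (1:ℝ))]
    · simp
    · intro s hs
      rw [Set.uIcc_of_le zero_le_one] at hs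
      exact rampR_one (by linarith [hs.2])
  · simp_rw [avgR_of_nonneg _ (not_lt.1 hx)]
    exact tendsto_const_nhds

lemma integral_shift_of_support {f : ℝ → ℂ} (hf : ∀ t, f t ≠ 0 → 1 / 2 < t ∧ t ≤ 33 / 64) {s : ℝ} (hs0 : 0 ≤ s)
    (hs1 : s ≤ 1 / 4) : ∫ t in (0:ℝ)..1, f (t + s) = ∫ t in (0:ℝ)..1, f t := by
  rw [intervalIntegral.integral_comp_add_right f s, intervalIntegral.integral_eq_integral_of_support_subset,
    intervalIntegral.integral_eq_integral_of_support_subset]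
  · intro t ht
    obtain ⟨h1, h2⟩ := hf t ht
    exact ⟨by linarith, by linarith⟩
  · intro t ht
    obtain ⟨h1, h2⟩ := hf t ht
    exact ⟨by linarith, by linarith⟩

/-- The square of the norm of the mean over `[0, 1/4]` is at most the mean of the square of the norm. -/
lemma sq_norm_mean_le {f : ℝ → ℂ} (hm : StronglyMeasurable f) {M : ℝ} (hb : ∀ s, ‖f s‖ ≤ M) :
    ‖4 * ∫ s in (0:ℝ)..(1 / 4), f s‖ ^ 2 ≤ 4 * ∫ s in (0:ℝ)..(1 / 4), ‖f s‖ ^ 2 := by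
  have hi : ∀ n : ℕ, IntervalIntegrable (fun s => ‖f s‖ ^ n) volume 0 (1 / 4) := fun n => by
    refine IntervalIntegrable.mono_fun' (g := fun _ => M ^ n) intervalIntegrable_const
      ((hm.norm.measurable.pow_const n).aestronglyMeasurable) (Filter.Eventually.of_forall fun s => ?_)
    simp only [norm_pow, norm_norm]
    gcongr
    exact hb s
  have h1 := hi 1
  have h2 := hi 2
  simp only [pow_one] at h1
  set m := 4 * ∫ s in (0:ℝ)..(1 / 4), ‖f s‖ with hm'
  have hle : ‖4 * ∫ s in (0:ℝ)..(1 / 4), f s‖ ≤ m := by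
    rw [norm_mul, hm']
    have := intervalIntegral.norm_integral_le_integral_norm (f := f) (μ := volume) (show (0:ℝ) ≤ 1 / 4 by norm_num)
    norm_num
    norm_num at this
    exact this
  have hpos : 0 ≤ ∫ s in (0:ℝ)..(1 / 4), (‖f s‖ - m) ^ 2 :=
    intervalIntegral.integral_nonneg (by norm_num) fun s _ => sq_nonneg _
  have he : ∫ s in (0:ℝ)..(1 / 4), (‖f s‖ - m) ^ 2 =
      (∫ s in (0:ℝ)..(1 / 4), ‖f s‖ ^ 2) - 2 * m * (∫ s in (0:ℝ)..(1 / 4), ‖f s‖) + 1 / 4 * m ^ 2 := by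
    simp_rw [show ∀ s, (‖f s‖ - m) ^ 2 = ‖f s‖ ^ 2 - 2 * m * ‖f s‖ + m ^ 2 from fun s => by ring]
    rw [intervalIntegral.integral_add (h2.sub (h1.const_mul _)) intervalIntegrable_const,
      intervalIntegral.integral_sub h2 (h1.const_mul _), intervalIntegral.integral_const_mul,
      intervalIntegral.integral_const, smul_eq_mul]
    norm_num
  rw [he] at hpos
  have : m ^ 2 ≤ 4 * ∫ s in (0:ℝ)..(1 / 4), ‖f s‖ ^ 2 := by
    have e : (∫ s in (0:ℝ)..(1 / 4), ‖f s‖) = m / 4 := by rw [hm']; ring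
    rw [e] at hpos
    nlinarith
  exact (pow_le_pow_left₀ (norm_nonneg _) hle 2).trans this

theorem exists_avg_bound : ∃ K : ℝ, 0 < K ∧ ∀ (J : ℕ) (N : ℤ → ℝ) (G : Finset ℤ),
    (∀ y ∈ G, 1 / 2 ≤ N y ∧ N y ≤ 33 / 64) →
    ∀ (g : ℝ → ℂ) (M : ℝ), Measurable g → (∀ t, ‖g t‖ ≤ M) → (∀ t, g t ≠ 0 → 1 / 2 < t ∧ t ≤ 33 / 64) →
    ∑ y ∈ G, ‖∫ t in (0:ℝ)..1, (avgR (J + 2) (t - N y) : ℂ) * g t * ee (y * t)‖ ^ 2 ≤ K * ∫ t in (0:ℝ)..1, ‖g t‖ ^ 2 := by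
  obtain ⟨K, hK, hmain⟩ := exists_scale_bound
  refine ⟨256 * K, by positivity, fun J N G hN g M hg hb hs => ?_⟩
  have hM : 0 ≤ M := (norm_nonneg _).trans (hb 0)
  obtain ⟨C, hC⟩ := exists_abs_Sk_le J
  have hC0 : 0 ≤ C := (abs_nonneg _).trans (hC 0 0)
  set f : ℤ → ℝ → ℝ → ℂ := fun y s t => (Sk J (t - s) (N y - s) : ℂ) * g t * ee (y * t) with hf
  have hfm : ∀ y, Measurable (Function.uncurry (f y)) := by
    intro y
    have h1 := (measurable_Sk J).comp (f := fun p : ℝ × ℝ => (p.2 - p.1, N y - p.1)) (by fun_prop)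
    have h2 : Measurable fun p : ℝ × ℝ => ee (y * p.2) := (continuous_ee.comp (by fun_prop)).measurable
    exact ((Complex.measurable_ofReal.comp h1).mul (hg.comp measurable_snd)).mul h2
  have hfb : ∀ y s t, ‖f y s t‖ ≤ C * M := by
    intro y s t
    simp only [hf, norm_mul, norm_ee, mul_one, Complex.norm_real, Real.norm_eq_abs]
    exact mul_le_mul (hC _ _) (hb t) (norm_nonneg _) hC0
  have hAm : ∀ y, StronglyMeasurable fun s => ∫ t in (0:ℝ)..1, f y s t := by
    intro y
    simp_rw [intervalIntegral.integral_of_le zero_le_one]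
    exact (hfm y).stronglyMeasurable.integral_prod_right
  have hAb : ∀ y s, ‖∫ t in (0:ℝ)..1, f y s t‖ ≤ C * M := by
    intro y s
    have := intervalIntegral.norm_integral_le_of_norm_le_const (f := f y s) (a := 0) (b := 1) fun t _ => hfb y s t
    simpa using this
  have hscale : ∀ s ∈ Set.Icc (0:ℝ) (1 / 4), ∑ y ∈ G, ‖∫ t in (0:ℝ)..1, f y s t‖ ^ 2 ≤ K * ∫ t in (0:ℝ)..1, ‖g t‖ ^ 2 := by
    intro s hs'
    have h1 := hmain (Finset.Icc 1 J) (fun i hi => (Finset.mem_Icc.1 hi).1) (fun y => N y - s) G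
      (fun y hy => ⟨by linarith [(hN y hy).1, hs'.2], by linarith [(hN y hy).2, hs'.1]⟩) (fun t => g (t + s)) M
      (hg.comp (measurable_id.add_const s)) fun t => hb _
    have h2 : ∫ t in (0:ℝ)..1, ‖g (t + s)‖ ^ 2 = ∫ t in (0:ℝ)..1, ‖g t‖ ^ 2 := by
      have := integral_shift_of_support (f := fun t => ((‖g t‖ ^ 2 : ℝ) : ℂ))
        (fun t ht => hs t fun h0 => ht (by simp [h0])) hs'.1 hs'.2
      rw [intervalIntegral.integral_ofReal, intervalIntegral.integral_ofReal] at this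
      exact_mod_cast this
    rw [h2] at h1
    refine le_trans (le_of_eq (Finset.sum_congr rfl fun y _ => ?_)) h1
    congr 1
    rw [← integral_shift_of_support (f := f y s) (fun t ht => hs t fun h0 => ht (by simp [hf, h0])) hs'.1 hs'.2]
    have : ∀ t, f y s (t + s) = ee (y * s) * ((∑ i ∈ Finset.Icc 1 J, Bk i t (N y - s) : ℝ) * g (t + s) * ee (y * t)) := by
      intro t
      simp only [hf]
      rw [add_sub_cancel_right, mul_add, ee_add, Sk]
      ring
    simp_rw [this]
    rw [intervalIntegral.integral_const_mul, norm_mul, norm_ee, one_mul]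
  have hE : ∀ y ∈ G, ∫ t in (0:ℝ)..1, (avgR (J + 2) (t - N y) : ℂ) * g t * ee (y * t) =
      16 * (4 * ∫ s in (0:ℝ)..(1 / 4), ∫ t in (0:ℝ)..1, f y s t) := by
    intro y hy
    have hswap : ∫ s in (0:ℝ)..(1 / 4), ∫ t in (0:ℝ)..1, f y s t = ∫ t in (0:ℝ)..1, ∫ s in (0:ℝ)..(1 / 4), f y s t := by
      simp_rw [intervalIntegral.integral_of_le zero_le_one, intervalIntegral.integral_of_le (show (0:ℝ) ≤ 1 / 4 by norm_num)]
      refine integral_integral_swap ?_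
      exact Integrable.of_bound (hfm y).aestronglyMeasurable (C * M) (Filter.Eventually.of_forall fun p => hfb y p.1 p.2)
    rw [hswap, ← mul_assoc, ← intervalIntegral.integral_const_mul]
    refine intervalIntegral.integral_congr fun t _ => ?_
    have h1 : ∫ s in (0:ℝ)..(1 / 4), f y s t = ((∫ s in (0:ℝ)..(1 / 4), Sk J (t - s) (N y - s) : ℝ) : ℂ) * (g t * ee (y * t)) := by
      rw [← intervalIntegral.integral_ofReal, ← intervalIntegral.integral_mul_const]
      refine intervalIntegral.integral_congr fun s _ => ?_
      simp only [hf]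
      ring
    rw [h1, integral_Sk]
    by_cases h0 : g t = 0
    · simp [h0]
    · rw [avgR_two_of_ge (by linarith [(hs t h0).1, (hN y hy).2])]
      push_cast
      ring
  calc _ = ∑ y ∈ G, 256 * ‖4 * ∫ s in (0:ℝ)..(1 / 4), ∫ t in (0:ℝ)..1, f y s t‖ ^ 2 := by
        refine Finset.sum_congr rfl fun y hy => ?_
        rw [hE y hy, norm_mul, mul_pow]
        norm_num
    _ ≤ ∑ y ∈ G, 256 * (4 * ∫ s in (0:ℝ)..(1 / 4), ‖∫ t in (0:ℝ)..1, f y s t‖ ^ 2) := by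
        gcongr with y hy
        exact sq_norm_mean_le (hAm y) (hAb y)
    _ = 1024 * ∫ s in (0:ℝ)..(1 / 4), ∑ y ∈ G, ‖∫ t in (0:ℝ)..1, f y s t‖ ^ 2 := by
        rw [intervalIntegral.integral_finsetSum, Finset.mul_sum]
        · exact Finset.sum_congr rfl fun y _ => by ring
        · intro y _
          refine IntervalIntegrable.mono_fun' (g := fun _ => (C * M) ^ 2) intervalIntegrable_const
            (((hAm y).norm.measurable.pow_const 2).aestronglyMeasurable) (Filter.Eventually.of_forall fun s => ?_)
          simp only [norm_pow, norm_norm]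
          exact pow_le_pow_left₀ (norm_nonneg _) (hAb y s) 2
    _ ≤ 1024 * ∫ s in (0:ℝ)..(1 / 4), K * ∫ t in (0:ℝ)..1, ‖g t‖ ^ 2 := by
        gcongr
        refine intervalIntegral.integral_mono_on (by norm_num) ?_ intervalIntegrable_const hscale
        refine IntervalIntegrable.mono_fun' (g := fun _ => ∑ y ∈ G, (C * M) ^ 2) intervalIntegrable_const ?_
            (Filter.Eventually.of_forall fun s => ?_)
        · exact (Finset.measurable_fun_sum G fun y _ => (hAm y).norm.measurable.pow_const 2).aestronglyMeasurable
        · beta_reduce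
          rw [Real.norm_of_nonneg (Finset.sum_nonneg fun _ _ => by positivity)]
          exact Finset.sum_le_sum fun y _ => pow_le_pow_left₀ (norm_nonneg _) (hAb y s) 2
    _ = _ := by
        rw [intervalIntegral.integral_const, smul_eq_mul]
        ring

/-- The discrete maximal inequality for bounded functions supported in a short interval. -/
theorem exists_cut_bound : ∃ K : ℝ, 0 < K ∧ ∀ (N : ℤ → ℝ) (G : Finset ℤ),
    (∀ y ∈ G, 1 / 2 ≤ N y ∧ N y ≤ 33 / 64) →
    ∀ (g : ℝ → ℂ) (M : ℝ), Measurable g → (∀ t, ‖g t‖ ≤ M) → (∀ t, g t ≠ 0 → 1 / 2 < t ∧ t ≤ 33 / 64) →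
    ∑ y ∈ G, ‖∫ t in (1 / 2 : ℝ)..(N y), g t * ee (y * t)‖ ^ 2 ≤ K * ∫ t in (0:ℝ)..1, ‖g t‖ ^ 2 := by
  obtain ⟨K, hK, hmain⟩ := exists_avg_bound
  refine ⟨K, hK, fun N G hN g M hg hb hs => ?_⟩
  refine le_of_tendsto (x := Filter.atTop) (tendsto_finsetSum G fun y hy => ?_) (Filter.Eventually.of_forall fun J => hmain J N G hN g M hg hb hs)
  refine (Filter.Tendsto.norm ?_).pow 2
  have hlim : ∫ t in (1 / 2 : ℝ)..(N y), g t * ee (y * t) =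
      ∫ t in (0:ℝ)..1, ((if t - N y < 0 then 1 else 0 : ℝ) : ℂ) * g t * ee (y * t) := by
    obtain ⟨h1, h2⟩ := hN y hy
    rw [intervalIntegral.integral_of_le h1, intervalIntegral.integral_of_le zero_le_one, integral_Ioc_eq_integral_Ioo,
      ← integral_indicator measurableSet_Ioo, ← integral_indicator measurableSet_Ioc]
    congr 1
    funext t
    by_cases h0 : g t = 0
    · simp [Set.indicator_apply, h0]
    · obtain ⟨h3, h4⟩ := hs t h0
      have h5 : t ∈ Set.Ioc (0:ℝ) 1 := ⟨by linarith, by linarith⟩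
      simp only [Set.indicator_apply, h5, if_true, Set.mem_Ioo, h3, true_and, sub_neg]
      split_ifs <;> simp
  rw [hlim]
  refine intervalIntegral.tendsto_integral_filter_of_dominated_convergence (fun _ => M) ?_ ?_ intervalIntegrable_const ?_
  · refine Filter.Eventually.of_forall fun J => ?_
    have h2 : Measurable fun t : ℝ => ee (y * t) := (continuous_ee.comp (by fun_prop)).measurable
    have h1 : Measurable fun t : ℝ => (avgR (J + 2) (t - N y) : ℂ) :=
      (Complex.continuous_ofReal.comp ((continuous_avgR _).comp (by fun_prop))).measurable
    exact ((h1.mul hg).mul h2).aestronglyMeasurable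
  · refine Filter.Eventually.of_forall fun J => Filter.Eventually.of_forall fun t _ => ?_
    rw [norm_mul, norm_mul, norm_ee, mul_one, Complex.norm_real, Real.norm_eq_abs]
    calc _ ≤ 1 * M := mul_le_mul (abs_avgR_le _ _) (hb t) (norm_nonneg _) zero_le_one
      _ = M := one_mul M
  · refine Filter.Eventually.of_forall fun t _ => ?_
    exact (((Complex.continuous_ofReal.tendsto _).comp (tendsto_avgR (t - N y))).mul_const _).mul_const _

lemma discrete_maximal_bound : ∃ K : ℝ, 0 < K ∧ ∀ (X : ℤ → ℝ) (G : Finset ℤ),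
    (∀ y ∈ G, 0 ≤ X y ∧ X y ≤ 1) → ∀ (g : ℝ → ℂ) (M : ℝ), Measurable g → (∀ t, ‖g t‖ ≤ M) →
    ∑ y ∈ G, ‖∫ u in (0:ℝ)..(X y), g u * ee (y * (u / 64))‖ ^ 2 ≤ K * ∫ u in (0:ℝ)..1, ‖g u‖ ^ 2 := by
  obtain ⟨K, hK, hmain⟩ := exists_cut_bound
  refine ⟨64 * K, by positivity, fun X G hX g M hg hb => ?_⟩
  set f : ℝ → ℂ := (Set.Ioc (1 / 2 : ℝ) (33 / 64)).indicator fun t => g (64 * t - 32) with hf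
  have hfm : Measurable f := (hg.comp (by fun_prop)).indicator measurableSet_Ioc
  have hfb : ∀ t, ‖f t‖ ≤ M := fun t => (norm_indicator_le_norm_self _ _).trans (hb _)
  have hfs : ∀ t, f t ≠ 0 → 1 / 2 < t ∧ t ≤ 33 / 64 := fun t ht => by
    have h : t ∈ Set.Ioc (1 / 2 : ℝ) (33 / 64) := Set.mem_of_indicator_ne_zero ht
    exact h
  have h1 := hmain (fun y => 1 / 2 + X y / 64) G
    (fun y hy => ⟨by linarith [(hX y hy).1], by linarith [(hX y hy).2]⟩) f M hfm hfb hfs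
  have h2 : ∫ t in (0:ℝ)..1, ‖f t‖ ^ 2 = 1 / 64 * ∫ u in (0:ℝ)..1, ‖g u‖ ^ 2 := by
    have e1 : ∫ t in (0:ℝ)..1, ‖f t‖ ^ 2 = ∫ t in (1 / 2 : ℝ)..(33 / 64), ‖g (64 * t - 32)‖ ^ 2 := by
      rw [intervalIntegral.integral_of_le zero_le_one, intervalIntegral.integral_of_le (by norm_num),
        ← integral_indicator measurableSet_Ioc, ← integral_indicator measurableSet_Ioc]
      congr 1
      funext t
      by_cases h0 : t ∈ Set.Ioc (1 / 2 : ℝ) (33 / 64)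
      · have h5 : t ∈ Set.Ioc (0:ℝ) 1 := ⟨by linarith [h0.1], by linarith [h0.2]⟩
        simp only [hf, Set.indicator_of_mem h0, Set.indicator_of_mem h5]
      · rw [Set.indicator_of_notMem h0]
        simp only [Set.indicator_apply, hf, h0, if_false]
        simp
    rw [e1, intervalIntegral.integral_comp_mul_sub (fun u => ‖g u‖ ^ 2) (by norm_num) 32, smul_eq_mul]
    norm_num
  have h3 : ∀ y ∈ G, ‖∫ t in (1 / 2 : ℝ)..(1 / 2 + X y / 64), f t * ee (y * t)‖ =
      1 / 64 * ‖∫ u in (0:ℝ)..(X y), g u * ee (y * (u / 64))‖ := by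
    intro y hy
    have e1 : ∫ t in (1 / 2 : ℝ)..(1 / 2 + X y / 64), f t * ee (y * t) =
        ∫ t in (1 / 2 : ℝ)..(1 / 2 + X y / 64), ee (y / 2) * (g (64 * t - 32) * ee (y * ((64 * t - 32) / 64))) := by
      have hle : (1 / 2 : ℝ) ≤ 1 / 2 + X y / 64 := by linarith [(hX y hy).1]
      rw [intervalIntegral.integral_of_le hle, intervalIntegral.integral_of_le hle]
      refine setIntegral_congr_fun measurableSet_Ioc fun t ht => ?_
      have h0 : t ∈ Set.Ioc (1 / 2 : ℝ) (33 / 64) := ⟨ht.1, by linarith [ht.2, (hX y hy).2]⟩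
      simp only [hf, Set.indicator_of_mem h0]
      rw [show (y : ℝ) * t = y / 2 + y * ((64 * t - 32) / 64) by ring, ee_add]
      ring
    rw [e1, intervalIntegral.integral_const_mul, norm_mul, norm_ee, one_mul,
      intervalIntegral.integral_comp_mul_sub (fun u => g u * ee (y * (u / 64))) (by norm_num) 32, norm_smul,
      show (64:ℝ) * (1 / 2) - 32 = 0 by norm_num, show (64:ℝ) * (1 / 2 + X y / 64) - 32 = X y by ring]
    norm_num
  rw [h2, Finset.sum_congr rfl fun y hy => by rw [h3 y hy, mul_pow], ← Finset.mul_sum] at h1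
  linarith

lemma integral_mul_cexp_eq {f : ℝ → ℂ} (hf : Measurable f) {M : ℝ} (hb : ∀ t, ‖f t‖ ≤ M) (ω : ℂ) {x : ℝ} (hx : 0 ≤ x) :
    ∫ u in (0:ℝ)..x, f u * Complex.exp (Complex.I * ω * u) =
      (∫ u in (0:ℝ)..x, f u) * Complex.exp (Complex.I * ω * x) -
        ∫ v in (0:ℝ)..x, (∫ u in (0:ℝ)..v, f u) * (Complex.I * ω * Complex.exp (Complex.I * ω * v)) := by
  set k : ℝ → ℂ := fun v => Complex.I * ω * Complex.exp (Complex.I * ω * v) with hk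
  have hkc : Continuous k := by fun_prop
  have hfi : ∀ a b, IntervalIntegrable f volume a b := fun a b =>
    IntervalIntegrable.mono_fun' (g := fun _ => M) intervalIntegrable_const hf.aestronglyMeasurable
      (Filter.Eventually.of_forall hb)
  have hftc : ∀ u, ∫ v in u..x, k v = Complex.exp (Complex.I * ω * x) - Complex.exp (Complex.I * ω * u) := by
    intro u
    refine intervalIntegral.integral_eq_sub_of_hasDerivAt (f := fun v : ℝ => Complex.exp (Complex.I * ω * v))
      (fun v _ => ?_) (hkc.intervalIntegrable _ _)
    have h1 : HasDerivAt (fun v : ℝ => Complex.I * ω * (v : ℂ)) (Complex.I * ω * 1) v :=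
      (Complex.ofRealCLM.hasDerivAt (x := v)).const_mul _
    refine h1.cexp.congr_deriv ?_
    simp only [hk]
    ring
  have hsw : ∫ u in (0:ℝ)..x, f u * ∫ v in u..x, k v = ∫ v in (0:ℝ)..x, (∫ u in (0:ℝ)..v, f u) * k v := by
    have e1 : ∫ u in (0:ℝ)..x, f u * ∫ v in u..x, k v =
        ∫ u in Set.Ioc 0 x, ∫ v in Set.Ioc 0 x, if u < v then f u * k v else 0 := by
      rw [intervalIntegral.integral_of_le hx]
      refine setIntegral_congr_fun measurableSet_Ioc fun u hu => ?_
      rw [intervalIntegral.integral_of_le hu.2, ← integral_const_mul, ← integral_indicator measurableSet_Ioc,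
        ← integral_indicator measurableSet_Ioc]
      congr 1
      funext v
      simp only [Set.indicator_apply, Set.mem_Ioc]
      by_cases h1 : u < v
      · simp [h1, hu.1.trans h1]
      · simp [h1]
    have e2 : ∫ v in (0:ℝ)..x, (∫ u in (0:ℝ)..v, f u) * k v =
        ∫ v in Set.Ioc 0 x, ∫ u in Set.Ioc 0 x, if u < v then f u * k v else 0 := by
      rw [intervalIntegral.integral_of_le hx]
      refine setIntegral_congr_fun measurableSet_Ioc fun v hv => ?_
      rw [intervalIntegral.integral_of_le hv.1.le, integral_Ioc_eq_integral_Ioo, ← integral_mul_const,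
        ← integral_indicator measurableSet_Ioo, ← integral_indicator measurableSet_Ioc]
      congr 1
      funext u
      simp only [Set.indicator_apply, Set.mem_Ioc, Set.mem_Ioo]
      by_cases h1 : u < v
      · simp [h1, (h1.trans_le hv.2).le]
      · simp [h1]
    rw [e1, e2]
    refine integral_integral_swap ?_
    obtain ⟨C, hC⟩ := (isCompact_Icc (a := (0:ℝ)) (b := x)).exists_bound_of_continuousOn hkc.continuousOn
    have hm : Measurable (Function.uncurry fun u v : ℝ => if u < v then f u * k v else 0) :=
      Measurable.ite (measurableSet_lt measurable_fst measurable_snd)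
        ((hf.comp measurable_fst).mul (hkc.measurable.comp measurable_snd)) measurable_const
    refine Integrable.of_bound hm.aestronglyMeasurable (M * C) ?_
    rw [Measure.prod_restrict]
    refine (ae_restrict_iff' (measurableSet_Ioc.prod measurableSet_Ioc)).2 (Filter.Eventually.of_forall fun p hp => ?_)
    have hM : 0 ≤ M := (norm_nonneg _).trans (hb 0)
    have hCp := hC p.2 ⟨hp.2.1.le, hp.2.2⟩
    simp only [Function.uncurry]
    split_ifs
    · rw [norm_mul]
      exact mul_le_mul (hb _) hCp (norm_nonneg _) hM
    · rw [norm_zero]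
      exact mul_nonneg hM ((norm_nonneg _).trans hCp)
  rw [← hsw]
  simp_rw [hftc, mul_sub]
  have hec : ∀ c : ℂ, Continuous fun u : ℝ => Complex.exp (Complex.I * ω * u) := fun _ => by fun_prop
  rw [intervalIntegral.integral_sub ((hfi 0 x).mul_const _) ((hfi 0 x).mul_continuousOn (hec 0).continuousOn),
    intervalIntegral.integral_mul_const]
  ring

lemma norm_cexp_le {lam : ℂ} {h t : ℝ} (hl : |lam.im| ≤ h) (ht0 : 0 ≤ t) (ht1 : t ≤ 1) :
    ‖Complex.exp (Complex.I * lam * t)‖ ≤ Real.exp h := by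
  rw [Complex.norm_exp]
  have : (Complex.I * lam * t).re = -lam.im * t := by simp
  rw [this]
  refine Real.exp_le_exp.2 ?_
  have h1 := neg_abs_le lam.im
  have h2 := abs_nonneg lam.im
  nlinarith

lemma intervalIntegrable_mul_cexp {g : ℝ → ℂ} (hg : IntervalIntegrable g volume 0 1) (lam : ℂ) :
    IntervalIntegrable (fun t => g t * Complex.exp (Complex.I * lam * t)) volume 0 1 :=
  hg.mul_continuousOn (Continuous.continuousOn (by fun_prop))

lemma norm_integral_mul_cexp_le {g : ℝ → ℂ} (hg : IntervalIntegrable g volume 0 1) {lam : ℂ} {h : ℝ} (hl : |lam.im| ≤ h)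
    {x : ℝ} (hx : x ∈ Set.Icc (0:ℝ) 1) :
    ‖∫ t in (0:ℝ)..x, g t * Complex.exp (Complex.I * lam * t)‖ ≤ Real.exp h * ∫ t in (0:ℝ)..1, ‖g t‖ := by
  have hsub : Set.uIcc 0 x ⊆ Set.uIcc (0:ℝ) 1 := by
    rw [Set.uIcc_of_le hx.1, Set.uIcc_of_le zero_le_one]
    exact Set.Icc_subset_Icc_right hx.2
  calc _ ≤ ∫ t in (0:ℝ)..x, ‖g t * Complex.exp (Complex.I * lam * t)‖ := intervalIntegral.norm_integral_le_integral_norm hx.1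
    _ ≤ ∫ t in (0:ℝ)..x, Real.exp h * ‖g t‖ := by
        refine intervalIntegral.integral_mono_on hx.1 ((intervalIntegrable_mul_cexp hg lam).mono_set hsub).norm
          ((hg.mono_set hsub).norm.const_mul _) fun t ht => ?_
        rw [norm_mul, mul_comm]
        exact mul_le_mul_of_nonneg_right (norm_cexp_le hl ht.1 (ht.2.trans hx.2)) (norm_nonneg _)
    _ ≤ Real.exp h * ∫ t in (0:ℝ)..1, ‖g t‖ := by
        rw [intervalIntegral.integral_const_mul]
        refine mul_le_mul_of_nonneg_left ?_ (Real.exp_pos h).le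
        exact intervalIntegral.integral_mono_interval le_rfl hx.1 hx.2 (Filter.Eventually.of_forall fun t => norm_nonneg _) hg.norm

lemma maxFourier_le {g : ℝ → ℂ} {lam : ℂ} {B : ℝ}
    (hB : ∀ x ∈ Set.Icc (0:ℝ) 1, ‖∫ t in (0:ℝ)..x, g t * Complex.exp (Complex.I * lam * t)‖ ≤ B) : maxFourier g lam ≤ B := by
  have : Nonempty (Set.Icc (0:ℝ) 1) := ⟨⟨0, by simp⟩⟩
  exact ciSup_le fun x => hB x.1 x.2

lemma le_maxFourier {g : ℝ → ℂ} (hg : IntervalIntegrable g volume 0 1) (lam : ℂ) {x : ℝ} (hx : x ∈ Set.Icc (0:ℝ) 1) :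
    ‖∫ t in (0:ℝ)..x, g t * Complex.exp (Complex.I * lam * t)‖ ≤ maxFourier g lam := by
  refine le_ciSup (f := fun x : Set.Icc (0:ℝ) 1 => ‖∫ t in (0:ℝ)..(x : ℝ), g t * Complex.exp (Complex.I * lam * t)‖) ?_ ⟨x, hx⟩
  refine ⟨Real.exp |lam.im| * ∫ t in (0:ℝ)..1, ‖g t‖, ?_⟩
  rintro _ ⟨y, rfl⟩
  exact norm_integral_mul_cexp_le hg le_rfl y.2

lemma maxFourier_nonneg (g : ℝ → ℂ) (lam : ℂ) : 0 ≤ maxFourier g lam := Real.iSup_nonneg fun _ => norm_nonneg _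

lemma maxFourier_le_integral {g : ℝ → ℂ} (hg : IntervalIntegrable g volume 0 1) {lam : ℂ} {h : ℝ} (hl : |lam.im| ≤ h) :
    maxFourier g lam ≤ Real.exp h * ∫ t in (0:ℝ)..1, ‖g t‖ :=
  maxFourier_le fun _ hx => norm_integral_mul_cexp_le hg hl hx

lemma exists_maxFourier_eq {g : ℝ → ℂ} (hg : IntervalIntegrable g volume 0 1) (lam : ℂ) :
    ∃ x ∈ Set.Icc (0:ℝ) 1, maxFourier g lam = ‖∫ t in (0:ℝ)..x, g t * Complex.exp (Complex.I * lam * t)‖ := by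
  have hc : ContinuousOn (fun x => ‖∫ t in (0:ℝ)..x, g t * Complex.exp (Complex.I * lam * t)‖) (Set.Icc 0 1) := by
    have := (intervalIntegral.continuousOn_primitive_interval' (intervalIntegrable_mul_cexp hg lam) (a := 0) Set.left_mem_uIcc).norm
    rwa [Set.uIcc_of_le zero_le_one] at this
  obtain ⟨x, hx, hmax⟩ := isCompact_Icc.exists_isMaxOn (Set.nonempty_Icc.2 zero_le_one) hc
  exact ⟨x, hx, le_antisymm (maxFourier_le fun y hy => hmax hy) (le_maxFourier hg lam hx)⟩

lemma maxFourier_add_le {g₁ g₂ : ℝ → ℂ} (h₁ : IntervalIntegrable g₁ volume 0 1) (h₂ : IntervalIntegrable g₂ volume 0 1) (lam : ℂ) :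
    maxFourier (fun t => g₁ t + g₂ t) lam ≤ maxFourier g₁ lam + maxFourier g₂ lam := by
  refine maxFourier_le fun x hx => ?_
  have hsub : Set.uIcc 0 x ⊆ Set.uIcc (0:ℝ) 1 := by
    rw [Set.uIcc_of_le hx.1, Set.uIcc_of_le zero_le_one]
    exact Set.Icc_subset_Icc_right hx.2
  simp_rw [add_mul]
  rw [intervalIntegral.integral_add ((intervalIntegrable_mul_cexp h₁ lam).mono_set hsub)
    ((intervalIntegrable_mul_cexp h₂ lam).mono_set hsub)]
  exact (norm_add_le _ _).trans (add_le_add (le_maxFourier h₁ lam hx) (le_maxFourier h₂ lam hx))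

lemma intervalIntegrable_of_bdd {g : ℝ → ℂ} (hg : Measurable g) {M : ℝ} (hb : ∀ t, ‖g t‖ ≤ M) (a b : ℝ) :
    IntervalIntegrable g volume a b :=
  IntervalIntegrable.mono_fun' (g := fun _ => M) intervalIntegrable_const hg.aestronglyMeasurable (Filter.Eventually.of_forall hb)

/-- The maximal Fourier transform is stable under bounded perturbations of the frequency. -/
lemma maxFourier_le_mul_of_near {g : ℝ → ℂ} (hg : Measurable g) {M : ℝ} (hb : ∀ t, ‖g t‖ ≤ M) {lam : ℂ} {ξ h : ℝ}
    (hl : |lam.im| ≤ h) (hξ : |lam.re - ξ| ≤ 1) :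
    maxFourier g lam ≤ Real.exp h * (2 + h) * maxFourier g ξ := by
  have hgi := intervalIntegrable_of_bdd hg hb 0 1
  have hh : 0 ≤ h := (abs_nonneg _).trans hl
  set f : ℝ → ℂ := fun t => g t * Complex.exp (Complex.I * (ξ : ℂ) * t) with hf
  have hfm : Measurable f := hg.mul (Continuous.measurable (by fun_prop))
  have hfb : ∀ t, ‖f t‖ ≤ M := by
    intro t
    have : ‖Complex.exp (Complex.I * (ξ : ℂ) * t)‖ = 1 := by
      rw [show Complex.I * (ξ : ℂ) * t = ((ξ * t : ℝ) : ℂ) * Complex.I by push_cast; ring]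
      exact Complex.norm_exp_ofReal_mul_I _
    simp only [hf, norm_mul, this, mul_one]
    exact hb t
  set ω : ℂ := lam - ξ with hω
  have hωim : |ω.im| ≤ h := by simpa [hω] using hl
  have hωn : ‖ω‖ ≤ 1 + h := by
    refine (Complex.norm_le_abs_re_add_abs_im ω).trans (add_le_add ?_ hωim)
    simpa [hω] using hξ
  have hF : ∀ v ∈ Set.Icc (0:ℝ) 1, ‖∫ u in (0:ℝ)..v, f u‖ ≤ maxFourier g ξ := fun v hv => le_maxFourier hgi ξ hv
  have h0 := maxFourier_nonneg g ξ
  refine maxFourier_le fun x hx => ?_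
  have e : ∫ t in (0:ℝ)..x, g t * Complex.exp (Complex.I * lam * t) = ∫ t in (0:ℝ)..x, f t * Complex.exp (Complex.I * ω * t) := by
    refine intervalIntegral.integral_congr fun t _ => ?_
    simp only [hf, hω, mul_assoc, ← Complex.exp_add]
    congr 2
    ring
  rw [e, integral_mul_cexp_eq hfm hfb ω hx.1]
  have b1 : ‖(∫ u in (0:ℝ)..x, f u) * Complex.exp (Complex.I * ω * x)‖ ≤ maxFourier g ξ * Real.exp h := by
    rw [norm_mul]
    exact mul_le_mul (hF x hx) (norm_cexp_le hωim hx.1 hx.2) (norm_nonneg _) h0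
  have b2 : ‖∫ v in (0:ℝ)..x, (∫ u in (0:ℝ)..v, f u) * (Complex.I * ω * Complex.exp (Complex.I * ω * v))‖ ≤
      maxFourier g ξ * ((1 + h) * Real.exp h) := by
    have := intervalIntegral.norm_integral_le_of_norm_le_const (a := 0) (b := x)
      (f := fun v => (∫ u in (0:ℝ)..v, f u) * (Complex.I * ω * Complex.exp (Complex.I * ω * v)))
      (C := maxFourier g ξ * ((1 + h) * Real.exp h)) fun v hv => by
        rw [Set.uIoc_of_le hx.1] at hv
        have hv' : v ∈ Set.Icc (0:ℝ) 1 := ⟨hv.1.le, hv.2.trans hx.2⟩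
        rw [norm_mul, norm_mul, norm_mul, Complex.norm_I, one_mul]
        refine mul_le_mul (hF v hv') ?_ (by positivity) h0
        exact mul_le_mul hωn (norm_cexp_le hωim hv'.1 hv'.2) (norm_nonneg _) (by positivity)
    refine this.trans ?_
    rw [sub_zero, abs_of_nonneg hx.1]
    exact mul_le_of_le_one_right (by positivity) hx.2
  refine (norm_sub_le _ _).trans ((add_le_add b1 b2).trans (le_of_eq ?_))
  ring

/-- The square summed maximal inequality along incompressible sequences, for bounded functions. -/
theorem exists_sq_sum_maxFourier_le (h : ℝ) (hh : 0 ≤ h) (d : ℕ) :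
    ∃ C : ℝ, 0 < C ∧ ∀ μ : ℤ → ℂ, Incompressible d μ → (∀ n : ℤ, |(μ n).im| ≤ h) →
      ∀ (g : ℝ → ℂ) (M : ℝ), Measurable g → (∀ t, ‖g t‖ ≤ M) →
      ∀ F : Finset ℤ, ∑ n ∈ F, maxFourier g (μ n) ^ 2 ≤ C * ∫ t in (0:ℝ)..1, ‖g t‖ ^ 2 := by
  obtain ⟨K, hK, hmain⟩ := discrete_maximal_bound
  refine ⟨(Real.exp h * (2 + h)) ^ 2 * ((d + 1) * K), by positivity, fun μ hμ him g M hg hb F => ?_⟩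
  have hgi := intervalIntegrable_of_bdd hg hb 0 1
  have hI : 0 ≤ ∫ t in (0:ℝ)..1, ‖g t‖ ^ 2 := intervalIntegral.integral_nonneg zero_le_one fun t _ => by positivity
  set ξ : ℤ → ℝ := fun y => Real.pi * y / 32 with hξ
  set r : ℤ → ℤ := fun n => round ((μ n).re * 32 / Real.pi) with hr
  have hnear : ∀ n, |(μ n).re - ξ (r n)| ≤ 1 := by
    intro n
    have h1 := abs_sub_round ((μ n).re * 32 / Real.pi)
    have hpi := Real.pi_pos
    have h2 : (μ n).re - ξ (r n) = Real.pi / 32 * ((μ n).re * 32 / Real.pi - round ((μ n).re * 32 / Real.pi)) := by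
      simp only [hξ, hr]
      field_simp
    rw [h2, abs_mul, abs_of_pos (by positivity)]
    have := Real.pi_le_four
    nlinarith [abs_nonneg ((μ n).re * 32 / Real.pi - round ((μ n).re * 32 / Real.pi))]
  have hfib : ∀ y, ((F.filter fun n => r n = y).card : ℝ) ≤ d := by
    intro y
    have h1 : ((F.filter fun n => r n = y : Finset ℤ) : Set ℤ).encard ≤ d := by
      refine (Set.encard_le_encard ?_).trans (hμ (ξ y))
      intro n hn
      have hn' := (Finset.mem_filter.1 (Finset.mem_coe.1 hn)).2
      simp only [Set.mem_ofPred_eq]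
      rw [← hn']
      exact hnear n
    rw [Set.encard_coe_eq_coe_finsetCard] at h1
    exact_mod_cast h1
  have hdisc : ∑ y ∈ F.image r, maxFourier g (ξ y) ^ 2 ≤ K * ∫ t in (0:ℝ)..1, ‖g t‖ ^ 2 := by
    choose X hX hXe using fun y : ℤ => exists_maxFourier_eq hgi (ξ y)
    refine le_trans (le_of_eq (Finset.sum_congr rfl fun y _ => ?_)) (hmain X (F.image r) (fun y _ => hX y) g M hg hb)
    rw [hXe]
    congr 2
    refine intervalIntegral.integral_congr fun t _ => ?_
    simp only [ee, hξ]
    congr 2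
    push_cast
    ring
  calc _ ≤ ∑ n ∈ F, (Real.exp h * (2 + h)) ^ 2 * maxFourier g (ξ (r n)) ^ 2 := by
        refine Finset.sum_le_sum fun n _ => ?_
        rw [← mul_pow]
        exact pow_le_pow_left₀ (maxFourier_nonneg _ _) (maxFourier_le_mul_of_near hg hb (him n) (hnear n)) 2
    _ = (Real.exp h * (2 + h)) ^ 2 * ∑ y ∈ F.image r, ((F.filter fun n => r n = y).card : ℝ) * maxFourier g (ξ y) ^ 2 := by
        rw [← Finset.mul_sum, ← Finset.sum_fiberwise_of_maps_to (g := r) (t := F.image r) fun n hn => Finset.mem_image_of_mem r hn]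
        congr 1
        refine Finset.sum_congr rfl fun y _ => ?_
        rw [Finset.sum_congr rfl fun n hn => by rw [(Finset.mem_filter.1 hn).2], Finset.sum_const, nsmul_eq_mul]
    _ ≤ (Real.exp h * (2 + h)) ^ 2 * ∑ y ∈ F.image r, (d + 1) * maxFourier g (ξ y) ^ 2 := by
        gcongr with y _
        linarith [hfib y]
    _ ≤ _ := by
        rw [← Finset.mul_sum, mul_assoc, mul_assoc]
        gcongr

/-- The part of `g` below the height `a`. -/
noncomputable def cutBelow (a : ℝ) (g : ℝ → ℂ) (t : ℝ) : ℂ := if ‖g t‖ ≤ a then g t else 0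

/-- The part of `g` above the height `a`. -/
noncomputable def cutAbove (a : ℝ) (g : ℝ → ℂ) (t : ℝ) : ℂ := if ‖g t‖ ≤ a then 0 else g t

lemma cutBelow_add_cutAbove (a : ℝ) (g : ℝ → ℂ) (t : ℝ) : cutBelow a g t + cutAbove a g t = g t := by
  unfold cutBelow cutAbove; split_ifs <;> simp

lemma measurable_cutBelow {g : ℝ → ℂ} (hg : Measurable g) (a : ℝ) : Measurable (cutBelow a g) :=
  Measurable.ite (measurableSet_le hg.norm measurable_const) hg measurable_const

lemma measurable_cutAbove {g : ℝ → ℂ} (hg : Measurable g) (a : ℝ) : Measurable (cutAbove a g) :=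
  Measurable.ite (measurableSet_le hg.norm measurable_const) measurable_const hg

lemma norm_cutBelow_le {a : ℝ} (ha : 0 ≤ a) (g : ℝ → ℂ) (t : ℝ) : ‖cutBelow a g t‖ ≤ a := by
  unfold cutBelow; split_ifs with h1
  · exact h1
  · simpa using ha

lemma norm_cutBelow_le_norm (a : ℝ) (g : ℝ → ℂ) (t : ℝ) : ‖cutBelow a g t‖ ≤ ‖g t‖ := by
  unfold cutBelow; split_ifs <;> simp

lemma norm_cutAbove_le_norm (a : ℝ) (g : ℝ → ℂ) (t : ℝ) : ‖cutAbove a g t‖ ≤ ‖g t‖ := by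
  unfold cutAbove; split_ifs <;> simp

lemma maxFourier_le_cut {g : ℝ → ℂ} (hm : Measurable g) (hg : IntervalIntegrable g volume 0 1) {a : ℝ} {lam : ℂ}
    {h : ℝ} (hl : |lam.im| ≤ h) :
    maxFourier g lam ≤ maxFourier (cutBelow a g) lam + Real.exp h * ∫ t in (0:ℝ)..1, ‖cutAbove a g t‖ := by
  have h1 : IntervalIntegrable (cutBelow a g) volume 0 1 := hg.mono_fun (measurable_cutBelow hm a).aestronglyMeasurable
    (Filter.Eventually.of_forall (norm_cutBelow_le_norm a g))
  have h2 : IntervalIntegrable (cutAbove a g) volume 0 1 := hg.mono_fun (measurable_cutAbove hm a).aestronglyMeasurable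
    (Filter.Eventually.of_forall (norm_cutAbove_le_norm a g))
  have := maxFourier_add_le h1 h2 lam
  simp_rw [cutBelow_add_cutAbove] at this
  exact this.trans (add_le_add_right (maxFourier_le_integral h2 hl) _)

lemma intervalIntegrable_of_rpow {p : ℝ} (hp : 1 ≤ p) {g : ℝ → ℂ} (hm : Measurable g)
    (hg : IntervalIntegrable (fun t => ‖g t‖ ^ p) volume 0 1) : IntervalIntegrable g volume 0 1 := by
  refine IntervalIntegrable.mono_fun' (g := fun t => 1 + ‖g t‖ ^ p) (intervalIntegrable_const.add hg) hm.aestronglyMeasurable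
    (Filter.Eventually.of_forall fun t => ?_)
  beta_reduce
  rcases le_total ‖g t‖ 1 with h1 | h1
  · have := Real.rpow_nonneg (norm_nonneg (g t)) p
    linarith
  · have := Real.rpow_le_rpow_of_exponent_le h1 hp
    rw [Real.rpow_one] at this
    linarith

lemma tendsto_integral_cutAbove {g : ℝ → ℂ} (hm : Measurable g) (hg : IntervalIntegrable g volume 0 1) :
    Filter.Tendsto (fun k : ℕ => ∫ t in (0:ℝ)..1, ‖cutAbove k g t‖) Filter.atTop (nhds 0) := by
  have := intervalIntegral.tendsto_integral_filter_of_dominated_convergence (a := 0) (b := 1) (μ := volume) (l := Filter.atTop)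
    (F := fun (k : ℕ) t => ‖cutAbove k g t‖) (f := fun _ => (0:ℝ)) (fun t => ‖g t‖)
    (Filter.Eventually.of_forall fun k => (measurable_cutAbove hm _).norm.aestronglyMeasurable)
    (Filter.Eventually.of_forall fun k => Filter.Eventually.of_forall fun t _ => by
      rw [norm_norm]; exact norm_cutAbove_le_norm _ g t) hg.norm
    (Filter.Eventually.of_forall fun t _ => by
      refine tendsto_const_nhds.congr' ?_
      obtain ⟨k, hk⟩ := exists_nat_ge ‖g t‖
      filter_upwards [Filter.eventually_ge_atTop k] with n hn
      have : ‖g t‖ ≤ n := hk.trans (by exact_mod_cast hn)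
      simp [cutAbove, this])
  simpa using this

lemma integral_cutAbove_le {p : ℝ} (hp : 1 ≤ p) {g : ℝ → ℂ} (hm : Measurable g)
    (hg : IntervalIntegrable (fun t => ‖g t‖ ^ p) volume 0 1) {a : ℝ} (ha : 0 < a) :
    ∫ t in (0:ℝ)..1, ‖cutAbove a g t‖ ≤ a ^ (1 - p) * ∫ t in (0:ℝ)..1, ‖g t‖ ^ p := by
  have hgi := intervalIntegrable_of_rpow hp hm hg
  rw [← intervalIntegral.integral_const_mul]
  refine intervalIntegral.integral_mono_on zero_le_one ?_ (hg.const_mul _) fun t _ => ?_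
  · exact (hgi.mono_fun (measurable_cutAbove hm a).aestronglyMeasurable
      (Filter.Eventually.of_forall (norm_cutAbove_le_norm a g))).norm
  · unfold cutAbove
    split_ifs with h1
    · rw [norm_zero]; positivity
    · push Not at h1
      have h2 := Real.rpow_le_rpow_of_nonpos ha h1.le (show 1 - p ≤ 0 by linarith)
      have h3 : 0 < ‖g t‖ := ha.trans h1
      calc ‖g t‖ = ‖g t‖ ^ (1 - p) * ‖g t‖ ^ p := by
            rw [← Real.rpow_add h3, sub_add_cancel, Real.rpow_one]
        _ ≤ _ := mul_le_mul_of_nonneg_right h2 (by positivity)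

/-- The square summed maximal inequality along incompressible sequences. -/
theorem exists_sq_sum_maxFourier_le_of_memL2 (h : ℝ) (hh : 0 ≤ h) (d : ℕ) :
    ∃ C : ℝ, 0 < C ∧ ∀ μ : ℤ → ℂ, Incompressible d μ → (∀ n : ℤ, |(μ n).im| ≤ h) →
      ∀ g : ℝ → ℂ, Measurable g → IntervalIntegrable (fun t => ‖g t‖ ^ (2:ℝ)) volume 0 1 →
      ∀ F : Finset ℤ, ∑ n ∈ F, maxFourier g (μ n) ^ 2 ≤ C * ∫ t in (0:ℝ)..1, ‖g t‖ ^ 2 := by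
  obtain ⟨C, hC, hmain⟩ := exists_sq_sum_maxFourier_le h hh d
  refine ⟨C, hC, fun μ hμ him g hm hg F => ?_⟩
  have hgi := intervalIntegrable_of_rpow one_le_two hm hg
  simp_rw [Real.rpow_two] at hg
  have hle : ∀ k : ℕ, ∑ n ∈ F, max (maxFourier g (μ n) - Real.exp h * ∫ t in (0:ℝ)..1, ‖cutAbove k g t‖) 0 ^ 2 ≤
      C * ∫ t in (0:ℝ)..1, ‖g t‖ ^ 2 := by
    intro k
    have hk : (0:ℝ) ≤ k := Nat.cast_nonneg k
    calc _ ≤ ∑ n ∈ F, maxFourier (cutBelow k g) (μ n) ^ 2 := by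
          refine Finset.sum_le_sum fun n _ => pow_le_pow_left₀ (le_max_right _ _) (max_le ?_ (maxFourier_nonneg _ _)) 2
          linarith [maxFourier_le_cut hm hgi (a := k) (him n)]
      _ ≤ C * ∫ t in (0:ℝ)..1, ‖cutBelow k g t‖ ^ 2 := hmain μ hμ him _ k (measurable_cutBelow hm _) (norm_cutBelow_le hk g) F
      _ ≤ _ := by
          refine mul_le_mul_of_nonneg_left ?_ hC.le
          refine intervalIntegral.integral_mono_on zero_le_one ?_ hg fun t _ =>
            pow_le_pow_left₀ (norm_nonneg _) (norm_cutBelow_le_norm _ g t) 2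
          refine hg.mono_fun ((measurable_cutBelow hm _).norm.pow_const 2).aestronglyMeasurable (Filter.Eventually.of_forall fun t => ?_)
          simp only [norm_pow, norm_norm]
          exact pow_le_pow_left₀ (norm_nonneg _) (norm_cutBelow_le_norm _ g t) 2
  refine le_of_tendsto (x := Filter.atTop) (tendsto_finsetSum F fun n _ => ?_) (Filter.Eventually.of_forall hle)
  have h1 := ((tendsto_integral_cutAbove hm hgi).const_mul (Real.exp h)).const_sub (maxFourier g (μ n))
  rw [mul_zero, sub_zero] at h1
  have h2 := (h1.max (tendsto_const_nhds (x := (0:ℝ)))).pow 2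
  rwa [max_eq_left (maxFourier_nonneg _ _)] at h2

lemma exists_sum_two_zpow_rpow_le {δ : ℝ} (hδ : 0 < δ) : ∃ C : ℝ, 0 < C ∧ ∀ (S : Finset ℤ) (B : ℝ), 0 < B →
    (∀ k ∈ S, (2:ℝ) ^ k ≤ B) → ∑ k ∈ S, ((2:ℝ) ^ k) ^ δ ≤ C * B ^ δ := by
  set r : ℝ := ((2:ℝ) ^ δ)⁻¹ with hr
  have h2 : (1:ℝ) < 2 ^ δ := Real.one_lt_rpow one_lt_two hδ
  have hr0 : 0 < r := by positivity
  have hr1 : r < 1 := inv_lt_one_of_one_lt₀ h2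
  refine ⟨(1 - r)⁻¹, inv_pos.2 (by linarith), fun S B hB hS => ?_⟩
  obtain ⟨k₀, h0, h1⟩ := exists_mem_Ico_zpow hB one_lt_two
  have hle : ∀ k ∈ S, k ≤ k₀ := fun k hk => by
    have := (zpow_lt_zpow_iff_right₀ (one_lt_two (α := ℝ))).1 ((hS k hk).trans_lt h1)
    omega
  have e : ∀ k ∈ S, ((2:ℝ) ^ k) ^ δ = ((2:ℝ) ^ k₀) ^ δ * r ^ (k₀ - k).toNat := by
    intro k hk
    obtain ⟨m, hm⟩ := Int.eq_ofNat_of_zero_le (sub_nonneg.2 (hle k hk))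
    have e1 : (2:ℝ) ^ k₀ = 2 ^ k * 2 ^ m := by
      rw [← zpow_natCast (2:ℝ) m, ← zpow_add₀ two_ne_zero]
      congr 1; omega
    rw [hm, Int.toNat_natCast, e1, Real.mul_rpow (by positivity) (by positivity), hr, inv_pow, ← Real.rpow_natCast (2:ℝ) m,
      ← Real.rpow_natCast ((2:ℝ) ^ δ) m, ← Real.rpow_mul zero_le_two, ← Real.rpow_mul zero_le_two, mul_comm δ, mul_assoc,
      mul_inv_cancel₀ (by positivity), mul_one]
  rw [Finset.sum_congr rfl e, ← Finset.mul_sum, mul_comm]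
  have hinj : Set.InjOn (fun k => (k₀ - k).toNat) (S : Set ℤ) := by
    intro a ha b hb hab
    have := hle a ha
    have := hle b hb
    simp only at hab
    omega
  have hgeo := summable_geometric_of_lt_one hr0.le hr1
  refine mul_le_mul ?_ (Real.rpow_le_rpow (by positivity) h0 hδ.le) (by positivity) (inv_pos.2 (by linarith)).le
  rw [← Finset.sum_image (f := fun m => r ^ m) hinj, ← tsum_geometric_of_lt_one hr0.le hr1]
  exact hgeo.sum_le_tsum _ fun i _ => by positivity

/-- The maximal inequality along incompressible sequences for exponents below two. -/
theorem exists_sum_maxFourier_le_of_lt_two {p : ℝ} (hp1 : 1 < p) (hp2 : p < 2) (h : ℝ) (hh : 0 ≤ h) (d : ℕ) :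
    ∃ C : ℝ, 0 < C ∧ ∀ μ : ℤ → ℂ, Incompressible d μ → (∀ n : ℤ, |(μ n).im| ≤ h) →
      ∀ g : ℝ → ℂ, Measurable g → IntervalIntegrable (fun t => ‖g t‖ ^ p) volume 0 1 →
      ∀ F : Finset ℤ, ∑ n ∈ F, maxFourier g (μ n) ^ (p / (p - 1)) ≤
        C * (∫ t in (0:ℝ)..1, ‖g t‖ ^ p) ^ (1 / (p - 1)) := by
  obtain ⟨C, hC, hmain⟩ := exists_sq_sum_maxFourier_le h hh d
  have hp0 : 0 < p - 1 := by linarith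
  set q := p / (p - 1) with hq
  set δ := q - 2 with hδ
  have hδ0 : 0 < δ := by
    rw [hδ, hq, sub_pos, lt_div_iff₀ hp0]; linarith
  have hδp : (1 - p) * δ = p - 2 := by rw [hδ, hq]; field_simp; ring
  have hδ1 : δ + 1 = 1 / (p - 1) := by rw [hδ, hq]; field_simp; ring
  obtain ⟨D, hD, hgeo⟩ := exists_sum_two_zpow_rpow_le hδ0
  refine ⟨2 ^ q * 4 * C * (D * (2 * Real.exp h) ^ δ), by positivity, fun μ hμ him g hm hg F => ?_⟩
  have hgi := intervalIntegrable_of_rpow hp1.le hm hg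
  set Q := ∫ t in (0:ℝ)..1, ‖g t‖ ^ p with hQ
  have hQ0 : 0 ≤ Q := intervalIntegral.integral_nonneg zero_le_one fun t _ => by positivity
  have hq0 : q ≠ 0 := by linarith
  rcases hQ0.eq_or_lt with hQz | hQpos
  · have hz : ∀ n, maxFourier g (μ n) = 0 := by
      intro n
      refine le_antisymm ((maxFourier_le_integral hgi (him n)).trans (le_of_eq ?_)) (maxFourier_nonneg _ _)
      have h1 := hQz
      rw [hQ, eq_comm, intervalIntegral.integral_of_le zero_le_one, integral_eq_zero_iff_of_nonneg
        (fun t => by positivity) ((intervalIntegrable_iff_integrableOn_Ioc_of_le zero_le_one).1 hg)] at h1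
      have h2 : ∫ t in (0:ℝ)..1, ‖g t‖ = 0 := by
        rw [intervalIntegral.integral_of_le zero_le_one]
        refine integral_eq_zero_of_ae ?_
        filter_upwards [h1] with t ht
        exact ((Real.rpow_eq_zero_iff_of_nonneg (norm_nonneg _)).1 ht).1
      rw [h2, mul_zero]
    simp_rw [hz, Real.zero_rpow hq0]
    rw [Finset.sum_const_zero]
    positivity
  set E := 2 * Real.exp h * Q with hE
  have hE0 : 0 < E := by positivity
  set a : ℤ → ℝ := fun k => ((2:ℝ) ^ k / E) ^ (1 / (1 - p)) with ha
  have ha0 : ∀ k, 0 < a k := fun k => by positivity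
  have hap : ∀ k, a k ^ (1 - p) = 2 ^ k / E := by
    intro k
    rw [ha]
    beta_reduce
    rw [← Real.rpow_mul (by positivity), one_div_mul_cancel (by linarith), Real.rpow_one]
  have htail : ∀ k, Real.exp h * ∫ t in (0:ℝ)..1, ‖cutAbove (a k) g t‖ ≤ 2 ^ k / 2 := by
    intro k
    have h1 := integral_cutAbove_le hp1.le hm hg (ha0 k)
    rw [hap, ← hQ] at h1
    calc _ ≤ Real.exp h * (2 ^ k / E * Q) := mul_le_mul_of_nonneg_left h1 (Real.exp_pos h).le
      _ = 2 ^ k / 2 := by rw [hE]; field_simp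
  have hlev : ∀ n, ∃ k : ℤ, 0 < maxFourier g (μ n) → (2:ℝ) ^ k < maxFourier g (μ n) ∧ maxFourier g (μ n) ≤ 2 ^ (k + 1) := by
    intro n
    by_cases h0 : 0 < maxFourier g (μ n)
    · obtain ⟨k, h1, h2⟩ := exists_mem_Ioc_zpow h0 one_lt_two
      exact ⟨k, fun _ => ⟨h1, h2⟩⟩
    · exact ⟨0, fun h1 => absurd h1 h0⟩
  choose k hk using hlev
  have hterm : ∀ n, maxFourier g (μ n) ^ q ≤ 2 ^ q * 4 * (((2:ℝ) ^ k n) ^ δ * maxFourier (cutBelow (a (k n)) g) (μ n) ^ 2) := by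
    intro n
    rcases (maxFourier_nonneg g (μ n)).eq_or_lt with h0 | h0
    · rw [← h0, Real.zero_rpow hq0]; positivity
    obtain ⟨h1, h2⟩ := hk n h0
    have h3 := maxFourier_le_cut hm hgi (a := a (k n)) (him n)
    have h4 := htail (k n)
    have h5 : (2:ℝ) ^ k n ≤ 2 * maxFourier (cutBelow (a (k n)) g) (μ n) := by linarith
    have h6 : (0:ℝ) < 2 ^ k n := by positivity
    calc _ ≤ (2 * (2:ℝ) ^ k n) ^ q := by
          refine Real.rpow_le_rpow h0.le ?_ (by linarith)
          rw [zpow_add_one₀ two_ne_zero] at h2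
          linarith
      _ = 2 ^ q * ((2 ^ k n) ^ δ * (2 ^ k n) ^ 2) := by
          rw [Real.mul_rpow zero_le_two h6.le, ← Real.rpow_two, ← Real.rpow_add h6, hδ, sub_add_cancel]
      _ ≤ 2 ^ q * ((2 ^ k n) ^ δ * (2 * maxFourier (cutBelow (a (k n)) g) (μ n)) ^ 2) := by
          gcongr
      _ = _ := by ring
  have hpt : ∀ (S : Finset ℤ) (t : ℝ), ∑ j ∈ S, ((2:ℝ) ^ j) ^ δ * ‖cutBelow (a j) g t‖ ^ 2 ≤ D * E ^ δ * ‖g t‖ ^ p := by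
    intro S t
    rcases (norm_nonneg (g t)).eq_or_lt with h0 | h0
    · have h1 : g t = 0 := norm_eq_zero.1 h0.symm
      have h2 : ∀ j, cutBelow (a j) g t = 0 := fun j => by simp [cutBelow, h1]
      simp only [h2, norm_zero]
      rw [Finset.sum_eq_zero fun j _ => by ring]
      positivity
    have e1 : ∑ j ∈ S, ((2:ℝ) ^ j) ^ δ * ‖cutBelow (a j) g t‖ ^ 2 =
        (∑ j ∈ S.filter fun j => ‖g t‖ ≤ a j, ((2:ℝ) ^ j) ^ δ) * ‖g t‖ ^ 2 := by
      rw [Finset.sum_mul, Finset.sum_filter]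
      refine Finset.sum_congr rfl fun j _ => ?_
      unfold cutBelow
      split_ifs <;> simp
    have h1 := hgeo (S.filter fun j => ‖g t‖ ≤ a j) (E * ‖g t‖ ^ (1 - p)) (by positivity) fun j hj => by
      have h2 := Real.rpow_le_rpow_of_nonpos h0 (Finset.mem_filter.1 hj).2 (show 1 - p ≤ 0 by linarith)
      rw [hap, div_le_iff₀ hE0] at h2
      linarith
    rw [e1]
    calc _ ≤ D * (E * ‖g t‖ ^ (1 - p)) ^ δ * ‖g t‖ ^ 2 := mul_le_mul_of_nonneg_right h1 (by positivity)
      _ = D * E ^ δ * (‖g t‖ ^ (p - 2) * ‖g t‖ ^ (2:ℝ)) := by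
          rw [Real.mul_rpow hE0.le (by positivity), ← Real.rpow_mul h0.le, hδp, Real.rpow_two]; ring
      _ = _ := by rw [← Real.rpow_add h0, sub_add_cancel]
  set S := F.image k with hS
  have hci : ∀ j, IntervalIntegrable (fun t => ((2:ℝ) ^ j) ^ δ * ‖cutBelow (a j) g t‖ ^ 2) volume 0 1 := by
    intro j
    refine IntervalIntegrable.const_mul ?_ _
    refine IntervalIntegrable.mono_fun' (g := fun _ => a j ^ 2) intervalIntegrable_const
      ((measurable_cutBelow hm _).norm.pow_const 2).aestronglyMeasurable (Filter.Eventually.of_forall fun t => ?_)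
    simp only [norm_pow, norm_norm]
    exact pow_le_pow_left₀ (norm_nonneg _) (norm_cutBelow_le (ha0 j).le g t) 2
  calc _ ≤ ∑ n ∈ F, 2 ^ q * 4 * (((2:ℝ) ^ k n) ^ δ * maxFourier (cutBelow (a (k n)) g) (μ n) ^ 2) :=
        Finset.sum_le_sum fun n _ => hterm n
    _ = 2 ^ q * 4 * ∑ j ∈ S, ((2:ℝ) ^ j) ^ δ * ∑ n ∈ F.filter fun n => k n = j, maxFourier (cutBelow (a j) g) (μ n) ^ 2 := by
        rw [← Finset.mul_sum, ← Finset.sum_fiberwise_of_maps_to (g := k) (t := S) fun n hn => Finset.mem_image_of_mem k hn]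
        congr 1
        refine Finset.sum_congr rfl fun j _ => ?_
        rw [Finset.mul_sum]
        exact Finset.sum_congr rfl fun n hn => by rw [(Finset.mem_filter.1 hn).2]
    _ ≤ 2 ^ q * 4 * ∑ j ∈ S, ((2:ℝ) ^ j) ^ δ * (C * ∫ t in (0:ℝ)..1, ‖cutBelow (a j) g t‖ ^ 2) := by
        gcongr with j _
        exact hmain μ hμ him _ (a j) (measurable_cutBelow hm _) (norm_cutBelow_le (ha0 j).le g) _
    _ = 2 ^ q * 4 * C * ∫ t in (0:ℝ)..1, ∑ j ∈ S, ((2:ℝ) ^ j) ^ δ * ‖cutBelow (a j) g t‖ ^ 2 := by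
        rw [intervalIntegral.integral_finsetSum fun j _ => hci j, mul_assoc _ C, Finset.mul_sum (a := C)]
        congr 1
        refine Finset.sum_congr rfl fun j _ => ?_
        rw [intervalIntegral.integral_const_mul]
        ring
    _ ≤ 2 ^ q * 4 * C * ∫ t in (0:ℝ)..1, D * E ^ δ * ‖g t‖ ^ p := by
        refine mul_le_mul_of_nonneg_left ?_ (by positivity)
        exact intervalIntegral.integral_mono_on zero_le_one
          (by simpa only [Finset.sum_fn] using IntervalIntegrable.sum S fun j _ => hci j) (hg.const_mul _) fun t _ => hpt S t
    _ = _ := by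
        rw [intervalIntegral.integral_const_mul, ← hQ, ← hδ1, Real.rpow_add hQpos, Real.rpow_one, hE,
          Real.mul_rpow (by positivity) hQpos.le]
        ring

/-- For `p ∈ (1,2]`, `h ≥ 0` and `d ∈ ℕ` there is `C = C(p,h,d) > 0` such that for every
incompressible sequence `μ` of density `d` lying in the strip `Π_h` and every `g ∈ L^p[0,1]`,
`∑_{n∈ℤ} (𝓕[g](μ_n))^{p'} ≤ C ‖g‖_p^{p'}`. -/
theorem stmt3 (p : ℝ) (hp1 : 1 < p) (hp2 : p ≤ 2) (h : ℝ) (hh : 0 ≤ h) (d : ℕ) :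
    ∃ C : ℝ, 0 < C ∧ ∀ μ : ℤ → ℂ, Incompressible d μ → (∀ n : ℤ, |(μ n).im| ≤ h) →
      ∀ g : ℝ → ℂ, Measurable g →
      IntervalIntegrable (fun t => ‖g t‖ ^ p) volume 0 1 →
      ∀ F : Finset ℤ, ∑ n ∈ F, maxFourier g (μ n) ^ (p / (p - 1)) ≤
        C * lpNorm01 p g ^ (p / (p - 1)) := by
  have hN : ∀ g : ℝ → ℂ, lpNorm01 p g ^ (p / (p - 1)) = (∫ t in (0:ℝ)..1, ‖g t‖ ^ p) ^ (1 / (p - 1)) := by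
    intro g
    have hQ0 : 0 ≤ ∫ t in (0:ℝ)..1, ‖g t‖ ^ p := intervalIntegral.integral_nonneg zero_le_one fun t _ => by positivity
    rw [lpNorm01, ← Real.rpow_mul hQ0]
    congr 1
    have : p - 1 ≠ 0 := by linarith
    field_simp
  simp_rw [hN]
  rcases hp2.eq_or_lt with rfl | hlt
  · obtain ⟨C, hC, hmain⟩ := exists_sq_sum_maxFourier_le_of_memL2 h hh d
    refine ⟨C, hC, fun μ hμ him g hm hg F => ?_⟩
    have := hmain μ hμ him g hm hg F
    rw [show (2:ℝ) / (2 - 1) = 2 by norm_num, show (1:ℝ) / (2 - 1) = 1 by norm_num, Real.rpow_one]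
    simp_rw [Real.rpow_two]
    exact this
  · exact exists_sum_maxFourier_le_of_lt_two hp1 hlt h hh d
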